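/- Every 1-connected (bridgeless) connected planar multigraph without loops is the contraction of a Mondrian diagram: there exists a collection of pairwise disjoint horizontal segments in the plane and pairwise disjoint vertical segments, each vertical segment having both endpoints on horizontal segments and meeting no other horizontal segment, such that contracting each horizontal segment to a point yields a plane graph isotopic to the given one. -/

import Mathlib

/-- A Mondrian diagram: a finite collection of pairwise disjoint horizontal
segments in the plane, together with a finite collection of pairwise disjoint
vertical segments, each of which begins and ends on a horizontal segment and
whose interior does not intersect any horizontal segment.  The horizontal
segment `i` is `[hx1 i, hx2 i] × {hy i}`; the vertical segment `e` is
`{vx e} × [vy1 e, vy2 e]`, with its bottom endpoint on the horizontal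
segment `bot e` and its top endpoint on the horizontal segment `top e`. -/
structure Mondrian where
  H : Type
  Vs : Type
  Hfin : Finite H
  Vfin : Finite Vs
  hx1 : H → ℝ
  hx2 : H → ℝ
  hy : H → ℝ
  hlt : ∀ i, hx1 i < hx2 i
  vx : Vs → ℝ
  vy1 : Vs → ℝ
  vy2 : Vs → ℝ
  vlt : ∀ e, vy1 e < vy2 e
  bot : Vs → H
  top : Vs → H
  bot_mem : ∀ e, hy (bot e) = vy1 e ∧ hx1 (bot e) ≤ vx e ∧ vx e ≤ hx2 (bot e)
  top_mem : ∀ e, hy (top e) = vy2 e ∧ hx1 (top e) ≤ vx e ∧ vx e ≤ hx2 (top e)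
  hdisj : ∀ i j, i ≠ j → hy i = hy j → (hx2 i < hx1 j ∨ hx2 j < hx1 i)
  vdisj : ∀ e f, e ≠ f → vx e = vx f → (vy2 e < vy1 f ∨ vy2 f < vy1 e)
  vint : ∀ e i, vy1 e < hy i → hy i < vy2 e → ¬(hx1 i ≤ vx e ∧ vx e ≤ hx2 i)

/-- The horizontal segment of a Mondrian diagram indexed by `i`, as a set. -/
def Mondrian.hseg (D : Mondrian) (i : D.H) : Set (ℝ × ℝ) :=
  {p | p.2 = D.hy i ∧ D.hx1 i ≤ p.1 ∧ p.1 ≤ D.hx2 i}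

/-- The vertical segment of a Mondrian diagram indexed by `e`, as a set. -/
def Mondrian.vseg (D : Mondrian) (e : D.Vs) : Set (ℝ × ℝ) :=
  {p | p.1 = D.vx e ∧ D.vy1 e ≤ p.2 ∧ p.2 ≤ D.vy2 e}

/-- The union of all segments of a Mondrian diagram. -/
def Mondrian.carrier (D : Mondrian) : Set (ℝ × ℝ) :=
  (⋃ i, D.hseg i) ∪ ⋃ e, D.vseg e

/-- `(a, b, y₀)` describes a spine of the region `R`: the horizontal segment
`[a,b] × {y₀}` lies in `R`, and every nonempty vertical slice of `R` is
connected and meets this segment. -/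
def IsSpine (R : Set (ℝ × ℝ)) (a b y₀ : ℝ) : Prop :=
  a < b ∧ (∀ x, a ≤ x → x ≤ b → (x, y₀) ∈ R) ∧
    ∀ x : ℝ, ({y | (x, y) ∈ R}).Nonempty →
      IsPreconnected {y | (x, y) ∈ R} ∧ a ≤ x ∧ x ≤ b ∧ (x, y₀) ∈ R

/-- A region is strong if the interior of its closure admits a horizontal
spine. -/
def IsStrongRegion (R : Set (ℝ × ℝ)) : Prop :=
  ∃ a b y₀, IsSpine (interior (closure R)) a b y₀

/-- A Mondrian diagram is strong if every bounded connected component of the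
complement of its carrier is strong. -/
def Mondrian.IsStrong (D : Mondrian) : Prop :=
  ∀ p ∈ D.carrierᶜ,
    Bornology.IsBounded (connectedComponentIn D.carrierᶜ p) →
      IsStrongRegion (connectedComponentIn D.carrierᶜ p)

/-- A plane (multi)graph: a loopless multigraph embedded in the plane.
Vertices are distinct points; each edge `e` is an arc `arc e : [0,1] → ℝ²`,
continuous and injective, running from `vpos (src e)` to `vpos (tgt e)`,
whose interior avoids all vertices; interiors of distinct edges are
disjoint from each other and from the other edges. -/
structure PlaneGraph where
  V : Type
  E : Type
  Vfin : Finite V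
  Efin : Finite E
  vpos : V → ℝ × ℝ
  vinj : Function.Injective vpos
  src : E → V
  tgt : E → V
  loopless : ∀ e, src e ≠ tgt e
  arc : E → ℝ → ℝ × ℝ
  arc_cont : ∀ e, ContinuousOn (arc e) (Set.Icc 0 1)
  arc_inj : ∀ e, Set.InjOn (arc e) (Set.Icc 0 1)
  arc_src : ∀ e, arc e 0 = vpos (src e)
  arc_tgt : ∀ e, arc e 1 = vpos (tgt e)
  int_avoid : ∀ e, ∀ t ∈ Set.Ioo (0 : ℝ) 1, ∀ v, arc e t ≠ vpos v
  arcs_disj : ∀ e f, e ≠ f → ∀ t ∈ Set.Ioo (0 : ℝ) 1, ∀ s ∈ Set.Icc (0 : ℝ) 1,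
    arc e t ≠ arc f s

/-- Adjacency in a plane graph using only edges outside the set `X`. -/
def PlaneGraph.AdjOff (G : PlaneGraph) (X : Set G.E) (v w : G.V) : Prop :=
  ∃ e, e ∉ X ∧ ((G.src e = v ∧ G.tgt e = w) ∨ (G.src e = w ∧ G.tgt e = v))

open Set Filter Topology Metric

/-- The nonvanishing function `f` has a continuous logarithm on `S`. -/
def HasLog {X : Type*} [TopologicalSpace X] (f : X → ℂ) (S : Set X) : Prop :=
  ∃ g : X → ℂ, ContinuousOn g S ∧ ∀ z ∈ S, Complex.exp (g z) = f z

theorem joinedIn_of_isPreconnected {O S : Set ℂ} (hO : IsOpen O) (hS : IsPreconnected S)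
    (hSO : S ⊆ O) {p q : ℂ} (hp : p ∈ S) (hq : q ∈ S) : JoinedIn O p q := by
  have h1 : S ⊆ connectedComponentIn O p := hS.subset_connectedComponentIn hp hSO
  have h2 : IsConnected (connectedComponentIn O p) :=
    isConnected_connectedComponentIn_iff.2 (hSO hp)
  have h3 := (hO.connectedComponentIn.isConnected_iff_isPathConnected).1 h2
  exact (h3.joinedIn p (h1 hp) q (h1 hq)).mono (connectedComponentIn_subset _ _)

theorem isPreconnected_pathComponentIn {O : Set ℂ} (p : ℂ) :
    IsPreconnected (pathComponentIn O p) := by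
  by_cases h : p ∈ O
  · exact (isPathConnected_pathComponentIn h).isConnected.isPreconnected
  · rw [show pathComponentIn O p = ∅ from by
      rw [← not_nonempty_iff_eq_empty, pathComponentIn_nonempty_iff]; exact h]
    exact isPreconnected_empty

/-- A limit point of a component of an open set which lies in the open set is in the component. -/
theorem mem_pathComponentIn_of_closure {O : Set ℂ} (hO : IsOpen O) {p z : ℂ}
    (hz : z ∈ closure (pathComponentIn O p)) (hzO : z ∈ O) : z ∈ pathComponentIn O p := by
  obtain ⟨w, hw1, hw2⟩ := mem_closure_iff.1 hz _ (hO.pathComponentIn z)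
    (mem_pathComponentIn_self hzO)
  exact JoinedIn.trans hw2 (JoinedIn.symm hw1)

theorem frontier_pathComponentIn {K : Set ℂ} (hK : IsClosed K) (p : ℂ) :
    frontier (pathComponentIn Kᶜ p) ⊆ K := by
  intro z hz
  by_contra h
  rw [(hK.isOpen_compl.pathComponentIn p).frontier_eq] at hz
  exact hz.2 (mem_pathComponentIn_of_closure hK.isOpen_compl hz.1 h)

theorem eq_of_exp_eq_one {X : Type*} [TopologicalSpace X] {S : Set X} (hS : IsPreconnected S)
    {u : X → ℂ}
    (hu : ContinuousOn u S) (h : ∀ z ∈ S, Complex.exp (u z) = 1) {x y : X} (hx : x ∈ S)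
    (hy : y ∈ S) : u x = u y := by
  have hT : DiscreteTopology (Complex.exp ⁻¹' {1}) :=
    (Complex.isCoveringMapOn_exp 1 (by simp)).1
  exact hS.constant_of_mapsTo (isDiscrete_iff_discreteTopology.2 hT) hu (fun z hz => h z hz) hx hy

theorem HasLog.mono {X : Type*} [TopologicalSpace X] {f : X → ℂ} {S T : Set X} (h : HasLog f S)
    (hT : T ⊆ S) : HasLog f T := by
  obtain ⟨g, h1, h2⟩ := h
  exact ⟨g, h1.mono hT, fun z hz => h2 z (hT hz)⟩

theorem HasLog.congr {X : Type*} [TopologicalSpace X] {f f' : X → ℂ} {S : Set X} (h : HasLog f S)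
    (hT : ∀ z ∈ S, f z = f' z) : HasLog f' S := by
  obtain ⟨g, h1, h2⟩ := h
  exact ⟨g, h1, fun z hz => (h2 z hz).trans (hT z hz)⟩

theorem HasLog.inv {X : Type*} [TopologicalSpace X] {f : X → ℂ} {S : Set X} (h : HasLog f S) :
    HasLog (fun z => (f z)⁻¹) S := by
  obtain ⟨g, h1, h2⟩ := h
  exact ⟨fun z => -g z, h1.neg, fun z hz => by rw [Complex.exp_neg, h2 z hz]⟩

theorem HasLog.mul {X : Type*} [TopologicalSpace X] {f f' : X → ℂ} {S : Set X} (h : HasLog f S)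
    (h' : HasLog f' S) : HasLog (fun z => f z * f' z) S := by
  obtain ⟨g, h1, h2⟩ := h
  obtain ⟨g', h1', h2'⟩ := h'
  exact ⟨fun z => g z + g' z, h1.add h1', fun z hz => by rw [Complex.exp_add, h2 z hz, h2' z hz]⟩

/-- Continuous logarithms on two relatively nice sets with preconnected intersection glue. -/
theorem HasLog.union_aux {f : ℂ → ℂ} {S T : Set ℂ} (hS : HasLog f S) (hT : HasLog f T)
    (hST : IsPreconnected (S ∩ T)) :
    ∃ g : ℂ → ℂ, ContinuousOn g S ∧ ContinuousOn g T ∧ ∀ z ∈ S ∪ T, Complex.exp (g z) = f z := by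
  classical
  obtain ⟨g, h1, h2⟩ := hS
  obtain ⟨g', h1', h2'⟩ := hT
  obtain ⟨c, hc, hgc⟩ : ∃ c, Complex.exp c = 1 ∧ ∀ z ∈ S ∩ T, g z = g' z + c := by
    rcases (S ∩ T).eq_empty_or_nonempty with h | ⟨x, hx⟩
    · exact ⟨0, by simp, by simp [h]⟩
    have hu : ∀ z ∈ S ∩ T, Complex.exp (g z - g' z) = 1 := fun z hz => by
      rw [Complex.exp_sub, h2 z hz.1, h2' z hz.2, div_self]
      rw [← h2 z hz.1]; exact Complex.exp_ne_zero _
    refine ⟨g x - g' x, hu x hx, fun z hz => ?_⟩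
    have := eq_of_exp_eq_one (u := fun z => g z - g' z) hST ((h1.mono inter_subset_left).sub
      (h1'.mono inter_subset_right)) hu hz hx
    rw [← this]; ring
  refine ⟨fun z => if z ∈ S then g z else g' z + c, ?_, ?_, ?_⟩
  · exact h1.congr fun z hz => by simp [hz]
  · refine (h1'.add (continuousOn_const (c := c))).congr fun z hz => ?_
    by_cases h : z ∈ S
    · simp [h, hgc z ⟨h, hz⟩]
    · simp [h]
  · rintro z hz
    by_cases h : z ∈ S
    · simp [h, h2 z h]
    · simp [h, Complex.exp_add, hc, h2' z (hz.resolve_left h)]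

theorem HasLog.union_isClosed {f : ℂ → ℂ} {S T : Set ℂ} (hS : HasLog f S) (hT : HasLog f T)
    (hST : IsPreconnected (S ∩ T)) (h1 : IsClosed S) (h2 : IsClosed T) : HasLog f (S ∪ T) := by
  obtain ⟨g, a, b, c⟩ := hS.union_aux hT hST
  exact ⟨g, a.union_of_isClosed b h1 h2, c⟩

theorem HasLog.union_isOpen {f : ℂ → ℂ} {S T : Set ℂ} (hS : HasLog f S) (hT : HasLog f T)
    (hST : IsPreconnected (S ∩ T)) (h1 : IsOpen S) (h2 : IsOpen T) : HasLog f (S ∪ T) := by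
  obtain ⟨g, a, b, c⟩ := hS.union_aux hT hST
  exact ⟨g, a.union_of_isOpen b h1 h2, c⟩

theorem hasLog_univ {X : Type*} [TopologicalSpace X] [LocallyPathConnectedSpace X]
    [SimplyConnectedSpace X] {f : X → ℂ} (hf : Continuous f) (h0 : ∀ z, f z ≠ 0) :
    ∃ g : X → ℂ, Continuous g ∧ ∀ z, Complex.exp (g z) = f z := by
  obtain ⟨g, h1, h2⟩ := Complex.exists_continuousOn_eqOn_exp_comp (U := (univ : Set X))
    ((Homeomorph.Set.univ X).toHomotopyEquiv.simplyConnectedSpace_iff.2 ‹_›) isOpen_univ hf.continuousOn (by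
      rintro ⟨z, -, hz⟩; exact h0 z hz)
  exact ⟨g, continuousOn_univ.1 h1, fun z => h2 (mem_univ z)⟩

theorem joinedIn_far {R : ℝ} (hR : 0 < R) {p q : ℂ} (hp : R < ‖p‖) (hq : R < ‖q‖) :
    JoinedIn {z : ℂ | R < ‖z‖} p q := by
  have hc : IsPreconnected (Complex.exp '' {w : ℂ | Real.log R < w.re}) :=
    ((convex_halfSpace_re_gt _).isPreconnected).image _ Complex.continuous_exp.continuousOn
  have hsub : ∀ z : ℂ, R < ‖z‖ → z ∈ Complex.exp '' {w : ℂ | Real.log R < w.re} := by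
    intro z hz
    have h0 : z ≠ 0 := by rintro rfl; simp at hz; linarith
    refine ⟨Complex.log z, ?_, Complex.exp_log h0⟩
    simp only [mem_ofPred_eq, Complex.log_re]
    exact Real.log_lt_log hR hz
  refine joinedIn_of_isPreconnected (isOpen_lt continuous_const continuous_norm) hc ?_
    (hsub p hp) (hsub q hq)
  rintro _ ⟨w, hw, rfl⟩
  simp only [mem_ofPred_eq] at hw ⊢
  rw [Complex.norm_exp]
  exact (Real.log_lt_iff_lt_exp hR).1 hw

/-- There is no logarithm of `z - p` on a circle around `p`. -/
theorem not_hasLog_sphere {p : ℂ} {r : ℝ} (hr : 0 < r) : ¬ HasLog (fun z => z - p) (sphere p r) := by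
  rintro ⟨g, hg, hge⟩
  have hmem : ∀ t : ℝ, p + r * Complex.exp (t * Complex.I) ∈ sphere p r := fun t => by
    simp [Complex.norm_exp_ofReal_mul_I, abs_of_pos hr]
  have hr' : (r : ℂ) ≠ 0 := by exact_mod_cast hr.ne'
  have hu : ∀ t : ℝ, Complex.exp (g (p + r * Complex.exp (t * Complex.I)) - t * Complex.I
      - Real.log r) = 1 := fun t => by
    rw [Complex.exp_sub, Complex.exp_sub, hge _ (hmem t), ← Complex.ofReal_exp, Real.exp_log hr]
    field_simp [Complex.exp_ne_zero]
    ring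
  have hcont : Continuous fun t : ℝ => g (p + r * Complex.exp (t * Complex.I)) - t * Complex.I
      - Real.log r := by
    refine ((hg.comp_continuous (by fun_prop) hmem).sub (by fun_prop)).sub continuous_const
  have := eq_of_exp_eq_one isPreconnected_univ hcont.continuousOn (fun t _ => hu t)
    (mem_univ 0) (mem_univ (2 * Real.pi))
  simp only [Complex.ofReal_mul, Complex.ofReal_ofNat, Complex.exp_two_pi_mul_I,
    Complex.ofReal_zero, zero_mul, Complex.exp_zero] at this
  have h2 : (2 * Real.pi * Complex.I : ℂ) = 0 := by linear_combination this
  simp [Real.pi_ne_zero] at h2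

/-- Logarithms are transported along homotopies of nonvanishing functions. -/
theorem hasLog_of_homotopy {X : Type*} [TopologicalSpace X] {Z : Set X} (F : ℝ → X → ℂ)
    (hF : ContinuousOn (Function.uncurry F) (Icc 0 1 ×ˢ Z))
    (h0 : ∀ t ∈ Icc (0:ℝ) 1, ∀ z ∈ Z, F t z ≠ 0) (hl : HasLog (F 0) Z) : HasLog (F 1) Z := by
  classical
  obtain ⟨g, hg, hge⟩ := hl
  let H : C(unitInterval × Z, {z : ℂ // z ≠ 0}) :=
    ⟨fun x => ⟨F x.1 x.2, h0 x.1 x.1.2 x.2 x.2.2⟩, by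
      refine Continuous.subtype_mk ?_ _
      exact hF.comp_continuous (f := fun x : unitInterval × Z => ((x.1 : ℝ), (x.2 : X)))
        (by fun_prop) (fun x => ⟨x.1.2, x.2.2⟩)⟩
  let f : C(Z, ℂ) := ⟨fun z => g z, hg.comp_continuous continuous_subtype_val fun z => z.2⟩
  have H0 : ∀ a, H (0, a) = ⟨_, (f a).exp_ne_zero⟩ := fun a => by
    apply Subtype.ext
    simp [H, f, hge a a.2]
  let L := Complex.isCoveringMap_exp.liftHomotopy H f H0
  have hL := Complex.isCoveringMap_exp.liftHomotopy_lifts H f H0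
  refine ⟨fun z => if hz : z ∈ Z then L (1, ⟨z, hz⟩) else 0, ?_, fun z hz => ?_⟩
  · rw [continuousOn_iff_continuous_domRestrict]
    have : Z.domRestrict (fun z => if hz : z ∈ Z then L (1, ⟨z, hz⟩) else 0) =
        fun z : Z => L (1, z) := by
      ext z; simp [domRestrict]
    rw [this]
    fun_prop
  · have := congrArg Subtype.val (congrFun hL (1, ⟨z, hz⟩))
    simp only [dif_pos hz]
    simpa [H, L] using this

/-- If `p` and `q` are joined off `Z`, then `(z - q) / (z - p)` has a logarithm on `Z`. -/
theorem hasLog_of_joinedIn {Z : Set ℂ} {p q : ℂ} (h : JoinedIn Zᶜ p q) :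
    HasLog (fun z => (z - q) / (z - p)) Z := by
  obtain ⟨γ, hγ⟩ := h
  have key := hasLog_of_homotopy (Z := Z) (fun t z => (z - γ.extend t) / (z - p)) ?_ ?_ ?_
  · simpa using key
  · refine ContinuousOn.div (Continuous.continuousOn ?_) (Continuous.continuousOn ?_) ?_
    · exact continuous_snd.sub (γ.continuous_extend.comp continuous_fst)
    · fun_prop
    · rintro ⟨t, z⟩ ⟨-, hz⟩ h
      have := hγ 0
      simp only [Path.source] at this
      exact this (by rwa [← sub_eq_zero.1 h])
  · intro t ht z hz
    have h0 := hγ 0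
    simp only [Path.source] at h0
    have h1 : γ.extend t ∈ Zᶜ := by rw [γ.extend_apply ht]; exact hγ _
    refine div_ne_zero (fun h => h1 ?_) (fun h => h0 ?_)
    · rwa [← sub_eq_zero.1 h]
    · rwa [← sub_eq_zero.1 h]
  · refine ⟨fun _ => 0, continuousOn_const, fun z hz => ?_⟩
    have h0 := hγ 0
    simp only [Path.source] at h0
    have : z - p ≠ 0 := fun h => h0 (by rwa [← sub_eq_zero.1 h])
    simp [this]

theorem exists_tietze {K : Set ℂ} (hK : IsClosed K) {g : ℂ → ℂ} (hg : ContinuousOn g K) :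
    ∃ g' : ℂ → ℂ, Continuous g' ∧ EqOn g' g K := by
  obtain ⟨G, hG⟩ := ContinuousMap.exists_restrict_eq hK ⟨K.domRestrict g, hg.domRestrict⟩
  exact ⟨G, G.continuous, fun z hz => by simpa using congrArg (fun f => f ⟨z, hz⟩) hG⟩

theorem joinedIn_of_hasLog_aux {K : Set ℂ} (hK : IsClosed K) {p q : ℂ} (hp : p ∉ K)
    (h : HasLog (fun z => (z - p) / (z - q)) K) (hb : Bornology.IsBounded (pathComponentIn Kᶜ p))
    (hq : q ∉ K) : JoinedIn Kᶜ p q := by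
  classical
  by_contra hpq
  obtain ⟨g, hg, hge⟩ := h
  obtain ⟨G, hG, hGe⟩ := exists_tietze hK hg
  set U := pathComponentIn Kᶜ p with hU
  have hqU : q ∉ closure U := fun h => hpq (mem_pathComponentIn_of_closure hK.isOpen_compl h hq)
  let F : ℂ → ℂ := fun z => if z ∈ closure U then (z - q) * Complex.exp (G z) else z - p
  have hfr : frontier (closure U) ⊆ frontier U := frontier_closure_subset
  have hF : Continuous F := by
    refine Continuous.if ?_ (by fun_prop) (by fun_prop)
    intro z hz
    have hzK : z ∈ K := frontier_pathComponentIn hK p (hfr hz)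
    rw [hGe hzK, hge z hzK]
    have : z - q ≠ 0 := fun h => hq (by rwa [← sub_eq_zero.1 h])
    field_simp
  have hF0 : ∀ z, F z ≠ 0 := by
    intro z
    by_cases hz : z ∈ closure U
    · simp only [F, hz, if_true]
      exact mul_ne_zero (fun h => hqU (by rwa [← sub_eq_zero.1 h])) (Complex.exp_ne_zero _)
    · simp only [F, hz, if_false]
      intro h
      rw [sub_eq_zero.1 h] at hz
      exact hz (subset_closure (mem_pathComponentIn_self hp))
  obtain ⟨L, hL, hLe⟩ := hasLog_univ hF hF0
  obtain ⟨R, hR⟩ := hb.closure.subset_ball p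
  have hRp : 0 < max R 1 := by positivity
  refine not_hasLog_sphere (p := p) hRp ⟨L, hL.continuousOn, fun z hz => ?_⟩
  rw [hLe]
  have : z ∉ closure U := fun h => by
    have := hR h
    rw [mem_ball] at this; rw [mem_sphere] at hz
    have := le_max_left R 1
    linarith
  simp [F, this]

theorem far_mem_pathComponentIn {K : Set ℂ} (hK : Bornology.IsBounded K) {p q : ℂ}
    (hp : ¬ Bornology.IsBounded (pathComponentIn Kᶜ p))
    (hq : ¬ Bornology.IsBounded (pathComponentIn Kᶜ q)) : JoinedIn Kᶜ p q := by
  obtain ⟨R, hR, hKR⟩ := hK.subset_ball_lt 0 0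
  have key : ∀ p, ¬ Bornology.IsBounded (pathComponentIn Kᶜ p) → ∃ z, JoinedIn Kᶜ p z ∧ R < ‖z‖ := by
    intro p hp
    by_contra! h
    exact hp (isBounded_iff_forall_norm_le.2 ⟨R, fun x hx => h x hx⟩)
  obtain ⟨z, hz, hz'⟩ := key p hp
  obtain ⟨w, hw, hw'⟩ := key q hq
  refine (hz.trans ((joinedIn_far hR hz' hw').mono ?_)).trans hw.symm
  intro x hx hxK
  have := hKR hxK
  simp at this hx
  linarith

/-- **Eilenberg's criterion.** -/
theorem joinedIn_of_hasLog {K : Set ℂ} (hK : IsCompact K) {p q : ℂ} (hp : p ∉ K) (hq : q ∉ K)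
    (h : HasLog (fun z => (z - p) / (z - q)) K) : JoinedIn Kᶜ p q := by
  by_cases h1 : Bornology.IsBounded (pathComponentIn Kᶜ p)
  · exact joinedIn_of_hasLog_aux hK.isClosed hp h h1 hq
  by_cases h2 : Bornology.IsBounded (pathComponentIn Kᶜ q)
  · refine (joinedIn_of_hasLog_aux hK.isClosed hq ?_ h2 hp).symm
    exact h.inv.congr fun z _ => by rw [inv_div]
  exact far_mem_pathComponentIn hK.isBounded h1 h2

theorem JoinedIn.notMem_left {K : Set ℂ} {p q : ℂ} (h : JoinedIn Kᶜ p q) : p ∉ K := h.mem.1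
theorem JoinedIn.notMem_right {K : Set ℂ} {p q : ℂ} (h : JoinedIn Kᶜ p q) : q ∉ K := h.mem.2

/-- **Janiszewski's theorem.** -/
theorem janiszewski {K L : Set ℂ} (hK : IsCompact K) (hL : IsCompact L)
    (hKL : IsPreconnected (K ∩ L)) {p q : ℂ} (h1 : JoinedIn Kᶜ p q) (h2 : JoinedIn Lᶜ p q) :
    JoinedIn (K ∪ L)ᶜ p q := by
  refine joinedIn_of_hasLog (hK.union hL) (not_or.2 ⟨h1.notMem_left, h2.notMem_left⟩)
    (not_or.2 ⟨h1.notMem_right, h2.notMem_right⟩) ?_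
  exact (hasLog_of_joinedIn h1.symm).union_isClosed (hasLog_of_joinedIn h2.symm) hKL
    hK.isClosed hL.isClosed

theorem continuousOn_invFunOn {X Y : Type*} [TopologicalSpace X] [TopologicalSpace Y] [T2Space Y]
    [Nonempty X] {f : X → Y} {K : Set X} (hK : IsCompact K) (hf : ContinuousOn f K)
    (hi : InjOn f K) : ContinuousOn (Function.invFunOn f K) (f '' K) := by
  rw [continuousOn_iff_isClosed]
  intro C hC
  refine ⟨f '' (K ∩ C), ((hK.inter_right hC).image_of_continuousOn
    (hf.mono inter_subset_left)).isClosed, ?_⟩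
  ext y
  constructor
  · rintro ⟨hy, x, hx, rfl⟩
    refine ⟨⟨x, ⟨hx, ?_⟩, rfl⟩, ⟨x, hx, rfl⟩⟩
    simpa [hi.leftInvOn_invFunOn hx] using hy
  · rintro ⟨⟨x, hx, rfl⟩, -⟩
    refine ⟨?_, ⟨x, hx.1, rfl⟩⟩
    simpa [hi.leftInvOn_invFunOn hx.1] using hx.2

/-- `A` is an arc in the plane from `a` to `b`. -/
def IsArc (A : Set ℂ) (a b : ℂ) : Prop :=
  ∃ γ : ℝ → ℂ, ContinuousOn γ (Icc 0 1) ∧ InjOn γ (Icc 0 1) ∧ γ 0 = a ∧ γ 1 = b ∧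
    γ '' Icc 0 1 = A

theorem isArc_image {γ : ℝ → ℂ} {s t : ℝ} (hst : s < t) (h1 : ContinuousOn γ (Icc s t))
    (h2 : InjOn γ (Icc s t)) : IsArc (γ '' Icc s t) (γ s) (γ t) := by
  have him : (fun u : ℝ => s + (t - s) * u) '' Icc 0 1 = Icc s t := by
    ext x
    constructor
    · rintro ⟨u, ⟨hu0, hu1⟩, rfl⟩
      constructor <;> simp only <;> nlinarith
    · rintro ⟨hx0, hx1⟩
      have h : 0 < t - s := by linarith
      refine ⟨(x - s) / (t - s), ⟨div_nonneg (by linarith) h.le, (div_le_one h).2 (by linarith)⟩, ?_⟩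
      simp only
      field_simp
      ring
  refine ⟨γ ∘ fun u => s + (t - s) * u, ?_, ?_, by simp, by simp, by rw [image_comp, him]⟩
  · exact h1.comp (by fun_prop) (mapsTo_iff_image_subset.2 him.subset)
  · refine h2.comp ?_ (mapsTo_iff_image_subset.2 him.subset)
    intro x _ y _ h
    have : t - s ≠ 0 := by linarith
    simpa [this] using h

namespace IsArc
variable {A B : Set ℂ} {a b c : ℂ}

theorem isCompact (h : IsArc A a b) : IsCompact A := by
  obtain ⟨γ, h1, -, -, -, rfl⟩ := h
  exact isCompact_Icc.image_of_continuousOn h1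

theorem isClosed (h : IsArc A a b) : IsClosed A := h.isCompact.isClosed

theorem isPreconnected (h : IsArc A a b) : IsPreconnected A := by
  obtain ⟨γ, h1, -, -, -, rfl⟩ := h
  exact isPreconnected_Icc.image _ h1

theorem left_mem (h : IsArc A a b) : a ∈ A := by
  obtain ⟨γ, h1, -, rfl, -, rfl⟩ := h
  exact ⟨0, by simp, rfl⟩

theorem right_mem (h : IsArc A a b) : b ∈ A := by
  obtain ⟨γ, h1, -, -, rfl, rfl⟩ := h
  exact ⟨1, by simp, rfl⟩

theorem ne (h : IsArc A a b) : a ≠ b := by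
  obtain ⟨γ, h1, h2, rfl, rfl, rfl⟩ := h
  intro h
  have := h2 (by simp) (by simp) h
  norm_num at this

theorem symm (h : IsArc A a b) : IsArc A b a := by
  obtain ⟨γ, h1, h2, rfl, rfl, rfl⟩ := h
  have hm : MapsTo (fun t : ℝ => 1 - t) (Icc 0 1) (Icc 0 1) := fun t ht => by
    constructor <;> simp only <;> linarith [ht.1, ht.2]
  refine ⟨fun t => γ (1 - t), h1.comp (by fun_prop) hm, ?_, by simp, by simp, ?_⟩
  · intro x hx y hy hxy
    have := h2 (hm hx) (hm hy) hxy
    linarith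
  · ext z
    constructor
    · rintro ⟨t, ht, rfl⟩; exact ⟨1 - t, hm ht, rfl⟩
    · rintro ⟨t, ht, rfl⟩; exact ⟨1 - t, hm ht, by simp⟩

theorem image {A : Set ℂ} (h : IsArc A a b) {f : ℂ → ℂ} (hf : ContinuousOn f A) (hi : InjOn f A) :
    IsArc (f '' A) (f a) (f b) := by
  obtain ⟨γ, h1, h2, rfl, rfl, rfl⟩ := h
  refine ⟨f ∘ γ, hf.comp h1 (mapsTo_image _ _), hi.comp h2 (mapsTo_image _ _), rfl, rfl, ?_⟩
  rw [image_comp]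

theorem concat (h : IsArc A a c) (h' : IsArc B c b) (hAB : A ∩ B ⊆ {c}) : IsArc (A ∪ B) a b := by
  classical
  obtain ⟨γ, h1, h2, rfl, rfl, rfl⟩ := h
  obtain ⟨δ, k1, k2, k0, rfl, rfl⟩ := h'
  let η : ℝ → ℂ := fun t => if t ≤ 1 then γ t else δ (t - 1)
  have e1 : EqOn η γ (Icc 0 1) := fun t ht => by simp [η, ht.2]
  have e2 : EqOn η (fun t => δ (t - 1)) (Icc 1 2) := fun t ht => by
    by_cases h : t ≤ 1
    · have : t = 1 := le_antisymm h ht.1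
      simp [η, this, k0]
    · simp [η, h]
  have hm : MapsTo (fun t : ℝ => t - 1) (Icc 1 2) (Icc 0 1) := fun t ht => by
    constructor <;> simp only <;> linarith [ht.1, ht.2]
  have hU : Icc (0:ℝ) 2 = Icc 0 1 ∪ Icc 1 2 := (Icc_union_Icc_eq_Icc (by norm_num) (by norm_num)).symm
  have hc : ContinuousOn η (Icc 0 2) := by
    rw [hU]
    exact (h1.congr e1).union_of_isClosed ((k1.comp (by fun_prop) hm).congr e2) isClosed_Icc
      isClosed_Icc
  have hi : InjOn η (Icc 0 2) := by
    have key : ∀ x ∈ Icc (0:ℝ) 1, ∀ y ∈ Icc (1:ℝ) 2, η x = η y → x = y := by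
      intro x hx y hy hxy
      rw [e1 hx, e2 hy] at hxy
      have h3 : γ x = γ 1 := hAB ⟨⟨x, hx, rfl⟩, ⟨y - 1, hm hy, hxy.symm⟩⟩
      have hx1 : x = 1 := h2 hx (by simp) h3
      have : y - 1 = 0 := k2 (hm hy) (by simp) (by rw [k0, ← h3]; exact hxy.symm)
      linarith
    rw [hU]
    rintro x (hx | hx) y (hy | hy) hxy
    · rw [e1 hx, e1 hy] at hxy; exact h2 hx hy hxy
    · exact key x hx y hy hxy
    · exact (key y hy x hx hxy.symm).symm
    · rw [e2 hx, e2 hy] at hxy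
      have := k2 (hm hx) (hm hy) hxy
      linarith
  have := isArc_image (by norm_num : (0:ℝ) < 2) hc hi
  have him : η '' Icc 0 2 = γ '' Icc 0 1 ∪ δ '' Icc 0 1 := by
    rw [hU, image_union, e1.image_eq, e2.image_eq]
    congr 1
    ext z
    constructor
    · rintro ⟨t, ht, rfl⟩; exact ⟨t - 1, hm ht, rfl⟩
    · rintro ⟨t, ht, rfl⟩
      exact ⟨t + 1, ⟨by linarith [ht.1], by linarith [ht.2]⟩, by simp⟩
  rw [him, e1 (by simp), e2 (by simp)] at this
  simpa [show (2:ℝ) - 1 = 1 by norm_num] using this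

/-- An arc splits at each of its interior points. -/
theorem split (h : IsArc A a b) (hc : c ∈ A) (hca : c ≠ a) (hcb : c ≠ b) :
    ∃ A₁ A₂, IsArc A₁ a c ∧ IsArc A₂ c b ∧ A₁ ∪ A₂ = A ∧ A₁ ∩ A₂ = {c} := by
  obtain ⟨γ, h1, h2, rfl, rfl, rfl⟩ := h
  obtain ⟨t, ht, rfl⟩ := hc
  have h0 : 0 < t := lt_of_le_of_ne ht.1 fun h => hca (by rw [h])
  have h3 : t < 1 := lt_of_le_of_ne ht.2 fun h => hcb (by rw [h])
  have s1 : Icc 0 t ⊆ Icc (0:ℝ) 1 := Icc_subset_Icc le_rfl h3.le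
  have s2 : Icc t 1 ⊆ Icc (0:ℝ) 1 := Icc_subset_Icc h0.le le_rfl
  refine ⟨_, _, isArc_image h0 (h1.mono s1) (h2.mono s1), isArc_image h3 (h1.mono s2) (h2.mono s2),
    ?_, ?_⟩
  · rw [← image_union, Icc_union_Icc_eq_Icc h0.le h3.le]
  · rw [← h2.image_inter s1 s2, Icc_inter_Icc_eq_singleton h0.le h3.le, image_singleton]

/-- The initial part of an arc up to the first hit of a closed set. -/
theorem firstHit (h : IsArc A a b) {C : Set ℂ} (hC : IsClosed C) (ha : a ∉ C)
    (hAC : (A ∩ C).Nonempty) : ∃ c A', IsArc A' a c ∧ A' ⊆ A ∧ A' ∩ C = {c} := by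
  obtain ⟨γ, h1, h2, rfl, rfl, rfl⟩ := h
  have hcl : IsClosed (Icc (0:ℝ) 1 ∩ γ ⁻¹' C) := h1.preimage_isClosed_of_isClosed isClosed_Icc hC
  have hcp : IsCompact (Icc (0:ℝ) 1 ∩ γ ⁻¹' C) := isCompact_Icc.of_isClosed_subset hcl
    inter_subset_left
  have hne : (Icc (0:ℝ) 1 ∩ γ ⁻¹' C).Nonempty := by
    obtain ⟨_, ⟨t, ht, rfl⟩, htC⟩ := hAC
    exact ⟨t, ht, htC⟩
  obtain ⟨t, ⟨ht, htC⟩, hmin⟩ := hcp.exists_isLeast hne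
  have h0 : 0 < t := lt_of_le_of_ne ht.1 fun h => ha (by rw [h]; exact htC)
  have s1 : Icc 0 t ⊆ Icc (0:ℝ) 1 := Icc_subset_Icc le_rfl ht.2
  refine ⟨γ t, _, isArc_image h0 (h1.mono s1) (h2.mono s1), image_mono s1, ?_⟩
  ext z
  constructor
  · rintro ⟨⟨s, hs, rfl⟩, hz⟩
    have := hmin ⟨s1 hs, hz⟩
    rw [le_antisymm hs.2 this]; rfl
  · rintro rfl
    exact ⟨⟨t, ⟨h0.le, le_rfl⟩, rfl⟩, htC⟩

theorem hasLog (h : IsArc A a b) {f : ℂ → ℂ} (hf : ContinuousOn f A) (h0 : ∀ z ∈ A, f z ≠ 0) :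
    HasLog f A := by
  obtain ⟨γ, h1, h2, rfl, rfl, rfl⟩ := h
  obtain ⟨G, hG, hGe⟩ := hasLog_univ (X := ℝ) (f := fun t => f (γ (projIcc 0 1 zero_le_one t)))
    (hf.comp_continuous (h1.comp_continuous (by fun_prop) fun t => (projIcc 0 1 zero_le_one t).2)
      fun t => ⟨_, (projIcc 0 1 zero_le_one t).2, rfl⟩)
    (fun t => h0 _ ⟨_, (projIcc 0 1 zero_le_one t).2, rfl⟩)
  refine ⟨G ∘ Function.invFunOn γ (Icc 0 1), hG.comp_continuousOn
    (continuousOn_invFunOn isCompact_Icc h1 h2), ?_⟩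
  rintro _ ⟨t, ht, rfl⟩
  simp [hGe, h2.leftInvOn_invFunOn ht, projIcc_of_mem _ ht]

/-- Arcs do not separate the plane. -/
theorem joinedIn (h : IsArc A a b) {p q : ℂ} (hp : p ∉ A) (hq : q ∉ A) : JoinedIn Aᶜ p q := by
  have hn : ∀ {p}, p ∉ A → ∀ z ∈ A, z - p ≠ 0 := fun hp z hz h => hp (by rwa [← sub_eq_zero.1 h])
  refine joinedIn_of_hasLog h.isCompact hp hq (h.hasLog ?_ fun z hz => div_ne_zero (hn hp z hz)
    (hn hq z hz))
  exact ContinuousOn.div (by fun_prop) (by fun_prop) (hn hq)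

theorem infinite (h : IsArc A a b) : A.Infinite := by
  obtain ⟨γ, h1, h2, rfl, rfl, rfl⟩ := h
  exact (Icc_infinite zero_lt_one).image h2

/-- Removing an endpoint leaves a connected set. -/
theorem isPreconnected_diff_left (h : IsArc A a b) : IsPreconnected (A \ {a}) := by
  obtain ⟨γ, h1, h2, rfl, rfl, rfl⟩ := h
  have : γ '' Icc 0 1 \ {γ 0} = γ '' Ioc 0 1 := by
    rw [← image_singleton, ← h2.image_sdiff_subset (by simp), Icc_sdiff_left]
  rw [this]
  exact isPreconnected_Ioc.image _ (h1.mono Ioc_subset_Icc_self)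

theorem isPreconnected_diff (h : IsArc A a b) : IsPreconnected (A \ {a, b}) := by
  obtain ⟨γ, h1, h2, rfl, rfl, rfl⟩ := h
  have : γ '' Icc 0 1 \ {γ 0, γ 1} = γ '' Ioo 0 1 := by
    rw [← image_pair, ← h2.image_sdiff_subset (by rintro x (rfl | rfl) <;> simp), Icc_sdiff_both]
  rw [this]
  exact isPreconnected_Ioo.image _ (h1.mono Ioo_subset_Icc_self)

/-- An arc is the closure of its interior points. -/
theorem subset_closure_diff (h : IsArc A a b) : A ⊆ closure (A \ {a, b}) := by
  obtain ⟨γ, h1, h2, rfl, rfl, rfl⟩ := h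
  have : γ '' Icc 0 1 \ {γ 0, γ 1} = γ '' Ioo 0 1 := by
    rw [← image_pair, ← h2.image_sdiff_subset (by rintro x (rfl | rfl) <;> simp), Icc_sdiff_both]
  rw [this]
  have h3 : closure (Ioo (0:ℝ) 1) = Icc 0 1 := closure_Ioo (by norm_num)
  have := ContinuousOn.image_closure (f := γ) (s := Ioo 0 1) (by rwa [h3])
  rwa [h3] at this

end IsArc

theorem sub_ne_zero_of_notMem {S : Set ℂ} {p z : ℂ} (hp : p ∉ S) (hz : z ∈ S) : z - p ≠ 0 :=
  fun h => hp (by rwa [← sub_eq_zero.1 h])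

theorem eq_zero_of_hasLog_sphere {p : ℂ} {r : ℝ} (hr : 0 < r) {n : ℤ}
    (h : HasLog (fun z => (z - p) ^ n) (sphere p r)) : n = 0 := by
  obtain ⟨g, hg, hge⟩ := h
  have hmem : ∀ t : ℝ, p + r * Complex.exp (t * Complex.I) ∈ sphere p r := fun t => by
    simp [Complex.norm_exp_ofReal_mul_I, abs_of_pos hr]
  have hr' : (r : ℂ) ≠ 0 := by exact_mod_cast hr.ne'
  have hu : ∀ t : ℝ, Complex.exp (g (p + r * Complex.exp (t * Complex.I)) - n * (t * Complex.I)
      - n * Real.log r) = 1 := fun t => by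
    rw [Complex.exp_sub, Complex.exp_sub, hge _ (hmem t), Complex.exp_int_mul, Complex.exp_int_mul,
      ← Complex.ofReal_exp, Real.exp_log hr]
    simp only [add_sub_cancel_left, mul_zpow]
    field_simp [Complex.exp_ne_zero]
  have hcont : Continuous fun t : ℝ => g (p + r * Complex.exp (t * Complex.I))
      - n * (t * Complex.I) - n * Real.log r := by
    refine ((hg.comp_continuous (by fun_prop) hmem).sub (by fun_prop)).sub continuous_const
  have := eq_of_exp_eq_one isPreconnected_univ hcont.continuousOn (fun t _ => hu t)
    (mem_univ 0) (mem_univ (2 * Real.pi))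
  simp only [Complex.ofReal_mul, Complex.ofReal_ofNat, Complex.exp_two_pi_mul_I,
    Complex.ofReal_zero, zero_mul, Complex.exp_zero] at this
  have h2 : (n * (2 * Real.pi * Complex.I) : ℂ) = 0 := by linear_combination this
  simpa [Real.pi_ne_zero] using h2

/-- The exponent of a pole in a bounded component vanishes if there is a logarithm. -/
theorem eq_zero_of_hasLog {K : Set ℂ} (hK : IsClosed K) {p : ℂ} (hp : p ∉ K)
    (hb : Bornology.IsBounded (pathComponentIn Kᶜ p)) {n : ℤ} {u : ℂ → ℂ}
    (hu : ContinuousOn u (closure (pathComponentIn Kᶜ p)))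
    (hu0 : ∀ z ∈ closure (pathComponentIn Kᶜ p), u z ≠ 0)
    (h : HasLog (fun z => (z - p) ^ n * u z) K) : n = 0 := by
  classical
  obtain ⟨g, hg, hge⟩ := h
  obtain ⟨G, hG, hGe⟩ := exists_tietze hK hg
  set U := pathComponentIn Kᶜ p with hU
  let F : ℂ → ℂ := fun z => if z ∈ closure U then Complex.exp (G z) * (u z)⁻¹ else (z - p) ^ n
  have hfr : frontier (closure U) ⊆ frontier U := frontier_closure_subset
  have hpU : p ∈ U := mem_pathComponentIn_self hp
  have hne : ∀ z ∈ closure (closure U)ᶜ, z - p ≠ 0 := by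
    intro z hz h
    rw [sub_eq_zero.1 h, closure_compl] at hz
    exact hz (interior_mono subset_closure
      (by rwa [(hK.isOpen_compl.pathComponentIn p).interior_eq]))
  have hF : Continuous F := by
    refine continuous_if ?_ ?_ ?_
    · intro z hz
      have hzK : z ∈ K := frontier_pathComponentIn hK p (hfr hz)
      rw [hGe hzK, hge z hzK]
      have : u z ≠ 0 := hu0 z (frontier_subset_closure (hfr hz))
      field_simp
    · have : closure {z | z ∈ closure U} = closure U := closure_closure
      rw [this]
      exact (by fun_prop : Continuous fun z => Complex.exp (G z)).continuousOn.mul (hu.inv₀ hu0)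
    · exact (by fun_prop : Continuous fun z => z - p).continuousOn.zpow₀ n
        fun z hz => Or.inl (hne z hz)
  have hF0 : ∀ z, F z ≠ 0 := by
    intro z
    by_cases hz : z ∈ closure U
    · simp only [F, hz, if_true]
      exact mul_ne_zero (Complex.exp_ne_zero _) (inv_ne_zero (hu0 z hz))
    · simp only [F, hz, if_false]
      exact zpow_ne_zero _ (hne z (subset_closure hz))
  obtain ⟨L, hL, hLe⟩ := hasLog_univ hF hF0
  obtain ⟨R, hR⟩ := hb.closure.subset_ball p
  have hRp : 0 < max R 1 := by positivity
  refine eq_zero_of_hasLog_sphere (p := p) hRp ⟨L, hL.continuousOn, fun z hz => ?_⟩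
  rw [hLe]
  have : z ∉ closure U := fun h => by
    have := hR h
    rw [mem_ball] at this; rw [mem_sphere] at hz
    have := le_max_left R 1
    linarith
  simp [F, this]

theorem exists_log_defect {f : ℂ → ℂ} {K B : Set ℂ} (h1 : HasLog f K) (h2 : HasLog f B) {c d : ℂ}
    (hc : c ∈ K ∩ B) (hd : d ∈ K ∩ B) : ∃ (g g' : ℂ → ℂ) (m : ℤ), ContinuousOn g K ∧
      ContinuousOn g' B ∧ (∀ z ∈ K, Complex.exp (g z) = f z) ∧ (∀ z ∈ B, Complex.exp (g' z) = f z) ∧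
      g c = g' c ∧ g d = g' d + m * (2 * Real.pi * Complex.I) := by
  obtain ⟨g, hg, hge⟩ := h1
  obtain ⟨g', hg', hge'⟩ := h2
  have e : ∀ z ∈ K ∩ B, Complex.exp (g z) = Complex.exp (g' z) := fun z hz => by
    rw [hge z hz.1, hge' z hz.2]
  have hec : Complex.exp (g c - g' c) = 1 := by
    rw [Complex.exp_sub, e c hc, div_self (Complex.exp_ne_zero _)]
  have hed : Complex.exp (g d) = Complex.exp (g' d + (g c - g' c)) := by
    rw [Complex.exp_add, hec, mul_one, e d hd]
  obtain ⟨m, hm⟩ := Complex.exp_eq_exp_iff_exists_int.1 hed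
  refine ⟨g, fun z => g' z + (g c - g' c), m, hg, hg'.add continuousOn_const, hge, ?_, by ring, hm⟩
  intro z hz
  rw [Complex.exp_add, hec, mul_one, hge' z hz]

theorem HasLog.union_of_eqOn {f g g' : ℂ → ℂ} {S T : Set ℂ} (hS : IsClosed S) (hT : IsClosed T)
    (h1 : ContinuousOn g S) (h1' : ContinuousOn g' T) (h2 : ∀ z ∈ S, Complex.exp (g z) = f z)
    (h2' : ∀ z ∈ T, Complex.exp (g' z) = f z) (h : ∀ z ∈ S ∩ T, g z = g' z) : HasLog f (S ∪ T) := by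
  classical
  have e2 : EqOn (fun z => if z ∈ S then g z else g' z) g' T := fun z hz => by
    by_cases hs : z ∈ S
    · simp [hs, h z ⟨hs, hz⟩]
    · simp [hs]
  refine ⟨fun z => if z ∈ S then g z else g' z, ?_, ?_⟩
  · exact (h1.congr fun z hz => by simp [hz]).union_of_isClosed (h1'.congr e2) hS hT
  · rintro z hz
    by_cases hs : z ∈ S
    · simp [hs, h2 z hs]
    · simp [hs, h2' z (hz.resolve_left hs)]

theorem joinedIn_plus_arc_aux {K B : Set ℂ} (hK : IsCompact K) {c d : ℂ} (hB : IsArc B c d)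
    (hc : c ∈ K) (hd : d ∈ K) (hKB : K ∩ B ⊆ {c, d}) {p q r : ℂ} (h1 : JoinedIn Kᶜ p q)
    (h2 : JoinedIn Kᶜ p r) (hp : p ∉ B) (hq : q ∉ B) (hr : r ∉ B)
    (hpq : ¬ JoinedIn (K ∪ B)ᶜ p q) (hqr : ¬ JoinedIn (K ∪ B)ᶜ q r)
    (hb : Bornology.IsBounded (pathComponentIn (K ∪ B)ᶜ q)) : JoinedIn (K ∪ B)ᶜ p r := by
  have hc' : c ∈ K ∩ B := ⟨hc, hB.left_mem⟩
  have hd' : d ∈ K ∩ B := ⟨hd, hB.right_mem⟩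
  have hKc : IsClosed (K ∪ B) := hK.isClosed.union hB.isClosed
  have key : ∀ {s}, s ∉ B → HasLog (fun z => (z - p) / (z - s)) B := fun {s} hs =>
    hB.hasLog (ContinuousOn.div (by fun_prop) (by fun_prop) fun z => sub_ne_zero_of_notMem hs)
      fun z hz => div_ne_zero (sub_ne_zero_of_notMem hp hz) (sub_ne_zero_of_notMem hs hz)
  obtain ⟨g, g', m, a1, a2, a3, a4, a5, a6⟩ :=
    exists_log_defect (hasLog_of_joinedIn h1.symm) (key hq) hc' hd'
  obtain ⟨k, k', n, b1, b2, b3, b4, b5, b6⟩ :=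
    exists_log_defect (hasLog_of_joinedIn h2.symm) (key hr) hc' hd'
  have hpu : p ∉ K ∪ B := not_or.2 ⟨h1.notMem_left, hp⟩
  have hqu : q ∉ K ∪ B := not_or.2 ⟨h1.notMem_right, hq⟩
  have hru : r ∉ K ∪ B := not_or.2 ⟨h2.notMem_right, hr⟩
  have hlog : HasLog (fun z => ((z - p) / (z - q)) ^ n * ((z - p) / (z - r)) ^ (-m)) (K ∪ B) := by
    refine HasLog.union_of_eqOn hK.isClosed hB.isClosed (g := fun z => n * g z + (-m : ℤ) * k z)
      (g' := fun z => n * g' z + (-m : ℤ) * k' z) ?_ ?_ ?_ ?_ ?_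
    · exact (continuousOn_const.mul a1).add (continuousOn_const.mul b1)
    · exact (continuousOn_const.mul a2).add (continuousOn_const.mul b2)
    · intro z hz
      rw [Complex.exp_add, Complex.exp_int_mul, Complex.exp_int_mul, a3 z hz, b3 z hz]
    · intro z hz
      rw [Complex.exp_add, Complex.exp_int_mul, Complex.exp_int_mul, a4 z hz, b4 z hz]
    · intro z hz
      rcases hKB hz with rfl | rfl
      · rw [a5, b5]
      · rw [a6, b6]; push_cast; ring
  have hcl : ∀ s, s ∉ K ∪ B → ¬ JoinedIn (K ∪ B)ᶜ q s →
      ∀ z ∈ closure (pathComponentIn (K ∪ B)ᶜ q), z - s ≠ 0 := fun s hs hqs z hz h =>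
    hqs (mem_pathComponentIn_of_closure hKc.isOpen_compl (by rwa [← sub_eq_zero.1 h]) hs)
  have hn : -n = 0 := by
    refine eq_zero_of_hasLog hKc hqu hb (u := fun z => (z - p) ^ (n - m) * (z - r) ^ m) ?_ ?_ ?_
    · exact ((by fun_prop : Continuous fun z : ℂ => z - p).continuousOn.zpow₀ _ fun z hz =>
        Or.inl (hcl p hpu (fun h => hpq h.symm) z hz)).mul
        ((by fun_prop : Continuous fun z : ℂ => z - r).continuousOn.zpow₀ _ fun z hz =>
        Or.inl (hcl r hru hqr z hz))
    · exact fun z hz => mul_ne_zero (zpow_ne_zero _ (hcl p hpu (fun h => hpq h.symm) z hz))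
        (zpow_ne_zero _ (hcl r hru hqr z hz))
    · refine hlog.congr fun z hz => ?_
      have e1 := sub_ne_zero_of_notMem hpu hz
      rw [div_zpow, div_zpow, zpow_sub₀ e1, zpow_neg, zpow_neg, zpow_neg]
      have e2 := zpow_ne_zero m (sub_ne_zero_of_notMem hru hz)
      have e3 := zpow_ne_zero n (sub_ne_zero_of_notMem hqu hz)
      have e4 := zpow_ne_zero m e1
      field_simp
  have hn0 : n = 0 := by omega
  refine joinedIn_of_hasLog (hK.union hB.isCompact) hpu hru ?_
  refine HasLog.union_of_eqOn hK.isClosed hB.isClosed b1 b2 b3 b4 fun z hz => ?_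
  rcases hKB hz with rfl | rfl
  · exact b5
  · rw [b6, hn0]; simp

/-- Adding an arc attached at its ends splits each component into at most two. -/
theorem joinedIn_plus_arc {K B : Set ℂ} (hK : IsCompact K) {c d : ℂ} (hB : IsArc B c d)
    (hKB : K ∩ B ⊆ {c, d}) {p q r : ℂ} (h1 : JoinedIn Kᶜ p q) (h2 : JoinedIn Kᶜ p r)
    (hp : p ∉ B) (hq : q ∉ B) (hr : r ∉ B) :
    JoinedIn (K ∪ B)ᶜ p q ∨ JoinedIn (K ∪ B)ᶜ p r ∨ JoinedIn (K ∪ B)ᶜ q r := by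
  by_cases hcd : c ∈ K ∧ d ∈ K
  · by_contra! hcon
    obtain ⟨n1, n2, n3⟩ := hcon
    by_cases hb : Bornology.IsBounded (pathComponentIn (K ∪ B)ᶜ q)
    · exact n2 (joinedIn_plus_arc_aux hK hB hcd.1 hcd.2 hKB h1 h2 hp hq hr n1 n3 hb)
    by_cases hb' : Bornology.IsBounded (pathComponentIn (K ∪ B)ᶜ r)
    · exact n1 (joinedIn_plus_arc_aux hK hB hcd.1 hcd.2 hKB h2 h1 hp hr hq n2
        (fun h => n3 h.symm) hb')
    exact n3 (far_mem_pathComponentIn (hK.union hB.isCompact).isBounded hb hb')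
  · left
    refine janiszewski hK hB.isCompact ?_ h1 (hB.joinedIn hp hq)
    apply Set.Subsingleton.isPreconnected
    intro x hx y hy
    rcases hKB hx with rfl | rfl <;> rcases hKB hy with rfl | rfl
    · rfl
    · exact absurd ⟨hx.1, hy.1⟩ hcd
    · exact absurd ⟨hy.1, hx.1⟩ hcd
    · rfl

/-- The complement of `K` has finitely many components. -/
def FinComp (K : Set ℂ) : Prop := ∃ T : Finset ℂ, ∀ z ∉ K, ∃ t ∈ T, JoinedIn Kᶜ z t

theorem FinComp.union_arc {K B : Set ℂ} (h : FinComp K) (hK : IsCompact K) {c d : ℂ}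
    (hB : IsArc B c d) (hKB : K ∩ B ⊆ {c, d}) : FinComp (K ∪ B) := by
  classical
  obtain ⟨T, hT⟩ := h
  have key : ∀ t, ∃ S : Finset ℂ, ∀ z ∉ K ∪ B, JoinedIn Kᶜ z t → ∃ s ∈ S, JoinedIn (K ∪ B)ᶜ z s := by
    intro t
    by_cases h1 : ∃ z ∉ K ∪ B, JoinedIn Kᶜ z t
    swap
    · exact ⟨∅, fun z hz hzt => absurd ⟨z, hz, hzt⟩ h1⟩
    obtain ⟨z, hz, hzt⟩ := h1
    by_cases h2 : ∃ w ∉ K ∪ B, JoinedIn Kᶜ w t ∧ ¬ JoinedIn (K ∪ B)ᶜ w z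
    swap
    · push Not at h2
      exact ⟨{z}, fun w hw hwt => ⟨z, by simp, h2 w hw hwt⟩⟩
    obtain ⟨w, hw, hwt, hwz⟩ := h2
    refine ⟨{z, w}, fun x hx hxt => ?_⟩
    rcases joinedIn_plus_arc hK hB hKB (hxt.trans hzt.symm) (hxt.trans hwt.symm)
      (fun h => hx (Or.inr h)) (fun h => hz (Or.inr h)) (fun h => hw (Or.inr h)) with h | h | h
    · exact ⟨z, by simp, h⟩
    · exact ⟨w, by simp, h⟩
    · exact absurd h.symm hwz
  choose S hS using key
  refine ⟨T.biUnion S, fun z hz => ?_⟩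
  obtain ⟨t, ht, hzt⟩ := hT z fun h => hz (Or.inl h)
  obtain ⟨s, hs, hzs⟩ := hS t z hz hzt
  exact ⟨s, Finset.mem_biUnion.2 ⟨t, ht, hs⟩, hzs⟩

/-- The union of the bounded components of the complement. -/
def ins (K : Set ℂ) : Set ℂ := {z | z ∉ K ∧ Bornology.IsBounded (pathComponentIn Kᶜ z)}

/-- The union of the unbounded components of the complement. -/
def outs (K : Set ℂ) : Set ℂ := {z | z ∉ K ∧ ¬ Bornology.IsBounded (pathComponentIn Kᶜ z)}

/-- A Jordan curve made of the arcs `A` and `B` from `a` to `b`. -/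
structure IsTwoArc (J A B : Set ℂ) (a b : ℂ) : Prop where
  left : IsArc A a b
  right : IsArc B a b
  inter : A ∩ B = {a, b}
  union : A ∪ B = J

/-- A Jordan curve. -/
def IsJordanCurve (J : Set ℂ) : Prop := ∃ A B a b, IsTwoArc J A B a b

theorem mem_ins_of_joinedIn {K : Set ℂ} {z w : ℂ} (hz : z ∈ ins K) (h : JoinedIn Kᶜ z w) :
    w ∈ ins K :=
  ⟨h.notMem_right, by rw [← pathComponentIn_congr (show z ∈ pathComponentIn Kᶜ w from h.symm)]; exact hz.2⟩

theorem mem_outs_of_joinedIn {K : Set ℂ} {z w : ℂ} (hz : z ∈ outs K) (h : JoinedIn Kᶜ z w) :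
    w ∈ outs K :=
  ⟨h.notMem_right, by rw [← pathComponentIn_congr (show z ∈ pathComponentIn Kᶜ w from h.symm)]; exact hz.2⟩

theorem ins_disjoint (K : Set ℂ) : Disjoint (ins K) K :=
  Set.disjoint_left.2 fun _ h => h.1

theorem outs_eq (K : Set ℂ) : outs K = (K ∪ ins K)ᶜ := by
  ext z
  simp only [outs, ins, mem_ofPred_eq, mem_compl_iff, mem_union]
  tauto

theorem isOpen_ins {K : Set ℂ} (hK : IsClosed K) : IsOpen (ins K) := by
  rw [isOpen_iff_mem_nhds]
  intro z hz
  filter_upwards [(hK.isOpen_compl.pathComponentIn z).mem_nhds (mem_pathComponentIn_self hz.1)]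
    with w hw using mem_ins_of_joinedIn hz hw

theorem isOpen_outs {K : Set ℂ} (hK : IsClosed K) : IsOpen (outs K) := by
  rw [isOpen_iff_mem_nhds]
  intro z hz
  filter_upwards [(hK.isOpen_compl.pathComponentIn z).mem_nhds (mem_pathComponentIn_self hz.1)]
    with w hw using mem_outs_of_joinedIn hz hw

theorem isClosed_union_ins {K : Set ℂ} (hK : IsClosed K) : IsClosed (K ∪ ins K) := by
  rw [← isOpen_compl_iff, ← outs_eq]; exact isOpen_outs hK

theorem closure_ins_subset {K : Set ℂ} (hK : IsClosed K) : closure (ins K) ⊆ K ∪ ins K :=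
  (isClosed_union_ins hK).closure_subset_iff.2 subset_union_right

theorem isPreconnected_outs {K : Set ℂ} (hK : IsCompact K) : IsPreconnected (outs K) := by
  refine isPreconnected_of_forall_pair fun x hx y hy => ?_
  have h := far_mem_pathComponentIn hK.isBounded hx.2 hy.2
  exact ⟨pathComponentIn Kᶜ x, fun z hz => mem_outs_of_joinedIn hx hz,
    mem_pathComponentIn_self hx.1, h, isPreconnected_pathComponentIn x⟩

/-- A connected unbounded set missing `K` is in the outside. -/
theorem subset_outs {K S : Set ℂ} (hK : IsClosed K) (hS : IsPreconnected S) (hSK : S ⊆ Kᶜ)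
    (hb : ¬ Bornology.IsBounded S) : S ⊆ outs K := fun z hz =>
  ⟨hSK hz, fun h => hb (h.subset fun _ hw =>
    joinedIn_of_isPreconnected hK.isOpen_compl hS hSK hz hw)⟩

theorem isPreconnected_far {R : ℝ} (hR : 0 < R) (c : ℂ) : IsPreconnected (closedBall c R)ᶜ := by
  refine isPreconnected_of_forall_pair fun x hx y hy => ?_
  have h := joinedIn_far hR (p := x - c) (q := y - c) (by simpa [dist_eq_norm] using hx)
    (by simpa [dist_eq_norm] using hy)
  refine ⟨(fun z => z + c) '' pathComponentIn {z : ℂ | R < ‖z‖} (x - c), ?_, ⟨x - c, ?_, by simp⟩,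
    ⟨y - c, h, by simp⟩, (isPreconnected_pathComponentIn _).image _ (by fun_prop)⟩
  · rintro _ ⟨z, hz, rfl⟩
    have : z ∈ {z : ℂ | R < ‖z‖} := pathComponentIn_subset hz
    rw [mem_ofPred_eq] at this
    simpa [dist_eq_norm] using this
  · exact mem_pathComponentIn_self h.mem.1

theorem not_isBounded_far (R : ℝ) (c : ℂ) : ¬ Bornology.IsBounded (closedBall c R)ᶜ := by
  intro h
  exact NormedSpace.unbounded_univ ℝ ℂ
    ((h.union isBounded_closedBall).subset fun z _ => by
      by_cases hz : z ∈ closedBall c R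
      · exact Or.inr hz
      · exact Or.inl hz)

theorem ins_subset_closedBall {K : Set ℂ} (hK : IsClosed K) {R : ℝ} (hR : 0 < R) {c : ℂ}
    (h : K ⊆ closedBall c R) : ins K ⊆ closedBall c R := by
  intro z hz
  by_contra hzb
  exact (subset_outs hK (isPreconnected_far hR c) (compl_subset_compl.2 h) (not_isBounded_far R c)
    hzb).2 hz.2

theorem outs_not_isBounded {K : Set ℂ} (hK : IsCompact K) : ¬ Bornology.IsBounded (outs K) := by
  obtain ⟨R, hR, hKR⟩ := hK.isBounded.subset_closedBall_lt 0 0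
  exact fun h => not_isBounded_far R 0 (h.subset (subset_outs hK.isClosed (isPreconnected_far hR 0)
    (compl_subset_compl.2 hKR) (not_isBounded_far R 0)))

theorem isBounded_ins {K : Set ℂ} (hK : IsCompact K) : Bornology.IsBounded (ins K) := by
  obtain ⟨R, hR, hKR⟩ := hK.isBounded.subset_closedBall_lt 0 0
  exact isBounded_closedBall.subset (ins_subset_closedBall hK.isClosed hR hKR)

theorem joinedIn_of_mem_arc {A : Set ℂ} {a b : ℂ} (h : IsArc A a b) : JoinedIn A a b := by
  obtain ⟨γ, h1, -, rfl, rfl, rfl⟩ := h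
  have := ((convex_Icc (0:ℝ) 1).isPathConnected ⟨0, by simp⟩).image' h1
  exact this.joinedIn _ ⟨0, by simp, rfl⟩ _ ⟨1, by simp, rfl⟩

theorem IsArc.exists_short {A : Set ℂ} {a b : ℂ} (h : IsArc A a b) {U : Set ℂ} (hU : U ∈ 𝓝 a) :
    ∃ c A₁ A₂, IsArc A₁ a c ∧ IsArc A₂ c b ∧ A₁ ∪ A₂ = A ∧ A₁ ∩ A₂ = {c} ∧ A₁ ⊆ U := by
  obtain ⟨γ, h1, h2, rfl, rfl, rfl⟩ := h
  have hc : Tendsto γ (𝓝[Icc 0 1] 0) (𝓝 (γ 0)) := h1 0 (by simp)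
  have := hc hU
  rw [mem_map, nhdsWithin_Icc_eq_nhdsGE (by norm_num : (0:ℝ) < 1), mem_nhdsGE_iff_exists_Icc_subset] at this
  obtain ⟨u, hu, hu'⟩ := this
  have h0 : 0 < min u (1/2) := lt_min hu (by norm_num)
  have h3 : min u (1/2) < 1 := lt_of_le_of_lt (min_le_right _ _) (by norm_num)
  set t := min u (1/2)
  have s1 : Icc 0 t ⊆ Icc (0:ℝ) 1 := Icc_subset_Icc le_rfl h3.le
  have s2 : Icc t 1 ⊆ Icc (0:ℝ) 1 := Icc_subset_Icc h0.le le_rfl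
  refine ⟨_, _, _, isArc_image h0 (h1.mono s1) (h2.mono s1), isArc_image h3 (h1.mono s2) (h2.mono s2),
    ?_, ?_, ?_⟩
  · rw [← image_union, Icc_union_Icc_eq_Icc h0.le h3.le]
  · rw [← h2.image_inter s1 s2, Icc_inter_Icc_eq_singleton h0.le h3.le, image_singleton]
  · rintro _ ⟨s, hs, rfl⟩
    exact hu' ⟨hs.1, hs.2.trans (min_le_left _ _)⟩

namespace IsTwoArc
variable {J A B : Set ℂ} {a b : ℂ}

theorem symm (h : IsTwoArc J A B a b) : IsTwoArc J B A a b :=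
  ⟨h.right, h.left, by rw [inter_comm, h.inter], by rw [union_comm, h.union]⟩

theorem flip (h : IsTwoArc J A B a b) : IsTwoArc J A B b a :=
  ⟨h.left.symm, h.right.symm, by rw [h.inter, pair_comm], h.union⟩

theorem isCompact (h : IsTwoArc J A B a b) : IsCompact J := by
  rw [← h.union]; exact h.left.isCompact.union h.right.isCompact

theorem exists_not_joinedIn (h : IsTwoArc J A B a b) : ∃ p ∉ J, ∃ q ∉ J, ¬ JoinedIn Jᶜ p q := by
  by_contra! hcon
  have hJ : IsPreconnected Jᶜ := by
    refine isPreconnected_of_forall_pair fun x hx y hy =>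
      ⟨pathComponentIn Jᶜ x, pathComponentIn_subset, mem_pathComponentIn_self hx, hcon x hx y hy,
        isPreconnected_pathComponentIn x⟩
  have hab := h.left.ne
  have key : ∀ {A}, IsArc A a b → HasLog (fun z => (z - a) / (z - b)) Aᶜ := fun {A} hA =>
    hasLog_of_joinedIn (by rw [compl_compl]; exact (joinedIn_of_mem_arc hA).symm)
  have hu := (key h.left).union_isOpen (key h.right)
    (by rw [← compl_union, h.union]; exact hJ) h.left.isClosed.isOpen_compl
    h.right.isClosed.isOpen_compl
  rw [← compl_inter, h.inter] at hu
  have hr : 0 < dist a b / 2 := by have := dist_pos.2 hab; linarith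
  have hsub : sphere a (dist a b / 2) ⊆ ({a, b} : Set ℂ)ᶜ := by
    intro z hz h
    rw [mem_sphere] at hz
    rcases h with h | h
    · rw [h, dist_self] at hz; linarith
    · rw [mem_singleton_iff.1 h, dist_comm] at hz; linarith
  have hb : ∀ t ∈ Icc (0:ℝ) 1, ∀ z ∈ sphere a (dist a b / 2), a + t * (z - a) - b ≠ 0 := by
    intro t ht z hz h
    rw [mem_sphere, dist_eq_norm] at hz
    have h1 : a - b = -(t * (z - a)) := by linear_combination h
    have h2 := congrArg norm h1
    rw [norm_neg, norm_mul, Complex.norm_real, hz, ← dist_eq_norm, Real.norm_eq_abs, abs_of_nonneg ht.1] at h2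
    nlinarith [ht.2]
  have hl := hasLog_of_homotopy (Z := sphere a (dist a b / 2))
    (fun t z => a + t * (z - a) - b) (by fun_prop) hb
    ⟨fun _ => Complex.log (a - b), continuousOn_const, fun z _ => by
      simp [Complex.exp_log (sub_ne_zero.2 hab)]⟩
  refine not_hasLog_sphere hr (((hu.mono hsub).mul hl).congr fun z hz => ?_)
  have := sub_ne_zero_of_notMem (p := b) (S := ({a, b} : Set ℂ)ᶜ) (by simp) (hsub hz)
  simp only [Complex.ofReal_one, one_mul, add_sub_cancel]
  field_simp

theorem joinedIn_or (h : IsTwoArc J A B a b) {p q r : ℂ} (hp : p ∉ J) (hq : q ∉ J) (hr : r ∉ J) :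
    JoinedIn Jᶜ p q ∨ JoinedIn Jᶜ p r ∨ JoinedIn Jᶜ q r := by
  rw [← h.union] at *
  simp only [mem_union, not_or] at hp hq hr
  exact joinedIn_plus_arc h.left.isCompact h.right h.inter.subset (h.left.joinedIn hp.1 hq.1)
    (h.left.joinedIn hp.1 hr.1) hp.2 hq.2 hr.2

theorem isPreconnected_ins (h : IsTwoArc J A B a b) : IsPreconnected (ins J) := by
  refine isPreconnected_of_forall_pair fun x hx y hy => ?_
  obtain ⟨z, hz⟩ : (outs J).Nonempty := by
    rw [nonempty_iff_ne_empty]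
    intro he
    exact outs_not_isBounded h.isCompact (by rw [he]; exact Bornology.isBounded_empty)
  have hxy : JoinedIn Jᶜ x y := by
    rcases h.joinedIn_or hx.1 hy.1 hz.1 with h | h | h
    · exact h
    · exact absurd (mem_ins_of_joinedIn hx h).2 hz.2
    · exact absurd (mem_ins_of_joinedIn hy h).2 hz.2
  exact ⟨pathComponentIn Jᶜ x, fun z hz => mem_ins_of_joinedIn hx hz,
    mem_pathComponentIn_self hx.1, hxy, isPreconnected_pathComponentIn x⟩

theorem ins_nonempty (h : IsTwoArc J A B a b) : (ins J).Nonempty := by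
  obtain ⟨p, hp, q, hq, hpq⟩ := h.exists_not_joinedIn
  by_contra! he
  have key : ∀ z ∉ J, ¬ Bornology.IsBounded (pathComponentIn Jᶜ z) := fun z hz hb => by
    have : z ∈ ins J := ⟨hz, hb⟩
    rw [he] at this; exact this
  exact hpq (far_mem_pathComponentIn h.isCompact.isBounded (key p hp) (key q hq))

theorem outs_nonempty (h : IsTwoArc J A B a b) : (outs J).Nonempty := by
  rw [nonempty_iff_ne_empty]
  intro he
  exact outs_not_isBounded h.isCompact (by rw [he]; exact Bornology.isBounded_empty)

/-- Any point of a Jordan curve can be made an end of the decomposition into two arcs. -/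
theorem exists_left {c : ℂ} (h : IsTwoArc J A B a b) (hc : c ∈ J) :
    ∃ A' B' e, IsTwoArc J A' B' c e := by
  wlog hcA : c ∈ A generalizing A B
  · refine this h.symm ?_
    rw [← h.union] at hc
    exact hc.resolve_left hcA
  by_cases hca : c = a
  · exact ⟨A, B, b, hca ▸ h⟩
  by_cases hcb : c = b
  · exact ⟨A, B, a, hcb ▸ h.flip⟩
  obtain ⟨A₁, A₂, h1, h2, h3, h4⟩ := h.left.split hcA hca hcb
  have hcB : c ∉ B := fun hB => by
    have : c ∈ A ∩ B := ⟨hcA, hB⟩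
    rw [h.inter] at this
    simp [hca, hcb] at this
  have h5 : A₁ ⊆ A := h3 ▸ subset_union_left
  have h6 : A₂ ⊆ A := h3 ▸ subset_union_right
  have ha2 : a ∉ A₂ := fun ha => hca (by
    have : a ∈ A₁ ∩ A₂ := ⟨h1.left_mem, ha⟩
    rw [h4] at this; exact this.symm)
  have hb1 : b ∉ A₁ := fun hb => hcb (by
    have : b ∈ A₁ ∩ A₂ := ⟨hb, h2.right_mem⟩
    rw [h4] at this; exact this.symm)
  refine ⟨A₁, A₂ ∪ B, a, h1.symm, h2.concat h.right.symm ?_, ?_, ?_⟩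
  · rintro x ⟨hx2, hxB⟩
    have : x ∈ A ∩ B := ⟨h6 hx2, hxB⟩
    rw [h.inter] at this
    rcases this with rfl | hx
    · exact absurd hx2 ha2
    · exact hx
  · rw [inter_union_distrib_left, h4]
    ext x
    simp only [mem_union, mem_inter_iff, mem_singleton_iff, mem_insert_iff]
    constructor
    · rintro (hx | ⟨hx1, hx2⟩)
      · exact Or.inl hx
      · have : x ∈ A ∩ B := ⟨h5 hx1, hx2⟩
        rw [h.inter] at this
        rcases this with rfl | hx
        · exact Or.inr rfl
        · rw [mem_singleton_iff.1 hx] at hx1; exact absurd hx1 hb1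
    · rintro (hx | rfl)
      · exact Or.inl hx
      · exact Or.inr ⟨h1.left_mem, h.right.left_mem⟩
  · rw [← union_assoc, h3, h.union]

/-- Any two points of a Jordan curve can be made the ends of the decomposition. -/
theorem exists_ends {c d : ℂ} (h : IsTwoArc J A B a b) (hc : c ∈ J) (hd : d ∈ J) (hcd : c ≠ d) :
    ∃ A' B', IsTwoArc J A' B' c d := by
  obtain ⟨A, B, b, h⟩ := h.exists_left hc
  wlog hdA : d ∈ A generalizing A B
  · refine this B A h.symm ?_
    rw [← h.union] at hd
    exact hd.resolve_left hdA
  by_cases hdb : d = b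
  · exact ⟨A, B, hdb ▸ h⟩
  obtain ⟨A₁, A₂, h1, h2, h3, h4⟩ := h.left.split hdA hcd.symm hdb
  have hdB : d ∉ B := fun hB => by
    have : d ∈ A ∩ B := ⟨hdA, hB⟩
    rw [h.inter] at this
    simp [hcd.symm, hdb] at this
  have h5 : A₁ ⊆ A := h3 ▸ subset_union_left
  have h6 : A₂ ⊆ A := h3 ▸ subset_union_right
  have hc2 : c ∉ A₂ := fun ha => hcd (by
    have : c ∈ A₁ ∩ A₂ := ⟨h1.left_mem, ha⟩
    rw [h4] at this; exact this)
  have hb1 : b ∉ A₁ := fun hb => hdb (by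
    have : b ∈ A₁ ∩ A₂ := ⟨hb, h2.right_mem⟩
    rw [h4] at this; exact this.symm)
  refine ⟨A₁, B ∪ A₂, h1, h.right.concat h2.symm ?_, ?_, ?_⟩
  · rintro x ⟨hxB, hx2⟩
    have : x ∈ A ∩ B := ⟨h6 hx2, hxB⟩
    rw [h.inter] at this
    rcases this with rfl | hx
    · exact absurd hx2 hc2
    · exact hx
  · rw [inter_union_distrib_left, h4]
    ext x
    simp only [mem_union, mem_inter_iff, mem_singleton_iff, mem_insert_iff]
    constructor
    · rintro (⟨hx1, hx2⟩ | hx)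
      · have : x ∈ A ∩ B := ⟨h5 hx1, hx2⟩
        rw [h.inter] at this
        rcases this with rfl | hx
        · exact Or.inl rfl
        · rw [mem_singleton_iff.1 hx] at hx1; exact absurd hx1 hb1
      · exact Or.inr hx
    · rintro (rfl | hx)
      · exact Or.inl ⟨h1.left_mem, h.right.left_mem⟩
      · exact Or.inr hx
  · rw [← h.union, ← h3]
    ext x; simp only [mem_union]; tauto

end IsTwoArc

namespace IsJordanCurve
variable {J : Set ℂ}

theorem isCompact (h : IsJordanCurve J) : IsCompact J := by
  obtain ⟨A, B, a, b, h⟩ := h; exact h.isCompact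

theorem isClosed (h : IsJordanCurve J) : IsClosed J := h.isCompact.isClosed

theorem isPreconnected_ins (h : IsJordanCurve J) : IsPreconnected (ins J) := by
  obtain ⟨A, B, a, b, h⟩ := h; exact h.isPreconnected_ins

theorem ins_nonempty (h : IsJordanCurve J) : (ins J).Nonempty := by
  obtain ⟨A, B, a, b, h⟩ := h; exact h.ins_nonempty

theorem outs_nonempty (h : IsJordanCurve J) : (outs J).Nonempty := by
  obtain ⟨A, B, a, b, h⟩ := h; exact h.outs_nonempty

theorem exists_ends (h : IsJordanCurve J) {c d : ℂ} (hc : c ∈ J) (hd : d ∈ J) (hcd : c ≠ d) :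
    ∃ A B, IsTwoArc J A B c d := by
  obtain ⟨A, B, a, b, h⟩ := h; exact h.exists_ends hc hd hcd

theorem joinedIn_of_mem_ins (h : IsJordanCurve J) {p q : ℂ} (hp : p ∈ ins J) (hq : q ∈ ins J) :
    JoinedIn Jᶜ p q :=
  joinedIn_of_isPreconnected h.isClosed.isOpen_compl h.isPreconnected_ins (fun _ h => h.1) hp hq

theorem pathComponentIn_eq (h : IsJordanCurve J) {p : ℂ} (hp : p ∈ ins J) :
    pathComponentIn Jᶜ p = ins J := by
  ext z
  exact ⟨fun hz => mem_ins_of_joinedIn hp hz, fun hz => h.joinedIn_of_mem_ins hp hz⟩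

/-- The whole curve is in the closure of each component of the complement. -/
theorem subset_closure_pathComponentIn (h : IsJordanCurve J) {z : ℂ} (hz : z ∉ J) :
    J ⊆ closure (pathComponentIn Jᶜ z) := by
  intro x hx
  by_contra hxc
  set P := pathComponentIn Jᶜ z with hP
  have hU : (closure P)ᶜ ∈ 𝓝 x := isClosed_closure.isOpen_compl.mem_nhds hxc
  obtain ⟨A₀, B₀, a₀, b₀, h₀⟩ := h
  obtain ⟨A, B, e, h⟩ := h₀.exists_left hx
  obtain ⟨c, A₁, A₂, h1, h2, h3, h4, h5⟩ := h.left.exists_short hU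
  obtain ⟨d, B₁, B₂, k1, k2, k3, k4, k5⟩ := h.right.exists_short hU
  have hA2 : A₂ ⊆ A := h3 ▸ subset_union_right
  have hB2 : B₂ ⊆ B := k3 ▸ subset_union_right
  have hL : IsArc (A₂ ∪ B₂) c d := by
    refine h2.concat k2.symm ?_
    rintro y ⟨y1, y2⟩
    have : y ∈ A ∩ B := ⟨hA2 y1, hB2 y2⟩
    rw [h.inter] at this
    rcases this with rfl | hy
    · have : y ∈ A₁ ∩ A₂ := ⟨h1.left_mem, y1⟩
      rw [h4, mem_singleton_iff] at this
      exact absurd this h1.ne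
    · exact hy
  set L := A₂ ∪ B₂ with hLdef
  have hJL : ∀ y ∈ J, y ∉ L → y ∉ closure P := by
    intro y hy hyL hyP
    rw [← h.union, ← h3, ← k3] at hy
    rcases hy with (hy | hy) | (hy | hy)
    · exact h5 hy hyP
    · exact hyL (Or.inl hy)
    · exact k5 hy hyP
    · exact hyL (Or.inr hy)
  have hLJ : L ⊆ J := h.union ▸ union_subset_union hA2 hB2
  obtain ⟨w, hw, hwP⟩ : ∃ w ∉ J, w ∉ P := by
    by_contra! hcon
    obtain ⟨p, hp, q, hq, hpq⟩ := h.exists_not_joinedIn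
    exact hpq (JoinedIn.trans (JoinedIn.symm (hcon p hp)) (hcon q hq))
  have hconn : JoinedIn Lᶜ z w := hL.joinedIn (fun h => hz (hLJ h)) (fun h => hw (hLJ h))
  have hPO : IsOpen P := h.isCompact.isClosed.isOpen_compl.pathComponentIn z
  have hpre := isPreconnected_pathComponentIn (O := Lᶜ) z
  obtain ⟨y, hy1, hy2, hy3⟩ := hpre P (closure P)ᶜ hPO isClosed_closure.isOpen_compl (by
      intro y hy
      have hyL : y ∉ L := pathComponentIn_subset hy
      by_cases hyc : y ∈ closure P
      · left
        by_cases hyJ : y ∈ J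
        · exact absurd hyc (hJL y hyJ hyL)
        · exact mem_pathComponentIn_of_closure h.isCompact.isClosed.isOpen_compl hyc hyJ
      · exact Or.inr hyc)
    ⟨z, mem_pathComponentIn_self (fun h => hz (hLJ h)), mem_pathComponentIn_self hz⟩
    ⟨w, hconn, fun hwc => hwP (mem_pathComponentIn_of_closure h.isCompact.isClosed.isOpen_compl hwc hw)⟩
  exact hy3 (subset_closure hy2)

theorem subset_closure_ins (h : IsJordanCurve J) : J ⊆ closure (ins J) := by
  obtain ⟨p, hp⟩ := h.ins_nonempty
  have := h.subset_closure_pathComponentIn hp.1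
  rwa [h.pathComponentIn_eq hp] at this

theorem subset_closure_outs (h : IsJordanCurve J) : J ⊆ closure (outs J) := by
  obtain ⟨p, hp⟩ := h.outs_nonempty
  exact (h.subset_closure_pathComponentIn hp.1).trans
    (closure_mono fun z hz => mem_outs_of_joinedIn hp hz)

theorem closure_ins (h : IsJordanCurve J) : closure (ins J) = J ∪ ins J :=
  (closure_ins_subset h.isClosed).antisymm (union_subset h.subset_closure_ins subset_closure)

theorem isBounded_ins (h : IsJordanCurve J) : Bornology.IsBounded (ins J) := _root_.isBounded_ins h.isCompact

end IsJordanCurve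

/-- `L` is a crosscut of the Jordan curve `J` from `a` to `b`. -/
structure IsCrosscut (J L : Set ℂ) (a b : ℂ) : Prop where
  arc : IsArc L a b
  left_mem : a ∈ J
  right_mem : b ∈ J
  sub : L \ {a, b} ⊆ ins J

namespace IsTwoArc
variable {J A B L : Set ℂ} {a b : ℂ}

theorem isJordan (h : IsTwoArc J A B a b) : IsJordanCurve J := ⟨A, B, a, b, h⟩

theorem inter_crosscut (h : IsTwoArc J A B a b) (hL : IsCrosscut J L a b) :
    IsTwoArc (A ∪ L) A L a b := by
  refine ⟨h.left, hL.arc, ?_, rfl⟩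
  ext x
  constructor
  · rintro ⟨h1, h2⟩
    by_contra hx
    exact (hL.sub ⟨h2, hx⟩).1 (h.union ▸ Or.inl h1)
  · rintro (rfl | hx)
    · exact ⟨h.left.left_mem, hL.arc.left_mem⟩
    · rw [mem_singleton_iff.1 hx]; exact ⟨h.left.right_mem, hL.arc.right_mem⟩

/-- The outside of the curve and the opposite open arc are outside of the smaller curve. -/
theorem outs_union_subset (h : IsTwoArc J A B a b) (hL : IsCrosscut J L a b) :
    outs J ∪ B \ {a, b} ⊆ outs (A ∪ L) := by
  have hLc : ∀ x ∈ L, x ∉ outs J := fun x hx hxo => by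
    by_cases hab : x ∈ ({a, b} : Set ℂ)
    · rcases hab with rfl | hab
      · exact hxo.1 hL.left_mem
      · exact hxo.1 (mem_singleton_iff.1 hab ▸ hL.right_mem)
    · exact hxo.2 (hL.sub ⟨hx, hab⟩).2
  have hBJ : B ⊆ J := h.union ▸ subset_union_right
  refine subset_outs (h.inter_crosscut hL).isCompact.isClosed ?_ ?_ ?_
  · exact (isPreconnected_outs h.isCompact).subset_closure subset_union_left
      (union_subset subset_closure ((sdiff_subset.trans hBJ).trans h.isJordan.subset_closure_outs))
  · rintro x (hx | hx) hxA
    · rcases hxA with hxA | hxL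
      · exact hx.1 (h.union ▸ Or.inl hxA)
      · exact hLc x hxL hx
    · rcases hxA with hxA | hxL
      · exact hx.2 (h.inter ▸ ⟨hxA, hx.1⟩)
      · exact (hL.sub ⟨hxL, hx.2⟩).1 (hBJ hx.1)
  · exact fun hb => outs_not_isBounded h.isCompact (hb.subset subset_union_left)

theorem ins_subset (h : IsTwoArc J A B a b) (hL : IsCrosscut J L a b) :
    ins (A ∪ L) ⊆ ins J \ L := by
  intro z hz
  have h1 : z ∉ outs J ∪ B \ {a, b} := fun hc => (h.outs_union_subset hL hc).2 hz.2
  have hzJ : z ∉ J := fun hJ => by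
    rw [← h.union] at hJ
    rcases hJ with hJ | hJ
    · exact hz.1 (Or.inl hJ)
    · refine h1 (Or.inr ⟨hJ, fun hab => hz.1 (Or.inl ?_)⟩)
      rcases hab with rfl | hab
      · exact h.left.left_mem
      · exact mem_singleton_iff.1 hab ▸ h.left.right_mem
  refine ⟨⟨hzJ, ?_⟩, fun hzL => hz.1 (Or.inr hzL)⟩
  by_contra hb
  exact h1 (Or.inl ⟨hzJ, hb⟩)

theorem joinedIn_theta (h : IsTwoArc J A B a b) (hL : IsCrosscut J L a b) {p q : ℂ}
    (hp : p ∈ ins (A ∪ L)) (hq : q ∈ ins (A ∪ L)) : JoinedIn (J ∪ L)ᶜ p q := by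
  have hc : IsClosed (J ∪ L) := h.isCompact.isClosed.union hL.arc.isClosed
  refine joinedIn_of_isPreconnected hc.isOpen_compl (h.inter_crosscut hL).isPreconnected_ins ?_ hp hq
  intro z hz hzJL
  have := h.ins_subset hL hz
  rcases hzJL with hJ | hL
  · exact this.1.1 hJ
  · exact this.2 hL

theorem mem_ins_of_joinedIn_theta (h : IsTwoArc J A B a b) {p q : ℂ}
    (hp : p ∈ ins (A ∪ L)) (hq : JoinedIn (J ∪ L)ᶜ p q) : q ∈ ins (A ∪ L) :=
  mem_ins_of_joinedIn hp (hq.mono (compl_subset_compl.2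
    (union_subset_union_left _ (h.union ▸ subset_union_left))))

/-- The two sides of a crosscut are disjoint. -/
theorem disjoint_theta (h : IsTwoArc J A B a b) (hL : IsCrosscut J L a b) :
    Disjoint (ins (A ∪ L)) (ins (B ∪ L)) := by
  rw [Set.disjoint_left]
  intro z hz hz'
  have h1 : ins (A ∪ L) ⊆ ins (B ∪ L) := fun w hw =>
    h.symm.mem_ins_of_joinedIn_theta hz' (h.joinedIn_theta hL hz hw)
  obtain ⟨x, hxA, hx⟩ : (A \ {a, b}).Nonempty :=
    (h.left.infinite.sdiff (toFinite _)).nonempty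
  have h2 : x ∈ closure (ins (B ∪ L)) := closure_mono h1
    ((h.inter_crosscut hL).isJordan.subset_closure_ins (Or.inl hxA))
  have h3 : x ∈ outs (B ∪ L) := h.symm.outs_union_subset hL (Or.inr ⟨hxA, hx⟩)
  rw [outs_eq] at h3
  exact h3 (closure_ins_subset (h.symm.inter_crosscut hL).isCompact.isClosed h2)

/-- **Theta curve lemma**: a crosscut divides the inside into two insides. -/
theorem ins_diff_eq (h : IsTwoArc J A B a b) (hL : IsCrosscut J L a b) :
    ins J \ L = ins (A ∪ L) ∪ ins (B ∪ L) := by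
  refine Subset.antisymm ?_ (union_subset (h.ins_subset hL) (h.symm.ins_subset hL))
  rintro z ⟨hz, hzL⟩
  obtain ⟨p, hp⟩ := (h.inter_crosscut hL).ins_nonempty
  obtain ⟨q, hq⟩ := (h.symm.inter_crosscut hL).ins_nonempty
  have hp' := h.ins_subset hL hp
  have hq' := h.symm.ins_subset hL hq
  have hKB : J ∩ L ⊆ {a, b} := fun x hx => by
    by_contra hab
    exact (hL.sub ⟨hx.2, hab⟩).1 hx.1
  rcases joinedIn_plus_arc h.isCompact hL.arc hKB (h.isJordan.joinedIn_of_mem_ins hz hp'.1)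
    (h.isJordan.joinedIn_of_mem_ins hz hq'.1) hzL hp'.2 hq'.2 with hj | hj | hj
  · exact Or.inl (h.mem_ins_of_joinedIn_theta hp hj.symm)
  · exact Or.inr (h.symm.mem_ins_of_joinedIn_theta hq hj.symm)
  · exact absurd hq (Set.disjoint_left.1 (h.disjoint_theta hL) (h.mem_ins_of_joinedIn_theta hp hj))

end IsTwoArc

theorem isArc_segment {a b : ℂ} (h : a ≠ b) : IsArc (segment ℝ a b) a b := by
  refine ⟨AffineMap.lineMap a b, AffineMap.lineMap_continuous.continuousOn, fun x _ y _ hxy => ?_,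
    by simp, by simp, (segment_eq_image_lineMap ℝ a b).symm⟩
  exact AffineMap.lineMap_injective ℝ h hxy

theorem IsArc.exists_trans {A B : Set ℂ} {a b c : ℂ} (hA : IsArc A a b) (hB : IsArc B b c)
    (hac : a ≠ c) : ∃ C ⊆ A ∪ B, IsArc C a c := by
  by_cases haB : a ∈ B
  · obtain ⟨_, B₂, -, h, h3, -⟩ := hB.split haB hA.ne hac
    exact ⟨B₂, (h3 ▸ subset_union_right : B₂ ⊆ B).trans subset_union_right, h⟩
  · obtain ⟨d, A', h1, h2, h3⟩ := hA.firstHit hB.isClosed haB ⟨b, hA.right_mem, hB.left_mem⟩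
    have hdB : d ∈ B := (h3.symm.subset rfl : d ∈ A' ∩ B).2
    by_cases hdc : d = c
    · exact ⟨A', h2.trans subset_union_left, hdc ▸ h1⟩
    by_cases hdb : d = b
    · subst hdb
      exact ⟨A' ∪ B, union_subset_union_left _ h2, h1.concat hB h3.subset⟩
    · obtain ⟨_, B₂, -, h, h4, -⟩ := hB.split hdB hdb hdc
      have hB2 : B₂ ⊆ B := h4 ▸ subset_union_right
      exact ⟨A' ∪ B₂, union_subset_union h2 hB2,
        h1.concat h ((inter_subset_inter_right _ hB2).trans h3.subset)⟩

theorem exists_isArc_of_isPreconnected {O : Set ℂ} (hO : IsOpen O) (hc : IsPreconnected O)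
    {p q : ℂ} (hp : p ∈ O) (hq : q ∈ O) (hpq : p ≠ q) : ∃ A ⊆ O, IsArc A p q := by
  have := hc.induction₂ (fun x y => x = y ∨ ∃ A ⊆ O, IsArc A x y) ?_ ?_ ?_ hp hq
  · exact this.resolve_left hpq
  · intro x hx
    obtain ⟨r, hr, hrO⟩ := Metric.isOpen_iff.1 hO x hx
    filter_upwards [mem_nhdsWithin_of_mem_nhds (ball_mem_nhds x hr)] with y hy
    by_cases hxy : x = y
    · exact Or.inl hxy
    · exact Or.inr ⟨segment ℝ x y, ((convex_ball x r).segment_subset (mem_ball_self hr) hy).trans hrO,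
        isArc_segment hxy⟩
  · rintro x y z - - - (rfl | ⟨A, hA, hA'⟩) (rfl | ⟨B, hB, hB'⟩)
    · exact Or.inl rfl
    · exact Or.inr ⟨B, hB, hB'⟩
    · exact Or.inr ⟨A, hA, hA'⟩
    · by_cases hxz : x = z
      · exact Or.inl hxz
      · obtain ⟨C, hC, hC'⟩ := hA'.exists_trans hB' hxz
        exact Or.inr ⟨C, hC.trans (union_subset hA hB), hC'⟩
  · rintro x y - - (rfl | ⟨A, hA, hA'⟩)
    · exact Or.inl rfl
    · exact Or.inr ⟨A, hA, hA'.symm⟩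

theorem locallyFinite_Icc_nat : LocallyFinite fun n : ℕ => Icc (n : ℝ) (n + 1) := by
  intro x
  refine ⟨Iio (x + 1), Iio_mem_nhds (by linarith), (finite_lt_nat (⌈x + 1⌉₊)).subset ?_⟩
  rintro n ⟨y, ⟨hy, -⟩, hy'⟩
  have : (n : ℝ) < ⌈x + 1⌉₊ := lt_of_lt_of_le (hy.trans_lt hy') (Nat.le_ceil _)
  exact_mod_cast this

/-- A chain of arcs shrinking to a point forms an arc together with this point. -/
theorem isArc_of_seq {y : ℕ → ℂ} {P : ℕ → Set ℂ} {v : ℂ} (hP : ∀ n, IsArc (P n) (y n) (y (n + 1)))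
    (h1 : ∀ n, P n ∩ P (n + 1) ⊆ {y (n + 1)}) (h2 : ∀ n m, n + 2 ≤ m → Disjoint (P n) (P m))
    (hv : ∀ n, v ∉ P n) (hlim : ∀ U ∈ 𝓝 v, ∀ᶠ n in atTop, P n ⊆ U) :
    IsArc (insert v (⋃ n, P n)) (y 0) v := by
  choose γ hc hi h0 h1' him using hP
  set f : ℝ → ℂ := fun t => γ ⌊t⌋₊ (t - ⌊t⌋₊) with hf
  have hfn : ∀ n : ℕ, EqOn f (fun t => γ n (t - n)) (Icc n (n + 1)) := by
    intro n t ht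
    by_cases htn : t = n + 1
    · subst htn
      have : ⌊(n : ℝ) + 1⌋₊ = n + 1 := by
        rw [Nat.floor_add_one (by positivity), Nat.floor_natCast]
      simp only [hf, this]
      simp [h0, h1']
    · have : ⌊t⌋₊ = n := by
        rw [Nat.floor_eq_iff (le_trans (by positivity) ht.1)]
        exact ⟨ht.1, lt_of_le_of_ne ht.2 htn⟩
      simp only [hf, this]
  have hmaps : ∀ n : ℕ, MapsTo (fun t : ℝ => t - n) (Icc n (n + 1)) (Icc 0 1) := fun n t ht =>
    ⟨by linarith [ht.1], by linarith [ht.2]⟩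
  have hcov : (⋃ n : ℕ, Icc (n : ℝ) (n + 1)) = Ici 0 := by
    ext t
    simp only [mem_iUnion, mem_Ici]
    constructor
    · rintro ⟨n, hn, -⟩; exact le_trans (by positivity) hn
    · intro ht; exact ⟨⌊t⌋₊, Nat.floor_le ht, (Nat.lt_floor_add_one t).le⟩
  have hfc : ContinuousOn f (Ici 0) := by
    rw [← hcov]
    refine locallyFinite_Icc_nat.continuousOn_iUnion (fun n => isClosed_Icc) fun n => ?_
    exact ((hc n).comp (by fun_prop) (hmaps n)).congr (hfn n)
  have hfl : ∀ t : ℝ, 0 ≤ t → t - ⌊t⌋₊ ∈ Icc (0:ℝ) 1 := fun t ht =>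
    ⟨by linarith [Nat.floor_le ht], by linarith [Nat.lt_floor_add_one t]⟩
  have hfP : ∀ t, 0 ≤ t → f t ∈ P ⌊t⌋₊ := fun t ht => by
    rw [← him]; exact mem_image_of_mem _ (hfl t ht)
  have hlt : ∀ s t : ℝ, 0 ≤ s → s < t → f s ≠ f t := by
    intro s t hs hst he
    have hs' := hfP s hs
    have ht' := hfP t (hs.trans hst.le)
    rcases (Nat.floor_mono hst.le).eq_or_lt with h | h
    · have h3 : t - ⌊s⌋₊ ∈ Icc (0:ℝ) 1 := by rw [h]; exact hfl t (hs.trans hst.le)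
      have := hi ⌊s⌋₊ (hfl s hs) h3 (by simpa only [hf, ← h] using he)
      linarith
    · rcases (Nat.succ_le_of_lt h).eq_or_lt with h | h
      · have h3 : f s = y (⌊s⌋₊ + 1) := h1 ⌊s⌋₊ ⟨hs', by rw [he, ← Nat.succ_eq_add_one, h]; exact ht'⟩
        rw [← h1' ⌊s⌋₊] at h3
        have := hi ⌊s⌋₊ (hfl s hs) (by simp) h3
        linarith [Nat.lt_floor_add_one s]
      · exact Set.disjoint_left.1 (h2 _ _ h) hs' (he ▸ ht')
  have hfi : InjOn f (Ici 0) := by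
    intro s hs t ht he
    rcases lt_trichotomy s t with h | h | h
    · exact absurd he (hlt s t hs h)
    · exact h
    · exact absurd he.symm (hlt t s ht h)
  set g : ℝ → ℂ := fun s => if s < 1 then f (s / (1 - s)) else v with hg
  have hg1 : ∀ s < 1, g s = f (s / (1 - s)) := fun s hs => if_pos hs
  have hmem : ∀ s ∈ Icc (0:ℝ) 1, s < 1 → s / (1 - s) ∈ Ici (0:ℝ) := fun s hs h =>
    div_nonneg hs.1 (by linarith)
  have hgv : g 1 = v := if_neg (lt_irrefl _)
  refine ⟨g, ?_, ?_, ?_, hgv, ?_⟩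
  · intro s hs
    rcases hs.2.lt_or_eq with h | rfl
    · have : ContinuousWithinAt (fun s => f (s / (1 - s))) (Icc 0 1 ∩ Iio 1) s := by
        refine ContinuousWithinAt.comp (g := f) (f := fun s => s / (1 - s)) (t := Ici (0:ℝ))
          (hfc _ (hmem s hs h)) ?_ fun t ht => hmem t ht.1 ht.2
        exact ContinuousAt.continuousWithinAt
          (continuousAt_id.div (by fun_prop) (by simp only [ne_eq]; intro h'; linarith))
      refine (this.congr (fun t ht => hg1 t ht.2) (hg1 s h)).mono_of_mem_nhdsWithin ?_
      exact inter_mem self_mem_nhdsWithin (mem_nhdsWithin_of_mem_nhds (Iio_mem_nhds h))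
    · rw [ContinuousWithinAt, hgv]
      intro U hU
      obtain ⟨N, hN⟩ := eventually_atTop.1 (hlim U hU)
      have hN1 : (1:ℝ) - 1 / (N + 1) < 1 := by
        have : (0:ℝ) < 1 / (N + 1) := by positivity
        linarith
      show ∀ᶠ t in 𝓝[Icc 0 1] (1:ℝ), g t ∈ U
      filter_upwards [self_mem_nhdsWithin, mem_nhdsWithin_of_mem_nhds (Ioi_mem_nhds hN1)] with t ht ht'
      by_cases h : t < 1
      · rw [hg1 t h]
        refine hN _ ?_ (hfP _ (hmem t ht h))
        rw [Nat.le_floor_iff (hmem t ht h), le_div_iff₀ (by linarith)]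
        have h3 : (1 - t) < 1 / (N + 1) := by
          have : (1:ℝ) - 1 / (N + 1) < t := ht'
          linarith
        rw [lt_div_iff₀ (by positivity)] at h3
        nlinarith
      · rw [hg]; simp only [if_neg h]; exact mem_of_mem_nhds hU
  · intro s hs t ht he
    by_cases h : s < 1 <;> by_cases h' : t < 1
    · rw [hg1 s h, hg1 t h'] at he
      have := hfi (hmem s hs h) (hmem t ht h') he
      rw [div_eq_div_iff (by linarith) (by linarith)] at this
      linarith
    · rw [hg1 s h, hg] at he
      simp only [if_neg h'] at he
      exact absurd (he ▸ hfP _ (hmem s hs h)) (hv _)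
    · rw [hg1 t h', hg] at he
      simp only [if_neg h] at he
      exact absurd (he ▸ hfP _ (hmem t ht h')) (hv _)
    · linarith [hs.2, ht.2]
  · rw [hg1 0 (by norm_num)]; simp [hf, h0]
  · ext z
    simp only [mem_image, mem_insert_iff, mem_iUnion]
    constructor
    · rintro ⟨s, hs, rfl⟩
      by_cases h : s < 1
      · rw [hg1 s h]; exact Or.inr ⟨_, hfP _ (hmem s hs h)⟩
      · left; rw [hg]; simp only [if_neg h]
    · rintro (rfl | ⟨n, hn⟩)
      · exact ⟨1, by simp, hgv⟩
      · rw [← him] at hn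
        obtain ⟨u, hu, rfl⟩ := hn
        have ht0 : (0:ℝ) ≤ n + u := add_nonneg (by positivity) hu.1
        have hfe : f (n + u) = γ n u := by
          rw [hfn n (x := n + u) ⟨by linarith [hu.1], by linarith [hu.2]⟩]
          simp
        have hlt1 : (n + u) / (1 + (n + u)) < 1 := by rw [div_lt_one (by linarith)]; linarith
        refine ⟨(n + u) / (1 + (n + u)), ⟨by positivity, hlt1.le⟩, ?_⟩
        rw [hg1 _ hlt1, ← hfe]
        congr 1
        field_simp
        ring

/-- Near `v`, finitely many components of small discs minus `K` are relevant. -/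
def LocFin (K : Set ℂ) (v : ℂ) : Prop :=
  ∀ r > 0, ∃ δ > 0, ∃ T : Set ℂ, T.Finite ∧ ∀ x ∈ ball v δ, x ∉ K →
    ∃ t ∈ T, JoinedIn (ball v r ∩ Kᶜ) x t

theorem LocFin.exists_nested {K : Set ℂ} {v p : ℂ} (h : LocFin K v)
    (hv : v ∈ closure (pathComponentIn Kᶜ p)) : ∃ t : ℝ → ℂ, 
      (∀ r > 0, pathComponentIn (ball v r ∩ Kᶜ) (t r) ⊆ pathComponentIn Kᶜ p) ∧
      (∀ r > 0, (pathComponentIn (ball v r ∩ Kᶜ) (t r)).Nonempty) ∧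
      ∀ r > 0, ∀ s > r, pathComponentIn (ball v r ∩ Kᶜ) (t r) ⊆
        pathComponentIn (ball v s ∩ Kᶜ) (t s) := by
  have hne : (𝓝 v ⊓ 𝓟 (pathComponentIn Kᶜ p)).NeBot := mem_closure_iff_clusterPt.1 hv
  set U := Ultrafilter.of (𝓝 v ⊓ 𝓟 (pathComponentIn Kᶜ p)) with hU
  have hUle : (U : Filter ℂ) ≤ 𝓝 v ⊓ 𝓟 (pathComponentIn Kᶜ p) := Ultrafilter.of_le _
  have hF : pathComponentIn Kᶜ p ∈ U := hUle (mem_inf_of_right (mem_principal_self _))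
  have key : ∀ r : ℝ, ∃ t, 0 < r → pathComponentIn (ball v r ∩ Kᶜ) t ∈ U := by
    intro r
    by_cases hr : 0 < r
    · obtain ⟨δ, hδ, T, hT, hT'⟩ := h r hr
      have hb : ball v δ ∈ U := hUle (mem_inf_of_left (ball_mem_nhds v hδ))
      have hm : (⋃ t ∈ T, pathComponentIn (ball v r ∩ Kᶜ) t) ∈ U := by
        refine mem_of_superset (inter_mem hb hF) ?_
        rintro x ⟨hx, hx'⟩
        obtain ⟨t, ht, htx⟩ := hT' x hx (pathComponentIn_subset hx')
        exact mem_biUnion ht htx.symm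
      obtain ⟨t, -, ht⟩ := (Ultrafilter.finite_biUnion_mem_iff hT).1 hm
      exact ⟨t, fun _ => ht⟩
    · exact ⟨0, fun h => absurd h hr⟩
  choose t ht using key
  have glue : ∀ {S S' : Set ℂ} {a b x : ℂ}, S ⊆ S' → x ∈ pathComponentIn S a →
      x ∈ pathComponentIn S' b → pathComponentIn S a ⊆ pathComponentIn S' b := by
    intro S S' a b x hS h1 h2 z hz
    exact JoinedIn.trans h2 ((JoinedIn.trans h1.symm hz).mono hS)
  refine ⟨t, fun r hr => ?_, fun r hr => Filter.nonempty_of_mem (ht r hr), fun r hr s hs => ?_⟩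
  · obtain ⟨x, hx, hx'⟩ := Filter.nonempty_of_mem (inter_mem (ht r hr) hF)
    exact glue inter_subset_right hx hx'
  · obtain ⟨x, hx, hxs⟩ := Filter.nonempty_of_mem (inter_mem (ht r hr) (ht s (hr.trans hs)))
    exact glue (inter_subset_inter_left _ (ball_subset_ball hs.le)) hx hxs

/-- One step of the construction of an access arc. -/
theorem exists_gate {Q Q' : Set ℂ} {K : Set ℂ} {v y w : ℂ} {r : ℝ} (hQ : IsOpen Q)
    (hQc : IsPreconnected Q) (hQK : Disjoint Q K) (hQ' : IsOpen Q') (hQQ' : Q' ⊆ Q)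
    (hne : Q'.Nonempty) (hK : IsClosed K) (hr : Q' ⊆ ball v r)
    (hcl : ∀ z ∈ closure Q', z ∉ K → dist z v < r → z ∈ Q')
    (hyw : y ≠ w) (hw : segment ℝ y w \ {y} ⊆ Q) (hy : y ∉ closure Q') :
    ∃ y' P, IsArc P y y' ∧ P \ {y} ⊆ Q ∧ P ∩ closure Q' = {y'} ∧ y' ∉ Q' ∧ dist y' v = r ∧
      ∃ w', y' ≠ w' ∧ segment ℝ y' w' \ {y'} ⊆ Q' := by
  obtain ⟨q, hq⟩ := hne
  have hwQ : w ∈ Q := hw ⟨right_mem_segment ℝ y w, hyw.symm⟩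
  have hyq : y ≠ q := fun h => hy (h ▸ subset_closure hq)
  obtain ⟨C, hC, hCQ⟩ : ∃ C, IsArc C y q ∧ C \ {y} ⊆ Q := by
    by_cases hwq : w = q
    · exact ⟨_, hwq ▸ isArc_segment hyw, hw⟩
    · obtain ⟨A, hA, hA'⟩ := exists_isArc_of_isPreconnected hQ hQc hwQ (hQQ' hq) hwq
      obtain ⟨C, hC, hC'⟩ := (isArc_segment hyw).exists_trans hA' hyq
      refine ⟨C, hC', fun z hz => ?_⟩
      rcases hC hz.1 with h | h
      · exact hw ⟨h, hz.2⟩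
      · exact hA h
  obtain ⟨y', P, h1, h2, h3⟩ := hC.firstHit isClosed_closure hy ⟨q, hC.right_mem, subset_closure hq⟩
  have hy' : y' ∈ closure Q' := (h3.symm.subset rfl : y' ∈ P ∩ closure Q').2
  have hPQ : P \ {y} ⊆ Q := (sdiff_subset_sdiff_left h2).trans hCQ
  have hy'Q : y' ∈ Q := hPQ ⟨h1.right_mem, h1.ne.symm⟩
  have hyQ : y' ∉ Q' := by
    intro h
    obtain ⟨z, hz, hz'⟩ := mem_closure_iff.1 (h1.subset_closure_diff h1.right_mem) Q' hQ' h
    have : z ∈ P ∩ closure Q' := ⟨hz'.1, subset_closure hz⟩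
    rw [h3] at this
    exact hz'.2 (Or.inr this)
  have hy'K : y' ∉ K := Set.disjoint_left.1 hQK hy'Q
  have hle : dist y' v ≤ r := closure_ball_subset_closedBall (closure_mono hr hy')
  have hdist : dist y' v = r := le_antisymm hle (not_lt.1 fun h => hyQ (hcl _ hy' hy'K h))
  refine ⟨y', P, h1, hPQ, h3, hyQ, hdist, ?_⟩
  obtain ⟨ρ, hρ, hρK⟩ := Metric.isOpen_iff.1 hK.isOpen_compl y' hy'K
  obtain ⟨w', hw', hwQ⟩ := mem_closure_iff.1 hy' _ isOpen_ball (mem_ball_self hρ)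
  have hne' : y' ≠ w' := fun h => hyQ (h ▸ hwQ)
  refine ⟨w', hne', ?_⟩
  have hpre : IsPreconnected (segment ℝ y' w' \ {y'}) :=
    (isArc_segment hne').isPreconnected_diff_left
  have hsub : segment ℝ y' w' \ {y'} ⊆ ball v r ∩ Kᶜ := by
    rintro z ⟨hz, hzy⟩
    refine ⟨?_, hρK ((convex_ball y' ρ).segment_subset (mem_ball_self hρ) hw' hz)⟩
    by_cases hzw : z = w'
    · exact hzw ▸ hr hwQ
    have hzo : z ∈ openSegment ℝ y' w' := mem_openSegment_of_ne_left_right (Ne.symm hzy) (Ne.symm hzw) hz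
    have := (convex_ball v r).openSegment_closure_interior_subset_interior
      (x := y') (y := w') (closure_mono hr hy') (by rw [isOpen_ball.interior_eq]; exact hr hwQ) hzo
    rwa [isOpen_ball.interior_eq] at this
  have := hpre.subset_of_closure_inter_subset hQ' ⟨w', ⟨right_mem_segment ℝ y' w', hne'.symm⟩, hwQ⟩
    (fun z hz => hcl z hz.1 (hsub hz.2).2 (hsub hz.2).1)
  exact this

/-- **Accessibility**. -/
theorem LocFin.accessible {K : Set ℂ} {v p : ℂ} (h : LocFin K v) (hK : IsClosed K) (hvK : v ∈ K)
    (hp : p ∉ K) (hv : v ∈ closure (pathComponentIn Kᶜ p)) :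
    ∃ A, IsArc A p v ∧ A \ {v} ⊆ pathComponentIn Kᶜ p := by
  obtain ⟨t, ht1, ht2, ht3⟩ := h.exists_nested hv
  set F := pathComponentIn Kᶜ p with hF
  have hd : 0 < dist p v := dist_pos.2 fun h => hp (h ▸ hvK)
  set d := dist p v with hd'
  set r : ℕ → ℝ := fun n => d / 2 ^ n with hr
  have hr0 : ∀ n, 0 < r n := fun n => by positivity
  have hrlt : ∀ n, r (n + 1) < r n := fun n => by
    simp only [hr]; rw [pow_succ]
    exact div_lt_div_of_pos_left hd (by positivity) (by linarith [show (0:ℝ) < 2 ^ n by positivity])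
  have hFo : IsOpen F := hK.isOpen_compl.pathComponentIn p
  set Q : ℕ → Set ℂ := fun n => match n with
    | 0 => F
    | n + 1 => pathComponentIn (ball v (r (n + 1)) ∩ Kᶜ) (t (r (n + 1))) with hQ
  have hopen : ∀ n, IsOpen (ball v (r n) ∩ Kᶜ) := fun n => isOpen_ball.inter hK.isOpen_compl
  have q1 : ∀ n, IsOpen (Q n) := by
    rintro (_ | n)
    · exact hFo
    · exact (hopen _).pathComponentIn _
  have q2 : ∀ n, IsPreconnected (Q n) := by
    rintro (_ | n)
    · exact isPreconnected_pathComponentIn p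
    · exact isPreconnected_pathComponentIn _
  have q3 : ∀ n, Q n ⊆ F := by
    rintro (_ | n)
    · exact Subset.rfl
    · exact ht1 _ (hr0 _)
  have q4 : ∀ n, Q (n + 1) ⊆ Q n := by
    rintro (_ | n)
    · exact q3 1
    · exact ht3 _ (hr0 _) _ (hrlt _)
  have q5 : ∀ n, (Q (n + 1)).Nonempty := fun n => ht2 _ (hr0 _)
  have q6 : ∀ n, Q (n + 1) ⊆ ball v (r (n + 1)) := fun n z hz => (pathComponentIn_subset hz).1
  have q7 : ∀ n, ∀ z ∈ closure (Q (n + 1)), z ∉ K → dist z v < r (n + 1) → z ∈ Q (n + 1) :=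
    fun n z hz hzK hzr => mem_pathComponentIn_of_closure (hopen _) hz ⟨hzr, hzK⟩
  have hFK : ∀ z ∈ F, z ∉ K := fun z hz => pathComponentIn_subset hz
  have step : ∀ n, ∀ y : {y : ℂ // dist y v = r n ∧ ∃ w, y ≠ w ∧ segment ℝ y w \ {y} ⊆ Q n},
      ∃ (y' : {y : ℂ // dist y v = r (n + 1) ∧ ∃ w, y ≠ w ∧ segment ℝ y w \ {y} ⊆ Q (n + 1)})
        (P : Set ℂ), IsArc P y y' ∧ P \ {y.1} ⊆ Q n ∧ P ∩ closure (Q (n + 1)) = {y'.1} ∧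
          y'.1 ∉ Q (n + 1) := by
    rintro n ⟨y, hy, w, hyw, hw⟩
    obtain ⟨y', P, h1, h2, h3, h4, h5, h6⟩ := exists_gate (q1 n) (q2 n)
      (Set.disjoint_left.2 fun z hz => hFK z (q3 n hz)) (q1 (n + 1)) (q4 n) (q5 n) hK (q6 n) (q7 n)
      hyw hw (fun hc => by
        have : dist y v ≤ r (n + 1) := closure_ball_subset_closedBall (closure_mono (q6 n) hc)
        have := hrlt n
        linarith)
    exact ⟨⟨y', h5, h6⟩, P, h1, h2, h3, h4⟩
  obtain ⟨ρ, hρ, hρF⟩ := Metric.isOpen_iff.1 hFo p (mem_pathComponentIn_self hp)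
  have start : dist p v = r 0 ∧ ∃ w, p ≠ w ∧ segment ℝ p w \ {p} ⊆ Q 0 := by
    refine ⟨by simp [hr, ← hd'], p + (ρ / 2 : ℝ), by simp [hρ.ne'], fun z hz => hρF ?_⟩
    refine (convex_ball p ρ).segment_subset (mem_ball_self hρ) ?_ hz.1
    rw [mem_ball, dist_self_add_left, Complex.norm_real, Real.norm_eq_abs, abs_of_pos (by positivity)]
    linarith
  choose nxt P s1 s2 s3 s4 using step
  let Y : (n : ℕ) → {y : ℂ // dist y v = r n ∧ ∃ w, y ≠ w ∧ segment ℝ y w \ {y} ⊆ Q n} :=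
    fun n => Nat.rec ⟨p, start⟩ (fun n y => nxt n y) n
  have hmono : ∀ m n, m ≤ n → Q n ⊆ Q m := fun m n h => antitone_nat_of_succ_le q4 h
  have a1 : ∀ n, IsArc (P n (Y n)) (Y n).1 (Y (n + 1)).1 := fun n => s1 n (Y n)
  have a2 : ∀ n, (Y (n + 1)).1 ∈ Q n := fun n =>
    s2 n (Y n) ⟨(a1 n).right_mem, fun h => (a1 n).ne (mem_singleton_iff.1 h).symm⟩
  have a3 : ∀ n, (Y n).1 ∈ F := by
    rintro (_ | n)
    · exact mem_pathComponentIn_self hp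
    · exact q3 _ (a2 n)
  have a4 : ∀ n, P n (Y n) ⊆ insert (Y n).1 (Q n) := fun n z hz => by
    by_cases h : z = (Y n).1
    · exact Or.inl h
    · exact Or.inr (s2 n (Y n) ⟨hz, h⟩)
  have a5 : ∀ n, P n (Y n) ⊆ F := fun n z hz => by
    rcases a4 n hz with rfl | h
    · exact a3 n
    · exact q3 n h
  have main := isArc_of_seq (v := v) a1 (fun n z hz => by
      rcases a4 (n + 1) hz.2 with h | h
      · exact h
      · exact (s3 n (Y n)).subset ⟨hz.1, subset_closure h⟩)
    (fun n m hnm => by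
      obtain ⟨k, rfl⟩ := Nat.exists_eq_add_of_le hnm
      rw [Set.disjoint_left]
      intro z hz hz'
      have hzQ : z ∈ Q (n + 1) := by
        rcases a4 _ hz' with rfl | h
        · have := a2 (n + 1 + k)
          rw [show n + 1 + k + 1 = n + 2 + k by ring] at this
          exact hmono (n + 1) _ (by omega) this
        · exact hmono (n + 1) _ (by omega) h
      have := (s3 n (Y n)).subset ⟨hz, subset_closure hzQ⟩
      rw [mem_singleton_iff] at this
      exact s4 n (Y n) (this ▸ hzQ))
    (fun n hn => hFK v (a5 n hn) hvK)
    (fun U hU => by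
      obtain ⟨ε, hε, hεU⟩ := Metric.mem_nhds_iff.1 hU
      have hlim : Tendsto r atTop (𝓝 0) := by
        have := (tendsto_pow_atTop_nhds_zero_of_lt_one (r := (1/2:ℝ)) (by norm_num)
          (by norm_num)).const_mul d
        simpa [hr, div_eq_mul_inv] using this
      filter_upwards [hlim.eventually (gt_mem_nhds hε), eventually_gt_atTop 0] with n hn hn0
      obtain ⟨m, rfl⟩ := Nat.exists_eq_succ_of_ne_zero hn0.ne'
      intro z hz
      refine hεU ?_
      rcases a4 _ hz with rfl | h
      · exact (Y _).2.1.trans_lt hn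
      · exact (mem_ball.1 (q6 m h)).trans hn)
  refine ⟨_, main, ?_⟩
  rintro z ⟨rfl | hz, hzv⟩
  · exact absurd rfl hzv
  · obtain ⟨n, hn⟩ := mem_iUnion.1 hz
    exact a5 n hn

/-- A finite plane graph, given by its vertices and its edge arcs. -/
structure IsPG (V : Set ℂ) (E : Set (Set ℂ)) : Prop where
  finV : V.Finite
  finE : E.Finite
  arc : ∀ e ∈ E, ∃ a b, IsArc e a b ∧ e ∩ V = {a, b}
  inter : ∀ e ∈ E, ∀ f ∈ E, e ≠ f → e ∩ f ⊆ V

/-- The point set of a plane graph. -/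
def carr (V : Set ℂ) (E : Set (Set ℂ)) : Set ℂ := V ∪ ⋃₀ E

theorem IsPG.isCompact {V : Set ℂ} {E : Set (Set ℂ)} (h : IsPG V E) : IsCompact (carr V E) :=
  h.finV.isCompact.union (h.finE.isCompact_sUnion fun e he => by
    obtain ⟨a, b, hab, -⟩ := h.arc e he; exact hab.isCompact)

theorem IsArc.exists_first_entry {A C : Set ℂ} {a b : ℂ} (h : IsArc A a b) (hC : IsClosed C) (ha : a ∉ C)
    (hb : b ∈ interior C) : ∃ c S R, IsArc S a c ∧ IsArc R c b ∧ S ∪ R = A ∧ S ∩ R = {c} ∧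
      S ∩ C = {c} := by
  obtain ⟨c, A', h1, h2, h3⟩ := h.firstHit hC ha ⟨b, h.right_mem, interior_subset hb⟩
  have hc : c ∈ C := (h3.symm.subset rfl : c ∈ A' ∩ C).2
  have hcb : c ≠ b := by
    rintro rfl
    obtain ⟨z, hz, hz'⟩ := mem_closure_iff.1 (h1.subset_closure_diff h1.right_mem) _ isOpen_interior hb
    have := h3.subset ⟨hz'.1, interior_subset hz⟩
    exact hz'.2 (Or.inr this)
  obtain ⟨S, R, k1, k2, k3, k4⟩ := h.split (h2 h1.right_mem) h1.ne.symm hcb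
  refine ⟨c, S, R, k1, k2, k3, k4, ?_⟩
  -- the initial part is connected off `c`
  have hsub : A' \ {c} ⊆ S \ {c} := by
    have hpre := h1.symm.isPreconnected_diff_left
    have hcov : A' \ {c} ⊆ S ∪ R := by rw [k3]; exact sdiff_subset.trans h2
    have hd : ¬ ((A' \ {c}) ∩ (S ∩ R)).Nonempty := by
      rintro ⟨z, ⟨-, hz⟩, hz'⟩
      rw [k4] at hz'; exact hz hz'
    have := (isPreconnected_closed_iff.1 hpre) S R k1.isClosed k2.isClosed hcov
      ⟨a, ⟨h1.left_mem, h1.ne⟩, k1.left_mem⟩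
    intro z hz
    rcases hcov hz with h | h
    · exact ⟨h, hz.2⟩
    · exact absurd (this ⟨z, hz, h⟩) hd
  have hA'S : A' ⊆ S := fun z hz => by
    by_cases hzc : z = c
    · exact hzc ▸ k1.right_mem
    · exact (hsub ⟨hz, hzc⟩).1
  have hSA' : S ⊆ A' := by
    intro z hz
    by_contra hzA
    have hza : z ≠ a := fun h => hzA (h ▸ h1.left_mem)
    have hzc : z ≠ c := fun h => hzA (h ▸ h1.right_mem)
    obtain ⟨S₁, S₂, j1, j2, j3, j4⟩ := k1.split hz hza hzc
    have hd : ¬ (A' ∩ (S₁ ∩ S₂)).Nonempty := by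
      rintro ⟨w, hw, hw'⟩
      rw [j4] at hw'; exact hzA (mem_singleton_iff.1 hw' ▸ hw)
    exact hd ((isPreconnected_closed_iff.1 h1.isPreconnected) S₁ S₂ j1.isClosed j2.isClosed
      (by rw [j3]; exact hA'S) ⟨a, h1.left_mem, j1.left_mem⟩ ⟨c, h1.right_mem, j2.right_mem⟩)
  rw [hSA'.antisymm hA'S, h3]

theorem finComp_sphere {v : ℂ} {r : ℝ} (hr : 0 < r) : FinComp (sphere v r ∪ {v}) := by
  have hO : IsOpen (sphere v r)ᶜ := isClosed_sphere.isOpen_compl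
  have hO2 : IsOpen (sphere v r ∪ {v})ᶜ := (isClosed_sphere.union isClosed_singleton).isOpen_compl
  have hrk : 1 < Module.rank ℝ ℂ := by rw [Complex.rank_real_complex]; norm_num
  refine ⟨{v + (r / 2 : ℝ), v + (r + 1 : ℝ)}, fun z hz => ?_⟩
  rcases lt_or_gt_of_ne (show dist z v ≠ r from fun h => hz (Or.inl h)) with h | h
  · refine ⟨v + (r / 2 : ℝ), by simp, ?_⟩
    have hd : dist (v + (r / 2 : ℝ) : ℂ) v = r / 2 := by
      rw [dist_self_add_left, Complex.norm_real, Real.norm_eq_abs, abs_of_pos (by positivity)]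
    refine janiszewski (isCompact_sphere v r) isCompact_singleton ?_ ?_ ?_
    · have : sphere v r ∩ {v} = ∅ := by
        ext w; simp only [mem_inter_iff, mem_sphere, mem_singleton_iff, mem_empty_iff_false, iff_false]
        rintro ⟨h1, rfl⟩
        rw [dist_self] at h1; exact hr.ne h1
      rw [this]; exact isPreconnected_empty
    · exact joinedIn_of_isPreconnected hO (convex_ball v r).isPreconnected
        (fun x hx hx' => (ne_of_lt hx) hx') h (by rw [mem_ball, hd]; linarith)
    · refine joinedIn_of_isPreconnected isClosed_singleton.isOpen_compl
        (isConnected_compl_singleton_of_one_lt_rank hrk v).isPreconnected Subset.rfl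
        (fun hzv => hz (Or.inr hzv)) ?_
      intro hv
      rw [mem_singleton_iff] at hv
      rw [hv, dist_self] at hd; linarith
  · refine ⟨v + (r + 1 : ℝ), by simp, joinedIn_of_isPreconnected hO2 (isPreconnected_far hr v)
      (fun x hx hx' => hx ?_) (by simpa using h) ?_⟩
    · rcases hx' with hx' | rfl
      · exact le_of_eq hx'
      · exact mem_closedBall_self hr.le
    rw [mem_compl_iff, mem_closedBall, dist_self_add_left, Complex.norm_real, Real.norm_eq_abs,
      abs_of_pos (by positivity)]
    linarith

theorem FinComp.biUnion_arc {K : Set ℂ} (h : FinComp K) (hK : IsCompact K) {ι : Type*}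
    (T : Finset ι) (S : ι → Set ℂ) (c : ι → ℂ) {v : ℂ}
    (hS : ∀ i ∈ T, IsArc (S i) v (c i)) (hSK : ∀ i ∈ T, S i ∩ K ⊆ {v, c i})
    (hSS : ∀ i ∈ T, ∀ j ∈ T, i ≠ j → S i ∩ S j ⊆ {v}) :
    FinComp (K ∪ ⋃ i ∈ T, S i) ∧ IsCompact (K ∪ ⋃ i ∈ T, S i) := by
  classical
  induction T using Finset.induction_on with
  | empty => simpa using ⟨h, hK⟩
  | insert i T hi ih =>
    obtain ⟨h1, h2⟩ := ih (fun j hj => hS j (Finset.mem_insert_of_mem hj))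
      (fun j hj => hSK j (Finset.mem_insert_of_mem hj))
      (fun j hj k hk => hSS j (Finset.mem_insert_of_mem hj) k (Finset.mem_insert_of_mem hk))
    have hA := hS i (Finset.mem_insert_self i T)
    have he : K ∪ ⋃ j ∈ insert i T, S j = (K ∪ ⋃ j ∈ T, S j) ∪ S i := by
      rw [Finset.set_biUnion_insert, union_assoc, union_comm (S i)]
    rw [he]
    refine ⟨h1.union_arc h2 hA ?_, h2.union hA.isCompact⟩
    rintro z ⟨hz | hz, hzi⟩
    · exact hSK i (Finset.mem_insert_self i T) ⟨hzi, hz⟩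
    · obtain ⟨j, hj, hzj⟩ := mem_iUnion₂.1 hz
      exact Or.inl (hSS i (Finset.mem_insert_self i T) j (Finset.mem_insert_of_mem hj)
        (fun h => hi (h ▸ hj)) ⟨hzi, hzj⟩)

theorem LocFin.of_small {K : Set ℂ} {v : ℂ} {r₀ : ℝ} (hr₀ : 0 < r₀)
    (h : ∀ r > 0, r < r₀ → ∃ δ > 0, ∃ T : Set ℂ, T.Finite ∧ ∀ x ∈ ball v δ, x ∉ K →
      ∃ t ∈ T, JoinedIn (ball v r ∩ Kᶜ) x t) : LocFin K v := by
  intro r hr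
  obtain ⟨δ, hδ, T, hT, hT'⟩ := h (min r (r₀ / 2)) (by positivity)
    ((min_le_right _ _).trans_lt (by linarith))
  refine ⟨δ, hδ, T, hT, fun x hx hxK => ?_⟩
  obtain ⟨t, ht, h⟩ := hT' x hx hxK
  exact ⟨t, ht, h.mono (inter_subset_inter_left _ (ball_subset_ball (min_le_left _ _)))⟩

theorem IsPG.locFin {V : Set ℂ} {E : Set (Set ℂ)} (h : IsPG V E) {v : ℂ} (hv : v ∈ V) :
    LocFin (carr V E) v := by
  classical
  obtain ⟨r₀, hr₀, hr₀V⟩ : ∃ r₀ > 0, ∀ w ∈ V, w ≠ v → r₀ < dist w v := by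
    have h1 : IsClosed (V \ {v}) := (h.finV.subset sdiff_subset).isClosed
    obtain ⟨ε, hε, hεV⟩ := Metric.isOpen_iff.1 h1.isOpen_compl v (by simp)
    refine ⟨ε / 2, by positivity, fun w hw hwv => ?_⟩
    by_contra hc
    exact hεV (show w ∈ ball v ε by rw [mem_ball]; linarith) ⟨hw, hwv⟩
  refine LocFin.of_small hr₀ fun r hr hrr => ?_
  set E₁ := {e ∈ E | v ∈ e} with hE₁
  set C : Set ℂ := (ball v r)ᶜ with hC
  have hCc : IsClosed C := isOpen_ball.isClosed_compl
  have key : ∀ e ∈ E₁, ∃ c S R, IsArc S v c ∧ IsClosed R ∧ S ∪ R = e ∧ S ∩ R = {c} ∧ S ∩ C = {c} ∧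
      S ∩ V = {v} := by
    rintro e ⟨he, hve⟩
    obtain ⟨a, b, hab, habV⟩ := h.arc e he
    obtain ⟨b, hab, habV⟩ : ∃ b, IsArc e v b ∧ e ∩ V = {v, b} := by
      have : v ∈ e ∩ V := ⟨hve, hv⟩
      rw [habV] at this
      rcases this with rfl | this
      · exact ⟨b, hab, habV⟩
      · rw [mem_singleton_iff.1 this]; exact ⟨a, hab.symm, by rw [habV, pair_comm]⟩
    have hbV : b ∈ V := (habV.symm.subset (Or.inr rfl) : b ∈ e ∩ V).2
    have hbr : r < dist b v := hrr.trans (hr₀V b hbV hab.ne.symm)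
    have hbC : b ∈ interior C := by
      rw [hC, interior_compl]
      exact fun hb => absurd (closure_ball_subset_closedBall hb) (by simpa using hbr)
    obtain ⟨c, S, R, h1, h2, h3, h4, h5⟩ := hab.exists_first_entry hCc (by simpa [hC] using hr) hbC
    refine ⟨c, S, R, h1, h2.isClosed, h3, h4, h5, ?_⟩
    ext z
    constructor
    · rintro ⟨hz, hzV⟩
      have : z ∈ e ∩ V := ⟨h3 ▸ Or.inl hz, hzV⟩
      rw [habV] at this
      rcases this with rfl | this
      · rfl
      · exfalso
        rw [mem_singleton_iff] at this
        subst this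
        have hzR : z ∈ S ∩ R := ⟨hz, h2.right_mem⟩
        rw [h4] at hzR
        exact h2.ne hzR.symm
    · rintro rfl; exact ⟨h1.left_mem, hv⟩
  choose! c S R k1 k2 k3 k4 k5 k6 using key
  have hcdist : ∀ e ∈ E₁, dist (c e) v = r := by
    intro e he
    apply le_antisymm
    · have h1 : S e \ {v, c e} ⊆ ball v r := fun z hz => by
        by_contra hzC
        have := (k5 e he).subset ⟨hz.1, hzC⟩
        exact hz.2 (Or.inr this)
      exact closure_ball_subset_closedBall (closure_mono h1
        ((k1 e he).subset_closure_diff (k1 e he).right_mem))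
    · have : c e ∈ S e ∩ C := (k5 e he).symm.subset rfl
      simpa [hC] using this.2
  have hE₁f : E₁.Finite := h.finE.subset (sep_subset _ _)
  set W : Set ℂ := (⋃ e ∈ E₁, R e) ∪ (⋃₀ (E \ E₁) ∪ V \ {v}) with hW
  have hSe : ∀ e ∈ E₁, S e ⊆ e := fun e he => by
    have := k3 e he; nth_rw 2 [← this]; exact subset_union_left
  have hRe : ∀ e ∈ E₁, R e ⊆ e := fun e he => by
    have := k3 e he; nth_rw 2 [← this]; exact subset_union_right
  have hWc : IsClosed W := by
    refine (hE₁f.isClosed_biUnion fun e he => k2 e he).union (IsClosed.union ?_ ?_)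
    · exact ((h.finE.subset sdiff_subset).isCompact_sUnion fun e he => by
        obtain ⟨a, b, hab, -⟩ := h.arc e he.1; exact hab.isCompact).isClosed
    · exact (h.finV.subset sdiff_subset).isClosed
  have hSW : ∀ e ∈ E₁, S e ∩ W ⊆ sphere v r := by
    rintro e he z ⟨hz, hzW⟩
    have hVv : z ∈ V → z = v := fun hzV => (k6 e he).subset ⟨hz, hzV⟩
    have hvR : ∀ f ∈ E₁, v ∉ R f := fun f hf hvf => by
      have : v ∈ S f ∩ R f := ⟨(k1 f hf).left_mem, hvf⟩
      rw [k4 f hf] at this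
      exact (k1 f hf).ne this
    rcases hzW with hzW | hzW | hzW
    · obtain ⟨f, hf, hzf⟩ := mem_iUnion₂.1 hzW
      by_cases hef : e = f
      · subst hef
        have : z ∈ S e ∩ R e := ⟨hz, hzf⟩
        rw [k4 e he, mem_singleton_iff] at this
        rw [this]; exact hcdist e he
      · have := hVv (h.inter e he.1 f hf.1 hef ⟨hSe e he hz, hRe f hf hzf⟩)
        subst this
        exact absurd hzf (hvR f hf)
    · obtain ⟨f, hf, hzf⟩ := hzW
      have := hVv (h.inter e he.1 f hf.1 (fun hef => hf.2 (hef ▸ he)) ⟨hSe e he hz, hzf⟩)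
      subst this
      exact absurd ⟨hf.1, hzf⟩ hf.2
    · exact absurd (hVv hzW.1) hzW.2
  set T := hE₁f.toFinset with hT
  have hTmem : ∀ e, e ∈ T ↔ e ∈ E₁ := fun e => hE₁f.mem_toFinset
  have hvW : v ∉ W := by
    rintro (hvW | hvW | hvW)
    · obtain ⟨f, hf, hvf⟩ := mem_iUnion₂.1 hvW
      have : v ∈ S f ∩ R f := ⟨(k1 f hf).left_mem, hvf⟩
      rw [k4 f hf] at this
      exact (k1 f hf).ne this
    · obtain ⟨f, hf, hvf⟩ := hvW
      exact hf.2 ⟨hf.1, hvf⟩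
    · exact hvW.2 rfl
  obtain ⟨hfin, hK1⟩ := (finComp_sphere (v := v) hr).biUnion_arc
    ((isCompact_sphere v r).union isCompact_singleton) T S c
    (fun e he => k1 e ((hTmem e).1 he))
    (fun e he z hz => by
      rcases hz.2 with h | h
      · exact Or.inr ((k5 e ((hTmem e).1 he)).subset ⟨hz.1, by
          simp only [hC, mem_compl_iff, mem_ball, not_lt]; exact (le_of_eq h.symm)⟩)
      · exact Or.inl h)
    (fun e he f hf hef z hz => by
      have he' := (hTmem e).1 he
      have hf' := (hTmem f).1 hf
      exact (k6 e he').subset ⟨hz.1, h.inter e he'.1 f hf'.1 hef ⟨hSe e he' hz.1, hSe f hf' hz.2⟩⟩)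
  set K₁ := sphere v r ∪ {v} ∪ ⋃ e ∈ T, S e with hK₁
  set K₂ := sphere v r ∪ W ∩ closedBall v r with hK₂
  have hK2 : IsCompact K₂ := (isCompact_sphere v r).union
    ((isCompact_closedBall v r).inter_left hWc)
  have hvK1 : v ∈ K₁ := Or.inl (Or.inr rfl)
  have hsK1 : sphere v r ⊆ K₁ := fun z hz => Or.inl (Or.inl hz)
  have hinc : K₁ ∩ K₂ = sphere v r := by
    refine Subset.antisymm ?_ (subset_inter hsK1 subset_union_left)
    rintro z ⟨(hz | hz) | hz, hz' | hz'⟩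
    · exact hz
    · exact hz
    · exact hz'
    · rw [mem_singleton_iff.1 hz] at hz'; exact absurd hz'.1 hvW
    · exact hz'
    · obtain ⟨e, he, hze⟩ := mem_iUnion₂.1 hz
      exact hSW e ((hTmem e).1 he) ⟨hze, hz'.1⟩
  have hcov : carr V E ∩ ball v r ⊆ K₁ ∪ K₂ := by
    rintro z ⟨hz, hzr⟩
    have hzc : z ∈ closedBall v r := ball_subset_closedBall hzr
    rcases hz with hz | ⟨e, he, hze⟩
    · by_cases hzv : z = v
      · rw [hzv]; exact Or.inl hvK1
      · exact Or.inr (Or.inr ⟨Or.inr (Or.inr ⟨hz, hzv⟩), hzc⟩)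
    · by_cases hve : v ∈ e
      · have he1 : e ∈ E₁ := ⟨he, hve⟩
        rw [← k3 e he1] at hze
        rcases hze with hze | hze
        · exact Or.inl (Or.inr (mem_biUnion ((hTmem e).2 he1) hze))
        · exact Or.inr (Or.inr ⟨Or.inl (mem_biUnion he1 hze), hzc⟩)
      · exact Or.inr (Or.inr ⟨Or.inr (Or.inl ⟨e, ⟨he, fun h => hve h.2⟩, hze⟩), hzc⟩)
  obtain ⟨δ₀, hδ₀, hδW⟩ := Metric.isOpen_iff.1 hWc.isOpen_compl v hvW
  set δ := min δ₀ r with hδ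
  have hδp : 0 < δ := lt_min hδ₀ hr
  have hrk : 1 < Module.rank ℝ ℂ := by rw [Complex.rank_real_complex]; norm_num
  have hbK1 : ∀ x ∈ ball v δ, x ∉ carr V E → x ∉ K₁ := by
    rintro x hx hxK ((h' | h') | h')
    · exact absurd (mem_ball.1 hx) (not_lt.2 ((min_le_right _ _).trans (le_of_eq h'.symm)))
    · exact hxK (mem_singleton_iff.1 h' ▸ Or.inl hv)
    · obtain ⟨e, he, hze⟩ := mem_iUnion₂.1 h'
      have he' := (hTmem e).1 he
      exact hxK (Or.inr ⟨e, he'.1, hSe e he' hze⟩)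
  have hbK2 : ball v δ ⊆ K₂ᶜ := by
    rintro x hx (h' | h')
    · exact absurd (mem_ball.1 hx) (not_lt.2 ((min_le_right _ _).trans (le_of_eq h'.symm)))
    · exact hδW (ball_subset_ball (min_le_left _ _) hx) h'.1
  have main : ∀ x ∈ ball v δ, ∀ y ∈ ball v δ, JoinedIn K₁ᶜ x y →
      JoinedIn (ball v r ∩ (carr V E)ᶜ) x y := by
    intro x hx y hy hxy
    have h2 : JoinedIn K₂ᶜ x y := joinedIn_of_isPreconnected hK2.isClosed.isOpen_compl
      (convex_ball v δ).isPreconnected hbK2 hx hy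
    have h3 := janiszewski hK1 hK2 (hinc ▸ isPreconnected_sphere hrk v r) hxy h2
    have hO : IsOpen (K₁ ∪ K₂)ᶜ := (hK1.union hK2).isClosed.isOpen_compl
    have hP := isPreconnected_pathComponentIn (O := (K₁ ∪ K₂)ᶜ) x
    have hxP : x ∈ pathComponentIn (K₁ ∪ K₂)ᶜ x := mem_pathComponentIn_self h3.source_mem
    have hxr : x ∈ ball v r := ball_subset_ball (min_le_right _ _) hx
    have hsub : pathComponentIn (K₁ ∪ K₂)ᶜ x ⊆ ball v r :=
      hP.subset_left_of_subset_union isOpen_ball (isClosed_closedBall (x := v) (ε := r)).isOpen_compl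
        (disjoint_left.2 fun z hz hz' => hz' (ball_subset_closedBall hz))
        (fun z hz => by
          have : z ∉ sphere v r := fun h => pathComponentIn_subset hz (Or.inl (hsK1 h))
          rcases lt_or_gt_of_ne (show dist z v ≠ r from this) with h | h
          · exact Or.inl h
          · exact Or.inr (by simpa using h)) ⟨x, hxP, hxr⟩
    refine joinedIn_of_isPreconnected (isOpen_ball.inter h.isCompact.isClosed.isOpen_compl) hP
      (fun z hz => ⟨hsub hz, fun hzK => pathComponentIn_subset hz (hcov ⟨hzK, hsub hz⟩)⟩) hxP h3
  obtain ⟨T', hT'⟩ := hfin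
  have hch : ∀ t ∈ T', (∃ x ∈ ball v δ, x ∉ carr V E ∧ JoinedIn K₁ᶜ x t) →
      ∃ x ∈ ball v δ, x ∉ carr V E ∧ JoinedIn K₁ᶜ x t := fun t _ h => h
  choose! g g1 g2 g3 using hch
  refine ⟨δ, hδp, g '' T', T'.finite_toSet.image g, fun x hx hxK => ?_⟩
  obtain ⟨t, ht, hxt⟩ := hT' x (hbK1 x hx hxK)
  have hex : ∃ x ∈ ball v δ, x ∉ carr V E ∧ JoinedIn K₁ᶜ x t := ⟨x, hx, hxK, hxt⟩
  exact ⟨g t, mem_image_of_mem g ht, main x hx _ (g1 t ht hex) (hxt.trans (g3 t ht hex).symm)⟩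

theorem IsPG.accessible {V : Set ℂ} {E : Set (Set ℂ)} (h : IsPG V E) {v p : ℂ} (hv : v ∈ V)
    (hp : p ∉ carr V E) (hcl : v ∈ closure (pathComponentIn (carr V E)ᶜ p)) :
    ∃ A, IsArc A p v ∧ A \ {v} ⊆ pathComponentIn (carr V E)ᶜ p :=
  (h.locFin hv).accessible h.isCompact.isClosed (Or.inl hv) hp hcl

/-- Two vertices on the boundary of a face can be joined inside the face. -/
theorem IsPG.exists_isArc_face {V : Set ℂ} {E : Set (Set ℂ)} (h : IsPG V E) {v w p : ℂ}
    (hv : v ∈ V) (hw : w ∈ V) (hvw : v ≠ w) (hp : p ∉ carr V E)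
    (hcv : v ∈ closure (pathComponentIn (carr V E)ᶜ p))
    (hcw : w ∈ closure (pathComponentIn (carr V E)ᶜ p)) :
    ∃ A, IsArc A v w ∧ A \ {v, w} ⊆ pathComponentIn (carr V E)ᶜ p := by
  obtain ⟨A, hA, hA'⟩ := h.accessible hv hp hcv
  obtain ⟨B, hB, hB'⟩ := h.accessible hw hp hcw
  obtain ⟨C, hC, hC'⟩ := hA.symm.exists_trans hB hvw
  refine ⟨C, hC', fun z hz => ?_⟩
  rcases hC hz.1 with h1 | h1
  · exact hA' ⟨h1, fun h => hz.2 (Or.inl h)⟩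
  · exact hB' ⟨h1, fun h => hz.2 (Or.inr h)⟩

theorem IsTwoArc.isPG {J A B : Set ℂ} {a b : ℂ} (h : IsTwoArc J A B a b) : IsPG {a, b} {A, B} := by
  have hm : ∀ {X}, IsArc X a b → X ∩ {a, b} = {a, b} := fun {X} hX =>
    inter_eq_right.2 (by rintro z (rfl | rfl); exacts [hX.left_mem, hX.right_mem])
  refine ⟨by simp, by simp, ?_, ?_⟩
  · rintro e (rfl | rfl)
    · exact ⟨a, b, h.left, hm h.left⟩
    · exact ⟨a, b, h.right, hm h.right⟩
  · rintro e (rfl | rfl) f (rfl | rfl) hef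
    · exact absurd rfl hef
    · exact h.inter.subset
    · rw [inter_comm]; exact h.inter.subset
    · exact absurd rfl hef

theorem IsTwoArc.carr_eq {J A B : Set ℂ} {a b : ℂ} (h : IsTwoArc J A B a b) :
    carr {a, b} {A, B} = J := by
  rw [carr, sUnion_pair, h.union, union_eq_right, ← h.union]
  rintro z (rfl | rfl)
  exacts [Or.inl h.left.left_mem, Or.inl h.left.right_mem]

theorem IsJordanCurve.exists_crosscut {J : Set ℂ} (h : IsJordanCurve J) {a b : ℂ} (ha : a ∈ J)
    (hb : b ∈ J) (hab : a ≠ b) : ∃ L, IsCrosscut J L a b := by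
  obtain ⟨A, B, hAB⟩ := h.exists_ends ha hb hab
  obtain ⟨p, hp⟩ := h.ins_nonempty
  have hcl := h.subset_closure_ins
  rw [← h.pathComponentIn_eq hp, ← hAB.carr_eq] at hcl
  rw [hAB.carr_eq] at hcl
  obtain ⟨L, hL, hLp⟩ := hAB.isPG.exists_isArc_face (v := a) (w := b) (p := p) (by simp) (by simp)
    hab (by rw [hAB.carr_eq]; exact hp.1) (by rw [hAB.carr_eq]; exact hcl ha)
    (by rw [hAB.carr_eq]; exact hcl hb)
  rw [hAB.carr_eq, h.pathComponentIn_eq hp] at hLp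
  exact ⟨L, hL, ha, hb, hLp⟩

/-- An arc contained in another arc with the same ends is equal to it. -/
theorem IsArc.eq_of_subset {A B : Set ℂ} {a b : ℂ} (hA : IsArc A a b) (hB : IsArc B a b)
    (h : A ⊆ B) : A = B := by
  refine h.antisymm fun z hz => ?_
  by_contra hzA
  obtain ⟨S₁, S₂, j1, j2, j3, j4⟩ := hB.split hz (fun h => hzA (h ▸ hA.left_mem))
    (fun h => hzA (h ▸ hA.right_mem))
  have hd : ¬ (A ∩ (S₁ ∩ S₂)).Nonempty := by
    rintro ⟨w, hw, hw'⟩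
    rw [j4] at hw'; exact hzA (mem_singleton_iff.1 hw' ▸ hw)
  exact hd ((isPreconnected_closed_iff.1 hA.isPreconnected) S₁ S₂ j1.isClosed j2.isClosed
    (by rw [j3]; exact h) ⟨a, hA.left_mem, j1.left_mem⟩ ⟨b, hA.right_mem, j2.right_mem⟩)

theorem IsJordanCurve.isTwoArc_of_subset {J S : Set ℂ} (h : IsJordanCurve J) {p q : ℂ}
    (hS : IsArc S p q) (hSJ : S ⊆ J) : ∃ B, IsTwoArc J S B p q := by
  obtain ⟨A, B, hAB⟩ := h.exists_ends (hSJ hS.left_mem) (hSJ hS.right_mem) hS.ne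
  have hpre := hS.isPreconnected_diff
  have hd : ¬ ((S \ {p, q}) ∩ (A ∩ B)).Nonempty := by
    rintro ⟨z, ⟨-, hz⟩, hz'⟩
    rw [hAB.inter] at hz'; exact hz hz'
  have hcov : S \ {p, q} ⊆ A ∪ B := by rw [hAB.union]; exact sdiff_subset.trans hSJ
  by_cases hA : ((S \ {p, q}) ∩ A).Nonempty
  · have : S ⊆ A := by
      intro z hz
      by_cases hzpq : z ∈ ({p, q} : Set ℂ)
      · rcases hzpq with rfl | rfl
        exacts [hAB.left.left_mem, hAB.left.right_mem]
      · by_contra hzA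
        exact hd (isPreconnected_closed_iff.1 hpre A B hAB.left.isClosed hAB.right.isClosed hcov hA
          ⟨z, ⟨hz, hzpq⟩, (hcov ⟨hz, hzpq⟩).resolve_left hzA⟩)
    exact ⟨B, by rw [hS.eq_of_subset hAB.left this]; exact hAB⟩
  · have : S ⊆ B := by
      intro z hz
      by_cases hzpq : z ∈ ({p, q} : Set ℂ)
      · rcases hzpq with rfl | rfl
        exacts [hAB.right.left_mem, hAB.right.right_mem]
      · exact (hcov ⟨hz, hzpq⟩).resolve_left fun hzA => hA ⟨z, ⟨hz, hzpq⟩, hzA⟩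
    exact ⟨A, by rw [hS.eq_of_subset hAB.right this]; exact hAB.symm⟩

theorem IsArc.exists_sub {A : Set ℂ} {a b p q : ℂ} (h : IsArc A a b) (hp : p ∈ A) (hq : q ∈ A)
    (hpq : p ≠ q) : ∃ S ⊆ A, IsArc S p q := by
  obtain ⟨γ, h1, h2, -, -, rfl⟩ := h
  obtain ⟨s, hs, rfl⟩ := hp
  obtain ⟨t, ht, rfl⟩ := hq
  have key : ∀ s ∈ Icc (0:ℝ) 1, ∀ t ∈ Icc (0:ℝ) 1, s < t →
      ∃ S ⊆ γ '' Icc 0 1, IsArc S (γ s) (γ t) := fun s hs t ht hst =>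
    have hsub : Icc s t ⊆ Icc 0 1 := Icc_subset_Icc hs.1 ht.2
    ⟨γ '' Icc s t, image_mono hsub, isArc_image hst (h1.mono hsub) (h2.mono hsub)⟩
  rcases lt_trichotomy s t with h | h | h
  · exact key s hs t ht h
  · exact absurd (congrArg γ h) hpq
  · obtain ⟨S, k1, k2⟩ := key t ht s hs h
    exact ⟨S, k1, k2.symm⟩

/-- Two near points of a Jordan curve cut off a small arc. -/
theorem IsJordanCurve.exists_small {J : Set ℂ} (h : IsJordanCurve J) {ε : ℝ} (hε : 0 < ε) :
    ∃ δ > 0, ∀ p ∈ J, ∀ q ∈ J, p ≠ q → dist p q < δ →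
      ∃ A B, IsTwoArc J A B p q ∧ A ⊆ ball p ε := by
  have key : ∀ x ∈ J, ∃ c d S, IsArc S c d ∧ S ⊆ ball x (ε / 2) ∧ S ⊆ J ∧ ∃ U, IsOpen U ∧ x ∈ U ∧ U ∩ J ⊆ S := by
    intro x hx
    obtain ⟨A₀, B₀, a₀, b₀, h₀⟩ := h
    obtain ⟨A, B, e, hAB⟩ := h₀.exists_left hx
    obtain ⟨c, A₁, A₂, h1, h2, h3, h4, h5⟩ :=
      hAB.left.exists_short (ball_mem_nhds x (half_pos hε))
    obtain ⟨d, B₁, B₂, k1, k2, k3, k4, k5⟩ :=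
      hAB.right.exists_short (ball_mem_nhds x (half_pos hε))
    have hxA : x ∉ A₂ := fun hxA => by
      have : x ∈ A₁ ∩ A₂ := ⟨h1.left_mem, hxA⟩
      rw [h4] at this; exact h1.ne this
    have hxB : x ∉ B₂ := fun hxB => by
      have : x ∈ B₁ ∩ B₂ := ⟨k1.left_mem, hxB⟩
      rw [k4] at this; exact k1.ne this
    have heA : e ∉ A₁ := fun heA => by
      have : e ∈ A₁ ∩ A₂ := ⟨heA, h2.right_mem⟩
      rw [h4] at this; exact h2.ne (mem_singleton_iff.1 this).symm
    have hinc : A₁ ∩ B₁ ⊆ {x} := fun z hz => by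
      have : z ∈ A ∩ B := ⟨h3 ▸ Or.inl hz.1, k3 ▸ Or.inl hz.2⟩
      rw [hAB.inter] at this
      rcases this with h | h
      · exact h
      · exact absurd (mem_singleton_iff.1 h ▸ hz.1) heA
    refine ⟨c, d, A₁ ∪ B₁, h1.symm.concat k1 hinc, union_subset h5 k5, ?_, (A₂ ∪ B₂)ᶜ,
      (h2.isClosed.union k2.isClosed).isOpen_compl, not_or.2 ⟨hxA, hxB⟩, ?_⟩
    · rw [← hAB.union, ← h3, ← k3]
      exact union_subset_union subset_union_left subset_union_left
    · rintro z ⟨hz, hzJ⟩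
      rw [← hAB.union, ← h3, ← k3] at hzJ
      rcases hzJ with (h | h) | (h | h)
      · exact Or.inl h
      · exact absurd (Or.inl h) hz
      · exact Or.inr h
      · exact absurd (Or.inr h) hz
  choose! c d S k1 k2 k3 U k4 k6 k5 using key
  obtain ⟨δ, hδ, hδ'⟩ := lebesgue_number_lemma_of_metric (c := fun x : J => U x) h.isCompact
    (fun x => k4 x x.2) (fun x hx => mem_iUnion.2 ⟨⟨x, hx⟩, k6 x hx⟩)
  refine ⟨δ, hδ, fun p hp q hq hpq hd => ?_⟩
  obtain ⟨⟨x, hx⟩, hxU⟩ := hδ' p hp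
  have hpS : p ∈ S x := k5 x hx ⟨hxU (mem_ball_self hδ), hp⟩
  have hqS : q ∈ S x := k5 x hx ⟨hxU (by rwa [mem_ball, dist_comm]), hq⟩
  obtain ⟨A, hA, hA'⟩ := (k1 x hx).exists_sub hpS hqS hpq
  obtain ⟨B, hB⟩ := h.isTwoArc_of_subset hA' (hA.trans (k3 x hx))
  refine ⟨A, B, hB, fun z hz => ?_⟩
  have h1 := k2 x hx hpS
  have h2 := k2 x hx (hA hz)
  rw [mem_ball] at *
  linarith [dist_triangle_right z p x]

/-- The maximal intervals of an open set of reals. -/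
def IsGap (T : Set ℝ) (α β : ℝ) : Prop := α < β ∧ α ∉ T ∧ β ∉ T ∧ Ioo α β ⊆ T

theorem IsGap.eq {T : Set ℝ} {α β α' β' t : ℝ} (h : IsGap T α β) (h' : IsGap T α' β')
    (ht : t ∈ Ioo α β) (ht' : t ∈ Ioo α' β') : α = α' ∧ β = β' := by
  constructor
  · rcases lt_trichotomy α α' with hh | hh | hh
    · exact absurd (h.2.2.2 ⟨hh, ht'.1.trans ht.2⟩) h'.2.1
    · exact hh
    · exact absurd (h'.2.2.2 ⟨hh, ht.1.trans ht'.2⟩) h.2.1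
  · rcases lt_trichotomy β β' with hh | hh | hh
    · exact absurd (h'.2.2.2 ⟨ht'.1.trans ht.2, hh⟩) h.2.2.1
    · exact hh
    · exact absurd (h.2.2.2 ⟨ht.1.trans ht'.2, hh⟩) h'.2.2.1

theorem exists_isGap {T : Set ℝ} (hT : IsOpen T) (hb : Bornology.IsBounded T) {t : ℝ} (ht : t ∈ T) :
    ∃ α β, IsGap T α β ∧ t ∈ Ioo α β := by
  obtain ⟨R, hR⟩ := hb.subset_closedBall 0
  have hR' : ∀ s ∈ T, |s| ≤ R := fun s hs => by simpa using hR hs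
  have hneg : -(R + 1) ∉ T := fun h => by have := hR' _ h; rw [abs_neg] at this; linarith [le_abs_self (R+1)]
  have hpos : (R + 1) ∉ T := fun h => by have := hR' _ h; linarith [le_abs_self (R+1)]
  have htR := abs_le.1 (hR' t ht)
  have hA : IsClosed (Tᶜ ∩ Iic t) := hT.isClosed_compl.inter isClosed_Iic
  have hA1 : (Tᶜ ∩ Iic t).Nonempty := ⟨-(R+1), hneg, by simp only [mem_Iic]; linarith⟩
  have hA2 : BddAbove (Tᶜ ∩ Iic t) := ⟨t, fun s hs => hs.2⟩
  have hA3 := hA.csSup_mem hA1 hA2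
  have hB : IsClosed (Tᶜ ∩ Ici t) := hT.isClosed_compl.inter isClosed_Ici
  have hB1 : (Tᶜ ∩ Ici t).Nonempty := ⟨R+1, hpos, by simp only [mem_Ici]; linarith⟩
  have hB2 : BddBelow (Tᶜ ∩ Ici t) := ⟨t, fun s hs => hs.2⟩
  have hB3 := hB.csInf_mem hB1 hB2
  set α := sSup (Tᶜ ∩ Iic t)
  set β := sInf (Tᶜ ∩ Ici t)
  have hα : α < t := lt_of_le_of_ne hA3.2 fun h => hA3.1 (h ▸ ht)
  have hβ : t < β := lt_of_le_of_ne hB3.2 fun h => hB3.1 (h ▸ ht)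
  refine ⟨α, β, ⟨hα.trans hβ, hA3.1, hB3.1, fun s hs => ?_⟩, hα, hβ⟩
  by_contra hsT
  rcases le_total s t with h | h
  · exact absurd (le_csSup hA2 ⟨hsT, h⟩) (not_le.2 hs.1)
  · exact absurd (csInf_le hB2 ⟨hsT, h⟩) (not_le.2 hs.2)

/-- The point with parameter `t` on the line through `o` with direction `u`. -/
noncomputable def pt (o u : ℂ) (t : ℝ) : ℂ := o + t * u

theorem continuous_pt (o u : ℂ) : Continuous (pt o u) := by unfold pt; fun_prop

theorem pt_re {o u : ℂ} (hu : ‖u‖ = 1) (t : ℝ) : ((pt o u t - o) / u).re = t := by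
  have : u ≠ 0 := by rintro rfl; simp at hu
  simp [pt, this]

theorem eq_pt {o u z : ℂ} (hu : ‖u‖ = 1) (h : ((z - o) / u).im = 0) :
    z = pt o u ((z - o) / u).re := by
  have h0 : u ≠ 0 := by rintro rfl; simp at hu
  have : (z - o) / u = (((z - o) / u).re : ℂ) := by
    apply Complex.ext <;> simp [h]
  rw [pt, ← this]; field_simp; ring

theorem dist_pt {o u : ℂ} (hu : ‖u‖ = 1) (s t : ℝ) : dist (pt o u s) (pt o u t) = |s - t| := by
  rw [dist_eq_norm, pt, pt, show o + s * u - (o + t * u) = ((s - t : ℝ) : ℂ) * u by push_cast; ring,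
    norm_mul, hu, mul_one, Complex.norm_real, Real.norm_eq_abs]

theorem isArc_pt {o u : ℂ} (hu : ‖u‖ = 1) {α β : ℝ} (h : α < β) :
    IsArc (pt o u '' Icc α β) (pt o u α) (pt o u β) :=
  isArc_image h (continuous_pt o u).continuousOn fun s _ t _ hst => by
    rw [← pt_re hu s (o := o), hst, pt_re hu]

/-- If no single chord of `C` on a line separates `p` from `q`, then all of them together do not. -/
theorem joinedIn_of_chords {C O : Set ℂ} (hC : IsCompact C) (hCp : IsPreconnected C) (hO : IsOpen O)
    (hOb : Bornology.IsBounded O) (hOC : closure O ⊆ C ∪ O) (hd : Disjoint O C) {o u : ℂ}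
    (hu : ‖u‖ = 1) {p q : ℂ} (hp : ((p - o) / u).im ≠ 0) (hq : ((q - o) / u).im ≠ 0)
    (h0 : JoinedIn Cᶜ p q)
    (hI : ∀ α β, IsGap {t | pt o u t ∈ O} α β → JoinedIn (C ∪ pt o u '' Icc α β)ᶜ p q) :
    JoinedIn (C ∪ O ∩ {z | ((z - o) / u).im = 0})ᶜ p q := by
  classical
  set T := {t | pt o u t ∈ O} with hT
  have hTo : IsOpen T := hO.preimage (continuous_pt o u)
  have hTb : Bornology.IsBounded T := by
    obtain ⟨R, hR⟩ := hOb.subset_closedBall o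
    refine (isBounded_closedBall (x := (0:ℝ)) (r := R)).subset fun t ht => ?_
    have := hR ht
    have e := dist_pt hu t 0 (o := o)
    rw [show pt o u 0 = o by simp [pt], sub_zero] at e
    rw [mem_closedBall, e] at this
    simpa using this
  set ℓ : Set ℂ := {z | ((z - o) / u).im = 0} with hℓ
  have hℓc : IsClosed ℓ := isClosed_eq (by fun_prop) continuous_const
  have hcl : IsClosed (C ∪ O ∩ ℓ) := by
    have : C ∪ O ∩ ℓ = C ∪ closure O ∩ ℓ := by
      refine Subset.antisymm (union_subset_union_right _ (inter_subset_inter_left _ subset_closure)) ?_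
      rintro z (hz | ⟨hz, hz'⟩)
      · exact Or.inl hz
      · exact (hOC hz).imp id fun h => ⟨h, hz'⟩
    rw [this]
    exact hC.isClosed.union (isClosed_closure.inter hℓc)
  have hK : IsCompact (C ∪ O ∩ ℓ) := by
    refine Metric.isCompact_of_isClosed_isBounded hcl ?_
    exact hC.isBounded.union (hOb.subset inter_subset_left)
  have hend : ∀ α β, IsGap T α β → pt o u α ∈ C ∧ pt o u β ∈ C := by
    intro α β h
    have hsub : pt o u '' closure (Ioo α β) ⊆ closure O :=
      (image_closure_subset_closure_image (continuous_pt o u)).trans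
        (closure_mono (by rintro _ ⟨t, ht, rfl⟩; exact h.2.2.2 ht))
    rw [closure_Ioo h.1.ne] at hsub
    exact ⟨(hOC (hsub ⟨α, ⟨le_rfl, h.1.le⟩, rfl⟩)).resolve_right h.2.1,
      (hOC (hsub ⟨β, ⟨h.1.le, le_rfl⟩, rfl⟩)).resolve_right h.2.2.1⟩
  set f : ℂ → ℂ := fun z => (z - p) / (z - q) with hf
  have hlog : ∀ Z : Set ℂ, JoinedIn Zᶜ p q → HasLog f Z := fun Z h => hasLog_of_joinedIn h.symm
  obtain ⟨g₀, hg₀, hg₀'⟩ := hlog C h0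
  have hG : ∀ α β, ∃ G : ℂ → ℂ, IsGap T α β → ContinuousOn G (C ∪ pt o u '' Icc α β) ∧
      (∀ z ∈ C ∪ pt o u '' Icc α β, Complex.exp (G z) = f z) ∧ EqOn G g₀ C := by
    intro α β
    by_cases h : IsGap T α β
    · obtain ⟨G, hG, hG'⟩ := hlog _ (hI α β h)
      have hα := (hend α β h).1
      have h1 : ∀ z ∈ C, G z - g₀ z = G (pt o u α) - g₀ (pt o u α) := fun z hz =>
        eq_of_exp_eq_one hCp ((hG.mono subset_union_left).sub hg₀) (fun w hw => by
          show Complex.exp (G w - g₀ w) = 1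
          rw [Complex.exp_sub, hG' w (Or.inl hw), hg₀' w hw, div_self]
          rw [← hg₀' w hw]; exact Complex.exp_ne_zero _) hz hα
      refine ⟨fun z => G z - (G (pt o u α) - g₀ (pt o u α)), fun _ => ⟨hG.sub continuousOn_const, ?_, ?_⟩⟩
      · intro z hz
        have : Complex.exp (G (pt o u α) - g₀ (pt o u α)) = 1 := by
          rw [Complex.exp_sub, hG' _ (Or.inl hα), hg₀' _ hα, div_self]
          rw [← hg₀' _ hα]; exact Complex.exp_ne_zero _
        rw [Complex.exp_sub, this, div_one, hG' z hz]
      · intro z hz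
        show G z - (G (pt o u α) - g₀ (pt o u α)) = g₀ z
        rw [← h1 z hz]; ring
    · exact ⟨0, fun h' => absurd h' h⟩
  choose G hG using hG
  have hgap : ∀ t, ∃ α β, t ∈ T → IsGap T α β ∧ t ∈ Ioo α β := by
    intro t
    by_cases ht : t ∈ T
    · obtain ⟨α, β, h⟩ := exists_isGap hTo hTb ht
      exact ⟨α, β, fun _ => h⟩
    · exact ⟨0, 0, fun h => absurd h ht⟩
  choose α β hαβ using hgap
  set re : ℂ → ℝ := fun z => ((z - o) / u).re with hre
  have hrec : Continuous re := by simp only [hre]; fun_prop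
  set g : ℂ → ℂ := fun z => if z ∈ C then g₀ z else G (α (re z)) (β (re z)) z with hg
  have hgC : ∀ z ∈ C, g z = g₀ z := fun z hz => if_pos hz
  have hgI : ∀ t a b, IsGap T a b → t ∈ Ioo a b → g (pt o u t) = G a b (pt o u t) := by
    intro t a b hab ht
    have htT := hab.2.2.2 ht
    have hn : pt o u t ∉ C := fun h => disjoint_left.1 hd htT h
    obtain ⟨h1, h2⟩ := (hαβ t htT).1.eq hab (hαβ t htT).2 ht
    simp only [hg, if_neg hn, hre, pt_re hu, h1, h2]
  have hIoo : ∀ z ∈ O ∩ ℓ, ∃ t ∈ T, z = pt o u t := fun z hz =>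
    ⟨re z, by rw [hT, mem_ofPred_eq, hre, ← eq_pt hu hz.2]; exact hz.1, eq_pt hu hz.2⟩
  refine joinedIn_of_hasLog hK (not_or.2 ⟨h0.notMem_left, fun h => hp h.2⟩)
    (not_or.2 ⟨h0.notMem_right, fun h => hq h.2⟩) ⟨g, ?_, ?_⟩
  swap
  · rintro z (hz | hz)
    · rw [hgC z hz, hg₀' z hz]
    · obtain ⟨t, ht, rfl⟩ := hIoo z hz
      obtain ⟨h1, h2⟩ := hαβ t ht
      rw [hgI t _ _ h1 h2, (hG _ _ h1).2.1 _ (Or.inr ⟨t, Ioo_subset_Icc_self h2, rfl⟩)]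
  · intro z hz
    by_cases hzC : z ∈ C
    · -- a point of the curve
      have hzq : z ≠ q := fun h => h0.notMem_right (h ▸ hzC)
      have hfz : f z ≠ 0 := by rw [← hg₀' z hzC]; exact Complex.exp_ne_zero _
      have hfc : ∀ w, w ≠ q → ContinuousAt f w := fun w hw =>
        (continuousAt_id.sub continuousAt_const).div (continuousAt_id.sub continuousAt_const)
          (sub_ne_zero.2 hw)
      set h : ℂ → ℂ := fun w => g₀ z + Complex.log (f w / f z) with hh
      have hhc : ∀ w, w ≠ q → f w / f z ∈ Complex.slitPlane → ContinuousAt h w := fun w hw hs =>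
        continuousAt_const.add (((hfc w hw).div_const _).clog hs)
      have hhe : ∀ w, f w / f z ∈ Complex.slitPlane → Complex.exp (h w) = f w := fun w hs => by
        rw [hh]
        simp only
        rw [Complex.exp_add, hg₀' z hzC, Complex.exp_log (Complex.slitPlane_ne_zero hs)]
        field_simp
      have hs1 : f z / f z ∈ Complex.slitPlane := by
        rw [div_self hfz]; exact Complex.one_mem_slitPlane
      have hhz : h z = g₀ z := by simp [hh, div_self hfz]
      have ev1 : ∀ᶠ w in 𝓝 z, w ≠ q ∧ f w / f z ∈ Complex.slitPlane :=
        (show ∀ᶠ w in 𝓝 z, w ≠ q from isOpen_ne.mem_nhds hzq).and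
          (((hfc z hzq).div_const _).preimage_mem_nhds (Complex.isOpen_slitPlane.mem_nhds hs1))
      have ev2 : ∀ᶠ w in 𝓝 z, w ∈ C → ‖g₀ w - h w‖ < 1 := by
        have : ContinuousWithinAt (fun w => g₀ w - h w) C z :=
          (hg₀ z hzC).sub (hhc z hzq hs1).continuousWithinAt
        have h2 : ∀ᶠ w in 𝓝[C] z, g₀ w - h w ∈ ball (0:ℂ) 1 :=
          this.preimage_mem_nhdsWithin (isOpen_ball.mem_nhds (by simp [hhz]))
        filter_upwards [eventually_nhdsWithin_iff.1 h2] with w hw hwC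
        simpa using hw hwC
      have ev3 : ∀ᶠ w in 𝓝 z, z ∉ ℓ → w ∉ ℓ := by
        by_cases hzl : z ∈ ℓ
        · exact Eventually.of_forall fun w h => absurd hzl h
        · filter_upwards [hℓc.isOpen_compl.mem_nhds hzl] with w hw _ using hw
      obtain ⟨r, hr, hrb⟩ := Metric.eventually_nhds_iff_ball.1 (ev1.and (ev2.and ev3))
      have hCh : ∀ w ∈ ball z r, w ∈ C → g₀ w = h w := fun w hw hwC => by
        obtain ⟨⟨k1, k2⟩, k3, -⟩ := hrb w hw
        have h1 : Complex.exp (g₀ w - h w) = 1 := by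
          rw [Complex.exp_sub, hg₀' w hwC, hhe w k2, div_self]
          rw [← hhe w k2]; exact Complex.exp_ne_zero _
        have h2 := abs_lt.1 ((Complex.abs_im_le_norm _).trans_lt (k3 hwC))
        have h3 := Complex.log_exp (x := g₀ w - h w) (by linarith [Real.pi_gt_three])
          (by linarith [Real.pi_gt_three])
        rw [h1, Complex.log_one] at h3
        exact sub_eq_zero.1 h3.symm
      have main : ∀ w ∈ ball z r, w ∈ C ∪ O ∩ ℓ → g w = h w := by
        rintro w hw (hwC | hwO)
        · rw [hgC w hwC, hCh w hw hwC]
        · have hzl : z ∈ ℓ := by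
            by_contra hzl
            exact (hrb w hw).2.2 hzl hwO.2
          obtain ⟨t, ht, rfl⟩ := hIoo w hwO
          obtain ⟨h1, h2⟩ := hαβ t ht
          rw [hgI t _ _ h1 h2]
          have hzs : z = pt o u (re z) := eq_pt hu hzl
          have hsT : re z ∉ T := fun hs => disjoint_left.1 hd hs (hzs ▸ hzC)
          have hend' := hend _ _ h1
          have hwr : |t - re z| < r := by
            have := dist_pt hu t (re z) (o := o)
            rw [← hzs] at this
            rwa [mem_ball, this] at hw
          have fin : ∀ e, pt o u e ∈ C → e ∈ Icc (α t) (β t) → uIcc e t ⊆ Icc (α t) (β t) →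
              |e - re z| < r → G (α t) (β t) (pt o u t) = h (pt o u t) := by
            intro e heC heI hsub her
            have hb : ∀ s ∈ uIcc e t, pt o u s ∈ ball z r := by
              intro s hs
              have := dist_pt hu s (re z) (o := o)
              rw [← hzs] at this
              rw [mem_ball, this, abs_lt]
              rw [abs_lt] at her hwr
              rcases mem_uIcc.1 hs with hs | hs <;> constructor <;> linarith [hs.1, hs.2]
            have hu1 := eq_of_exp_eq_one (S := pt o u '' uIcc e t)
              (u := fun w => G (α t) (β t) w - h w)
              (isPreconnected_uIcc.image _ (continuous_pt o u).continuousOn)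
              (((hG _ _ h1).1.mono ((image_mono hsub).trans subset_union_right)).sub fun w hw => by
                obtain ⟨s, hs, rfl⟩ := hw
                obtain ⟨⟨j1, j2⟩, -⟩ := hrb _ (hb s hs)
                exact (hhc _ j1 j2).continuousWithinAt)
              (fun w hw => by
                obtain ⟨s, hs, rfl⟩ := hw
                obtain ⟨⟨j1, j2⟩, -⟩ := hrb _ (hb s hs)
                rw [Complex.exp_sub, (hG _ _ h1).2.1 _ (Or.inr ⟨s, hsub hs, rfl⟩), hhe _ j2, div_self]
                rw [← hhe _ j2]; exact Complex.exp_ne_zero _)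
              (mem_image_of_mem _ left_mem_uIcc) (mem_image_of_mem _ right_mem_uIcc)
            rw [(hG _ _ h1).2.2 heC, hCh _ (hb e left_mem_uIcc) heC, sub_self] at hu1
            exact sub_eq_zero.1 hu1.symm
          rw [abs_lt] at hwr
          have hl := h1.1.le
          by_cases hs : re z ≤ α t
          · refine fin (α t) hend'.1 ⟨le_rfl, hl⟩ ?_ ?_
            · rw [uIcc_of_le h2.1.le]; exact Icc_subset_Icc_right h2.2.le
            · rw [abs_lt]; constructor <;> linarith [h2.1]
          · have hs' : β t ≤ re z := by
              by_contra hc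
              exact hsT (h1.2.2.2 ⟨not_le.1 hs, not_le.1 hc⟩)
            refine fin (β t) hend'.2 ⟨hl, le_rfl⟩ ?_ ?_
            · rw [uIcc_of_ge h2.2.le]; exact Icc_subset_Icc_left h2.1.le
            · rw [abs_lt]; constructor <;> linarith [h2.2]
      refine ((hhc z hzq hs1).continuousWithinAt).congr_of_eventuallyEq ?_ (main z (mem_ball_self hr) hz)
      filter_upwards [self_mem_nhdsWithin, nhdsWithin_le_nhds (ball_mem_nhds z hr)] with w hw hw'
      exact main w hw' hw
    · obtain ⟨t, ht, rfl⟩ := hIoo z (hz.resolve_left hzC)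
      obtain ⟨h1, h2⟩ := hαβ t ht
      have hev : ∀ᶠ w in 𝓝[C ∪ O ∩ ℓ] (pt o u t), w ∈ pt o u '' Ioo (α t) (β t) := by
        have e1 : ∀ᶠ w in 𝓝[C ∪ O ∩ ℓ] (pt o u t), w ∈ O := nhdsWithin_le_nhds (hO.mem_nhds ht)
        have e2 : ∀ᶠ w in 𝓝[C ∪ O ∩ ℓ] (pt o u t), re w ∈ Ioo (α t) (β t) :=
          nhdsWithin_le_nhds (hrec.continuousAt.preimage_mem_nhds (by
            simp only [hre, pt_re hu]; exact isOpen_Ioo.mem_nhds h2))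
        filter_upwards [e1, e2, self_mem_nhdsWithin] with w hw1 hw2 hw3
        exact ⟨re w, hw2, (eq_pt hu (hw3.resolve_left fun h => disjoint_left.1 hd hw1 h).2).symm⟩
      have hc : ContinuousWithinAt (G (α t) (β t)) (C ∪ O ∩ ℓ) (pt o u t) := by
        refine (((hG _ _ h1).1 (pt o u t) (Or.inr ⟨t, Ioo_subset_Icc_self h2, rfl⟩))).mono_of_mem_nhdsWithin ?_
        filter_upwards [hev] with w hw
        exact Or.inr (image_mono Ioo_subset_Icc_self hw)
      refine hc.congr_of_eventuallyEq ?_ (hgI t _ _ h1 h2)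
      filter_upwards [hev] with w hw
      obtain ⟨s, hs, rfl⟩ := hw
      exact hgI s _ _ h1 hs

theorem finite_gaps {T : Set ℝ} (hb : Bornology.IsBounded T) {δ : ℝ} (hδ : 0 < δ) :
    {x : ℝ × ℝ | IsGap T x.1 x.2 ∧ δ ≤ x.2 - x.1}.Finite := by
  obtain ⟨R, hR⟩ := hb.subset_closedBall 0
  have hR' : ∀ s ∈ T, |s| ≤ R := fun s hs => by simpa using hR hs
  refine Finite.of_finite_image (f := fun x => ⌈x.1 / δ⌉)
    ((finite_Icc ⌊(-R - δ) / δ⌋ ⌈R / δ + 1⌉).subset ?_) ?_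
  · rintro _ ⟨⟨α, β⟩, ⟨h1, h2⟩, rfl⟩
    simp only at h1 h2 ⊢
    have k1 : -R ≤ α + δ / 2 := (abs_le.1 (hR' _ (h1.2.2.2 ⟨by linarith, by linarith⟩))).1
    have k2 : α + δ / 2 ≤ R := (abs_le.1 (hR' _ (h1.2.2.2 ⟨by linarith, by linarith⟩))).2
    constructor
    · refine (Int.floor_le_floor ?_).trans (Int.floor_le_ceil _)
      gcongr; linarith
    · refine Int.ceil_le_ceil ?_
      have : α / δ ≤ R / δ := by gcongr; linarith
      linarith
  · rintro ⟨α, β⟩ ⟨h1, h2⟩ ⟨α', β'⟩ ⟨h1', h2'⟩ he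
    simp only at h1 h2 h1' h2' he
    have key : |α / δ - α' / δ| < 1 := by
      have a1 := Int.le_ceil (α / δ)
      have a2 := Int.ceil_lt_add_one (α / δ)
      have a3 := Int.le_ceil (α' / δ)
      have a4 := Int.ceil_lt_add_one (α' / δ)
      rw [he] at a1 a2
      rw [abs_lt]; constructor <;> linarith
    rw [← sub_div, abs_div, abs_of_pos hδ, div_lt_one hδ, abs_lt] at key
    have hm : max α α' < min β β' := by
      rw [max_lt_iff, lt_min_iff, lt_min_iff]
      refine ⟨⟨?_, ?_⟩, ?_, ?_⟩ <;> linarith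
    obtain ⟨t, ht, ht'⟩ := exists_between hm
    obtain ⟨e1, e2⟩ := h1.eq h1' (t := t) ⟨(le_max_left _ _).trans_lt ht, ht'.trans_le (min_le_left _ _)⟩
      ⟨(le_max_right _ _).trans_lt ht, ht'.trans_le (min_le_right _ _)⟩
    rw [e1, e2]

theorem IsJordanCurve.isCrosscut_gap {C : Set ℂ} (hC : IsJordanCurve C) {o u : ℂ} (hu : ‖u‖ = 1)
    {α β : ℝ} (h : IsGap {t | pt o u t ∈ ins C} α β) :
    IsCrosscut C (pt o u '' Icc α β) (pt o u α) (pt o u β) := by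
  have hsub : pt o u '' closure (Ioo α β) ⊆ closure (ins C) :=
    (image_closure_subset_closure_image (continuous_pt o u)).trans
      (closure_mono (by rintro _ ⟨t, ht, rfl⟩; exact h.2.2.2 ht))
  rw [closure_Ioo h.1.ne, hC.closure_ins] at hsub
  refine ⟨isArc_pt hu h.1, (hsub ⟨α, ⟨le_rfl, h.1.le⟩, rfl⟩).resolve_right h.2.1,
    (hsub ⟨β, ⟨h.1.le, le_rfl⟩, rfl⟩).resolve_right h.2.2.1, ?_⟩
  rintro _ ⟨⟨t, ht, rfl⟩, hne⟩
  refine h.2.2.2 ⟨lt_of_le_of_ne ht.1 fun h => hne ?_, lt_of_le_of_ne ht.2 fun h => hne ?_⟩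
  · rw [h]; exact Or.inl rfl
  · rw [h]; exact Or.inr rfl

/-- Finitely many chords on a line cut the inside of a Jordan curve into pieces which do not
really cross the line. -/
theorem IsJordanCurve.exists_chords {C : Set ℂ} (hC : IsJordanCurve C) {o u : ℂ} (hu : ‖u‖ = 1)
    {ε : ℝ} (hε : 0 < ε) : ∃ S : Set (ℝ × ℝ), S.Finite ∧
      (∀ x ∈ S, IsGap {t | pt o u t ∈ ins C} x.1 x.2) ∧
      ∀ W, IsPreconnected W → W ⊆ ins C → (∀ x ∈ S, Disjoint W (pt o u '' Icc x.1 x.2)) →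
        ∀ p ∈ W, ∀ q ∈ W, ((p - o) / u).im ≤ -ε → ε ≤ ((q - o) / u).im → False := by
  set T := {t | pt o u t ∈ ins C} with hT
  have hO := isOpen_ins hC.isClosed
  have hTb : Bornology.IsBounded T := by
    obtain ⟨R, hR⟩ := hC.isBounded_ins.subset_closedBall o
    refine (isBounded_closedBall (x := (0:ℝ)) (r := R)).subset fun t ht => ?_
    have := hR ht
    have e := dist_pt hu t 0 (o := o)
    rw [show pt o u 0 = o by simp [pt], sub_zero] at e
    rw [mem_closedBall, e] at this
    simpa using this
  obtain ⟨δ, hδ, hsm⟩ := hC.exists_small (half_pos hε)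
  set δ' := min δ (ε / 2) with hδ'
  have hδp : 0 < δ' := lt_min hδ (half_pos hε)
  refine ⟨_, finite_gaps hTb hδp, fun x hx => hx.1, fun W hW hWC hWd p hp q hq hpε hqε => ?_⟩
  have hfar : ∀ z t, ε ≤ |((z - o) / u).im| → ε ≤ dist z (pt o u t) := fun z t h => by
    have h0 : u ≠ 0 := by rintro rfl; simp at hu
    have e : ((z - o) / u).im = ((z - pt o u t) / u).im := by
      have : (z - o) / u = (z - pt o u t) / u + (t : ℝ) := by rw [pt]; field_simp; ring
      rw [this]; simp
    rw [e] at h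
    refine h.trans ((Complex.abs_im_le_norm _).trans ?_)
    rw [norm_div, hu, div_one, dist_eq_norm]
  have hpa : ε ≤ |((p - o) / u).im| := by rw [abs_of_nonpos (by linarith)]; linarith
  have hqa : ε ≤ |((q - o) / u).im| := by rw [abs_of_nonneg (by linarith)]; linarith
  have hall : ∀ α β, IsGap T α β → JoinedIn (C ∪ pt o u '' Icc α β)ᶜ p q := by
    intro α β h
    have hcr := hC.isCrosscut_gap hu h
    by_cases hlen : δ' ≤ β - α
    · refine joinedIn_of_isPreconnected (hC.isClosed.union hcr.arc.isClosed).isOpen_compl hW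
        (fun z hz => not_or.2 ⟨(hWC hz).1, disjoint_left.1 (hWd (α, β) ⟨h, hlen⟩) hz⟩) hp hq
    · rw [not_le] at hlen
      have hdist : dist (pt o u α) (pt o u β) < δ' := by
        rw [dist_pt hu, abs_sub_comm, abs_of_pos (by linarith [h.1])]; exact hlen
      obtain ⟨A, B, hAB, hA⟩ := hsm _ hcr.left_mem _ hcr.right_mem hcr.arc.ne
        (hdist.trans_le (min_le_left _ _))
      have hsmall : A ∪ pt o u '' Icc α β ⊆ closedBall (pt o u α) (ε / 2) := by
        refine union_subset (hA.trans ball_subset_closedBall) ?_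
        rintro _ ⟨t, ht, rfl⟩
        rw [mem_closedBall, dist_pt hu, abs_of_nonneg (by linarith [ht.1])]
        linarith [ht.2, min_le_right δ (ε / 2)]
      have hins := ins_subset_closedBall (hAB.left.isClosed.union hcr.arc.isClosed) (half_pos hε) hsmall
      have hside : ∀ z ∈ W, ε ≤ |((z - o) / u).im| → z ∈ ins (B ∪ pt o u '' Icc α β) := by
        intro z hz hzε
        have h1 : z ∈ ins C \ pt o u '' Icc α β := ⟨hWC hz, fun ⟨t, _, ht⟩ => by
          have := hfar z t hzε
          rw [ht, dist_self] at this; linarith⟩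
        rw [hAB.ins_diff_eq hcr] at h1
        refine h1.resolve_left fun h2 => ?_
        have := hins h2
        rw [mem_closedBall] at this
        linarith [hfar z α hzε]
      exact hAB.symm.joinedIn_theta hcr (hside p hp hpa) (hside q hq hqa)
  have hfin := joinedIn_of_chords hC.isCompact (by
    obtain ⟨A, B, a, b, hAB⟩ := hC
    rw [← hAB.union]
    exact hAB.left.isPreconnected.union a hAB.left.left_mem hAB.right.left_mem hAB.right.isPreconnected)
    hO hC.isBounded_ins hC.closure_ins.subset (ins_disjoint C) hu
    (show ((p - o) / u).im ≠ 0 from (by linarith : ((p - o) / u).im < 0).ne)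
    (show ((q - o) / u).im ≠ 0 from (by linarith : 0 < ((q - o) / u).im).ne')
    (hC.joinedIn_of_mem_ins (hWC hp) (hWC hq)) hall
  have hPp : IsPreconnected (pathComponentIn (C ∪ ins C ∩ {z | ((z - o) / u).im = 0})ᶜ p) :=
    isPreconnected_pathComponentIn p
  have hc : Continuous fun z : ℂ => ((z - o) / u).im := by fun_prop
  obtain ⟨z, hz, hz0⟩ := hPp.intermediate_value (mem_pathComponentIn_self hfin.mem.1) hfin
    hc.continuousOn (show (0 : ℝ) ∈ Icc _ _ from ⟨by linarith, by linarith⟩)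
  exact (JoinedIn.notMem_right hz) (Or.inr ⟨mem_ins_of_joinedIn (hWC hp)
    (JoinedIn.mono hz (compl_subset_compl.2 subset_union_left)), hz0⟩)

theorem IsArc.exists_map {A A' : Set ℂ} {a b a' b' : ℂ} (h : IsArc A a b) (h' : IsArc A' a' b') :
    ∃ g : ℂ → ℂ, ContinuousOn g A ∧ InjOn g A ∧ g a = a' ∧ g b = b' ∧ g '' A = A' := by
  obtain ⟨γ, h1, h2, rfl, rfl, rfl⟩ := h
  obtain ⟨γ', h1', h2', rfl, rfl, rfl⟩ := h'
  have hl : LeftInvOn (Function.invFunOn γ (Icc 0 1)) γ (Icc 0 1) := h2.leftInvOn_invFunOn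
  have hm : MapsTo (Function.invFunOn γ (Icc 0 1)) (γ '' Icc 0 1) (Icc 0 1) := by
    rintro _ ⟨t, ht, rfl⟩; rw [hl ht]; exact ht
  refine ⟨γ' ∘ Function.invFunOn γ (Icc 0 1),
    h1'.comp (continuousOn_invFunOn isCompact_Icc h1 h2) hm, ?_, ?_, ?_, ?_⟩
  · rintro _ ⟨s, hs, rfl⟩ _ ⟨t, ht, rfl⟩ hst
    simp only [Function.comp_apply, hl hs, hl ht] at hst
    rw [h2' hs ht hst]
  · simp [hl (left_mem_Icc.2 zero_le_one)]
  · simp [hl (right_mem_Icc.2 zero_le_one)]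
  · rw [← image_comp]
    exact image_congr fun t ht => by simp [hl ht]

/-- Extending an embedding of a compact set over an arc attached at its ends. -/
theorem IsArc.exists_extend {N L : Set ℂ} {φ g : ℂ → ℂ} {a b : ℂ} (hL : IsArc L a b)
    (hN : IsCompact N) (hφ : ContinuousOn φ N) (hi : InjOn φ N)
    (hNL : L ∩ N ⊆ {a, b}) (haN : a ∈ N) (hbN : b ∈ N) (hg : ContinuousOn g L) (hgi : InjOn g L)
    (hga : g a = φ a) (hgb : g b = φ b) (hNL' : g '' L ∩ φ '' N ⊆ {φ a, φ b}) :
    ∃ χ : ℂ → ℂ, ContinuousOn χ (N ∪ L) ∧ InjOn χ (N ∪ L) ∧ EqOn χ φ N ∧ EqOn χ g L := by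
  classical
  have hgN : EqOn (N.piecewise φ g) g L := by
    intro z hz
    by_cases hzN : z ∈ N
    · rw [piecewise_eq_of_mem _ _ _ hzN]
      rcases hNL ⟨hz, hzN⟩ with rfl | rfl
      exacts [hga.symm, hgb.symm]
    · rw [piecewise_eq_of_notMem _ _ _ hzN]
  have hφN : EqOn (N.piecewise φ g) φ N := piecewise_eqOn _ _ _
  have key : ∀ z ∈ N, ∀ w ∈ L, φ z = g w → z = w := by
    intro z hz w hw hzw
    have : φ z ∈ g '' L ∩ φ '' N := ⟨hzw ▸ mem_image_of_mem g hw, z, hz, rfl⟩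
    rcases hNL' this with h | h
    · rw [hi hz haN h]; exact hgi hL.left_mem hw (by rw [hga, ← hzw, h])
    · rw [hi hz hbN h]; exact hgi hL.right_mem hw (by rw [hgb, ← hzw, h])
  refine ⟨N.piecewise φ g, ?_, ?_, hφN, hgN⟩
  · exact (hφ.congr hφN).union_of_isClosed (hg.congr hgN) hN.isClosed hL.isClosed
  · rintro z (hz | hz) w (hw | hw) hzw
    · rw [hφN hz, hφN hw] at hzw; exact hi hz hw hzw
    · rw [hφN hz, hgN hw] at hzw; exact key z hz w hw hzw
    · rw [hφN hw, hgN hz] at hzw; exact (key w hw z hz hzw.symm).symm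
    · rw [hgN hz, hgN hw] at hzw; exact hgi hz hw hzw

theorem IsTwoArc.image {J A B : Set ℂ} {a b : ℂ} (h : IsTwoArc J A B a b) {f : ℂ → ℂ}
    (hf : ContinuousOn f J) (hi : InjOn f J) :
    IsTwoArc (f '' J) (f '' A) (f '' B) (f a) (f b) := by
  have hA : A ⊆ J := h.union ▸ subset_union_left
  have hB : B ⊆ J := h.union ▸ subset_union_right
  refine ⟨h.left.image (hf.mono hA) (hi.mono hA), h.right.image (hf.mono hB) (hi.mono hB), ?_, ?_⟩
  · rw [← hi.image_inter hA hB, h.inter, image_pair]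
  · rw [← image_union, h.union]

theorem IsJordanCurve.image {J : Set ℂ} (h : IsJordanCurve J) {f : ℂ → ℂ}
    (hf : ContinuousOn f J) (hi : InjOn f J) : IsJordanCurve (f '' J) := by
  obtain ⟨A, B, a, b, h⟩ := h
  exact (h.image hf hi).isJordan

/-- Two cell decompositions of the same combinatorial type, with a homeomorphism between their
one-dimensional skeleta. -/
structure Net (X Y N : Set ℂ) (φ : ℂ → ℂ) (𝒞 : Set (Set ℂ)) : Prop where
  fin : 𝒞.Finite
  compact : IsCompact N
  cont : ContinuousOn φ N
  inj : InjOn φ N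
  jordan : ∀ C ∈ 𝒞, IsJordanCurve C
  sub : ∀ C ∈ 𝒞, C ⊆ N
  cover : N ⊆ ⋃₀ 𝒞
  left : X = N ∪ ⋃ C ∈ 𝒞, ins C
  right : Y = φ '' N ∪ ⋃ C ∈ 𝒞, ins (φ '' C)
  disjL : ∀ C ∈ 𝒞, Disjoint (ins C) N
  disjR : ∀ C ∈ 𝒞, Disjoint (ins (φ '' C)) (φ '' N)
  pairL : ∀ C ∈ 𝒞, ∀ D ∈ 𝒞, C ≠ D → Disjoint (ins C) (ins D)
  pairR : ∀ C ∈ 𝒞, ∀ D ∈ 𝒞, C ≠ D → Disjoint (ins (φ '' C)) (ins (φ '' D))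

structure Refines (N : Set ℂ) (φ : ℂ → ℂ) (𝒞 : Set (Set ℂ)) (N' : Set ℂ) (χ : ℂ → ℂ)
    (𝒞' : Set (Set ℂ)) : Prop where
  sub : N ⊆ N'
  eqOn : EqOn χ φ N
  cell : ∀ C' ∈ 𝒞', ∃ C ∈ 𝒞, ins C' ⊆ ins C ∧ ins (χ '' C') ⊆ ins (φ '' C)

theorem Refines.refl (N : Set ℂ) (φ : ℂ → ℂ) (𝒞 : Set (Set ℂ)) : Refines N φ 𝒞 N φ 𝒞 :=
  ⟨subset_rfl, fun _ _ => rfl, fun C hC => ⟨C, hC, subset_rfl, subset_rfl⟩⟩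

theorem Refines.trans {N N' N'' : Set ℂ} {φ χ χ' : ℂ → ℂ} {𝒞 𝒞' 𝒞'' : Set (Set ℂ)}
    (h : Refines N φ 𝒞 N' χ 𝒞') (h' : Refines N' χ 𝒞' N'' χ' 𝒞'') :
    Refines N φ 𝒞 N'' χ' 𝒞'' :=
  ⟨h.sub.trans h'.sub, fun z hz => (h'.eqOn (h.sub hz)).trans (h.eqOn hz), fun C hC => by
    obtain ⟨D, hD, h1, h2⟩ := h'.cell C hC
    obtain ⟨E, hE, h3, h4⟩ := h.cell D hD
    exact ⟨E, hE, h1.trans h3, h2.trans h4⟩⟩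

namespace Net
variable {X Y N : Set ℂ} {φ : ℂ → ℂ} {𝒞 : Set (Set ℂ)}

theorem jordanR (h : Net X Y N φ 𝒞) {C : Set ℂ} (hC : C ∈ 𝒞) : IsJordanCurve (φ '' C) :=
  (h.jordan C hC).image (h.cont.mono (h.sub C hC)) (h.inj.mono (h.sub C hC))

theorem inv (h : Net X Y N φ 𝒞) :
    Net Y X (φ '' N) (Function.invFunOn φ N) ((φ '' ·) '' 𝒞) := by
  have hl : LeftInvOn (Function.invFunOn φ N) φ N := h.inj.leftInvOn_invFunOn
  have hC : ∀ C ∈ 𝒞, Function.invFunOn φ N '' (φ '' C) = C := fun C hC =>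
    (hl.mono (h.sub C hC)).image_image
  have hN : Function.invFunOn φ N '' (φ '' N) = N := hl.image_image
  refine ⟨h.fin.image _, h.compact.image_of_continuousOn h.cont,
    continuousOn_invFunOn h.compact h.cont h.inj, ?_, ?_, ?_, ?_, ?_, ?_, ?_, ?_, ?_, ?_⟩
  · rintro _ ⟨z, hz, rfl⟩ _ ⟨w, hw, rfl⟩ hzw
    rw [hl hz, hl hw] at hzw; rw [hzw]
  · rintro _ ⟨C, hC, rfl⟩; exact h.jordanR hC
  · rintro _ ⟨C, hC, rfl⟩; exact image_mono (h.sub C hC)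
  · rintro _ ⟨z, hz, rfl⟩
    obtain ⟨C, hC, hzC⟩ := h.cover hz
    exact ⟨_, ⟨C, hC, rfl⟩, mem_image_of_mem φ hzC⟩
  · rw [h.right, biUnion_image]
  · rw [h.left, biUnion_image, hN]
    congr 1
    exact iUnion₂_congr fun C hC' => by rw [hC C hC']
  · rintro _ ⟨C, hC, rfl⟩; exact h.disjR C hC
  · rintro _ ⟨C, hC', rfl⟩
    simp only [hC C hC', hN]
    exact h.disjL C hC'
  · rintro _ ⟨C, hC', rfl⟩ _ ⟨D, hD, rfl⟩ hCD
    exact h.pairR C hC' D hD (fun e => hCD (by rw [e]))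
  · rintro _ ⟨C, hC', rfl⟩ _ ⟨D, hD, rfl⟩ hCD
    simp only [hC C hC', hC D hD]
    exact h.pairL C hC' D hD (fun e => hCD (by rw [e]))

/-- Refinements of the inverse net give refinements of the net. -/
theorem refines_inv (h : Net X Y N φ 𝒞) {M : Set ℂ} {ψ : ℂ → ℂ} {𝒟 : Set (Set ℂ)}
    (hM : Net Y X M ψ 𝒟)
    (hr : Refines (φ '' N) (Function.invFunOn φ N) ((φ '' ·) '' 𝒞) M ψ 𝒟) :
    Refines N φ 𝒞 (ψ '' M) (Function.invFunOn ψ M) ((ψ '' ·) '' 𝒟) := by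
  have hl : LeftInvOn (Function.invFunOn φ N) φ N := h.inj.leftInvOn_invFunOn
  have hl' : LeftInvOn (Function.invFunOn ψ M) ψ M := hM.inj.leftInvOn_invFunOn
  have hψ : ∀ z ∈ N, ψ (φ z) = z := fun z hz => by
    rw [hr.eqOn (mem_image_of_mem φ hz), hl hz]
  refine ⟨fun z hz => ⟨φ z, hr.sub (mem_image_of_mem φ hz), hψ z hz⟩, fun z hz => ?_, ?_⟩
  · conv_lhs => rw [← hψ z hz]
    exact hl' (hr.sub (mem_image_of_mem φ hz))
  · rintro _ ⟨D, hD, rfl⟩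
    obtain ⟨_, ⟨C, hC, rfl⟩, h1, h2⟩ := hr.cell D hD
    refine ⟨C, hC, ?_, ?_⟩
    · rwa [(hl.mono (h.sub C hC)).image_image] at h2
    · simp only [(hl'.mono (hM.sub D hD)).image_image]; exact h1

/-- Splitting a cell by a crosscut. -/
theorem split_map (h : Net X Y N φ 𝒞) {C L L' : Set ℂ} {a b : ℂ} (hC : C ∈ 𝒞)
    (hL : IsCrosscut C L a b) (hL' : IsCrosscut (φ '' C) L' (φ a) (φ b)) {g : ℂ → ℂ}
    (hg : ContinuousOn g L) (hgi : InjOn g L) (hga : g a = φ a) (hgb : g b = φ b)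
    (hgL : g '' L = L') :
    ∃ χ 𝒞', Net X Y (N ∪ L) χ 𝒞' ∧ Refines N φ 𝒞 (N ∪ L) χ 𝒞' ∧ EqOn χ g L := by
  obtain ⟨A, B, hAB⟩ := (h.jordan C hC).exists_ends hL.left_mem hL.right_mem hL.arc.ne
  have hCN := h.sub C hC
  have hAC : A ⊆ C := hAB.union ▸ subset_union_left
  have hBC : B ⊆ C := hAB.union ▸ subset_union_right
  have hAB' := hAB.image (h.cont.mono hCN) (h.inj.mono hCN)
  have hNL : L ∩ N ⊆ {a, b} := fun z hz => by
    by_contra hn; exact disjoint_left.1 (h.disjL C hC) (hL.sub ⟨hz.1, hn⟩) hz.2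
  have hNL' : L' ∩ φ '' N ⊆ {φ a, φ b} := fun z hz => by
    by_contra hn; exact disjoint_left.1 (h.disjR C hC) (hL'.sub ⟨hz.1, hn⟩) hz.2
  obtain ⟨χ, hc, hi, he, hgL'⟩ := hL.arc.exists_extend h.compact h.cont h.inj hNL
    (hCN hL.left_mem) (hCN hL.right_mem) hg hgi hga hgb (hgL ▸ hNL')
  have hLL : χ '' L = L' := by rw [hgL'.image_eq, hgL]
  have hiA : χ '' (A ∪ L) = φ '' A ∪ L' := by
    rw [image_union, hLL, (he.mono (hAC.trans hCN)).image_eq]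
  have hiB : χ '' (B ∪ L) = φ '' B ∪ L' := by
    rw [image_union, hLL, (he.mono (hBC.trans hCN)).image_eq]
  have hiN : χ '' (N ∪ L) = φ '' N ∪ L' := by rw [image_union, hLL, he.image_eq]
  have hiD : ∀ D ∈ 𝒞, χ '' D = φ '' D := fun D hD => (he.mono (h.sub D hD)).image_eq
  have hLC : L ⊆ C ∪ ins C := fun z hz => by
    by_cases hz' : z ∈ ({a, b} : Set ℂ)
    · rcases hz' with rfl | rfl
      exacts [Or.inl hL.left_mem, Or.inl hL.right_mem]
    · exact Or.inr (hL.sub ⟨hz, hz'⟩)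
  have hLC' : L' ⊆ φ '' C ∪ ins (φ '' C) := fun z hz => by
    by_cases hz' : z ∈ ({φ a, φ b} : Set ℂ)
    · rcases hz' with rfl | rfl
      exacts [Or.inl hL'.left_mem, Or.inl hL'.right_mem]
    · exact Or.inr (hL'.sub ⟨hz, hz'⟩)
  have hdL : ∀ D ∈ 𝒞, D ≠ C → Disjoint (ins D) L := fun D hD hDC =>
    disjoint_of_subset_right hLC (disjoint_union_right.2
      ⟨disjoint_of_subset_right hCN (h.disjL D hD), h.pairL D hD C hC hDC⟩)
  have hdR : ∀ D ∈ 𝒞, D ≠ C → Disjoint (ins (φ '' D)) L' := fun D hD hDC =>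
    disjoint_of_subset_right hLC' (disjoint_union_right.2
      ⟨disjoint_of_subset_right (image_mono hCN) (h.disjR D hD), h.pairR D hD C hC hDC⟩)
  have hA := hAB.ins_subset hL
  have hB := hAB.symm.ins_subset hL
  have hA' := hAB'.ins_subset hL'
  have hB' := hAB'.symm.ins_subset hL'
  have hsub : ∀ D ∈ insert (A ∪ L) (insert (B ∪ L) (𝒞 \ {C})), D ∈ 𝒞 ∧ D ≠ C ∨
      (ins D ⊆ ins C \ L ∧ ins (χ '' D) ⊆ ins (φ '' C) \ L') := by
    rintro D (rfl | rfl | hD)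
    · rw [hiA]; exact Or.inr ⟨hA, hA'⟩
    · rw [hiB]; exact Or.inr ⟨hB, hB'⟩
    · exact Or.inl hD
  refine ⟨χ, insert (A ∪ L) (insert (B ∪ L) (𝒞 \ {C})), ⟨((h.fin.sdiff).insert _).insert _,
    h.compact.union hL.arc.isCompact, hc, hi, ?_, ?_, ?_, ?_, ?_, ?_, ?_, ?_, ?_⟩,
    ⟨subset_union_left, he, ?_⟩, hgL'⟩
  · rintro D (rfl | rfl | hD)
    exacts [(hAB.inter_crosscut hL).isJordan, (hAB.symm.inter_crosscut hL).isJordan,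
      h.jordan D hD.1]
  · rintro D (rfl | rfl | hD)
    exacts [union_subset_union_left _ (hAC.trans hCN), union_subset_union_left _ (hBC.trans hCN),
      (h.sub D hD.1).trans subset_union_left]
  · rintro z (hz | hz)
    · obtain ⟨D, hD, hzD⟩ := h.cover hz
      by_cases hDC : D = C
      · rw [hDC, ← hAB.union] at hzD
        rcases hzD with hz | hz
        exacts [⟨_, Or.inl rfl, Or.inl hz⟩, ⟨_, Or.inr (Or.inl rfl), Or.inl hz⟩]
      · exact ⟨D, Or.inr (Or.inr ⟨hD, hDC⟩), hzD⟩
    · exact ⟨_, Or.inl rfl, Or.inr hz⟩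
  · rw [h.left, biUnion_insert, biUnion_insert, ← union_assoc (ins (A ∪ L)),
      ← hAB.ins_diff_eq hL]
    ext z
    simp only [mem_union, mem_iUnion, exists_prop, Set.mem_sdiff, mem_singleton_iff]
    constructor
    · rintro (hz | ⟨D, hD, hz⟩)
      · exact Or.inl (Or.inl hz)
      · by_cases hDC : D = C
        · subst hDC
          by_cases hzL : z ∈ L
          exacts [Or.inl (Or.inr hzL), Or.inr (Or.inl ⟨hz, hzL⟩)]
        · exact Or.inr (Or.inr ⟨D, ⟨hD, hDC⟩, hz⟩)
    · rintro ((hz | hz) | ⟨hz, _⟩ | ⟨D, ⟨hD, _⟩, hz⟩)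
      · exact Or.inl hz
      · rcases hLC hz with hz | hz
        exacts [Or.inl (hCN hz), Or.inr ⟨C, hC, hz⟩]
      · exact Or.inr ⟨C, hC, hz⟩
      · exact Or.inr ⟨D, hD, hz⟩
  · rw [h.right, biUnion_insert, biUnion_insert, ← union_assoc (ins (χ '' (A ∪ L))), hiA, hiB,
      ← hAB'.ins_diff_eq hL', hiN]
    ext z
    simp only [mem_union, mem_iUnion, exists_prop, Set.mem_sdiff, mem_singleton_iff]
    constructor
    · rintro (hz | ⟨D, hD, hz⟩)
      · exact Or.inl (Or.inl hz)
      · by_cases hDC : D = C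
        · subst hDC
          by_cases hzL : z ∈ L'
          exacts [Or.inl (Or.inr hzL), Or.inr (Or.inl ⟨hz, hzL⟩)]
        · exact Or.inr (Or.inr ⟨D, ⟨hD, hDC⟩, by rwa [hiD D hD]⟩)
    · rintro ((hz | hz) | ⟨hz, _⟩ | ⟨D, ⟨hD, _⟩, hz⟩)
      · exact Or.inl hz
      · rcases hLC' hz with hz | hz
        exacts [Or.inl (image_mono hCN hz), Or.inr ⟨C, hC, hz⟩]
      · exact Or.inr ⟨C, hC, hz⟩
      · exact Or.inr ⟨D, hD, by rwa [← hiD D hD]⟩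
  · intro D hD
    rcases hsub D hD with ⟨h1, h2⟩ | ⟨h1, h2⟩
    · exact disjoint_union_right.2 ⟨h.disjL D h1, hdL D h1 h2⟩
    · exact disjoint_union_right.2 ⟨disjoint_of_subset_left (h1.trans sdiff_subset) (h.disjL C hC),
        disjoint_of_subset_left h1 disjoint_sdiff_left⟩
  · intro D hD
    rw [hiN]
    rcases hsub D hD with ⟨h1, h2⟩ | ⟨h1, h2⟩
    · rw [hiD D h1]; exact disjoint_union_right.2 ⟨h.disjR D h1, hdR D h1 h2⟩
    · exact disjoint_union_right.2 ⟨disjoint_of_subset_left (h2.trans sdiff_subset) (h.disjR C hC),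
        disjoint_of_subset_left h2 disjoint_sdiff_left⟩
  · have hd := hAB.disjoint_theta hL
    have h3 : ∀ D ∈ 𝒞 \ {C}, Disjoint (ins (A ∪ L)) (ins D) := fun D hD =>
      disjoint_of_subset_left (hA.trans sdiff_subset) (h.pairL C hC D hD.1 (Ne.symm hD.2))
    have h4 : ∀ D ∈ 𝒞 \ {C}, Disjoint (ins (B ∪ L)) (ins D) := fun D hD =>
      disjoint_of_subset_left (hB.trans sdiff_subset) (h.pairL C hC D hD.1 (Ne.symm hD.2))
    rintro D (rfl | rfl | hD) E (rfl | rfl | hE) hDE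
    exacts [absurd rfl hDE, hd, h3 E hE, hd.symm, absurd rfl hDE, h4 E hE, (h3 D hD).symm,
      (h4 D hD).symm, h.pairL D hD.1 E hE.1 hDE]
  · have hd := hAB'.disjoint_theta hL'
    have h3 : ∀ D ∈ 𝒞 \ {C}, Disjoint (ins (φ '' A ∪ L')) (ins (χ '' D)) := fun D hD => by
      rw [hiD D hD.1]
      exact disjoint_of_subset_left (hA'.trans sdiff_subset) (h.pairR C hC D hD.1 (Ne.symm hD.2))
    have h4 : ∀ D ∈ 𝒞 \ {C}, Disjoint (ins (φ '' B ∪ L')) (ins (χ '' D)) := fun D hD => by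
      rw [hiD D hD.1]
      exact disjoint_of_subset_left (hB'.trans sdiff_subset) (h.pairR C hC D hD.1 (Ne.symm hD.2))
    rintro D (rfl | rfl | hD) E (rfl | rfl | hE) hDE <;> try rw [hiA]
    · exact absurd rfl hDE
    · rw [hiB]; exact hd
    · exact h3 E hE
    · rw [hiB]; exact hd.symm
    · exact absurd rfl hDE
    · rw [hiB]; exact h4 E hE
    · exact (h3 D hD).symm
    · rw [hiB]; exact (h4 D hD).symm
    · rw [hiD D hD.1, hiD E hE.1]; exact h.pairR D hD.1 E hE.1 hDE
  · intro D hD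
    rcases hsub D hD with ⟨h1, h2⟩ | ⟨h1, h2⟩
    · exact ⟨D, h1, subset_rfl, by rw [hiD D h1]⟩
    · exact ⟨C, hC, h1.trans sdiff_subset, h2.trans sdiff_subset⟩

theorem split (h : Net X Y N φ 𝒞) {C L : Set ℂ} {a b : ℂ} (hC : C ∈ 𝒞) (hL : IsCrosscut C L a b) :
    ∃ χ 𝒞', Net X Y (N ∪ L) χ 𝒞' ∧ Refines N φ 𝒞 (N ∪ L) χ 𝒞' := by
  obtain ⟨L', hL'⟩ := (h.jordanR hC).exists_crosscut (mem_image_of_mem φ hL.left_mem)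
    (mem_image_of_mem φ hL.right_mem) fun e => hL.arc.ne
      (h.inj (h.sub C hC hL.left_mem) (h.sub C hC hL.right_mem) e)
  obtain ⟨g, hg, hgi, hga, hgb, hgL⟩ := hL.arc.exists_map hL'.arc
  obtain ⟨χ, 𝒞', h1, h2, -⟩ := h.split_map hC hL hL' hg hgi hga hgb hgL
  exact ⟨χ, 𝒞', h1, h2⟩

theorem closure_cell (h : Net X Y N φ 𝒞) {C : Set ℂ} (hC : C ∈ 𝒞) : closure (ins C) ∩ N ⊆ C :=
  fun z hz => by
    rw [(h.jordan C hC).closure_ins] at hz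
    exact hz.1.resolve_right fun h' => disjoint_left.1 (h.disjL C hC) h' hz.2

/-- Adding an arc whose interior lies off the skeleton. -/
theorem add_arc (h : Net X Y N φ 𝒞) {L : Set ℂ} {a b : ℂ} (hL : IsArc L a b) (ha : a ∈ N)
    (hb : b ∈ N) (hX : L ⊆ X) (hLN : L ∩ N ⊆ {a, b}) :
    ∃ χ 𝒞', Net X Y (N ∪ L) χ 𝒞' ∧ Refines N φ 𝒞 (N ∪ L) χ 𝒞' := by
  have hsub : L \ {a, b} ⊆ ⋃ C ∈ 𝒞, ins C := fun z hz => by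
    have := hX hz.1
    rw [h.left] at this
    exact this.resolve_left fun hzN => hz.2 (hLN ⟨hz.1, hzN⟩)
  obtain ⟨z, hz⟩ : (L \ {a, b}).Nonempty := (hL.infinite.sdiff (by simp)).nonempty
  obtain ⟨C, hC, hzC⟩ := mem_iUnion₂.1 (hsub hz)
  have hLC : L \ {a, b} ⊆ ins C := by
    have hCo := isOpen_ins (h.jordan C hC).isClosed
    have hOo : IsOpen (⋃ D ∈ 𝒞 \ {C}, ins D) :=
      isOpen_biUnion fun D hD => isOpen_ins (h.jordan D hD.1).isClosed
    refine hL.isPreconnected_diff.subset_left_of_subset_union hCo hOo ?_ ?_ ⟨z, hz, hzC⟩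
    · rw [disjoint_iUnion₂_right]
      exact fun D hD => h.pairL C hC D hD.1 (Ne.symm hD.2)
    · intro w hw
      obtain ⟨D, hD, hwD⟩ := mem_iUnion₂.1 (hsub hw)
      by_cases hDC : D = C
      · exact Or.inl (hDC ▸ hwD)
      · exact Or.inr (mem_iUnion₂.2 ⟨D, ⟨hD, hDC⟩, hwD⟩)
  have hcl : L ⊆ closure (ins C) := hL.subset_closure_diff.trans (closure_mono hLC)
  exact h.split hC ⟨hL, h.closure_cell hC ⟨hcl hL.left_mem, ha⟩,
    h.closure_cell hC ⟨hcl hL.right_mem, hb⟩, hLC⟩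

theorem add_arcs (h : Net X Y N φ 𝒞) {S : Set (Set ℂ)} (hS : S.Finite)
    (hSa : ∀ L ∈ S, ∃ a b, IsArc L a b ∧ a ∈ N ∧ b ∈ N ∧ L ⊆ X ∧ L ∩ N ⊆ {a, b})
    (hSd : ∀ L ∈ S, ∀ M ∈ S, L ≠ M → L ∩ M ⊆ N) :
    ∃ χ 𝒞', Net X Y (N ∪ ⋃₀ S) χ 𝒞' ∧ Refines N φ 𝒞 (N ∪ ⋃₀ S) χ 𝒞' := by
  induction S, hS using Set.Finite.induction_on with
  | empty => exact ⟨φ, 𝒞, by simpa using h, by simpa using Refines.refl N φ 𝒞⟩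
  | @insert L S hLS _ ih =>
    obtain ⟨φ₁, 𝒞₁, h1, hr1⟩ := ih (fun M hM => hSa M (Or.inr hM))
      (fun M hM K hK => hSd M (Or.inr hM) K (Or.inr hK))
    obtain ⟨a, b, hL, ha, hb, hX, hLN⟩ := hSa L (Or.inl rfl)
    obtain ⟨φ₂, 𝒞₂, h2, hr2⟩ := h1.add_arc hL (Or.inl ha) (Or.inl hb) hX (by
      rintro z ⟨hz, hz' | ⟨M, hM, hzM⟩⟩
      · exact hLN ⟨hz, hz'⟩
      · exact hLN ⟨hz, hSd L (Or.inl rfl) M (Or.inr hM) (by rintro rfl; exact hLS hM) ⟨hz, hzM⟩⟩)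
    have e : N ∪ ⋃₀ S ∪ L = N ∪ ⋃₀ insert L S := by
      rw [sUnion_insert, union_assoc, union_comm (⋃₀ S)]
    rw [e] at h2 hr2
    exact ⟨φ₂, 𝒞₂, h2, hr1.trans hr2⟩

/-- Refining a net so that no cell crosses the strip around a given line. -/
theorem refine_line (h : Net X Y N φ 𝒞) {o u : ℂ} (hu : ‖u‖ = 1) {ε : ℝ} (hε : 0 < ε) :
    ∃ N' χ 𝒞', Net X Y N' χ 𝒞' ∧ Refines N φ 𝒞 N' χ 𝒞' ∧ ∀ C ∈ 𝒞', ∀ p ∈ ins C, ∀ q ∈ ins C,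
      ((p - o) / u).im ≤ -ε → ε ≤ ((q - o) / u).im → False := by
  have hex : ∀ C : Set ℂ, ∃ S : Set (ℝ × ℝ), S.Finite ∧ (C ∈ 𝒞 →
      (∀ x ∈ S, IsGap {t | pt o u t ∈ ins C} x.1 x.2) ∧
      ∀ W, IsPreconnected W → W ⊆ ins C → (∀ x ∈ S, Disjoint W (pt o u '' Icc x.1 x.2)) →
        ∀ p ∈ W, ∀ q ∈ W, ((p - o) / u).im ≤ -ε → ε ≤ ((q - o) / u).im → False) := fun C => by
    by_cases hC : C ∈ 𝒞
    · obtain ⟨S, hS, h1⟩ := (h.jordan C hC).exists_chords hu hε (o := o)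
      exact ⟨S, hS, fun _ => h1⟩
    · exact ⟨∅, finite_empty, fun h => absurd h hC⟩
  choose S hSf hS using hex
  have hcr : ∀ C ∈ 𝒞, ∀ x ∈ S C, IsCrosscut C (pt o u '' Icc x.1 x.2) (pt o u x.1) (pt o u x.2) :=
    fun C hC x hx => (h.jordan C hC).isCrosscut_gap hu ((hS C hC).1 x hx)
  have hoff : ∀ C ∈ 𝒞, ∀ x ∈ S C, ∀ t ∈ Icc x.1 x.2, pt o u t ∉ N →
      pt o u t ∈ ins C ∧ t ∈ Ioo x.1 x.2 := by
    intro C hC x hx t ht htN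
    have h1 : t ≠ x.1 := by rintro rfl; exact htN (h.sub C hC (hcr C hC x hx).left_mem)
    have h2 : t ≠ x.2 := by rintro rfl; exact htN (h.sub C hC (hcr C hC x hx).right_mem)
    have h3 : t ∈ Ioo x.1 x.2 := ⟨lt_of_le_of_ne ht.1 h1.symm, lt_of_le_of_ne ht.2 h2⟩
    exact ⟨((hS C hC).1 x hx).2.2.2 h3, h3⟩
  obtain ⟨χ, 𝒞', h', hr⟩ := h.add_arcs
    (S := ⋃ C ∈ 𝒞, (fun x : ℝ × ℝ => pt o u '' Icc x.1 x.2) '' S C)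
    (h.fin.biUnion fun C _ => (hSf C).image _) (by
      intro L hL
      obtain ⟨C, hC, x, hx, rfl⟩ := mem_iUnion₂.1 hL
      have hc := hcr C hC x hx
      refine ⟨_, _, hc.arc, h.sub C hC hc.left_mem, h.sub C hC hc.right_mem, ?_, ?_⟩
      · intro z hz
        rw [h.left]
        by_cases hzN : z ∈ N
        · exact Or.inl hzN
        · obtain ⟨t, ht, rfl⟩ := hz
          exact Or.inr (mem_iUnion₂.2 ⟨C, hC, (hoff C hC x hx t ht hzN).1⟩)
      · intro z hz
        by_contra hn
        exact disjoint_left.1 (h.disjL C hC) (hc.sub ⟨hz.1, hn⟩) hz.2) (by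
      intro L hL M hM hLM z hz
      obtain ⟨C, hC, x, hx, rfl⟩ := mem_iUnion₂.1 hL
      obtain ⟨D, hD, y, hy, rfl⟩ := mem_iUnion₂.1 hM
      by_contra hzN
      obtain ⟨⟨t, ht, rfl⟩, s, hs, hst⟩ := hz
      have hst : s = t := by rw [← pt_re hu s (o := o), hst, pt_re hu]
      subst hst
      obtain ⟨h1, h2⟩ := hoff C hC x hx s ht hzN
      obtain ⟨h3, h4⟩ := hoff D hD y hy s hs hzN
      have hCD : C = D := by
        by_contra hne
        exact disjoint_left.1 (h.pairL C hC D hD hne) h1 h3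
      subst hCD
      obtain ⟨e1, e2⟩ := ((hS C hC).1 x hx).eq ((hS C hC).1 y hy) h2 h4
      exact hLM (by simp only [e1, e2]))
  refine ⟨_, χ, 𝒞', h', hr, fun C' hC' => ?_⟩
  obtain ⟨C, hC, h1, -⟩ := hr.cell C' hC'
  refine (hS C hC).2 _ (h'.jordan C' hC').isPreconnected_ins h1 fun x hx => ?_
  exact disjoint_of_subset_right (fun z hz => Or.inr ⟨_, mem_iUnion₂.2 ⟨C, hC, x, hx, rfl⟩, hz⟩)
    (h'.disjL C' hC')

theorem refine_lines (h : Net X Y N φ 𝒞) {ε : ℝ} (hε : 0 < ε) (S : Finset (ℂ × ℂ))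
    (hu : ∀ x ∈ S, ‖x.2‖ = 1) :
    ∃ N' χ 𝒞', Net X Y N' χ 𝒞' ∧ Refines N φ 𝒞 N' χ 𝒞' ∧ ∀ x ∈ S, ∀ C ∈ 𝒞', ∀ p ∈ ins C,
      ∀ q ∈ ins C, ((p - x.1) / x.2).im ≤ -ε → ε ≤ ((q - x.1) / x.2).im → False := by
  classical
  induction S using Finset.induction_on with
  | empty => exact ⟨N, φ, 𝒞, h, Refines.refl N φ 𝒞, by simp⟩
  | insert y S _ ih =>
    obtain ⟨N₁, φ₁, 𝒞₁, h1, hr1, ht1⟩ := ih fun x hx => hu x (Finset.mem_insert_of_mem hx)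
    obtain ⟨N₂, φ₂, 𝒞₂, h2, hr2, ht2⟩ := h1.refine_line (hu y (Finset.mem_insert_self y S)) hε
      (o := y.1)
    refine ⟨N₂, φ₂, 𝒞₂, h2, hr1.trans hr2, fun x hx C hC p hp q hq => ?_⟩
    rcases Finset.mem_insert.1 hx with rfl | hx
    · exact ht2 C hC p hp q hq
    · obtain ⟨D, hD, hCD, -⟩ := hr2.cell C hC
      exact ht1 x hx D hD p (hCD hp) q (hCD hq)

theorem bounded (h : Net X Y N φ 𝒞) : Bornology.IsBounded X := by
  rw [h.left]
  exact h.compact.isBounded.union ((Bornology.isBounded_biUnion h.fin).2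
    fun C hC => (h.jordan C hC).isBounded_ins)

theorem refine_small (h : Net X Y N φ 𝒞) {ε : ℝ} (hε : 0 < ε) :
    ∃ N' χ 𝒞', Net X Y N' χ 𝒞' ∧ Refines N φ 𝒞 N' χ 𝒞' ∧
      ∀ C ∈ 𝒞', ∀ p ∈ ins C, ∀ q ∈ ins C, dist p q ≤ ε := by
  obtain ⟨R, hR⟩ := h.bounded.subset_closedBall 0
  set η := ε / 6 with hη
  have hηp : 0 < η := by positivity
  set K : ℤ := ⌈R / η⌉ with hK
  have hRK : R ≤ K * η := by
    rw [← div_le_iff₀ hηp]; exact Int.le_ceil _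
  let g1 : ℤ → ℂ × ℂ := fun k => (((k * η : ℝ) : ℂ) * Complex.I, 1)
  let g2 : ℤ → ℂ × ℂ := fun k => (((k * η : ℝ) : ℂ), -Complex.I)
  obtain ⟨N', χ, 𝒞', h', hr, ht⟩ := h.refine_lines hηp
    ((Finset.Icc (-K) K).image g1 ∪ (Finset.Icc (-K) K).image g2) (by
      intro x hx
      simp only [Finset.mem_union, Finset.mem_image] at hx
      rcases hx with ⟨k, -, rfl⟩ | ⟨k, -, rfl⟩ <;> simp [g1, g2])
  have hX : ∀ C ∈ 𝒞', ins C ⊆ closedBall 0 R := fun C hC z hz =>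
    hR (by rw [h'.left]; exact Or.inr (mem_iUnion₂.2 ⟨C, hC, hz⟩))
  have key : ∀ f : ℂ → ℝ, (∀ z, |f z| ≤ ‖z‖) → (∀ k ∈ Finset.Icc (-K) K, ∀ C ∈ 𝒞', ∀ p ∈ ins C,
      ∀ q ∈ ins C, f p - k * η ≤ - η → η ≤ f q - k * η → False) →
      ∀ C ∈ 𝒞', ∀ p ∈ ins C, ∀ q ∈ ins C, f q - f p ≤ 3 * η := by
    intro f hf hk C hC p hp q hq
    by_contra! hlt
    set k : ℤ := ⌊f p / η⌋ + 2 with hkd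
    have h1 : (⌊f p / η⌋ : ℝ) * η ≤ f p := by
      rw [← le_div_iff₀ hηp]; exact Int.floor_le _
    have h2 : f p < (⌊f p / η⌋ + 1 : ℝ) * η := by
      rw [← div_lt_iff₀ hηp]; exact Int.lt_floor_add_one _
    have h3 := hX C hC hp
    have h4 := hX C hC hq
    rw [mem_closedBall_zero_iff] at h3 h4
    have h5 := abs_le.1 ((hf p).trans h3)
    have h6 := abs_le.1 ((hf q).trans h4)
    have hkc : (k : ℝ) = ⌊f p / η⌋ + 2 := by rw [hkd]; push_cast; ring
    refine hk k (Finset.mem_Icc.2 ⟨?_, ?_⟩) C hC p hp q hq ?_ ?_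
    · have : (-K : ℝ) * η < k * η := by rw [hkc]; nlinarith
      exact_mod_cast (lt_of_mul_lt_mul_right this hηp.le).le
    · have : (k : ℝ) * η < K * η := by rw [hkc]; nlinarith
      exact_mod_cast (lt_of_mul_lt_mul_right this hηp.le).le
    · rw [hkc]; nlinarith
    · rw [hkc]; nlinarith
  have him := key Complex.im Complex.abs_im_le_norm (by
    intro k hk C hC p hp q hq h1 h2
    refine ht (g1 k) (Finset.mem_union_left _ (Finset.mem_image_of_mem _ hk)) C hC p hp q hq ?_ ?_
    · simpa [g1] using h1
    · simpa [g1] using h2)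
  have hre := key Complex.re Complex.abs_re_le_norm (by
    intro k hk C hC p hp q hq h1 h2
    have hI : ∀ z : ℂ, (z / (-Complex.I)).im = z.re := fun z => by
      rw [div_neg, Complex.div_I]; simp
    refine ht (g2 k) (Finset.mem_union_right _ (Finset.mem_image_of_mem _ hk)) C hC p hp q hq ?_ ?_
    · simp only [g2]
      rw [hI]; simpa using h1
    · simp only [g2]
      rw [hI]; simpa using h2)
  refine ⟨N', χ, 𝒞', h', hr, fun C hC p hp q hq => ?_⟩
  rw [dist_eq_norm]
  refine (Complex.norm_le_abs_re_add_abs_im _).trans ?_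
  have a1 : |(p - q).re| ≤ 3 * η := by
    rw [Complex.sub_re, abs_le]
    constructor <;> linarith [hre C hC p hp q hq, hre C hC q hq p hp]
  have a2 : |(p - q).im| ≤ 3 * η := by
    rw [Complex.sub_im, abs_le]
    constructor <;> linarith [him C hC p hp q hq, him C hC q hq p hp]
  linarith

theorem refine_small₂ (h : Net X Y N φ 𝒞) {ε : ℝ} (hε : 0 < ε) :
    ∃ N' χ 𝒞', Net X Y N' χ 𝒞' ∧ Refines N φ 𝒞 N' χ 𝒞' ∧
      ∀ C ∈ 𝒞', (∀ p ∈ ins C, ∀ q ∈ ins C, dist p q ≤ ε) ∧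
        ∀ p ∈ ins (χ '' C), ∀ q ∈ ins (χ '' C), dist p q ≤ ε := by
  obtain ⟨N₁, φ₁, 𝒞₁, h1, hr1, hs1⟩ := h.refine_small hε
  obtain ⟨M, ψ, 𝒟, hM, hrM, hsM⟩ := h1.inv.refine_small hε
  have hr2 := h1.refines_inv hM hrM
  refine ⟨_, _, _, hM.inv, hr1.trans hr2, ?_⟩
  intro C hC
  refine ⟨?_, ?_⟩
  · obtain ⟨D, hD, hCD, -⟩ := hr2.cell C hC
    exact fun p hp q hq => hs1 D hD p (hCD hp) q (hCD hq)
  · obtain ⟨D, hD, rfl⟩ := hC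
    simp only
    rw [((hM.inj.leftInvOn_invFunOn).mono (hM.sub D hD)).image_image]
    exact hsM D hD

end Net

namespace Net
variable {X Y N : Set ℂ} {φ : ℂ → ℂ} {𝒞 : Set (Set ℂ)}

/-- The union of the products of corresponding closed cells. -/
def rel (φ : ℂ → ℂ) (𝒞 : Set (Set ℂ)) : Set (ℂ × ℂ) :=
  ⋃ C ∈ 𝒞, closure (ins C) ×ˢ closure (ins (φ '' C))

theorem isCompact_rel (h : Net X Y N φ 𝒞) : IsCompact (rel φ 𝒞) :=
  h.fin.isCompact_biUnion fun _ hC => (h.jordan _ hC).isBounded_ins.isCompact_closure.prod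
    (h.jordanR hC).isBounded_ins.isCompact_closure

theorem rel_anti {N' : Set ℂ} {χ : ℂ → ℂ} {𝒞' : Set (Set ℂ)}
    (hr : Refines N φ 𝒞 N' χ 𝒞') : rel χ 𝒞' ⊆ rel φ 𝒞 := by
  refine iUnion₂_subset fun C hC => ?_
  obtain ⟨D, hD, h1, h2⟩ := hr.cell C hC
  exact (prod_mono (closure_mono h1) (closure_mono h2)).trans (subset_iUnion₂_of_subset D hD subset_rfl)

theorem mk_mem_rel (h : Net X Y N φ 𝒞) {z : ℂ} (hz : z ∈ N) : (z, φ z) ∈ rel φ 𝒞 := by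
  obtain ⟨C, hC, hzC⟩ := h.cover hz
  exact mem_iUnion₂.2 ⟨C, hC, (h.jordan C hC).subset_closure_ins hzC,
    (h.jordanR hC).subset_closure_ins (mem_image_of_mem φ hzC)⟩

theorem exists_cellL (h : Net X Y N φ 𝒞) {z : ℂ} (hz : z ∈ X) : ∃ C ∈ 𝒞, z ∈ closure (ins C) := by
  rw [h.left] at hz
  rcases hz with hz | hz
  · obtain ⟨C, hC, hzC⟩ := h.cover hz
    exact ⟨C, hC, (h.jordan C hC).subset_closure_ins hzC⟩
  · obtain ⟨C, hC, hzC⟩ := mem_iUnion₂.1 hz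
    exact ⟨C, hC, subset_closure hzC⟩

theorem exists_rel (h : Net X Y N φ 𝒞) {z : ℂ} (hz : z ∈ X) : ∃ w, (z, w) ∈ rel φ 𝒞 := by
  obtain ⟨C, hC, hzC⟩ := h.exists_cellL hz
  obtain ⟨w, hw⟩ := (h.jordanR hC).ins_nonempty
  exact ⟨w, mem_iUnion₂.2 ⟨C, hC, hzC, subset_closure hw⟩⟩

theorem rel_inv (h : Net X Y N φ 𝒞) {z w : ℂ} :
    (w, z) ∈ rel (Function.invFunOn φ N) ((φ '' ·) '' 𝒞) ↔ (z, w) ∈ rel φ 𝒞 := by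
  have hC : ∀ C ∈ 𝒞, Function.invFunOn φ N '' (φ '' C) = C := fun C hC =>
    (h.inj.leftInvOn_invFunOn.mono (h.sub C hC)).image_image
  simp only [rel, mem_iUnion₂, mem_prod, exists_prop, exists_mem_image]
  constructor
  · rintro ⟨C, hC', h1, h2⟩
    rw [hC C hC'] at h2
    exact ⟨C, hC', h2, h1⟩
  · rintro ⟨C, hC', h1, h2⟩
    rw [← hC C hC'] at h1
    exact ⟨C, hC', h2, h1⟩

theorem subset_of_mem_closure (h : Net X Y N φ 𝒞) {C : Set ℂ} (hC : C ∈ 𝒞) :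
    closure (ins C) ⊆ X := by
  rw [(h.jordan C hC).closure_ins, h.left]
  exact union_subset ((h.sub C hC).trans subset_union_left)
    (fun z hz => Or.inr (mem_iUnion₂.2 ⟨C, hC, hz⟩))

theorem fst_mem (h : Net X Y N φ 𝒞) {x : ℂ × ℂ} (hx : x ∈ rel φ 𝒞) : x.1 ∈ X := by
  obtain ⟨C, hC, h1, -⟩ := mem_iUnion₂.1 hx
  exact h.subset_of_mem_closure hC h1

theorem dist_le (h : Net X Y N φ 𝒞) {ε : ℝ}
    (hε : ∀ C ∈ 𝒞, ∀ p ∈ ins (φ '' C), ∀ q ∈ ins (φ '' C), dist p q ≤ ε) {z w w' : ℂ}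
    (hw : (z, w) ∈ rel φ 𝒞) (hw' : (z, w') ∈ rel φ 𝒞) : dist w w' ≤ ε + ε := by
  have hcl : ∀ C ∈ 𝒞, ∀ p ∈ closure (ins (φ '' C)), ∀ q ∈ closure (ins (φ '' C)), dist p q ≤ ε := by
    intro C hC p hp q hq
    have := closure_prod_eq (s := ins (φ '' C)) (t := ins (φ '' C))
    have hpq : (p, q) ∈ closure (ins (φ '' C) ×ˢ ins (φ '' C)) := this ▸ ⟨hp, hq⟩
    exact closure_minimal (t := {x : ℂ × ℂ | dist x.1 x.2 ≤ ε})
      (fun x hx => hε C hC x.1 hx.1 x.2 hx.2)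
      (isClosed_le (continuous_fst.dist continuous_snd) continuous_const) hpq
  obtain ⟨C, hC, h1, h2⟩ := mem_iUnion₂.1 hw
  obtain ⟨D, hD, h3, h4⟩ := mem_iUnion₂.1 hw'
  by_cases hCD : C = D
  · subst hCD
    have := hcl C hC w h2 w' h4
    linarith [dist_nonneg (x := w) (y := w')]
  · have hdj := h.pairL C hC D hD hCD
    have hz1 : z ∉ ins C := fun hz =>
      disjoint_left.1 (hdj.closure_right (isOpen_ins (h.jordan C hC).isClosed)) hz h3
    have hz2 : z ∉ ins D := fun hz =>
      disjoint_left.1 (hdj.closure_left (isOpen_ins (h.jordan D hD).isClosed)) h1 hz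
    simp only at h1 h3
    rw [(h.jordan C hC).closure_ins] at h1
    rw [(h.jordan D hD).closure_ins] at h3
    have e1 := hcl C hC w h2 _ ((h.jordanR hC).subset_closure_ins
      (mem_image_of_mem φ (h1.resolve_right hz1)))
    have e2 := hcl D hD _ ((h.jordanR hD).subset_closure_ins
      (mem_image_of_mem φ (h3.resolve_right hz2))) w' h4
    exact (dist_triangle w (φ z) w').trans (add_le_add e1 e2)

/-- Nested compact relations with small fibres have a single-valued intersection. -/
theorem exists_limit_fibre {R : ℕ → Set (ℂ × ℂ)} (hR : ∀ n, IsCompact (R n))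
    (hanti : ∀ n, R (n + 1) ⊆ R n) {z : ℂ} (hz : ∀ n, ∃ w, (z, w) ∈ R n) :
    ∃ w, ∀ n, (z, w) ∈ R n := by
  obtain ⟨x, hx⟩ := IsCompact.nonempty_iInter_of_sequence_nonempty_isCompact_isClosed
    (fun n => R n ∩ Prod.fst ⁻¹' {z}) (fun n => inter_subset_inter_left _ (hanti n))
    (fun n => by obtain ⟨w, hw⟩ := hz n; exact ⟨(z, w), hw, rfl⟩)
    ((hR 0).inter_right (isClosed_singleton.preimage continuous_fst))
    (fun n => (hR n).isClosed.inter (isClosed_singleton.preimage continuous_fst))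
  rw [mem_iInter] at hx
  refine ⟨x.2, fun n => ?_⟩
  have := hx n
  rw [← (show x.1 = z from this.2)]; exact this.1

/-- The homeomorphism of the skeleta extends to the cells. -/
theorem exists_extend (h : Net X Y N φ 𝒞) : ∃ Φ : ℂ → ℂ, ContinuousOn Φ X ∧ InjOn Φ X ∧
    Φ '' X = Y ∧ EqOn Φ φ N := by
  let St := {x : Set ℂ × (ℂ → ℂ) × Set (Set ℂ) // Net X Y x.1 x.2.1 x.2.2}
  have hstep : ∀ (n : ℕ) (x : St), ∃ y : St, Refines x.1.1 x.1.2.1 x.1.2.2 y.1.1 y.1.2.1 y.1.2.2 ∧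
      ∀ C ∈ y.1.2.2, (∀ p ∈ ins C, ∀ q ∈ ins C, dist p q ≤ 1 / ((n : ℝ) + 1)) ∧
        ∀ p ∈ ins (y.1.2.1 '' C), ∀ q ∈ ins (y.1.2.1 '' C), dist p q ≤ 1 / ((n : ℝ) + 1) := by
    rintro n ⟨⟨N', χ, 𝒞'⟩, hx⟩
    obtain ⟨N'', χ', 𝒞'', h1, h2, h3⟩ := hx.refine_small₂ (Nat.one_div_pos_of_nat (n := n) (α := ℝ))
    exact ⟨⟨⟨N'', χ', 𝒞''⟩, h1⟩, h2, h3⟩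
  choose nx hnx1 hnx2 using hstep
  let s : ℕ → St := fun n => Nat.rec ⟨⟨N, φ, 𝒞⟩, h⟩ nx n
  have hs0 : s 0 = ⟨⟨N, φ, 𝒞⟩, h⟩ := rfl
  have hss : ∀ n, s (n + 1) = nx n (s n) := fun n => rfl
  let R : ℕ → Set (ℂ × ℂ) := fun n => rel (s n).1.2.1 (s n).1.2.2
  have hRc : ∀ n, IsCompact (R n) := fun n => (s n).2.isCompact_rel
  have hRa : ∀ n, R (n + 1) ⊆ R n := fun n => rel_anti (by rw [hss]; exact hnx1 n (s n))
  have hre : ∀ n, Refines N φ 𝒞 (s n).1.1 (s n).1.2.1 (s n).1.2.2 := by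
    intro n
    induction n with
    | zero => exact Refines.refl N φ 𝒞
    | succ n ih => exact ih.trans (by rw [hss]; exact hnx1 n (s n))
  have hlim : ∀ d : ℝ, (∀ n : ℕ, d ≤ 1 / ((n : ℝ) + 1) + 1 / ((n : ℝ) + 1)) → d ≤ 0 := by
    intro d hd
    have h0 := (tendsto_one_div_add_atTop_nhds_zero_nat (𝕜 := ℝ))
    exact ge_of_tendsto (by simpa using h0.add h0) (Eventually.of_forall hd)
  set G := ⋂ n, R n with hG
  have hGc : IsCompact G := (hRc 0).of_isClosed_subset (isClosed_iInter fun n => (hRc n).isClosed) (iInter_subset R 0)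
  have hu1 : ∀ x ∈ G, ∀ y ∈ G, x.1 = y.1 → x = y := by
    rintro ⟨z, w⟩ hx ⟨z', w'⟩ hy (rfl : z = z')
    rw [hG, mem_iInter] at hx hy
    refine Prod.ext rfl (dist_le_zero.1 (hlim _ fun n => ?_))
    exact (s (n + 1)).2.dist_le (fun C hC => (hnx2 n (s n) C hC).2) (hx (n + 1)) (hy (n + 1))
  have hu2 : ∀ x ∈ G, ∀ y ∈ G, x.2 = y.2 → x = y := by
    rintro ⟨z, w⟩ hx ⟨z', w'⟩ hy (rfl : w = w')
    rw [hG, mem_iInter] at hx hy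
    refine Prod.ext (dist_le_zero.1 (hlim _ fun n => ?_)) rfl
    have hN := (s (n + 1)).2
    refine hN.inv.dist_le ?_ (hN.rel_inv.2 (hx (n + 1))) (hN.rel_inv.2 (hy (n + 1)))
    rintro _ ⟨C, hC, rfl⟩
    simp only [(hN.inj.leftInvOn_invFunOn.mono (hN.sub C hC)).image_image]
    exact (hnx2 n (s n) C hC).1
  have hG1 : Prod.fst '' G = X := by
    refine Subset.antisymm ?_ fun z hz => ?_
    · rintro _ ⟨x, hx, rfl⟩
      exact h.fst_mem (mem_iInter.1 hx 0)
    · obtain ⟨w, hw⟩ := exists_limit_fibre hRc hRa (fun n => (s n).2.exists_rel hz)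
      exact ⟨(z, w), mem_iInter.2 hw, rfl⟩
  have hG2 : Prod.snd '' G = Y := by
    refine Subset.antisymm ?_ fun w hw => ?_
    · rintro _ ⟨x, hx, rfl⟩
      exact h.inv.fst_mem (h.rel_inv.2 (mem_iInter.1 hx 0))
    · obtain ⟨z, hz⟩ := exists_limit_fibre (R := fun n => Prod.swap '' R n) (z := w)
        (fun n => (hRc n).image continuous_swap) (fun n => image_mono (hRa n)) (fun n => by
          obtain ⟨z, hz⟩ := (s n).2.inv.exists_rel hw
          exact ⟨z, (z, w), (s n).2.rel_inv.1 hz, rfl⟩)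
      refine ⟨(z, w), mem_iInter.2 fun n => ?_, rfl⟩
      obtain ⟨⟨a, b⟩, hab, he⟩ := hz n
      obtain ⟨rfl, rfl⟩ := Prod.ext_iff.1 he
      exact hab
  have hi1 : InjOn Prod.fst G := fun x hx y hy => hu1 x hx y hy
  have hl : LeftInvOn (Function.invFunOn Prod.fst G) Prod.fst G := hi1.leftInvOn_invFunOn
  refine ⟨fun z => (Function.invFunOn Prod.fst G z).2, ?_, ?_, ?_, ?_⟩
  · rw [← hG1]
    exact continuous_snd.comp_continuousOn
      (continuousOn_invFunOn hGc continuous_fst.continuousOn hi1)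
  · rw [← hG1]
    rintro _ ⟨x, hx, rfl⟩ _ ⟨y, hy, rfl⟩ hxy
    simp only [hl hx, hl hy] at hxy
    rw [hu2 x hx y hy hxy]
  · rw [← hG1, image_image, ← hG2]
    exact image_congr fun x hx => by simp only [hl hx]
  · intro z hz
    have : (z, φ z) ∈ G := mem_iInter.2 fun n => by
      rw [← (hre n).eqOn hz]
      exact (s n).2.mk_mem_rel ((hre n).sub hz)
    exact congrArg Prod.snd (hl this)

end Net

/-- A self-homeomorphism of a compact set that is the identity off an open subset of the plane
extends by the identity. -/
theorem exists_homeomorph_of_eqOn {X U : Set ℂ} (hX : IsCompact X) (hU : IsOpen U) (hUX : U ⊆ X)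
    {f : ℂ → ℂ} (hf : ContinuousOn f X) (hi : InjOn f X) (hfX : f '' X = X)
    (hid : ∀ z ∈ X \ U, f z = z) : ∃ Φ : ℂ ≃ₜ ℂ, (∀ z ∉ U, Φ z = z) ∧ EqOn Φ f X := by
  classical
  have glue : ∀ f : ℂ → ℂ, ContinuousOn f X → (∀ z ∈ X \ U, f z = z) →
      Continuous (X.piecewise f id) ∧ ∀ z ∉ U, X.piecewise f id z = z := by
    intro f hf hid
    have h1 : ∀ z ∉ U, X.piecewise f id z = z := fun z hz => by
      by_cases hzX : z ∈ X
      · rw [piecewise_eq_of_mem _ _ _ hzX, hid z ⟨hzX, hz⟩]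
      · rw [piecewise_eq_of_notMem _ _ _ hzX, id]
    refine ⟨?_, h1⟩
    rw [← continuousOn_univ, show (univ : Set ℂ) = X ∪ Uᶜ from by
      ext z; by_cases hz : z ∈ U <;> simp [hz, fun h => hUX h]]
    exact (hf.congr (piecewise_eqOn _ _ _)).union_of_isClosed
      (continuousOn_id.congr fun z hz => h1 z hz) hX.isClosed hU.isClosed_compl
  have hl : LeftInvOn (Function.invFunOn f X) f X := hi.leftInvOn_invFunOn
  have hr : ∀ w ∈ X, Function.invFunOn f X w ∈ X ∧ f (Function.invFunOn f X w) = w := by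
    intro w hw
    rw [← hfX] at hw
    obtain ⟨z, hz, rfl⟩ := hw
    rw [hl hz]; exact ⟨hz, rfl⟩
  obtain ⟨c1, e1⟩ := glue f hf hid
  obtain ⟨c2, -⟩ := glue (Function.invFunOn f X)
    (by simpa [hfX] using continuousOn_invFunOn hX hf hi) (fun z hz => by
      conv_lhs => rw [← hid z hz]
      exact hl hz.1)
  have hm : ∀ z ∈ X, f z ∈ X := fun z hz => hfX ▸ mem_image_of_mem f hz
  refine ⟨⟨⟨X.piecewise f id, X.piecewise (Function.invFunOn f X) id, fun z => ?_, fun z => ?_⟩,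
    c1, c2⟩, e1, piecewise_eqOn _ _ _⟩
  · by_cases hz : z ∈ X
    · rw [piecewise_eq_of_mem X f id hz, piecewise_eq_of_mem _ _ _ (hm z hz), hl hz]
    · rw [piecewise_eq_of_notMem X f id hz, id, piecewise_eq_of_notMem _ _ _ hz, id]
  · by_cases hz : z ∈ X
    · rw [piecewise_eq_of_mem X (Function.invFunOn f X) id hz,
        piecewise_eq_of_mem _ _ _ (hr z hz).1, (hr z hz).2]
    · rw [piecewise_eq_of_notMem X (Function.invFunOn f X) id hz, id,
        piecewise_eq_of_notMem _ _ _ hz, id]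

theorem IsJordanCurve.net {J : Set ℂ} (hJ : IsJordanCurve J) :
    Net (J ∪ ins J) (J ∪ ins J) J id {J} where
  fin := finite_singleton J
  compact := hJ.isCompact
  cont := continuousOn_id
  inj := injOn_id J
  jordan := by rintro _ rfl; exact hJ
  sub := by rintro _ rfl; exact subset_rfl
  cover := by rw [sUnion_singleton]
  left := by rw [biUnion_singleton]
  right := by rw [biUnion_singleton, image_id]
  disjL := by rintro _ rfl; exact ins_disjoint _
  disjR := by rintro _ rfl; rw [image_id]; exact ins_disjoint _
  pairL := by rintro _ rfl _ rfl h; exact absurd rfl h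
  pairR := by rintro _ rfl _ rfl h; exact absurd rfl h

/-- A homeomorphism between two crosscuts with the same ends extends to a homeomorphism of the
plane that moves only points inside the curve. -/
theorem IsJordanCurve.exists_homeomorph {J L M : Set ℂ} {a b : ℂ} (h : IsJordanCurve J)
    (hM : IsCrosscut J M a b) (hL : IsCrosscut J L a b) {g : ℂ → ℂ} (hg : ContinuousOn g M)
    (hgi : InjOn g M) (hga : g a = a) (hgb : g b = b) (hgM : g '' M = L) :
    ∃ Φ : ℂ ≃ₜ ℂ, (∀ z ∉ ins J, Φ z = z) ∧ EqOn Φ g M := by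
  obtain ⟨φ, 𝒞, hnet, he, heg⟩ := h.net.split_map (mem_singleton J) hM
    (by simpa using hL) hg hgi hga hgb hgM
  obtain ⟨Φ, h1, h2, h3, h4⟩ := hnet.exists_extend
  have hc : IsCompact (J ∪ ins J) := h.closure_ins ▸ h.isBounded_ins.isCompact_closure
  obtain ⟨Ψ, e1, e2⟩ := exists_homeomorph_of_eqOn hc (isOpen_ins h.isClosed) subset_union_right
    h1 h2 h3 (fun z hz => by
      have hzJ : z ∈ J := hz.1.resolve_right hz.2
      rw [h4 (Or.inl hzJ), he.eqOn hzJ, id])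
  refine ⟨Ψ, e1, fun z hz => ?_⟩
  rw [e2, h4 (Or.inr hz), heg hz]
  rw [hnet.left]
  exact Or.inl (Or.inr hz)

namespace IsPG
variable {V : Set ℂ} {E : Set (Set ℂ)}

theorem mono_edges (h : IsPG V E) {E' : Set (Set ℂ)} (hE : E' ⊆ E) : IsPG V E' :=
  ⟨h.finV, h.finE.subset hE, fun e he => h.arc e (hE he),
    fun e he f hf => h.inter e (hE he) f (hE hf)⟩

theorem inter_carr_erase (h : IsPG V E) {e : Set ℂ} (he : e ∈ E) :
    e ∩ carr V (E \ {e}) ⊆ V := by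
  rintro z ⟨hz, hz' | ⟨f, hf, hzf⟩⟩
  · exact hz'
  · exact h.inter e he f hf.1 (Ne.symm hf.2) ⟨hz, hzf⟩

theorem finComp (h : IsPG V E) : FinComp (carr V E) := by
  obtain ⟨hV, hE, ha, hi⟩ := h
  induction E, hE using Set.Finite.induction_on with
  | empty =>
    have hc := hV.countable.isPathConnected_compl_of_one_lt_rank
      (E := ℂ) (by rw [Complex.rank_real_complex]; norm_num)
    obtain ⟨t, ht, hj⟩ := hc
    refine ⟨{t}, fun z hz => ⟨t, by simp, ?_⟩⟩
    rw [carr, sUnion_empty, union_empty] at hz ⊢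
    exact (hj hz).symm
  | @insert e E heE hE ih =>
    have hPG : IsPG V (insert e E) := ⟨hV, hE.insert e, ha, hi⟩
    have hE' : IsPG V E := hPG.mono_edges (subset_insert e E)
    obtain ⟨a, b, hab, heV⟩ := ha e (Or.inl rfl)
    have := (ih (fun f hf => ha f (Or.inr hf)) (fun f hf g hg => hi f (Or.inr hf) g (Or.inr hg)))
    have h2 := this.union_arc hE'.isCompact hab (by
      rw [← heV]
      refine fun z hz => ⟨hz.2, ?_⟩
      have := hPG.inter_carr_erase (e := e) (Or.inl rfl)
      rw [insert_sdiff_of_mem _ (mem_singleton e), sdiff_singleton_eq_self heE] at this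
      exact this ⟨hz.2, hz.1⟩)
    rwa [carr, sUnion_insert, union_comm e, ← union_assoc]

/-- A face whose closure meets the interior of an edge contains the edge in its closure. -/
theorem subset_closure_face (h : IsPG V E) {e : Set ℂ} (he : e ∈ E) {p z : ℂ}
    (hze : z ∈ e) (hzV : z ∉ V) (hz : z ∈ closure (pathComponentIn (carr V E)ᶜ p)) :
    e ⊆ closure (pathComponentIn (carr V E)ᶜ p) := by
  set F := pathComponentIn (carr V E)ᶜ p with hF
  have hFo : IsOpen F := h.isCompact.isClosed.isOpen_compl.pathComponentIn p
  obtain ⟨a, b, hab, heV⟩ := h.arc e he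
  refine hab.subset_closure_diff.trans (closure_minimal ?_ isClosed_closure)
  rintro w ⟨hwe, hwab⟩
  rw [← heV] at hwab
  have hwV : w ∉ V := fun hw => hwab ⟨hwe, hw⟩
  by_contra hwF
  have hV : ∀ x ∈ e, x ∉ V → x ≠ a ∧ x ≠ b := fun x hx hxV => by
    constructor <;> rintro rfl
    · exact hxV (heV.symm.subset (Or.inl rfl)).2
    · exact hxV (heV.symm.subset (Or.inr rfl)).2
  obtain ⟨e1, e2, h1, h2, h12, hi12⟩ := hab.split hwe (hV w hwe hwV).1 (hV w hwe hwV).2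
  wlog hz1 : z ∈ e1 generalizing a b e1 e2
  · exact this b a hab.symm (by rw [heV, pair_comm]) (fun x hx hxV => (hV x hx hxV).symm) e2 e1
      h2.symm h1.symm (by rw [union_comm, h12]) (by rw [inter_comm, hi12])
      ((h12.symm.subset hze).resolve_left hz1)
  have haV : a ∈ V := (heV.symm.subset (Or.inl rfl)).2
  obtain ⟨m, M, e3, hM, h3, hM3, hiM, hMF⟩ := h2.exists_short
    (U := (closure F)ᶜ) (isClosed_closure.isOpen_compl.mem_nhds hwF)
  have hMe : M ⊆ e := (hM3 ▸ subset_union_left).trans (h12 ▸ subset_union_right)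
  have h3e : e3 ⊆ e := (hM3 ▸ subset_union_right).trans (h12 ▸ subset_union_right)
  have h1e : e1 ⊆ e := h12 ▸ subset_union_left
  have h1M : e1 ∩ M ⊆ {w} := fun x hx => hi12.subset ⟨hx.1, hM3 ▸ Or.inl hx.2⟩
  have h13 : Disjoint e1 e3 := by
    rw [disjoint_left]
    intro x hx hx3
    have : x = w := hi12.subset ⟨hx, hM3 ▸ Or.inr hx3⟩
    subst this
    exact hM.ne (hiM.subset ⟨hM.left_mem, hx3⟩)
  have hdec : carr V E = carr V (E \ {e}) ∪ e3 ∪ e1 ∪ M := by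
    have : carr V E = carr V (E \ {e}) ∪ e := by
      rw [carr, carr, union_assoc, ← sUnion_singleton e, ← sUnion_union, sUnion_singleton,
        sdiff_union_of_subset (singleton_subset_iff.2 he)]
    rw [this, ← h12, ← hM3]
    ac_rfl
  set K := carr V (E \ {e}) ∪ e3 with hK
  have hKc : IsCompact K := (h.mono_edges sdiff_subset).isCompact.union h3.isCompact
  have hKe : ∀ x ∈ e, x ∉ V → x ∉ e3 → x ∉ K := fun x hx hxV hx3 hxK =>
    hxK.elim (fun hc => hxV (h.inter_carr_erase he ⟨hx, hc⟩)) hx3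
  have hK1 : K ∩ e1 = {a} := by
    refine Subset.antisymm (fun x hx => ?_) ?_
    · have hxV : x ∈ V := by
        by_contra hxV
        exact hKe x (h1e hx.2) hxV (disjoint_left.1 h13 hx.2) hx.1
      rcases heV.subset ⟨h1e hx.2, hxV⟩ with hxa | rfl
      · exact hxa
      · exact absurd h3.right_mem (disjoint_left.1 h13 hx.2)
    · rintro _ rfl
      exact ⟨Or.inl (Or.inl haV), h1.left_mem⟩
  have hzK : z ∉ K := hKe z hze hzV (disjoint_left.1 h13 hz1)
  obtain ⟨q, hqM, hq⟩ := (hM.infinite.sdiff (t := {w, m}) (by simp)).nonempty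
  have hq3 : q ∉ e3 := fun hq3 => hq (Or.inr (hiM.subset ⟨hqM, hq3⟩))
  have hq1 : q ∉ e1 := fun hq1 => hq (Or.inl (h1M ⟨hq1, hqM⟩))
  have hqK : q ∉ K := by
    refine hKe q (hMe hqM) (fun hqV => ?_) hq3
    rcases heV.subset ⟨hMe hqM, hqV⟩ with rfl | rfl
    · exact hq1 h1.left_mem
    · exact hq3 h3.right_mem
  have hzq : JoinedIn Kᶜ z q := by
    refine joinedIn_of_isPreconnected hKc.isClosed.isOpen_compl
      (h1.concat hM h1M).isPreconnected_diff ?_ ⟨Or.inl hz1, ?_⟩ ⟨Or.inr hqM, ?_⟩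
    · rintro x ⟨hx, hxn⟩ hxK
      rcases hx with hx | hx
      · exact hxn (Or.inl (hK1.subset ⟨hxK, hx⟩))
      · have hx3 : x ∉ e3 := fun hx3 => hxn (Or.inr (hiM.subset ⟨hx, hx3⟩))
        refine hKe x (hMe hx) (fun hxV => ?_) hx3 hxK
        rcases heV.subset ⟨hMe hx, hxV⟩ with rfl | rfl
        · exact hxn (Or.inl rfl)
        · exact hx3 h3.right_mem
    · rintro (rfl | rfl)
      · exact hzV haV
      · exact disjoint_left.1 h13 hz1 h3.left_mem
    · rintro (rfl | rfl)
      · exact hq1 h1.left_mem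
      · exact hq (Or.inr rfl)
  obtain ⟨p', hp'F, hp'⟩ := mem_closure_iff.1 hz _ (hKc.isClosed.isOpen_compl.pathComponentIn z)
    (mem_pathComponentIn_self hzK) |>.imp fun _ h => h.symm
  have hp'C : p' ∉ carr V E := JoinedIn.notMem_right hp'F
  have hfin := janiszewski hKc h1.isCompact (by rw [hK1]; exact isPreconnected_singleton)
    (JoinedIn.trans (JoinedIn.symm hp') hzq)
    (h1.joinedIn (fun hx => hp'C (hdec ▸ Or.inl (Or.inr hx))) hq1)
  have hsub : pathComponentIn (K ∪ e1)ᶜ p' ⊆ F := by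
    refine (isPreconnected_pathComponentIn p').subset_left_of_subset_union hFo
      isClosed_closure.isOpen_compl (disjoint_compl_right.mono_left subset_closure) ?_
      ⟨p', mem_pathComponentIn_self hfin.mem.1, hp'F⟩
    intro x hx
    by_cases hxF : x ∈ closure F
    · refine Or.inl (mem_pathComponentIn_of_closure h.isCompact.isClosed.isOpen_compl hxF ?_)
      rw [hdec]
      rintro (hx' | hx')
      · exact JoinedIn.notMem_right hx hx'
      · exact hMF hx' hxF
    · exact Or.inr hxF
  exact hMF hqM (subset_closure (hsub hfin))

/-- The simple graph of adjacency through edges, with the vertex `u` removed. -/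
def _root_.adjGraph (E : Set (Set ℂ)) (u : ℂ) : SimpleGraph ℂ where
  Adj a b := a ≠ u ∧ b ≠ u ∧ ∃ e ∈ E, IsArc e a b
  symm := ⟨fun _ _ h => ⟨h.2.1, h.1, h.2.2.imp fun _ h => ⟨h.1, h.2.symm⟩⟩⟩
  loopless := ⟨fun _ h => by obtain ⟨-, -, e, -, h⟩ := h; exact h.ne rfl⟩

/-- If removing the vertex `u` disconnects a plane graph, some face has vertices of different
components on its boundary. -/
theorem exists_face (h : IsPG V E) {u a b : ℂ} (hu : u ∈ V) (ha : a ∈ V \ {u}) (hb : b ∈ V \ {u})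
    (hab : ¬ (adjGraph E u).Reachable a b) :
    ∃ a' ∈ V \ {u}, ∃ b' ∈ V \ {u}, ¬ (adjGraph E u).Reachable a' b' ∧ ∃ p ∉ carr V E,
      a' ∈ closure (pathComponentIn (carr V E)ᶜ p) ∧
      b' ∈ closure (pathComponentIn (carr V E)ᶜ p) := by
  classical
  by_contra! hcon
  have hKc := h.isCompact.isClosed
  set K := carr V E with hK
  set V1 := {v ∈ V \ {u} | (adjGraph E u).Reachable a v} with hV1
  set V2 := {v ∈ V \ {u} | ¬ (adjGraph E u).Reachable a v} with hV2
  have hVV : V ⊆ insert u (V1 ∪ V2) := fun v hv => by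
    by_cases hvu : v = u
    · exact Or.inl hvu
    · by_cases hr : (adjGraph E u).Reachable a v
      exacts [Or.inr (Or.inl ⟨⟨hv, hvu⟩, hr⟩), Or.inr (Or.inr ⟨⟨hv, hvu⟩, hr⟩)]
  have hV12 : Disjoint V1 V2 := disjoint_left.2 fun v h1 h2 => h2.2 h1.2
  have hu1 : u ∉ V1 := fun h => h.1.2 rfl
  have hu2 : u ∉ V2 := fun h => h.1.2 rfl
  obtain ⟨T, hT⟩ := h.finComp
  let F : ℂ → Set ℂ := fun p => pathComponentIn Kᶜ p
  have hno : ∀ p ∉ K, ∀ v1 ∈ V1, ∀ v2 ∈ V2, v1 ∈ closure (F p) → v2 ∉ closure (F p) := by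
    intro p hp v1 h1 v2 h2 hc
    refine hcon v1 h1.1 v2 h2.1 (fun hr => h2.2 (h1.2.trans hr)) p hp hc
  have hedge : ∀ e ∈ E, ∀ v1 ∈ V1, ∀ v2 ∈ V2, v1 ∈ e → v2 ∉ e := by
    intro e he v1 h1 v2 h2 hv1 hv2
    obtain ⟨c, d, hcd, heV⟩ := h.arc e he
    have m1 : v1 ∈ ({c, d} : Set ℂ) := heV ▸ ⟨hv1, h1.1.1⟩
    have m2 : v2 ∈ ({c, d} : Set ℂ) := heV ▸ ⟨hv2, h2.1.1⟩
    have hne : v1 ≠ v2 := fun hh => disjoint_left.1 hV12 h1 (hh ▸ h2)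
    have harc : IsArc e v1 v2 := by
      rcases m1 with rfl | rfl <;> rcases m2 with rfl | rfl
      exacts [absurd rfl hne, hcd, hcd.symm, absurd rfl hne]
    exact h2.2 (h1.2.trans (SimpleGraph.Adj.reachable ⟨h1.1.2, h2.1.2, e, he, harc⟩))
  -- the part of the plane attached to a set of vertices
  let P : Set ℂ → Set ℂ := fun W => W ∪ ⋃₀ {e ∈ E | (e ∩ W).Nonempty} ∪
    ⋃ t ∈ {t ∈ (T : Set ℂ) | t ∉ K ∧ (closure (F t) ∩ W).Nonempty}, closure (F t)
  have hPc : ∀ W, W ⊆ V → IsClosed (P W) := fun W hW => by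
    refine ((h.finV.subset hW).isClosed.union ?_).union ?_
    · rw [sUnion_eq_biUnion]
      refine (h.finE.subset (sep_subset _ _)).isClosed_biUnion ?_
      rintro e ⟨he, -⟩
      obtain ⟨c, d, hcd, -⟩ := h.arc e he
      exact hcd.isClosed
    · exact (T.finite_toSet.subset (sep_subset _ _)).isClosed_biUnion fun _ _ => isClosed_closure
  have hconn : IsPreconnected ({u}ᶜ : Set ℂ) :=
    (isConnected_compl_singleton_of_one_lt_rank
      (by rw [Complex.rank_real_complex]; norm_num) u).isPreconnected
  have haV1 : a ∈ V1 := ⟨ha, SimpleGraph.Reachable.refl _⟩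
  have hbV2 : b ∈ V2 := ⟨hb, hab⟩
  have hend : ∀ e ∈ E, ∃ v ∈ e, v ∈ V1 ∪ V2 := by
    intro e he
    obtain ⟨c, d, hcd, heV⟩ := h.arc e he
    by_cases hcu : c = u
    · refine ⟨d, hcd.right_mem, (hVV (heV.symm.subset (Or.inr rfl)).2).resolve_left ?_⟩
      rintro rfl
      exact hcd.ne hcu
    · exact ⟨c, hcd.left_mem, (hVV (heV.symm.subset (Or.inl rfl)).2).resolve_left hcu⟩
  have hface : ∀ t ∉ K, ∃ v ∈ V1 ∪ V2, v ∈ closure (F t) := by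
    intro t ht
    by_contra! hv
    have hFo : IsOpen (F t) := hKc.isOpen_compl.pathComponentIn t
    have hcl : ∀ z, z ≠ u → z ∈ closure (F t) → z ∈ F t := by
      intro z hzu hz
      refine mem_pathComponentIn_of_closure hKc.isOpen_compl hz ?_
      have hzV : z ∉ V := fun hzV => hv z ((hVV hzV).resolve_left hzu) hz
      rintro (hzV' | ⟨e, he, hze⟩)
      · exact hzV hzV'
      · obtain ⟨v, hve, hv'⟩ := hend e he
        exact hv v hv' (h.subset_closure_face he hze hzV hz hve)
    have hsub : ({u}ᶜ : Set ℂ) ⊆ F t := by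
      refine hconn.subset_left_of_subset_union hFo isClosed_closure.isOpen_compl
        (disjoint_compl_right.mono_left subset_closure) (fun z hz => ?_)
        ⟨t, ?_, mem_pathComponentIn_self ht⟩
      · by_cases hz' : z ∈ closure (F t)
        exacts [Or.inl (hcl z hz hz'), Or.inr hz']
      · rintro rfl
        exact ht (Or.inl hu)
    exact JoinedIn.notMem_right (hsub ha.2) (Or.inl ha.1)
  have hcov : ∀ z, z ≠ u → z ∈ P V1 ∪ P V2 := by
    intro z hzu
    by_cases hzK : z ∈ K
    · rcases hzK with hzV | ⟨e, he, hze⟩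
      · exact ((hVV hzV).resolve_left hzu).imp (fun h => Or.inl (Or.inl h))
          (fun h => Or.inl (Or.inl h))
      · obtain ⟨v, hve, hv⟩ := hend e he
        exact hv.imp (fun h => Or.inl (Or.inr ⟨e, ⟨he, v, hve, h⟩, hze⟩))
          (fun h => Or.inl (Or.inr ⟨e, ⟨he, v, hve, h⟩, hze⟩))
    · obtain ⟨t, ht, hzt⟩ := hT z hzK
      have htK : t ∉ K := JoinedIn.notMem_right hzt
      obtain ⟨v, hv, hvt⟩ := hface t htK
      have hz : z ∈ closure (F t) := subset_closure (JoinedIn.symm hzt)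
      exact hv.imp (fun h => Or.inr (mem_biUnion ⟨ht, htK, v, hvt, h⟩ hz))
          (fun h => Or.inr (mem_biUnion ⟨ht, htK, v, hvt, h⟩ hz))
  have key : ∀ W W' : Set ℂ, W ⊆ V → V1 ∪ V2 ⊆ W ∪ W' →
      (∀ p ∉ K, ∀ v ∈ W, ∀ v' ∈ W', v ∈ closure (F p) → v' ∉ closure (F p)) →
      (∀ e ∈ E, ∀ v ∈ W, ∀ v' ∈ W', v ∈ e → v' ∉ e) → Disjoint W W' → ∀ z, z ≠ u → z ∈ P W →
      (z ∈ V → z ∈ W) ∧ (∀ e ∈ E, z ∈ e → z ∉ V → ∃ v ∈ W, v ∈ e) ∧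
      (z ∉ K → ∃ v ∈ W, v ∈ closure (F z)) := by
    intro W W' hWV h21 hno hedge hd z hzu hz
    refine ⟨fun hzV => ?_, fun e he hze hzV => ?_, fun hzK => ?_⟩
    · refine (h21 ((hVV hzV).resolve_left hzu)).resolve_right fun hzW' => ?_
      rcases hz with (hz | ⟨e, ⟨he, v, hve, hv⟩, hze⟩) | hz
      · exact disjoint_left.1 hd hz hzW'
      · exact hedge e he v hv z hzW' hve hze
      · obtain ⟨t, ⟨-, ht, v, hvt, hv⟩, hzt⟩ := mem_iUnion₂.1 hz
        exact hno t ht v hv z hzW' hvt hzt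
    · rcases hz with (hz | ⟨f, ⟨hf, v, hvf, hv⟩, hzf⟩) | hz
      · exact absurd (hWV hz) hzV
      · have hfe : f = e := by
          by_contra hfe
          exact hzV (h.inter f hf e he hfe ⟨hzf, hze⟩)
        exact ⟨v, hv, hfe ▸ hvf⟩
      · obtain ⟨t, ⟨-, ht, v, hvt, hv⟩, hzt⟩ := mem_iUnion₂.1 hz
        obtain ⟨v', hve, hv'⟩ := hend e he
        refine ⟨v', (h21 hv').resolve_right fun h' => ?_, hve⟩
        exact hno t ht v hv v' h' hvt (h.subset_closure_face he hze hzV hzt hve)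
    · rcases hz with (hz | ⟨f, ⟨hf, v, hvf, hv⟩, hzf⟩) | hz
      · exact absurd (Or.inl (hWV hz)) hzK
      · exact absurd (Or.inr ⟨f, hf, hzf⟩) hzK
      · obtain ⟨t, ⟨-, ht, v, hvt, hv⟩, hzt⟩ := mem_iUnion₂.1 hz
        have hzF : z ∈ F t := mem_pathComponentIn_of_closure hKc.isOpen_compl hzt hzK
        refine ⟨v, hv, ?_⟩
        have : F z = F t := pathComponentIn_congr hzF
        rwa [this]
  have hinc : ∀ z, z ≠ u → z ∈ P V1 → z ∉ P V2 := by
    intro z hzu hz1 hz2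
    obtain ⟨a1, a2, a3⟩ := key V1 V2 (fun v hv => hv.1.1) Subset.rfl hno hedge hV12 z hzu hz1
    obtain ⟨b1, b2, b3⟩ := key V2 V1 (fun v hv => hv.1.1) (union_comm V1 V2).subset
      (fun p hp v hv v' hv' h1 h2 => hno p hp v' hv' v hv h2 h1)
      (fun p hp v hv v' hv' h1 h2 => hedge p hp v' hv' v hv h2 h1) hV12.symm z hzu hz2
    by_cases hzV : z ∈ V
    · exact disjoint_left.1 hV12 (a1 hzV) (b1 hzV)
    by_cases hzK : z ∈ K
    · obtain ⟨e, he, hze⟩ := hzK.resolve_left hzV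
      obtain ⟨v, hv, hve⟩ := a2 e he hze hzV
      obtain ⟨w, hw, hwe⟩ := b2 e he hze hzV
      exact hedge e he v hv w hw hve hwe
    · obtain ⟨v, hv, hve⟩ := a3 hzK
      obtain ⟨w, hw, hwe⟩ := b3 hzK
      exact hno z hzK v hv w hw hve hwe
  obtain ⟨z, hz, h1, h2⟩ := isPreconnected_closed_iff.1 hconn _ _ (hPc V1 fun v hv => hv.1.1)
    (hPc V2 fun v hv => hv.1.1) (fun z hz => hcov z hz)
    ⟨a, ha.2, Or.inl (Or.inl haV1)⟩ ⟨b, hb.2, Or.inl (Or.inl hbV2)⟩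
  exact hinc z hz h1 h2

end IsPG

theorem IsPG.insert_arc {V : Set ℂ} {E : Set (Set ℂ)} (h : IsPG V E) {L : Set ℂ} {a b : ℂ}
    (hL : IsArc L a b) (ha : a ∈ V) (hb : b ∈ V) (hd : L \ {a, b} ⊆ (carr V E)ᶜ) :
    IsPG V (insert L E) := by
  have hLV : L ∩ carr V E ⊆ {a, b} := fun z hz => by
    by_contra hzab
    exact hd ⟨hz.1, hzab⟩ hz.2
  have hab : {a, b} ⊆ V := insert_subset ha (singleton_subset_iff.2 hb)
  refine ⟨h.finV, h.finE.insert L, ?_, ?_⟩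
  · rintro e (rfl | he)
    · refine ⟨a, b, hL, Subset.antisymm (fun z hz => hLV ⟨hz.1, Or.inl hz.2⟩) ?_⟩
      rintro z (rfl | rfl)
      exacts [⟨hL.left_mem, ha⟩, ⟨hL.right_mem, hb⟩]
    · exact h.arc e he
  · rintro e (rfl | he) f (rfl | hf) hef z ⟨hze, hzf⟩
    · exact absurd rfl hef
    · exact hab (hLV ⟨hze, Or.inr ⟨f, hf, hzf⟩⟩)
    · exact hab (hLV ⟨hzf, Or.inr ⟨e, he, hze⟩⟩)
    · exact h.inter e he f hf hef ⟨hze, hzf⟩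

theorem adjGraph_mono {E E' : Set (Set ℂ)} (hE : E ⊆ E') (u : ℂ) :
    adjGraph E u ≤ adjGraph E' u :=
  fun _ _ h => ⟨h.1, h.2.1, h.2.2.imp fun _ h => ⟨hE h.1, h.2⟩⟩

/-- A plane graph inside a disc can be enlarged inside the disc so that removing any vertex does
not disconnect it. -/
theorem IsPG.exists_enlargement {V : Set ℂ} {E : Set (Set ℂ)} (h : IsPG V E) {R : ℝ} {p q : ℂ}
    {A B : Set ℂ} (hA : IsArc A p q) (hAE : A ∈ E) (hBE : B ∈ E) (hAB : A ∪ B = sphere 0 R)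
    (hV : V ∩ sphere 0 R ⊆ {p, q}) (hK : carr V E ⊆ closedBall 0 R) :
    ∃ E', E ⊆ E' ∧ IsPG V E' ∧ carr V E' ⊆ closedBall 0 R ∧
      ∀ u ∈ V, ∀ a ∈ V \ {u}, ∀ b ∈ V \ {u}, (adjGraph E' u).Reachable a b := by
  let bad : Set (Set ℂ) → Set (ℂ × ℂ × ℂ) := fun E' =>
    {t ∈ V ×ˢ (V ×ˢ V) | t.2.1 ≠ t.1 ∧ t.2.2 ≠ t.1 ∧ ¬ (adjGraph E' t.1).Reachable t.2.1 t.2.2}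
  have hfin : ∀ E', (bad E').Finite := fun E' =>
    (h.finV.prod (h.finV.prod h.finV)).subset (sep_subset _ _)
  let C : Set (Set (Set ℂ)) := {E' | E ⊆ E' ∧ IsPG V E' ∧ carr V E' ⊆ closedBall 0 R}
  obtain ⟨E', ⟨hEE, hPG, hK'⟩, hmin⟩ : ∃ E' ∈ C, ∀ E'' ∈ C, (bad E').ncard ≤ (bad E'').ncard := by
    obtain ⟨E', hE', hm⟩ := (InvImage.wf (fun E' => (bad E').ncard) (wellFounded_lt (α := ℕ))).has_min
      C ⟨E, Subset.rfl, h, hK⟩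
    exact ⟨E', hE', fun E'' hE'' => not_lt.1 (hm E'' hE'')⟩
  refine ⟨E', hEE, hPG, hK', ?_⟩
  by_contra! hcon
  obtain ⟨u, hu, a, ha, b, hb, hab⟩ := hcon
  obtain ⟨a, ha, b, hb, hab, x, hx, hxa, hxb⟩ := hPG.exists_face hu ha hb hab
  have hne : a ≠ b := by rintro rfl; exact hab (SimpleGraph.Reachable.refl _)
  have hsK : sphere 0 R ⊆ carr V E' := by
    rw [← hAB]
    exact union_subset (fun z hz => Or.inr ⟨A, hEE hAE, hz⟩) (fun z hz => Or.inr ⟨B, hEE hBE, hz⟩)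
  set F := pathComponentIn (carr V E')ᶜ x with hF
  have hFs : F ⊆ ball 0 R ∪ (closedBall 0 R)ᶜ := fun z hz => by
    have hz' : z ∉ sphere 0 R := fun hz' => JoinedIn.notMem_right hz (hsK hz')
    rw [mem_sphere] at hz'
    rcases lt_or_gt_of_ne hz' with h | h
    exacts [Or.inl h, Or.inr (by simpa using h)]
  have hdis : Disjoint (ball (0 : ℂ) R) (closedBall 0 R)ᶜ :=
    disjoint_compl_right.mono_left ball_subset_closedBall
  have hFb : F ⊆ ball 0 R := by
    have hxF : x ∈ F := mem_pathComponentIn_self hx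
    rcases hFs hxF with hxb' | hxo
    · exact (isPreconnected_pathComponentIn x).subset_left_of_subset_union isOpen_ball
        isClosed_closedBall.isOpen_compl hdis hFs ⟨x, hxF, hxb'⟩
    · exfalso
      have hFo : F ⊆ (closedBall 0 R)ᶜ := (isPreconnected_pathComponentIn x).subset_right_of_subset_union
        isOpen_ball isClosed_closedBall.isOpen_compl hdis hFs ⟨x, hxF, hxo⟩
      have hcl : closure F ⊆ (ball 0 R)ᶜ := closure_minimal
        (hFo.trans (compl_subset_compl.2 ball_subset_closedBall)) isOpen_ball.isClosed_compl
      have hpq : ∀ c ∈ V, c ∈ closure F → c ∈ ({p, q} : Set ℂ) := fun c hc hcF => by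
        have h1 := hcl hcF
        have h2 := hK' (Or.inl hc)
        refine hV ⟨hc, ?_⟩
        rw [mem_compl_iff, mem_ball, not_lt] at h1
        exact le_antisymm h2 h1
      have harc : IsArc A a b := by
        rcases hpq a ha.1 hxa with rfl | rfl <;> rcases hpq b hb.1 hxb with rfl | rfl
        exacts [absurd rfl hne, hA, hA.symm, absurd rfl hne]
      exact hab (SimpleGraph.Adj.reachable ⟨ha.2, hb.2, A, hEE hAE, harc⟩)
  obtain ⟨L, hL, hLF⟩ := hPG.exists_isArc_face ha.1 hb.1 hne hx hxa hxb
  have hPG' : IsPG V (insert L E') := hPG.insert_arc hL ha.1 hb.1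
    (hLF.trans fun z hz => JoinedIn.notMem_right hz)
  have hmem : insert L E' ∈ C := by
    refine ⟨hEE.trans (subset_insert _ _), hPG', ?_⟩
    rw [carr, sUnion_insert]
    rintro z (hz | hz | hz)
    · exact hK' (Or.inl hz)
    · by_cases hzab : z ∈ ({a, b} : Set ℂ)
      · rcases hzab with rfl | rfl
        exacts [hK' (Or.inl ha.1), hK' (Or.inl hb.1)]
      · exact ball_subset_closedBall (hFb (hLF ⟨hz, hzab⟩))
    · exact hK' (Or.inr hz)
  refine (hmin _ hmem).not_gt (ncard_lt_ncard ?_ (hfin _))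
  refine ⟨fun t ht => ⟨ht.1, ht.2.1, ht.2.2.1, fun hr => ht.2.2.2
    (hr.mono (adjGraph_mono (subset_insert _ _) _))⟩, fun hsub => ?_⟩
  have := @hsub (u, a, b) ⟨⟨hu, ha.1, hb.1⟩, ha.2, hb.2, hab⟩
  exact this.2.2.2 (SimpleGraph.Adj.reachable ⟨ha.2, hb.2, L, Or.inl rfl, hL⟩)

/-- The graph of a function of the height. -/
def gr (f : ℝ → ℝ) (s t : ℝ) : Set ℂ := {z | z.im ∈ Icc s t ∧ z.re = f z.im}

theorem gr_eq_image (f : ℝ → ℝ) (s t : ℝ) :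
    gr f s t = (fun y : ℝ => (⟨f y, y⟩ : ℂ)) '' Icc s t := by
  ext z
  constructor
  · rintro ⟨h1, h2⟩
    exact ⟨z.im, h1, Complex.ext h2.symm rfl⟩
  · rintro ⟨y, hy, rfl⟩
    exact ⟨hy, rfl⟩

theorem gr_mono {f g : ℝ → ℝ} {s t s' t' : ℝ} (hs : s ≤ s') (ht : t' ≤ t)
    (hfg : ∀ y ∈ Icc s' t', f y = g y) : gr f s' t' ⊆ gr g s t :=
  fun z hz => ⟨⟨hs.trans hz.1.1, hz.1.2.trans ht⟩, hz.2.trans (hfg _ hz.1)⟩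

theorem isArc_gr {f : ℝ → ℝ} {s t : ℝ} (hst : s < t) (hf : Continuous f) :
    IsArc (gr f s t) ⟨f s, s⟩ ⟨f t, t⟩ := by
  rw [gr_eq_image]
  refine isArc_image hst (Continuous.continuousOn ?_) fun x _ y _ h => congrArg Complex.im h
  have : (fun y : ℝ => (⟨f y, y⟩ : ℂ)) = fun y : ℝ => (f y : ℂ) + y * Complex.I := by
    ext y; apply Complex.ext <;> simp
  rw [this]; fun_prop

/-- A lens: a region bounded by two graphs that only meet at the two tips. -/
structure IsLens (l r : ℝ → ℝ) (s t : ℝ) : Prop where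
  lt : s < t
  contl : Continuous l
  contr : Continuous r
  bot : l s = r s
  top : l t = r t
  sep : ∀ y ∈ Ioo s t, l y < r y

/-- The interior of a lens. -/
def lens (l r : ℝ → ℝ) (s t : ℝ) : Set ℂ := {z | z.im ∈ Ioo s t ∧ l z.im < z.re ∧ z.re < r z.im}

namespace IsLens
variable {l r : ℝ → ℝ} {s t : ℝ}

theorem le (h : IsLens l r s t) {y : ℝ} (hy : y ∈ Icc s t) : l y ≤ r y := by
  rcases eq_or_lt_of_le hy.1 with rfl | h1
  · exact h.bot.le
  rcases eq_or_lt_of_le hy.2 with rfl | h2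
  · exact h.top.le
  exact (h.sep y ⟨h1, h2⟩).le

theorem isTwoArc (h : IsLens l r s t) :
    IsTwoArc (gr l s t ∪ gr r s t) (gr l s t) (gr r s t) ⟨l s, s⟩ ⟨l t, t⟩ where
  left := isArc_gr h.lt h.contl
  right := by
    have := isArc_gr h.lt h.contr
    rwa [← h.bot, ← h.top] at this
  inter := by
    ext z
    constructor
    · rintro ⟨⟨⟨h1, h2⟩, h3⟩, -, h4⟩
      rcases eq_or_lt_of_le h1 with h5 | h5
      · exact Or.inl (Complex.ext (by rw [h3, ← h5]) h5.symm)
      rcases eq_or_lt_of_le h2 with h6 | h6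
      · exact Or.inr (Complex.ext (by rw [h3, h6]) h6)
      · exact absurd (h3.symm.trans h4) (h.sep _ ⟨h5, h6⟩).ne
    · rintro (rfl | rfl)
      · exact ⟨⟨left_mem_Icc.2 h.lt.le, rfl⟩, left_mem_Icc.2 h.lt.le, h.bot⟩
      · exact ⟨⟨right_mem_Icc.2 h.lt.le, rfl⟩, right_mem_Icc.2 h.lt.le, h.top⟩
  union := rfl

theorem isOpen (h : IsLens l r s t) : IsOpen (lens l r s t) := by
  have h1 := h.contl.comp Complex.continuous_im
  have h2 := h.contr.comp Complex.continuous_im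
  exact (isOpen_Ioo.preimage Complex.continuous_im).inter
    ((isOpen_lt h1 Complex.continuous_re).inter (isOpen_lt Complex.continuous_re h2))

theorem disjoint (h : IsLens l r s t) : Disjoint (lens l r s t) (gr l s t ∪ gr r s t) := by
  rw [disjoint_left]
  rintro z ⟨-, h1, h2⟩ (⟨-, h3⟩ | ⟨-, h3⟩)
  · exact h1.ne' h3
  · exact h2.ne h3

theorem union_eq (h : IsLens l r s t) : lens l r s t ∪ (gr l s t ∪ gr r s t) =
    {z | z.im ∈ Icc s t ∧ l z.im ≤ z.re ∧ z.re ≤ r z.im} := by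
  ext z
  constructor
  · rintro (⟨h1, h2, h3⟩ | ⟨h1, h2⟩ | ⟨h1, h2⟩)
    · exact ⟨Ioo_subset_Icc_self h1, h2.le, h3.le⟩
    · exact ⟨h1, h2.ge, h2.trans_le (h.le h1)⟩
    · exact ⟨h1, (h.le h1).trans h2.ge, h2.le⟩
  · rintro ⟨h1, h2, h3⟩
    by_cases h4 : z.re = l z.im
    · exact Or.inr (Or.inl ⟨h1, h4⟩)
    by_cases h5 : z.re = r z.im
    · exact Or.inr (Or.inr ⟨h1, h5⟩)
    have h6 := lt_of_le_of_ne h2 (Ne.symm h4)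
    have h7 := lt_of_le_of_ne h3 h5
    refine Or.inl ⟨⟨lt_of_le_of_ne h1.1 ?_, lt_of_le_of_ne h1.2 ?_⟩, h6, h7⟩
    · intro hs
      rw [← hs] at h6 h7
      exact (h6.trans h7).ne h.bot
    · intro hs
      rw [hs] at h6 h7
      exact (h6.trans h7).ne h.top

theorem isClosed_union (h : IsLens l r s t) :
    IsClosed (lens l r s t ∪ (gr l s t ∪ gr r s t)) := by
  rw [h.union_eq]
  have h1 := h.contl.comp Complex.continuous_im
  have h2 := h.contr.comp Complex.continuous_im
  exact (isClosed_Icc.preimage Complex.continuous_im).inter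
    ((isClosed_le h1 Complex.continuous_re).inter (isClosed_le Complex.continuous_re h2))

theorem isBounded (h : IsLens l r s t) : Bornology.IsBounded (lens l r s t) := by
  obtain ⟨a, ha⟩ := (isCompact_Icc (a := s) (b := t)).bddBelow_image h.contl.continuousOn
  obtain ⟨b, hb⟩ := (isCompact_Icc (a := s) (b := t)).bddAbove_image h.contr.continuousOn
  refine (isBounded_Icc (a := a) (b := b) |>.reProdIm (isBounded_Icc (a := s) (b := t))).subset ?_
  rintro z ⟨h1, h2, h3⟩
  have hmem := Ioo_subset_Icc_self h1
  exact ⟨⟨(ha (mem_image_of_mem l hmem)).trans h2.le, h3.le.trans (hb (mem_image_of_mem r hmem))⟩, hmem⟩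

/-- A connected set disjoint from the boundary of a lens that meets the lens is inside it. -/
theorem subset_of_isPreconnected (h : IsLens l r s t) {S : Set ℂ} (hS : IsPreconnected S)
    (hd : Disjoint S (gr l s t ∪ gr r s t)) (hne : (S ∩ lens l r s t).Nonempty) :
    S ⊆ lens l r s t := by
  refine hS.subset_left_of_subset_union h.isOpen h.isClosed_union.isOpen_compl
    (disjoint_compl_right.mono_left subset_union_left) (fun z hz => ?_) hne
  by_cases hz' : z ∈ lens l r s t
  · exact Or.inl hz'
  · refine Or.inr fun h => h.elim hz' (disjoint_left.1 hd hz)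

theorem ins_eq (h : IsLens l r s t) : ins (gr l s t ∪ gr r s t) = lens l r s t := by
  have hsub : lens l r s t ⊆ ins (gr l s t ∪ gr r s t) := fun z hz => by
    have hzJ : z ∉ gr l s t ∪ gr r s t := disjoint_left.1 h.disjoint hz
    refine ⟨hzJ, h.isBounded.subset (h.subset_of_isPreconnected
      (isPreconnected_pathComponentIn z) ?_ ⟨z, mem_pathComponentIn_self hzJ, hz⟩)⟩
    exact disjoint_left.2 fun w hw => JoinedIn.notMem_right hw
  refine Subset.antisymm (h.subset_of_isPreconnected h.isTwoArc.isPreconnected_ins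
    (ins_disjoint _) ?_) hsub
  have hm : (s + t) / 2 ∈ Ioo s t := ⟨by linarith [h.lt], by linarith [h.lt]⟩
  have h1 := h.sep _ hm
  have : (⟨(l ((s + t) / 2) + r ((s + t) / 2)) / 2, (s + t) / 2⟩ : ℂ) ∈ lens l r s t :=
    ⟨hm, by show _ < _ / 2; linarith, by show _ / 2 < _; linarith⟩
  exact ⟨_, hsub this, this⟩

theorem isPreconnected (h : IsLens l r s t) : IsPreconnected (lens l r s t) :=
  h.ins_eq ▸ h.isTwoArc.isPreconnected_ins

end IsLens

theorem exists_interp {l r ca cb : ℝ → ℝ} (hl : Continuous l) (hr : Continuous r)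
    (hca : ca = l ∨ ca = r) (hcb : cb = l ∨ cb = r) {ya yb : ℝ} (hab : ya < yb) :
    ∃ m : ℝ → ℝ, Continuous m ∧ (∀ y ≤ ya, m y = ca y) ∧ (∀ y, yb ≤ y → m y = cb y) ∧
      ∀ y ∈ Ioo ya yb, l y < r y → l y < m y ∧ m y < r y := by
  obtain ⟨a, ha, hca⟩ : ∃ a : ℝ, (a = 0 ∨ a = 1) ∧ ∀ y, ca y = l y + a * (r y - l y) := by
    rcases hca with rfl | rfl
    exacts [⟨0, Or.inl rfl, fun y => by ring⟩, ⟨1, Or.inr rfl, fun y => by ring⟩]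
  obtain ⟨b, hb, hcb⟩ : ∃ b : ℝ, (b = 0 ∨ b = 1) ∧ ∀ y, cb y = l y + b * (r y - l y) := by
    rcases hcb with rfl | rfl
    exacts [⟨0, Or.inl rfl, fun y => by ring⟩, ⟨1, Or.inr rfl, fun y => by ring⟩]
  have hd : 0 < yb - ya := sub_pos.2 hab
  let v : ℝ → ℝ := fun y => max 0 (min 1 ((y - ya) / (yb - ya)))
  have hv : Continuous v := by fun_prop
  refine ⟨fun y => l y + ((1 - v y) ^ 2 * a + v y * (1 - v y) + v y ^ 2 * b) * (r y - l y),
    by fun_prop, fun y hy => ?_, fun y hy => ?_, fun y hy hlr => ?_⟩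
  · have : v y = 0 := max_eq_left ((min_le_right _ _).trans
      (div_nonpos_of_nonpos_of_nonneg (sub_nonpos.2 hy) hd.le))
    beta_reduce; rw [this, hca]; ring
  · have : v y = 1 := by
      have : 1 ≤ (y - ya) / (yb - ya) := by rw [le_div_iff₀ hd]; linarith
      show max 0 (min 1 _) = _
      rw [min_eq_left this, max_eq_right zero_le_one]
    beta_reduce; rw [this, hcb]; ring
  · have h0 : 0 < v y := lt_max_of_lt_right (lt_min zero_lt_one (div_pos (sub_pos.2 hy.1) hd))
    have h1 : v y < 1 := max_lt zero_lt_one (min_lt_of_right_lt (by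
      rw [div_lt_one hd]; linarith [hy.2]))
    have h2 : 0 < v y * (1 - v y) := mul_pos h0 (sub_pos.2 h1)
    have h3 : 0 ≤ (1 - v y) ^ 2 := sq_nonneg _
    have h4 : 0 ≤ v y ^ 2 := sq_nonneg _
    have hr' : 0 < r y - l y := sub_pos.2 hlr
    have h5 : 0 < (1 - v y) ^ 2 * a + v y * (1 - v y) + v y ^ 2 * b := by
      rcases ha with rfl | rfl <;> rcases hb with rfl | rfl <;> nlinarith
    have h6 : (1 - v y) ^ 2 * a + v y * (1 - v y) + v y ^ 2 * b < 1 := by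
      rcases ha with rfl | rfl <;> rcases hb with rfl | rfl <;> nlinarith
    constructor
    · show _ < _ + _
      nlinarith [mul_pos h5 hr']
    · show _ + _ < _
      nlinarith [mul_pos (sub_pos.2 h6) hr']

namespace IsLens
variable {l r m : ℝ → ℝ} {s t ya yb : ℝ}

theorem neg (h : IsLens l r s t) : IsLens (fun y => -r y) (fun y => -l y) s t :=
  ⟨h.lt, h.contr.neg, h.contl.neg, by rw [h.bot], by rw [h.top], fun y hy => neg_lt_neg (h.sep y hy)⟩

theorem exists_left (h : IsLens l r s t) (hm : Continuous m) (hab : ya < yb) (hs : s ≤ ya)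
    (ht : yb ≤ t) (ha : (∀ y ≤ ya, m y = l y) ∨ ∀ y ≤ ya, m y = r y)
    (hb : (∀ y, yb ≤ y → m y = l y) ∨ ∀ y, yb ≤ y → m y = r y)
    (hmid : ∀ y ∈ Ioo ya yb, l y < m y) :
    ∃ s' t', s ≤ s' ∧ t' ≤ t ∧ IsLens l m s' t' ∧ ∀ y ∈ Ioo s t, l y < m y → y ∈ Ioo s' t' := by
  obtain ⟨s', h1, h2, h3, h4, h5⟩ : ∃ s', s ≤ s' ∧ s' ≤ ya ∧ l s' = m s' ∧
      (∀ y ∈ Ioo s t, y ≤ ya → s' < y → l y < m y) ∧ ∀ y ∈ Ioo s t, l y < m y → s' < y := by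
    rcases ha with ha | ha
    · refine ⟨ya, hs, le_rfl, (ha _ le_rfl).symm, fun y _ h1 h2 => absurd h2 h1.not_gt,
        fun y _ h1 => ?_⟩
      by_contra! h2
      exact h1.ne (ha y h2).symm
    · exact ⟨s, le_rfl, hs, h.bot.trans (ha s hs).symm, fun y hy h1 h2 => (h.sep y hy).trans_eq
        (ha y h1).symm, fun y hy _ => hy.1⟩
  obtain ⟨t', k1, k2, k3, k4, k5⟩ : ∃ t', t' ≤ t ∧ yb ≤ t' ∧ l t' = m t' ∧
      (∀ y ∈ Ioo s t, yb ≤ y → y < t' → l y < m y) ∧ ∀ y ∈ Ioo s t, l y < m y → y < t' := by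
    rcases hb with hb | hb
    · refine ⟨yb, ht, le_rfl, (hb _ le_rfl).symm, fun y _ h1 h2 => absurd h2 h1.not_gt,
        fun y _ h1 => ?_⟩
      by_contra! h2
      exact h1.ne (hb y h2).symm
    · exact ⟨t, le_rfl, ht, h.top.trans (hb t ht).symm, fun y hy h1 h2 => (h.sep y hy).trans_eq
        (hb y h1).symm, fun y hy _ => hy.2⟩
  refine ⟨s', t', h1, k1, ⟨by linarith, h.contl, hm, h3, k3, fun y hy => ?_⟩,
    fun y hy hlm => ⟨h5 y hy hlm, k5 y hy hlm⟩⟩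
  have hy' : y ∈ Ioo s t := ⟨h1.trans_lt hy.1, hy.2.trans_le k1⟩
  rcases le_or_gt y ya with h6 | h6
  · exact h4 y hy' h6 hy.1
  rcases le_or_gt yb y with h7 | h7
  · exact k4 y hy' h7 hy.2
  exact hmid y ⟨h6, h7⟩

theorem exists_right (h : IsLens l r s t) (hm : Continuous m) (hab : ya < yb) (hs : s ≤ ya)
    (ht : yb ≤ t) (ha : (∀ y ≤ ya, m y = l y) ∨ ∀ y ≤ ya, m y = r y)
    (hb : (∀ y, yb ≤ y → m y = l y) ∨ ∀ y, yb ≤ y → m y = r y)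
    (hmid : ∀ y ∈ Ioo ya yb, m y < r y) :
    ∃ s' t', s ≤ s' ∧ t' ≤ t ∧ IsLens m r s' t' ∧ ∀ y ∈ Ioo s t, m y < r y → y ∈ Ioo s' t' := by
  obtain ⟨s', t', h1, h2, h3, h4⟩ := h.neg.exists_left hm.neg hab hs ht
    (ha.symm.imp (fun h y hy => congrArg Neg.neg (h y hy)) (fun h y hy => congrArg Neg.neg (h y hy)))
    (hb.symm.imp (fun h y hy => congrArg Neg.neg (h y hy)) (fun h y hy => congrArg Neg.neg (h y hy)))
    (fun y hy => neg_lt_neg (hmid y hy))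
  refine ⟨s', t', h1, h2, ?_, fun y hy h => h4 y hy (neg_lt_neg h)⟩
  simpa using h3.neg

end IsLens

/-- A set meeting the disc in a union of lenses. -/
def HasLenses (X : Set ℂ) (R : ℝ) : Prop :=
  ∀ z ∈ ball (0 : ℂ) R, z ∉ X → ∃ l r s t, IsLens l r s t ∧ gr l s t ∪ gr r s t ⊆ X ∧
    Disjoint (lens l r s t) X ∧ z ∈ lens l r s t

/-- Cutting a lens along a graph preserves the decomposition into lenses. -/
theorem HasLenses.union_gr {X : Set ℂ} {R : ℝ} (hX : HasLenses X R) {l r m : ℝ → ℝ}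
    {s t ya yb : ℝ} (h : IsLens l r s t) (hJ : gr l s t ∪ gr r s t ⊆ X)
    (hd : Disjoint (lens l r s t) X) (hm : Continuous m) (hab : ya < yb) (hs : s ≤ ya)
    (ht : yb ≤ t) (ha : (∀ y ≤ ya, m y = l y) ∨ ∀ y ≤ ya, m y = r y)
    (hb : (∀ y, yb ≤ y → m y = l y) ∨ ∀ y, yb ≤ y → m y = r y)
    (hmid : ∀ y ∈ Ioo ya yb, l y < m y ∧ m y < r y) : HasLenses (X ∪ gr m ya yb) R := by
  have hgm : ∀ s' t', s ≤ s' → t' ≤ t → gr m s' t' ⊆ X ∪ gr m ya yb := by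
    rintro s' t' hs' ht' z ⟨⟨h1, h2⟩, h3⟩
    have h4 : z.im ∈ Icc s t := ⟨hs'.trans h1, h2.trans ht'⟩
    rcases le_or_gt z.im ya with h6 | h6
    · exact Or.inl (hJ (ha.imp (fun h => ⟨h4, h3.trans (h _ h6)⟩) (fun h => ⟨h4, h3.trans (h _ h6)⟩)))
    rcases le_or_gt yb z.im with h7 | h7
    · exact Or.inl (hJ (hb.imp (fun h => ⟨h4, h3.trans (h _ h7)⟩) (fun h => ⟨h4, h3.trans (h _ h7)⟩)))
    exact Or.inr ⟨⟨h6.le, h7.le⟩, h3⟩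
  have hmle : ∀ y, l y ≤ r y → l y ≤ m y ∧ m y ≤ r y := fun y hy => by
    rcases le_or_gt y ya with h6 | h6
    · rcases ha with ha | ha <;> rw [ha y h6]
      exacts [⟨le_rfl, hy⟩, ⟨hy, le_rfl⟩]
    rcases le_or_gt yb y with h7 | h7
    · rcases hb with ha | ha <;> rw [ha y h7]
      exacts [⟨le_rfl, hy⟩, ⟨hy, le_rfl⟩]
    exact ⟨(hmid y ⟨h6, h7⟩).1.le, (hmid y ⟨h6, h7⟩).2.le⟩
  have hM : gr m ya yb ⊆ lens l r s t ∪ X := by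
    rw [← union_eq_self_of_subset_left hJ, ← union_assoc, h.union_eq]
    refine fun z hz => Or.inl ?_
    have h4 : z.im ∈ Icc s t := ⟨hs.trans hz.1.1, hz.1.2.trans ht⟩
    refine ⟨h4, ?_⟩
    rw [hz.2]
    exact hmle _ (h.le h4)
  intro z hz hzX
  have hzm : z ∉ gr m ya yb := fun h => hzX (Or.inr h)
  by_cases hzl : z ∈ lens l r s t
  · rcases lt_trichotomy z.re (m z.im) with hlt | heq | hgt
    · obtain ⟨s', t', h1, h2, h3, h4⟩ := h.exists_left hm hab hs ht ha hb fun y hy => (hmid y hy).1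
      refine ⟨l, m, s', t', h3, union_subset ?_ (hgm _ _ h1 h2), ?_,
        h4 _ hzl.1 (hzl.2.1.trans hlt), hzl.2.1, hlt⟩
      · exact (gr_mono h1 h2 fun _ _ => rfl).trans
          (subset_union_left.trans (hJ.trans subset_union_left))
      · rw [disjoint_left]
        rintro w ⟨w1, w2, w3⟩ (hw | hw)
        · have hwi : w.im ∈ Ioo s t := ⟨h1.trans_lt w1.1, w1.2.trans_le h2⟩
          exact disjoint_left.1 hd ⟨hwi, w2, w3.trans_le (hmle _ (h.sep _ hwi).le).2⟩ hw
        · exact w3.ne hw.2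
    · exact absurd (hgm s t le_rfl le_rfl ⟨Ioo_subset_Icc_self hzl.1, heq⟩) hzX
    · obtain ⟨s', t', h1, h2, h3, h4⟩ := h.exists_right hm hab hs ht ha hb fun y hy => (hmid y hy).2
      refine ⟨m, r, s', t', h3, union_subset (hgm _ _ h1 h2) ?_, ?_,
        h4 _ hzl.1 (hgt.trans hzl.2.2), hgt, hzl.2.2⟩
      · exact (gr_mono h1 h2 fun _ _ => rfl).trans
          (subset_union_right.trans (hJ.trans subset_union_left))
      · rw [disjoint_left]
        rintro w ⟨w1, w2, w3⟩ (hw | hw)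
        · have hwi : w.im ∈ Ioo s t := ⟨h1.trans_lt w1.1, w1.2.trans_le h2⟩
          exact disjoint_left.1 hd ⟨hwi, (hmle _ (h.sep _ hwi).le).1.trans_lt w2, w3⟩ hw
        · exact w2.ne' hw.2
  · obtain ⟨l₂, r₂, s₂, t₂, k1, k2, k3, k4⟩ := hX z hz fun h => hzX (Or.inl h)
    refine ⟨l₂, r₂, s₂, t₂, k1, k2.trans subset_union_left, ?_, k4⟩
    rw [disjoint_union_right]
    refine ⟨k3, disjoint_left.2 fun w hw hwm => ?_⟩
    have hwl : w ∈ lens l r s t := (hM hwm).resolve_right (disjoint_left.1 k3 hw)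
    exact hzl (h.subset_of_isPreconnected k1.isPreconnected (k3.mono_right hJ) ⟨w, hw, hwl⟩ k4)

/-- Only finitely many powers reparametrise an arc so that a given point gets a given height. -/
theorem exists_pow_avoid {γ : ℝ → ℂ} (hγ : InjOn γ (Icc 0 1)) {B : Set ℝ} {W : Set ℂ}
    (hB : B.Finite) (hBI : B ⊆ Icc 0 1) (hW : W.Finite) (h0 : γ 0 ∉ W) (h1 : γ 1 ∉ W) :
    ∃ k : ℕ, k ≠ 0 ∧ ∀ b ∈ B, γ (b ^ k) ∉ W := by
  have hfin : (⋃ b ∈ B, ⋃ w ∈ W, {k : ℕ | k ≠ 0 ∧ γ (b ^ k) = w}).Finite := by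
    refine hB.biUnion fun b hb => hW.biUnion fun w hw => Subsingleton.finite ?_
    rintro k ⟨hk, hkw⟩ k' ⟨hk', hkw'⟩
    obtain ⟨hb0, hb1⟩ := hBI hb
    have hI : ∀ j : ℕ, b ^ j ∈ Icc (0 : ℝ) 1 := fun j => ⟨pow_nonneg hb0 j, pow_le_one₀ hb0 hb1⟩
    have heq : b ^ k = b ^ k' := hγ (hI k) (hI k') (hkw.trans hkw'.symm)
    have hb0' : 0 < b := lt_of_le_of_ne hb0 fun h => by
      rw [← h, zero_pow hk] at hkw
      exact h0 (hkw ▸ hw)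
    have hb1' : b < 1 := lt_of_le_of_ne hb1 fun h => by
      rw [h, one_pow] at hkw
      exact h1 (hkw ▸ hw)
    exact pow_right_injective₀ hb0' hb1'.ne heq
  obtain ⟨k, hk, hk'⟩ := ((infinite_univ (α := ℕ)).sdiff (hfin.union (finite_singleton 0))).nonempty
  refine ⟨k, fun h => hk' (Or.inr h), fun b hb hw => hk' (Or.inl ?_)⟩
  exact mem_biUnion hb (mem_biUnion hw ⟨fun h => hk' (Or.inr h), rfl⟩)

/-- A crosscut of a lens between boundary points of different heights can be straightened. -/
theorem HasLenses.exists_straighten {V X L : Set ℂ} {R : ℝ} (hX : HasLenses X R)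
    (hsX : sphere 0 R ⊆ X) (hV : V.Finite) (hi : InjOn Complex.im (V ∩ X)) {u t : ℂ}
    (hL : IsArc L u t) (hu : u ∈ V ∩ X) (ht : t ∈ V ∩ X) (hLX : L ∩ X = {u, t})
    (hLR : L ⊆ closedBall 0 R) (hXc : IsClosed X) :
    ∃ Φ : ℂ ≃ₜ ℂ, (∀ z ∉ ball 0 R, Φ z = z) ∧ (∀ z ∈ X, Φ z = z) ∧ InjOn Complex.im (Φ '' L) ∧
      InjOn Complex.im (Φ '' (V ∩ (X ∪ L))) ∧ HasLenses (X ∪ Φ '' L) R := by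
  wlog hut : u.im < t.im generalizing u t
  · have hne : t.im ≠ u.im := fun h => hL.ne (hi hu ht h.symm)
    exact this hL.symm ht hu (by rw [hLX, pair_comm]) (lt_of_le_of_ne (not_lt.1 hut) hne)
  set S := L \ {u, t} with hS
  have hSX : Disjoint S X := disjoint_left.2 fun z hz hzX => hz.2 (hLX.subset ⟨hz.1, hzX⟩)
  have hSR : S ⊆ ball 0 R := fun z hz => by
    have h1 := hLR hz.1
    exact lt_of_le_of_ne h1 fun h => disjoint_left.1 hSX hz (hsX h)
  obtain ⟨z₀, hz₀⟩ : S.Nonempty := (hL.infinite.sdiff (t := {u, t}) (by simp)).nonempty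
  obtain ⟨l, r, s, t', hl, hJX, hd, hz₀l⟩ := hX z₀ (hSR hz₀) (disjoint_left.1 hSX hz₀)
  set J := gr l s t' ∪ gr r s t' with hJ
  have hJc : IsJordanCurve J := ⟨_, _, _, _, hl.isTwoArc⟩
  have hSl : S ⊆ lens l r s t' := hl.subset_of_isPreconnected hL.isPreconnected_diff
    (hSX.mono_right hJX) ⟨z₀, hz₀, hz₀l⟩
  have hLcl : L ⊆ J ∪ lens l r s t' := by
    rw [← hl.ins_eq, ← hJc.closure_ins, hl.ins_eq]
    exact hL.subset_closure_diff.trans (closure_mono hSl)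
  have hJm : ∀ z ∈ L, z ∈ X → z ∈ J := fun z hz hzX =>
    (hLcl hz).resolve_right fun h => disjoint_left.1 hd h hzX
  have huJ := hJm u hL.left_mem hu.2
  have htJ := hJm t hL.right_mem ht.2
  have hcL : IsCrosscut J L u t := ⟨hL, huJ, htJ, by rwa [hl.ins_eq]⟩
  have hlR : lens l r s t' ⊆ ball 0 R := by
    have hbd : lens l r s t' ⊆ ball 0 R ∪ (closedBall 0 R)ᶜ := fun z hz => by
      have hz' : z ∉ sphere 0 R := fun h => disjoint_left.1 hd hz (hsX h)
      rw [mem_sphere] at hz'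
      rcases lt_or_gt_of_ne hz' with h | h
      exacts [Or.inl h, Or.inr (by simpa using h)]
    exact hl.isPreconnected.subset_left_of_subset_union isOpen_ball
        isClosed_closedBall.isOpen_compl (disjoint_compl_right.mono_left ball_subset_closedBall)
        hbd ⟨z₀, hz₀l, hSR hz₀⟩
  have hside : ∀ z ∈ J, ∃ c : ℝ → ℝ, (c = l ∨ c = r) ∧ z.im ∈ Icc s t' ∧ c z.im = z.re := by
    rintro z (h | h)
    exacts [⟨l, Or.inl rfl, h.1, h.2.symm⟩, ⟨r, Or.inr rfl, h.1, h.2.symm⟩]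
  obtain ⟨ca, hca, hua, hcau⟩ := hside u huJ
  obtain ⟨cb, hcb, htb, hcbt⟩ := hside t htJ
  obtain ⟨m, hm, hma, hmb, hmid⟩ := exists_interp hl.contl hl.contr hca hcb hut
  have hmid' : ∀ y ∈ Ioo u.im t.im, l y < m y ∧ m y < r y := fun y hy =>
    hmid y hy (hl.sep y ⟨hua.1.trans_lt hy.1, hy.2.trans_le htb.2⟩)
  set M := gr m u.im t.im with hM
  have hmu : m u.im = u.re := (hma _ le_rfl).trans hcau
  have hmt : m t.im = t.re := (hmb _ le_rfl).trans hcbt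
  have hMa : IsArc M u t := by
    have := isArc_gr hut hm
    rwa [hmu, hmt] at this
  have hMinj : InjOn Complex.im M := fun z hz w hw h =>
    Complex.ext (by rw [hz.2, hw.2, h]) h
  have hcM : IsCrosscut J M u t := by
    refine ⟨hMa, huJ, htJ, fun z hz => ?_⟩
    rw [hl.ins_eq]
    have h1 : z.im ∈ Ioo u.im t.im := by
      refine ⟨lt_of_le_of_ne hz.1.1.1 fun h => hz.2 (Or.inl ?_),
        lt_of_le_of_ne hz.1.1.2 fun h => hz.2 (Or.inr ?_)⟩
      · exact hMinj hz.1 hMa.left_mem h.symm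
      · exact hMinj hz.1 hMa.right_mem h
    have h2 := hmid' _ h1
    rw [← hz.1.2] at h2
    exact ⟨⟨hua.1.trans_lt h1.1, h1.2.trans_le htb.2⟩, h2⟩
  obtain ⟨γ, hγc, hγi, hγ0, hγ1, hγL⟩ := id hL
  have hd' : 0 < t.im - u.im := sub_pos.2 hut
  let ν : ℝ → ℝ := fun y => (y - u.im) / (t.im - u.im)
  have hνI : ∀ y ∈ Icc u.im t.im, ν y ∈ Icc (0 : ℝ) 1 := fun y hy =>
    ⟨div_nonneg (sub_nonneg.2 hy.1) hd'.le, by rw [div_le_one hd']; linarith [hy.2]⟩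
  obtain ⟨k, hk, hav⟩ := exists_pow_avoid hγi (B := ν '' (Complex.im '' (V ∩ X) ∩ Icc u.im t.im))
    (W := V ∩ S) (((hV.inter_of_left _).image _).inter_of_left _ |>.image _)
    (by rintro _ ⟨y, hy, rfl⟩; exact hνI y hy.2) (hV.inter_of_left _)
    (by rw [hγ0]; exact fun h => h.2.2 (Or.inl rfl)) (by rw [hγ1]; exact fun h => h.2.2 (Or.inr rfl))
  let g : ℂ → ℂ := fun z => γ (ν z.im ^ k)
  have hpI : ∀ x ∈ Icc (0 : ℝ) 1, x ^ k ∈ Icc (0 : ℝ) 1 := fun x hx =>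
    ⟨pow_nonneg hx.1 k, pow_le_one₀ hx.1 hx.2⟩
  have hgI : ∀ z ∈ M, ν z.im ^ k ∈ Icc (0 : ℝ) 1 := fun z hz => hpI _ (hνI _ hz.1)
  have hgc : ContinuousOn g M := hγc.comp (Continuous.continuousOn (by fun_prop)) hgI
  have hgi : InjOn g M := fun z hz w hw h => by
    have h1 := hγi (hgI z hz) (hgI w hw) h
    have h2 := (pow_left_inj₀ (hνI _ hz.1).1 (hνI _ hw.1).1 hk).1 h1
    exact hMinj hz hw (by
      have := (div_left_inj' hd'.ne').1 h2
      linarith)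
  have hgu : g u = u := by
    show γ (((u.im - u.im) / _) ^ k) = u
    rw [sub_self, zero_div, zero_pow hk, hγ0]
  have hgt : g t = t := by
    show γ (((t.im - u.im) / _) ^ k) = t
    rw [div_self hd'.ne', one_pow, hγ1]
  have hgM : g '' M = L := by
    refine Subset.antisymm ?_ ?_
    · rintro _ ⟨z, hz, rfl⟩
      rw [← hγL]
      exact mem_image_of_mem γ (hgI z hz)
    · intro w hw
      rw [← hγL] at hw
      obtain ⟨τ, hτ, rfl⟩ := hw
      obtain ⟨x, hx, hxτ⟩ : τ ∈ (fun x : ℝ => x ^ k) '' Icc 0 1 := by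
        refine intermediate_value_Icc zero_le_one (by fun_prop) ?_
        simpa [hk] using hτ
      have hy : u.im + x * (t.im - u.im) ∈ Icc u.im t.im :=
        ⟨by nlinarith [hx.1], by nlinarith [hx.2]⟩
      refine ⟨⟨m (u.im + x * (t.im - u.im)), u.im + x * (t.im - u.im)⟩, ⟨hy, rfl⟩, ?_⟩
      show γ (((u.im + x * (t.im - u.im) - u.im) / (t.im - u.im)) ^ k) = _
      rw [add_sub_cancel_left, mul_div_cancel_right₀ _ hd'.ne']
      exact congrArg γ hxτ
  obtain ⟨Ψ, hΨ, hΨg⟩ := hJc.exists_homeomorph hcM hcL hgc hgi hgu hgt hgM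
  rw [hl.ins_eq] at hΨ
  have hfix : ∀ z ∉ lens l r s t', Ψ.symm z = z := fun z hz => by
    rw [Homeomorph.symm_apply_eq, hΨ z hz]
  have hLM : Ψ.symm '' L = M := by
    rw [← hgM, ← hΨg.image_eq, ← image_comp]
    simp
  have hfixX : ∀ z ∈ X, Ψ.symm z = z := fun z hz => hfix z fun h => disjoint_left.1 hd h hz
  refine ⟨Ψ.symm, fun z hz => hfix z fun h => hz (hlR h), hfixX, hLM ▸ hMinj, ?_, ?_⟩
  · have hmem : ∀ z ∈ Ψ.symm '' (V ∩ (X ∪ L)), z ∈ V ∩ X ∨ (z ∈ M ∧ g z ∈ V ∩ S) := by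
      rintro _ ⟨w, ⟨hwV, hw⟩, rfl⟩
      by_cases hwX : w ∈ X
      · rw [hfixX w hwX]
        exact Or.inl ⟨hwV, hwX⟩
      · have hwL := hw.resolve_left hwX
        have hwM : Ψ.symm w ∈ M := hLM ▸ mem_image_of_mem _ hwL
        refine Or.inr ⟨hwM, ?_⟩
        rw [← hΨg hwM, Homeomorph.apply_symm_apply]
        refine ⟨hwV, hwL, ?_⟩
        rintro (rfl | rfl)
        exacts [hwX hu.2, hwX ht.2]
    have hmix : ∀ z ∈ V ∩ X, ∀ w ∈ M, g w ∈ V ∩ S → z.im ≠ w.im := by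
      intro z hz w hw hgw h
      exact hav _ ⟨w.im, ⟨⟨z, hz, h⟩, hw.1⟩, rfl⟩ hgw
    intro z hz w hw h
    rcases hmem z hz with h1 | h1 <;> rcases hmem w hw with h2 | h2
    · exact hi h1 h2 h
    · exact absurd h (hmix z h1 w h2.1 h2.2)
    · exact absurd h.symm (hmix w h2 z h1.1 h1.2)
    · exact hMinj h1.1 h2.1 h
  · rw [hLM]
    refine hX.union_gr hl hJX hd hm hut hua.1 htb.2 ?_ ?_ hmid'
    · rcases hca with rfl | rfl
      exacts [Or.inl hma, Or.inr hma]
    · rcases hcb with rfl | rfl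
      exacts [Or.inl hmb, Or.inr hmb]

theorem IsArc.end_mem {A : Set ℂ} {a b c d : ℂ} (h : IsArc A a b) (h' : IsArc A c d) :
    c ∈ ({a, b} : Set ℂ) := by
  by_contra hc
  rw [mem_insert_iff, mem_singleton_iff, not_or] at hc
  obtain ⟨A1, A2, h1, h2, h3, h4⟩ := h.split h'.left_mem hc.1 hc.2
  obtain ⟨z, hz, hz1, hz2⟩ := isPreconnected_closed_iff.1 h'.isPreconnected_diff_left A1 A2
    h1.isClosed h2.isClosed (by rw [h3]; exact sdiff_subset)
    ⟨a, ⟨h.left_mem, Ne.symm hc.1⟩, h1.left_mem⟩ ⟨b, ⟨h.right_mem, Ne.symm hc.2⟩, h2.right_mem⟩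
  exact hz.2 (h4.subset ⟨hz1, hz2⟩)

namespace IsPG
variable {V : Set ℂ} {E : Set (Set ℂ)}

theorem inter_eq (h : IsPG V E) {e : Set ℂ} (he : e ∈ E) {a b : ℂ} (hab : IsArc e a b) :
    e ∩ V = {a, b} := by
  obtain ⟨c, d, hcd, heV⟩ := h.arc e he
  rw [heV]
  have h1 := hcd.end_mem hab
  have h2 := hcd.end_mem hab.symm
  rcases h1 with rfl | rfl <;> rcases h2 with rfl | rfl
  exacts [absurd rfl hab.ne, rfl, pair_comm _ _, absurd rfl hab.ne]

theorem exists_arc_of_isPath (h : IsPG V E) {u x t : ℂ} (p : (adjGraph E u).Walk x t)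
    (hp : p.IsPath) (hxt : x ≠ t) :
    ∃ EL ⊆ E, IsArc (⋃₀ EL) x t ∧ ⋃₀ EL ∩ V = {v | v ∈ p.support} := by
  induction p with
  | nil => exact absurd rfl hxt
  | @cons x y t hadj p ih =>
    have hadj' := hadj.2.2
    obtain ⟨f, hf, hxy⟩ := hadj'
    have hfV := h.inter_eq hf hxy
    rw [SimpleGraph.Walk.cons_isPath_iff] at hp
    by_cases hyt : y = t
    · subst hyt
      have : p = SimpleGraph.Walk.nil := SimpleGraph.Walk.isPath_iff_nil.1 hp.1 |>.eq_nil
      subst this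
      refine ⟨{f}, singleton_subset_iff.2 hf, by rwa [sUnion_singleton], ?_⟩
      rw [sUnion_singleton, hfV]
      ext; simp
    · obtain ⟨EL, hEL, harc, hV⟩ := ih hp.1 hyt
      have hfE : f ∉ EL := fun hfE => hp.2 (hV.subset ⟨⟨f, hfE, hxy.left_mem⟩,
        (hfV.symm.subset (Or.inl rfl)).2⟩)
      refine ⟨insert f EL, insert_subset hf hEL, ?_, ?_⟩
      · rw [sUnion_insert]
        refine hxy.concat harc ?_
        rintro z ⟨hzf, g, hg, hzg⟩
        have hzV : z ∈ V := h.inter f hf g (hEL hg) (fun h => hfE (h ▸ hg)) ⟨hzf, hzg⟩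
        rcases hfV.subset ⟨hzf, hzV⟩ with rfl | hz
        · exact absurd (hV.subset ⟨⟨g, hg, hzg⟩, hzV⟩) hp.2
        · exact hz
      · rw [sUnion_insert, union_inter_distrib_right, hfV, hV]
        ext z
        simp only [SimpleGraph.Walk.support_cons, List.mem_cons, mem_union, mem_insert_iff,
          mem_singleton_iff, mem_ofPred_eq]
        constructor
        · rintro ((h | rfl) | h)
          exacts [Or.inl h, Or.inr p.start_mem_support, Or.inr h]
        · rintro (h | h)
          exacts [Or.inl (Or.inl h), Or.inr h]

end IsPG

theorem SimpleGraph.Walk.exists_path_first {α : Type*} {G : SimpleGraph α} {S : Set α} {x y : α}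
    (p : G.Walk x y) (hy : y ∈ S) :
    ∃ t ∈ S, ∃ q : G.Walk x t, q.IsPath ∧ ∀ v ∈ q.support, v ∈ S → v = t := by
  classical
  induction p with
  | nil => exact ⟨_, hy, SimpleGraph.Walk.nil, SimpleGraph.Walk.IsPath.nil, by simp⟩
  | @cons x z y hadj p ih =>
    by_cases hx : x ∈ S
    · exact ⟨x, hx, SimpleGraph.Walk.nil, SimpleGraph.Walk.IsPath.nil, by simp⟩
    · obtain ⟨t, ht, q, -, hq⟩ := ih hy
      refine ⟨t, ht, (SimpleGraph.Walk.cons hadj q).bypass, SimpleGraph.Walk.bypass_isPath _,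
        fun v hv hvS => ?_⟩
      have := SimpleGraph.Walk.support_bypass_subset_support _ hv
      rw [SimpleGraph.Walk.support_cons, List.mem_cons] at this
      rcases this with rfl | h
      exacts [absurd hvS hx, hq v h hvS]

theorem adjGraph_support_ne {E : Set (Set ℂ)} {u x t : ℂ} (p : (adjGraph E u).Walk x t)
    (hx : x ≠ u) : ∀ v ∈ p.support, v ≠ u := by
  induction p with
  | nil => simpa using hx
  | cons hadj p ih =>
    intro v hv
    rw [SimpleGraph.Walk.support_cons, List.mem_cons] at hv
    rcases hv with rfl | hv
    exacts [hx, ih hadj.2.1 v hv]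

/-- A proper subgraph of a 2-connected plane graph has an ear. -/
theorem IsPG.exists_ear {V : Set ℂ} {E E' : Set (Set ℂ)} (h : IsPG V E) (hE' : E' ⊆ E)
    (hne : E' ≠ E)
    (h2 : ∀ u ∈ V, ∀ a ∈ V \ {u}, ∀ b ∈ V \ {u}, (adjGraph E u).Reachable a b) {p q : ℂ}
    (hpq : p ≠ q) (hp : p ∈ V ∩ ⋃₀ E') (hq : q ∈ V ∩ ⋃₀ E') :
    ∃ EL ⊆ E, ∃ u t, IsArc (⋃₀ EL) u t ∧ u ∈ V ∩ ⋃₀ E' ∧ t ∈ V ∩ ⋃₀ E' ∧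
      ⋃₀ EL ∩ ⋃₀ E' = {u, t} ∧ ∃ e ∈ EL, e ∉ E' := by
  obtain ⟨e₀, he₀, he₀'⟩ : ∃ e ∈ E, e ∉ E' := by
    by_contra! hc
    exact hne (hE'.antisymm hc)
  obtain ⟨a, b, hab, habV⟩ := h.arc e₀ he₀
  have hints : ∀ e ∈ E, e ∉ E' → ∀ z ∈ e, z ∈ ⋃₀ E' → z ∈ V := fun e he he' z hz ⟨g, hg, hzg⟩ =>
    h.inter e he g (hE' hg) (fun h => he' (h ▸ hg)) ⟨hz, hzg⟩
  have haV := (habV.symm.subset (Or.inl rfl)).2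
  have hbV := (habV.symm.subset (Or.inr rfl)).2
  by_cases hboth : a ∈ ⋃₀ E' ∧ b ∈ ⋃₀ E'
  · refine ⟨{e₀}, singleton_subset_iff.2 he₀, a, b, by rwa [sUnion_singleton], ⟨haV, hboth.1⟩,
      ⟨hbV, hboth.2⟩, ?_, e₀, rfl, he₀'⟩
    rw [sUnion_singleton]
    refine Subset.antisymm (fun z hz => habV.subset ⟨hz.1, hints e₀ he₀ he₀' z hz.1 hz.2⟩) ?_
    rintro z (rfl | rfl)
    exacts [⟨hab.left_mem, hboth.1⟩, ⟨hab.right_mem, hboth.2⟩]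
  obtain ⟨w₀, hw₀V, hw₀⟩ : ∃ w ∈ V, w ∉ ⋃₀ E' := by
    by_cases ha : a ∈ ⋃₀ E'
    exacts [⟨b, hbV, fun hb => hboth ⟨ha, hb⟩⟩, ⟨a, haV, ha⟩]
  obtain ⟨W⟩ := h2 q hq.1 p ⟨hp.1, hpq⟩ w₀ ⟨hw₀V, fun h => hw₀ (h ▸ hq.2)⟩
  obtain ⟨⟨⟨u, w⟩, hadj⟩, -, hu, hw⟩ := W.exists_boundary_dart (⋃₀ E') hp.2 hw₀
  obtain ⟨e, he, huw⟩ := hadj.2.2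
  dsimp only at hu hw huw
  have heV := h.inter_eq he huw
  have huV : u ∈ V := (heV.symm.subset (Or.inl rfl)).2
  have hwV : w ∈ V := (heV.symm.subset (Or.inr rfl)).2
  have he' : e ∉ E' := fun he' => hw ⟨e, he', huw.right_mem⟩
  obtain ⟨y, hy, hyu⟩ : ∃ y ∈ V ∩ ⋃₀ E', y ≠ u := by
    by_cases hpu : p = u
    exacts [⟨q, hq, fun h => hpq (hpu.trans h.symm)⟩, ⟨p, hp, hpu⟩]
  obtain ⟨W'⟩ := h2 u huV w ⟨hwV, huw.ne.symm⟩ y ⟨hy.1, hyu⟩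
  obtain ⟨t, ht, P, hP, hPt⟩ := W'.exists_path_first (S := V ∩ ⋃₀ E') hy
  have hwt : w ≠ t := by rintro rfl; exact hw ht.2
  have hPu := adjGraph_support_ne P huw.ne.symm
  obtain ⟨EL, hEL, hLarc, hLV⟩ := h.exists_arc_of_isPath P hP hwt
  have heL : e ∉ EL := fun heL => hPu u (hLV.subset ⟨⟨e, heL, huw.left_mem⟩, huV⟩) rfl
  have hEL' : ∀ f ∈ insert e EL, f ∉ E' := by
    rintro f (rfl | hf) hf'
    · exact he' hf'
    · obtain ⟨c, d, hcd, hfV⟩ := h.arc f (hEL hf)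
      have hm : ∀ v ∈ ({c, d} : Set ℂ), v = t := fun v hv => by
        have hv' := hfV.symm.subset hv
        exact hPt v (hLV.subset ⟨⟨f, hf, hv'.1⟩, hv'.2⟩) ⟨hv'.2, f, hf', hv'.1⟩
      exact hcd.ne ((hm c (Or.inl rfl)).trans (hm d (Or.inr rfl)).symm)
  have hsub : insert e EL ⊆ E := insert_subset he hEL
  refine ⟨insert e EL, hsub, u, t, ?_, ⟨huV, hu⟩, ht, ?_, e, Or.inl rfl, he'⟩
  · rw [sUnion_insert]
    refine huw.concat hLarc ?_
    rintro z ⟨hze, g, hg, hzg⟩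
    have hzV : z ∈ V := h.inter e he g (hEL hg) (fun h => heL (h ▸ hg)) ⟨hze, hzg⟩
    rcases heV.subset ⟨hze, hzV⟩ with rfl | hz
    · exact absurd rfl (hPu _ (hLV.subset ⟨⟨g, hg, hzg⟩, hzV⟩))
    · exact hz
  · refine Subset.antisymm ?_ ?_
    · rintro z ⟨⟨f, hf, hzf⟩, hz⟩
      have hzV := hints f (hsub hf) (hEL' f hf) z hzf hz
      rcases hf with rfl | hf
      · rcases heV.subset ⟨hzf, hzV⟩ with rfl | rfl
        exacts [Or.inl rfl, absurd hz hw]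
      · exact Or.inr (hPt z (hLV.subset ⟨⟨f, hf, hzf⟩, hzV⟩) ⟨hzV, hz⟩)
    · rintro z (rfl | rfl)
      · exact ⟨⟨e, Or.inl rfl, huw.left_mem⟩, hu⟩
      · refine ⟨?_, ht.2⟩
        rw [sUnion_insert]
        exact Or.inr hLarc.right_mem

/-- The right half of the circle of radius `R` as a function of the height. -/
noncomputable def semi (R : ℝ) (y : ℝ) : ℝ := √(R ^ 2 - y ^ 2)

theorem isLens_semi {R : ℝ} (hR : 0 < R) : IsLens (fun y => -semi R y) (semi R) (-R) R := by
  have hc : Continuous (semi R) := by unfold semi; fun_prop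
  refine ⟨by linarith, hc.neg, hc, by simp [semi], by simp [semi], fun y hy => ?_⟩
  have : 0 < semi R y := Real.sqrt_pos.2 (by nlinarith [hy.1, hy.2])
  show -semi R y < semi R y
  linarith

theorem norm_sq_eq (z : ℂ) : ‖z‖ ^ 2 = z.re ^ 2 + z.im ^ 2 := by
  rw [Complex.sq_norm, Complex.normSq_apply]; ring

theorem gr_semi_union {R : ℝ} (hR : 0 < R) :
    gr (fun y => -semi R y) (-R) R ∪ gr (semi R) (-R) R = sphere 0 R := by
  ext z
  have hz : z ∈ sphere (0 : ℂ) R ↔ z.re ^ 2 + z.im ^ 2 = R ^ 2 := by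
    rw [mem_sphere_zero_iff_norm, ← norm_sq_eq, sq_eq_sq₀ (norm_nonneg z) hR.le]
  rw [hz]
  constructor
  · have hs : z.im ∈ Icc (-R) R → semi R z.im ^ 2 = R ^ 2 - z.im ^ 2 := fun h =>
      Real.sq_sqrt (by nlinarith [h.1, h.2])
    rintro (⟨h1, h2⟩ | ⟨h1, h2⟩)
    · rw [h2, neg_sq, hs h1]; ring
    · rw [h2, hs h1]; ring
  · intro h
    have h1 : z.im ∈ Icc (-R) R := abs_le.1 (abs_le_of_sq_le_sq (by nlinarith) hR.le)
    have h2 : semi R z.im = |z.re| := by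
      rw [semi, ← Real.sqrt_sq_eq_abs]; congr 1; linarith
    rcases abs_choice z.re with h3 | h3
    · exact Or.inr ⟨h1, by rw [h2, h3]⟩
    · exact Or.inl ⟨h1, by show _ = -semi R z.im; rw [h2, h3, neg_neg]⟩

theorem hasLenses_sphere {R : ℝ} (hR : 0 < R) : HasLenses (sphere 0 R) R := by
  intro z hz _
  have hl := isLens_semi hR
  refine ⟨_, _, _, _, hl, (gr_semi_union hR).subset, ?_, ?_⟩
  · rw [← gr_semi_union hR]
    exact hl.disjoint
  · have h : z.re ^ 2 + z.im ^ 2 < R ^ 2 := by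
      rw [← norm_sq_eq]
      exact pow_lt_pow_left₀ (mem_ball_zero_iff.1 hz) (norm_nonneg z) two_ne_zero
    have h1 : |z.re| < semi R z.im := by
      rw [semi, ← Real.sqrt_sq_eq_abs]
      exact Real.sqrt_lt_sqrt (sq_nonneg _) (by linarith)
    exact ⟨abs_lt.1 (abs_lt_of_sq_lt_sq (by nlinarith [sq_nonneg z.re]) hR.le),
      (abs_lt.1 h1).1, (abs_lt.1 h1).2⟩

theorem injOn_im_gr (f : ℝ → ℝ) (s t : ℝ) : InjOn Complex.im (gr f s t) :=
  fun z hz w hw h => Complex.ext (by rw [hz.2, hw.2, h]) h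

/-- A 2-connected plane graph bounded by a circle can be drawn with monotone edges and with its
vertices at different heights. -/
theorem IsPG.exists_monotone {V : Set ℂ} {E : Set (Set ℂ)} (h : IsPG V E) {R : ℝ} (hR : 0 < R)
    (hA : gr (fun y => -semi R y) (-R) R ∈ E) (hB : gr (semi R) (-R) R ∈ E)
    (hK : carr V E ⊆ closedBall 0 R)
    (h2 : ∀ u ∈ V, ∀ a ∈ V \ {u}, ∀ b ∈ V \ {u}, (adjGraph E u).Reachable a b) :
    ∃ φ : ℂ ≃ₜ ℂ, (∀ e ∈ E, InjOn Complex.im (φ '' e)) ∧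
      InjOn Complex.im (φ '' (V ∩ ⋃₀ E)) := by
  set A := gr (fun y => -semi R y) (-R) R with hAdef
  set B := gr (semi R) (-R) R with hBdef
  have hAB : A ∪ B = sphere 0 R := gr_semi_union hR
  have hl := isLens_semi hR
  set p : ℂ := ⟨-semi R (-R), -R⟩ with hp
  set q : ℂ := ⟨-semi R R, R⟩ with hq
  have hAa : IsArc A p q := hl.isTwoArc.left
  have hBa : IsArc B p q := hl.isTwoArc.right
  have hAV := h.inter_eq hA hAa
  have hBV := h.inter_eq hB hBa
  have hpV : p ∈ V := (hAV.symm.subset (Or.inl rfl)).2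
  have hqV : q ∈ V := (hAV.symm.subset (Or.inr rfl)).2
  let C : Set (Set (Set ℂ)) := {E' | E' ⊆ E ∧ {A, B} ⊆ E' ∧ ∃ φ : ℂ ≃ₜ ℂ,
    (∀ z ∉ ball 0 R, φ z = z) ∧ (∀ e ∈ E', InjOn Complex.im (φ '' e)) ∧
      InjOn Complex.im (φ '' (V ∩ ⋃₀ E')) ∧ HasLenses (φ '' ⋃₀ E') R}
  have hCf : C.Finite := h.finE.finite_subsets.subset fun E' hE' => hE'.1
  have hid : ∀ S : Set ℂ, Homeomorph.refl ℂ '' S = S := fun S => image_id S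
  have hC0 : {A, B} ∈ C := by
    refine ⟨insert_subset hA (singleton_subset_iff.2 hB), Subset.rfl, Homeomorph.refl ℂ,
      fun z _ => rfl, ?_, ?_, ?_⟩
    · rintro e (rfl | rfl)
      · rw [hid]; exact injOn_im_gr _ _ _
      · rw [hid]; exact injOn_im_gr _ _ _
    · rw [hid, sUnion_pair, inter_comm, union_inter_distrib_right,
        hAV, hBV, union_self]
      exact (injOn_im_gr _ _ _).mono (insert_subset hAa.left_mem (singleton_subset_iff.2 hAa.right_mem))
    · rw [hid, sUnion_pair, hAB]
      exact hasLenses_sphere hR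
  obtain ⟨E', hE', hmax⟩ := hCf.exists_maximal ⟨_, hC0⟩
  obtain ⟨hEE, hABE, φ, hφ, hmono, hinj, hlens⟩ := hE'
  by_cases hne : E' = E
  · subst hne
    exact ⟨φ, hmono, hinj⟩
  exfalso
  have hAE : A ⊆ ⋃₀ E' := fun z hz => ⟨A, hABE (Or.inl rfl), hz⟩
  have hBE : B ⊆ ⋃₀ E' := fun z hz => ⟨B, hABE (Or.inr rfl), hz⟩
  obtain ⟨EL, hEL, u, t, hL, hu, ht, hLX, f, hf, hf'⟩ := h.exists_ear hEE hne h2 hAa.ne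
    ⟨hpV, hAE hAa.left_mem⟩ ⟨hqV, hAE hAa.right_mem⟩
  have hballs : ∀ z ∈ closedBall (0 : ℂ) R, φ z ∈ closedBall (0 : ℂ) R := by
    intro z hz
    by_contra hz'
    have h1 := hφ (φ z) fun h => hz' (ball_subset_closedBall h)
    rw [φ.injective h1] at hz'
    exact hz' hz
  have hmem : ∀ z ∈ V ∩ ⋃₀ E', φ z ∈ φ '' V ∩ φ '' ⋃₀ E' := fun z hz =>
    ⟨mem_image_of_mem _ hz.1, mem_image_of_mem _ hz.2⟩
  obtain ⟨Φ, hΦ, hΦX, hΦL, hΦV, hΦl⟩ := hlens.exists_straighten (V := φ '' V)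
    (L := φ '' ⋃₀ EL) (u := φ u) (t := φ t) (fun z hz => by
      refine ⟨z, (hAB.symm.subset hz).elim (fun h => hAE h) (fun h => hBE h), hφ z fun hz' => ?_⟩
      exact (mem_ball.1 hz').ne (mem_sphere.1 hz))
    (h.finV.image φ) (by rwa [← image_inter φ.injective])
    (hL.image φ.continuous.continuousOn φ.injective.injOn) (hmem u hu) (hmem t ht)
    (by rw [← image_inter φ.injective, hLX, image_pair])
    (by
      rintro _ ⟨z, ⟨e, he, hze⟩, rfl⟩
      exact hballs z (hK (Or.inr ⟨e, hEL he, hze⟩)))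
    (φ.isClosed_image.2 (by
      rw [sUnion_eq_biUnion]
      refine (h.finE.subset hEE).isClosed_biUnion fun e he => ?_
      obtain ⟨a, b, hab, -⟩ := h.arc e (hEE he)
      exact hab.isClosed))
  have hcomp : ∀ S : Set ℂ, (φ.trans Φ) '' S = Φ '' (φ '' S) := fun S => by
    rw [← image_comp]; rfl
  have hΦS : ∀ S ⊆ φ '' ⋃₀ E', Φ '' S = S := fun S hS => by
    have : EqOn Φ id S := fun z hz => hΦX z (hS hz)
    rw [this.image_eq, image_id]
  have hnew : E' ∪ EL ∈ C := by
    refine ⟨union_subset hEE hEL, hABE.trans subset_union_left, φ.trans Φ, ?_, ?_, ?_, ?_⟩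
    · intro z hz
      rw [Homeomorph.trans_apply, hφ z hz, hΦ z hz]
    · rintro e (he | he)
      · rw [hcomp, hΦS _ (image_mono (subset_sUnion_of_mem he))]
        exact hmono e he
      · rw [hcomp]
        exact hΦL.mono (image_mono (image_mono (subset_sUnion_of_mem he)))
    · rwa [hcomp, sUnion_union, image_inter φ.injective, image_union]
    · rwa [hcomp, sUnion_union, image_union, image_union, hΦS _ Subset.rfl]
  exact hf' (hmax hnew subset_union_left (Or.inr hf))

/-- A relation on a finite type in which every nonempty finite set has a minimal element can be
ranked. -/
theorem exists_rank {ι : Type*} (r : ι → ι → Prop) (S : Finset ι)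
    (h : ∀ T : Finset ι, T.Nonempty → ∃ m ∈ T, ∀ i ∈ T, ¬ r i m) :
    ∃ rk : ι → ℕ, InjOn rk S ∧ ∀ i ∈ S, ∀ j ∈ S, r i j → rk i < rk j := by
  classical
  induction hn : S.card generalizing S with
  | zero =>
    rw [Finset.card_eq_zero] at hn
    subst hn
    exact ⟨fun _ => 0, by simp, by simp⟩
  | succ n ih =>
    obtain ⟨m, hm, hmin⟩ := h S (Finset.card_pos.1 (by omega))
    obtain ⟨rk, h1, h2⟩ := ih (S.erase m) (by rw [Finset.card_erase_of_mem hm]; omega)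
    refine ⟨fun i => if i = m then 0 else rk i + 1, fun i hi j hj hij => ?_, fun i hi j hj hij => ?_⟩
    · by_cases him : i = m <;> by_cases hjm : j = m <;> simp only [him, hjm, if_true, if_false] at hij ⊢
      · omega
      · omega
      · exact h1 (Finset.mem_coe.2 (Finset.mem_erase.2 ⟨him, hi⟩))
          (Finset.mem_coe.2 (Finset.mem_erase.2 ⟨hjm, hj⟩)) (by omega)
    · have hjm : j ≠ m := by rintro rfl; exact hmin i hi hij
      by_cases him : i = m
      · simp [him, hjm]
      · have := h2 i (Finset.mem_erase.2 ⟨him, hi⟩) j (Finset.mem_erase.2 ⟨hjm, hj⟩) hij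
        simp only [him, hjm, if_false]
        omega

/-- Two disjoint graphs are ordered in the same way at all common heights. -/
theorem lt_of_common {f g : ℝ → ℝ} (hf : Continuous f) (hg : Continuous g) {S : Set ℝ}
    (hS : S.OrdConnected) (hne : ∀ y ∈ S, f y ≠ g y) {y z : ℝ} (hy : y ∈ S) (hz : z ∈ S)
    (h : f y < g y) : f z < g z := by
  by_contra! hc
  obtain ⟨w, hw, hwz⟩ := hS.isPreconnected.intermediate_value hy hz
    (f := fun t => f t - g t) (by fun_prop) (show (0 : ℝ) ∈ _ from ⟨by linarith, by linarith⟩)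
  exact hne w hw (sub_eq_zero.1 hwz)

/-- Disjoint graphs over intervals can be ranked from left to right. -/
theorem exists_rank_gr {ι : Type*} [Finite ι] {f : ι → ℝ → ℝ} {lo hi : ι → ℝ}
    (hf : ∀ i, Continuous (f i)) (hlo : ∀ i, lo i ≤ hi i)
    (hd : ∀ i j, i ≠ j → ∀ y ∈ Icc (lo i) (hi i) ∩ Icc (lo j) (hi j), f i y ≠ f j y) :
    ∃ rk : ι → ℕ, Function.Injective rk ∧
      ∀ i j, ∀ y ∈ Icc (lo i) (hi i) ∩ Icc (lo j) (hi j), f i y < f j y → rk i < rk j := by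
  classical
  have := Fintype.ofFinite ι
  let r : ι → ι → Prop := fun i j => ∃ y ∈ Icc (lo i) (hi i) ∩ Icc (lo j) (hi j), f i y < f j y
  have hr : ∀ i j, r i j → ∀ y ∈ Icc (lo i) (hi i) ∩ Icc (lo j) (hi j), f i y < f j y := by
    rintro i j ⟨y, hy, h⟩ z hz
    have hij : i ≠ j := by rintro rfl; exact h.ne rfl
    exact lt_of_common (hf i) (hf j) (ordConnected_Icc.inter ordConnected_Icc) (hd i j hij) hy hz h
  suffices ∀ T : Finset ι, T.Nonempty → ∃ m ∈ T, ∀ i ∈ T, ¬ r i m by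
    obtain ⟨rk, h1, h2⟩ := exists_rank r Finset.univ this
    exact ⟨rk, fun i j h => h1 (by simp) (by simp) h,
      fun i j y hy h => h2 i (Finset.mem_univ i) j (Finset.mem_univ j) ⟨y, hy, h⟩⟩
  intro T hT
  -- the graphs whose top can be seen from the left
  let vis : Finset ι := {i ∈ T | ∀ k ∈ T, hi i ∈ Icc (lo k) (hi k) → ¬ f k (hi i) < f i (hi i)}
  have key : ∀ U ⊆ T, U.Nonempty → (∀ g ∈ U, (∀ g' ∈ U, hi g' ≤ hi g) → ∀ k ∈ T,
      hi g ∈ Icc (lo k) (hi k) → f k (hi g) < f g (hi g) → k ∈ U) → ∃ g ∈ U, g ∈ vis := by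
    intro U hUT hU hk
    obtain ⟨g₀, hg₀, hmax⟩ := U.exists_max_image hi hU
    obtain ⟨g, hg, hmin⟩ := (U.filter fun g => hi g = hi g₀).exists_min_image (fun g => f g (hi g₀))
      ⟨g₀, by simp [hg₀]⟩
    rw [Finset.mem_filter] at hg
    refine ⟨g, hg.1, Finset.mem_filter.2 ⟨hUT hg.1, fun k hkT hkI hlt => ?_⟩⟩
    have hkU := hk g hg.1 (by rw [hg.2]; exact hmax) k hkT hkI hlt
    have hke : hi k = hi g₀ := le_antisymm (hmax k hkU) (hg.2 ▸ hkI.2)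
    have := hmin k (Finset.mem_filter.2 ⟨hkU, hke⟩)
    rw [hg.2] at hlt
    exact absurd hlt this.not_gt
  obtain ⟨e₀, -, he₀⟩ := key T Subset.rfl hT fun g _ _ k hk _ _ => hk
  obtain ⟨e, he, hmin⟩ := vis.exists_min_image hi ⟨e₀, he₀⟩
  obtain ⟨heT, hev⟩ := Finset.mem_filter.1 he
  refine ⟨e, heT, ?_⟩
  by_contra! hcon
  obtain ⟨g₀, hg₀, hg₀e⟩ := hcon
  have hprop : ∀ g ∈ T, r g e → hi g < hi e ∧ hi g ∈ Icc (lo e) (hi e) := by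
    rintro g hg hge
    obtain ⟨y, hy, -⟩ := id hge
    have hlt : hi g < hi e := by
      by_contra! hle
      have hI : hi e ∈ Icc (lo g) (hi g) := ⟨hy.1.1.trans hy.2.2, hle⟩
      exact hev g hg hI (hr g e hge _ ⟨hI, hlo e, le_rfl⟩)
    exact ⟨hlt, hy.2.1.trans hy.1.2, hlt.le⟩
  obtain ⟨g, hg, hgv⟩ := key (T.filter fun g => r g e) (Finset.filter_subset _ _)
    ⟨g₀, Finset.mem_filter.2 ⟨hg₀, hg₀e⟩⟩ (by
      intro g hg _ k hk hkI hlt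
      rw [Finset.mem_filter] at hg
      have hgI := (hprop g hg.1 hg.2).2
      exact Finset.mem_filter.2 ⟨hk, hi g, ⟨hkI, hgI⟩,
        hlt.trans (hr g e hg.2 _ ⟨⟨hlo g, le_rfl⟩, hgI⟩)⟩)
  rw [Finset.mem_filter] at hg
  exact (hmin g hgv).not_gt (hprop g hg.1 hg.2).1

/-- An arc on which the height is injective is a graph. -/
theorem IsArc.exists_gr {e : Set ℂ} {a b : ℂ} (h : IsArc e a b) (hi : InjOn Complex.im e)
    (hab : a.im < b.im) : ∃ f : ℝ → ℝ, Continuous f ∧ e = gr f a.im b.im := by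
  have him : Complex.im '' e = Icc a.im b.im := by
    obtain ⟨γ, h1, h2, rfl, rfl, rfl⟩ := id h
    have hc : ContinuousOn (fun t => (γ t).im) (Icc 0 1) := Complex.continuous_im.comp_continuousOn h1
    have hinj : InjOn (fun t => (γ t).im) (Icc 0 1) := hi.comp h2 (mapsTo_image _ _)
    have hm : StrictMonoOn (fun t => (γ t).im) (Icc 0 1) :=
      hc.strictMonoOn_of_injOn_Icc zero_le_one hab.le hinj
    rw [← image_comp]
    refine Subset.antisymm ?_ (intermediate_value_Icc zero_le_one hc)
    rintro _ ⟨t, ht, rfl⟩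
    exact ⟨hm.monotoneOn (left_mem_Icc.2 zero_le_one) ht ht.1,
      hm.monotoneOn ht (right_mem_Icc.2 zero_le_one) ht.2⟩
  have hg := continuousOn_invFunOn h.isCompact Complex.continuous_im.continuousOn hi
  set g := Function.invFunOn Complex.im e
  rw [him] at hg
  refine ⟨IccExtend hab.le ((Icc a.im b.im).domRestrict fun y => (g y).re),
    (Complex.continuous_re.comp_continuousOn hg).domRestrict.Icc_extend', ?_⟩
  have hge : ∀ y ∈ Icc a.im b.im, g y ∈ e ∧ (g y).im = y := fun y hy =>
    ⟨Function.invFunOn_mem (him.symm.subset hy), Function.invFunOn_eq (him.symm.subset hy)⟩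
  ext z
  constructor
  · intro hz
    have hzI : z.im ∈ Icc a.im b.im := him ▸ mem_image_of_mem _ hz
    refine ⟨hzI, ?_⟩
    rw [IccExtend_of_mem _ _ hzI]
    show z.re = (g z.im).re
    rw [hi (hge _ hzI).1 hz (hge _ hzI).2]
  · rintro ⟨hzI, hz⟩
    rw [IccExtend_of_mem _ _ hzI] at hz
    have : z = g z.im := Complex.ext hz (hge _ hzI).2.symm
    rw [this]
    exact (hge _ hzI).1

/-- The distance to a set invariant under translation to the left increases to the right. -/
theorem infDist_mono_re {A : Set ℂ} (hA : ∀ z ∈ A, ∀ t : ℝ, 0 ≤ t → z - t ∈ A) (hne : A.Nonempty)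
    {z w : ℂ} (him : z.im = w.im) (hre : z.re ≤ w.re) : infDist z A ≤ infDist w A := by
  refine (le_infDist hne).2 fun a ha => ?_
  have hw : w - ((w.re - z.re : ℝ) : ℂ) = z := by
    apply Complex.ext <;> simp [him]
  have := infDist_le_dist_of_mem (x := z) (hA a ha (w.re - z.re) (by linarith))
  refine this.trans (le_of_eq ?_)
  rw [dist_eq_norm, dist_eq_norm]
  congr 1
  linear_combination (-1 : ℂ) * hw

theorem infDist_anti_re {B : Set ℂ} (hB : ∀ z ∈ B, ∀ t : ℝ, 0 ≤ t → z + t ∈ B) (hne : B.Nonempty)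
    {z w : ℂ} (him : z.im = w.im) (hre : z.re ≤ w.re) : infDist w B ≤ infDist z B := by
  refine (le_infDist hne).2 fun a ha => ?_
  have hw : z + ((w.re - z.re : ℝ) : ℂ) = w := by
    apply Complex.ext <;> simp [him]
  have := infDist_le_dist_of_mem (x := w) (hB a ha (w.re - z.re) (by linarith))
  refine this.trans (le_of_eq ?_)
  rw [dist_eq_norm, dist_eq_norm]
  congr 1
  linear_combination (-1 : ℂ) * hw

/-- A function that is `0` on `A`, `1` on `B` and monotone along horizontal lines when `A` is
invariant under translations to the left and `B` to the right. -/
noncomputable def sep (A B : Set ℂ) (z : ℂ) : ℝ :=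
  Real.exp z.re * infDist z A / (Real.exp z.re * infDist z A + infDist z B)

section sep
variable {A B : Set ℂ}

theorem sep_denom_pos (hA : IsClosed A) (hB : IsClosed B) (nA : A.Nonempty) (nB : B.Nonempty)
    {z : ℂ} (hz : z ∉ A ∩ B) : 0 < Real.exp z.re * infDist z A + infDist z B := by
  have h1 : 0 ≤ infDist z A := infDist_nonneg
  have h2 : 0 ≤ infDist z B := infDist_nonneg
  have he := Real.exp_pos z.re
  by_cases h : z ∈ A
  · have := (hB.notMem_iff_infDist_pos nB).1 fun h' => hz ⟨h, h'⟩
    positivity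
  · have := (hA.notMem_iff_infDist_pos nA).1 h
    positivity

theorem sep_nonneg (z : ℂ) : 0 ≤ sep A B z := by
  have h1 : 0 ≤ infDist z A := infDist_nonneg
  have h2 : 0 ≤ infDist z B := infDist_nonneg
  unfold sep; positivity

theorem sep_le_one (z : ℂ) : sep A B z ≤ 1 := by
  have h1 : 0 ≤ infDist z A := infDist_nonneg
  have h2 : 0 ≤ infDist z B := infDist_nonneg
  unfold sep
  exact div_le_one_of_le₀ (by linarith) (by positivity)

theorem sep_eq_zero {z : ℂ} (hz : z ∈ A) : sep A B z = 0 := by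
  simp [sep, infDist_zero_of_mem hz]

theorem sep_eq_one (hA : IsClosed A) (nA : A.Nonempty) {z : ℂ} (hz : z ∈ B) (hz' : z ∉ A) :
    sep A B z = 1 := by
  have := (hA.notMem_iff_infDist_pos nA).1 hz'
  have he := Real.exp_pos z.re
  rw [sep, infDist_zero_of_mem hz, add_zero, div_self (by positivity)]

theorem continuousOn_sep (hA : IsClosed A) (hB : IsClosed B) (nA : A.Nonempty) (nB : B.Nonempty) :
    ContinuousOn (sep A B) (A ∩ B)ᶜ := by
  unfold sep
  refine ContinuousOn.div ?_ ?_ fun z hz => (sep_denom_pos hA hB nA nB hz).ne'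
  · exact ((Real.continuous_exp.comp Complex.continuous_re).mul
      (continuous_infDist_pt A)).continuousOn
  · exact (((Real.continuous_exp.comp Complex.continuous_re).mul
      (continuous_infDist_pt A)).add (continuous_infDist_pt B)).continuousOn

theorem sep_mono (hA : IsClosed A) (nA : A.Nonempty) (nB : B.Nonempty)
    (hAl : ∀ z ∈ A, ∀ t : ℝ, 0 ≤ t → z - t ∈ A) (hBr : ∀ z ∈ B, ∀ t : ℝ, 0 ≤ t → z + t ∈ B)
    {z w : ℂ} (him : z.im = w.im) (hre : z.re ≤ w.re) : sep A B z ≤ sep A B w := by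
  by_cases hz : z ∈ A
  · rw [sep_eq_zero hz]; exact sep_nonneg w
  have h1 := (hA.notMem_iff_infDist_pos nA).1 hz
  have h2 := infDist_mono_re hAl nA him hre
  have h3 := infDist_anti_re hBr nB him hre
  have h4 : 0 ≤ infDist w B := infDist_nonneg
  have he := Real.exp_pos z.re
  have he' := Real.exp_le_exp.2 hre
  have h5 : Real.exp z.re * infDist z A ≤ Real.exp w.re * infDist w A := by gcongr
  have h6 : 0 < Real.exp z.re * infDist z A := by positivity
  unfold sep
  rw [div_le_div_iff₀ (by linarith) (by linarith)]
  nlinarith [mul_le_mul h5 h3 h4 (by linarith)]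

theorem sep_lt (hA : IsClosed A) (hB : IsClosed B) (nA : A.Nonempty) (nB : B.Nonempty)
    (hAl : ∀ z ∈ A, ∀ t : ℝ, 0 ≤ t → z - t ∈ A) (hBr : ∀ z ∈ B, ∀ t : ℝ, 0 ≤ t → z + t ∈ B)
    {z w : ℂ} (him : z.im = w.im) (hre : z.re < w.re) (hzA : z ∉ A) (hzB : z ∉ B) :
    sep A B z < sep A B w := by
  have h1 := (hA.notMem_iff_infDist_pos nA).1 hzA
  have h1' := (hB.notMem_iff_infDist_pos nB).1 hzB
  have h2 := infDist_mono_re hAl nA him hre.le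
  have h3 := infDist_anti_re hBr nB him hre.le
  have h4 : 0 ≤ infDist w B := infDist_nonneg
  have he := Real.exp_pos z.re
  have he' := Real.exp_lt_exp.2 hre
  have h5 : Real.exp z.re * infDist z A < Real.exp w.re * infDist w A :=
    mul_lt_mul he' h2 h1 (by positivity)
  have h6 : 0 < Real.exp z.re * infDist z A := by positivity
  unfold sep
  rw [div_lt_div_iff₀ (by linarith) (by linarith)]
  nlinarith [mul_le_mul_of_nonneg_left h3 h6.le, mul_lt_mul_of_pos_right h5 h1']
end sep

/-- A function with jumps only at a finite set of points, no two at the same height, which is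
strictly increasing along horizontal lines is inverted by a contraction of horizontal bars. -/
theorem exists_contraction_of_strictMono {V : Set ℂ} (hV : V.Finite) (hVi : InjOn Complex.im V)
    {R : ℂ → ℝ} (hR : ContinuousOn R Vᶜ)
    (hmono : ∀ z w : ℂ, z.im = w.im → z.re < w.re → R z < R w)
    {C : ℝ} (hC : ∀ z : ℂ, |R z - z.re| ≤ C) :
    ∃ (π : ℂ → ℂ) (a b : ℂ → ℝ), Continuous π ∧ (∀ z, (π z).im = z.im) ∧
      (∀ z, π ⟨R z, z.im⟩ = z) ∧
      (∀ v ∈ V, ∀ X : ℝ, X ∈ Icc (a v) (b v) ↔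
        (∀ t < v.re, R ⟨t, v.im⟩ ≤ X) ∧ (∀ t > v.re, X ≤ R ⟨t, v.im⟩)) ∧
      (∀ v ∈ V, ∀ X ∈ Icc (a v) (b v), π ⟨X, v.im⟩ = v) ∧
      InjOn π (⋃ v ∈ V, {z : ℂ | z.im = v.im ∧ z.re ∈ Icc (a v) (b v)})ᶜ := by
  have hC' : ∀ t y : ℝ, |R ⟨t, y⟩ - t| ≤ C := fun t y => hC ⟨t, y⟩
  have hm : ∀ y s t : ℝ, s < t → R ⟨s, y⟩ < R ⟨t, y⟩ := fun y s t h => hmono _ _ rfl h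
  have hm' : ∀ y s t : ℝ, s ≤ t → R ⟨s, y⟩ ≤ R ⟨t, y⟩ := fun y s t h => by
    rcases h.eq_or_lt with rfl | h
    · exact le_rfl
    · exact (hm y s t h).le
  set S : ℂ → Set ℝ := fun z => {t | R ⟨t, z.im⟩ < z.re} with hS
  have memS : ∀ z t, t ∈ S z ↔ R ⟨t, z.im⟩ < z.re := fun z t => Iff.rfl
  set P : ℂ → ℝ := fun z => sSup (S z) with hP
  have bdd : ∀ z, BddAbove (S z) := fun z => ⟨z.re + C, fun t ht => by
    have := (abs_le.1 (hC' t z.im)).1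
    have := (memS z t).1 ht
    linarith⟩
  have ne : ∀ z, (S z).Nonempty := fun z => ⟨z.re - C - 1, by
    rw [memS]
    have := (abs_le.1 (hC' (z.re - C - 1) z.im)).2
    linarith⟩
  have ltP : ∀ z c, c < P z ↔ ∃ t > c, R ⟨t, z.im⟩ < z.re := by
    intro z c
    constructor
    · intro h
      obtain ⟨t, ht, hct⟩ := exists_lt_of_lt_csSup (ne z) h
      exact ⟨t, hct, ht⟩
    · rintro ⟨t, hct, ht⟩
      exact lt_of_lt_of_le hct (le_csSup (bdd z) ht)
  have Plt : ∀ z c, P z < c ↔ ∃ t < c, z.re < R ⟨t, z.im⟩ := by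
    intro z c
    constructor
    · intro h
      obtain ⟨t, h1, h2⟩ := exists_between h
      obtain ⟨t', h3, h4⟩ := exists_between h2
      refine ⟨t', h4, lt_of_le_of_lt ?_ (hm _ _ _ h3)⟩
      by_contra hlt
      exact absurd (le_csSup (bdd z) ((memS z t).2 (not_le.1 hlt))) (not_le.2 h1)
    · rintro ⟨t, hct, ht⟩
      refine lt_of_le_of_lt (csSup_le (ne z) fun s hs => ?_) hct
      by_contra hlt
      have h1 := hm z.im _ _ (not_le.1 hlt)
      have h2 := (memS z s).1 hs
      linarith
  have avoid : ∀ y s t : ℝ, s < t → ∃ r ∈ Ioo s t, (⟨r, y⟩ : ℂ) ∉ V := by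
    intro y s t hst
    obtain ⟨r, hr, hr'⟩ := ((Ioo_infinite hst).sdiff (hV.image Complex.re)).nonempty
    exact ⟨r, hr, fun h => hr' ⟨_, h, rfl⟩⟩
  have hat : ∀ t y : ℝ, (⟨t, y⟩ : ℂ) ∉ V → ContinuousAt R ⟨t, y⟩ := fun t y h =>
    hR.continuousAt (hV.isClosed.isOpen_compl.mem_nhds h)
  have hvert : ∀ t y : ℝ, Continuous fun w : ℂ => (⟨t, w.im⟩ : ℂ) := fun t y => by
    have : (fun w : ℂ => (⟨t, w.im⟩ : ℂ)) = fun w => (t : ℂ) + (w.im : ℂ) * Complex.I := by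
      funext w; apply Complex.ext <;> simp
    rw [this]; fun_prop
  have contP : Continuous P := by
    rw [continuous_iff_continuousAt]
    intro z
    rw [ContinuousAt, tendsto_order]
    constructor
    · intro c hc
      obtain ⟨t, h1, h2⟩ := (ltP z c).1 hc
      obtain ⟨r, hr, hrV⟩ := avoid z.im c t h1
      have h3 : ContinuousAt (fun w : ℂ => R ⟨r, w.im⟩) z :=
        ContinuousAt.comp (f := fun w : ℂ => (⟨r, w.im⟩ : ℂ)) (hat r z.im hrV)
          (hvert r 0).continuousAt
      have h4 : R ⟨r, z.im⟩ < z.re := (hm _ _ _ hr.2).trans h2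
      filter_upwards [h3.eventually_lt Complex.continuous_re.continuousAt h4] with w hw
      exact (ltP w c).2 ⟨r, hr.1, hw⟩
    · intro c hc
      obtain ⟨t, h1, h2⟩ := (Plt z c).1 hc
      obtain ⟨r, hr, hrV⟩ := avoid z.im t c h1
      have h3 : ContinuousAt (fun w : ℂ => R ⟨r, w.im⟩) z :=
        ContinuousAt.comp (f := fun w : ℂ => (⟨r, w.im⟩ : ℂ)) (hat r z.im hrV)
          (hvert r 0).continuousAt
      have h4 : z.re < R ⟨r, z.im⟩ := h2.trans (hm _ _ _ hr.1)
      filter_upwards [Complex.continuous_re.continuousAt.eventually_lt h3 h4] with w hw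
      exact (Plt w c).2 ⟨r, hr.2, hw⟩
  have Peq : ∀ z c, P z = c ↔ (∀ t < c, R ⟨t, z.im⟩ ≤ z.re) ∧ ∀ t > c, z.re ≤ R ⟨t, z.im⟩ := by
    intro z c
    constructor
    · rintro rfl
      refine ⟨fun t ht => ?_, fun t ht => ?_⟩
      · obtain ⟨s, hs, hs'⟩ := (ltP z t).1 ht
        exact ((hm _ _ _ hs).trans hs').le
      · obtain ⟨s, hs, hs'⟩ := (Plt z t).1 ht
        exact (hs'.trans (hm _ _ _ hs)).le
    · rintro ⟨h1, h2⟩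
      refine le_antisymm (le_of_forall_gt_imp_ge_of_dense fun d hd => ?_)
        (le_of_forall_lt_imp_le_of_dense fun d hd => ?_)
      · obtain ⟨s, hs, hs'⟩ := exists_between hd
        obtain ⟨s', hs1, hs2⟩ := exists_between hs'
        exact ((Plt z d).2 ⟨s', hs2, (h2 s hs).trans_lt (hm _ _ _ hs1)⟩).le
      · obtain ⟨s, hs, hs'⟩ := exists_between hd
        obtain ⟨s', hs1, hs2⟩ := exists_between hs
        exact ((ltP z d).2 ⟨s', hs1, (hm _ _ _ hs2).trans_le (h1 s hs')⟩).le
  set a : ℂ → ℝ := fun v => sSup ((fun t => R ⟨t, v.im⟩) '' Iio v.re) with ha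
  set b : ℂ → ℝ := fun v => sInf ((fun t => R ⟨t, v.im⟩) '' Ioi v.re) with hb
  have hab : ∀ v : ℂ, ∀ X : ℝ, X ∈ Icc (a v) (b v) ↔
        (∀ t < v.re, R ⟨t, v.im⟩ ≤ X) ∧ (∀ t > v.re, X ≤ R ⟨t, v.im⟩) := by
    intro v X
    have b1 : BddAbove ((fun t => R ⟨t, v.im⟩) '' Iio v.re) := ⟨R ⟨v.re, v.im⟩, by
      rintro _ ⟨t, ht, rfl⟩; exact (hm _ _ _ ht).le⟩
    have b2 : BddBelow ((fun t => R ⟨t, v.im⟩) '' Ioi v.re) := ⟨R ⟨v.re, v.im⟩, by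
      rintro _ ⟨t, ht, rfl⟩; exact (hm _ _ _ ht).le⟩
    refine and_congr ?_ ?_
    · rw [ha, csSup_le_iff b1 (nonempty_Iio.image _)]
      simp
    · rw [hb, le_csInf_iff b2 (nonempty_Ioi.image _)]
      simp
  refine ⟨fun z => ⟨P z, z.im⟩, a, b, ?_, fun z => rfl, ?_, fun v _ => hab v, ?_, ?_⟩
  · have : (fun z : ℂ => (⟨P z, z.im⟩ : ℂ)) = fun w => (P w : ℂ) + (w.im : ℂ) * Complex.I := by
      funext w; apply Complex.ext <;> simp
    rw [this]; fun_prop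
  · intro z
    have : P ⟨R z, z.im⟩ = z.re := by
      rw [Peq]
      exact ⟨fun t ht => hm' _ _ _ ht.le, fun t ht => hm' _ _ _ ht.le⟩
    apply Complex.ext
    · exact this
    · rfl
  · intro v _ X hX
    apply Complex.ext
    · exact (Peq ⟨X, v.im⟩ v.re).2 ((hab v X).1 hX)
    · rfl
  · have key : ∀ z w : ℂ, z.im = w.im → P z = P w → z.re < w.re →
        z ∈ ⋃ v ∈ V, {z : ℂ | z.im = v.im ∧ z.re ∈ Icc (a v) (b v)} := by
      intro z w him hPe hlt
      obtain ⟨h1, h2⟩ := (Peq z (P z)).1 rfl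
      obtain ⟨h3, h4⟩ := (Peq w (P z)).1 hPe.symm
      by_cases hv : (⟨P z, z.im⟩ : ℂ) ∈ V
      · exact mem_biUnion hv ⟨rfl, (hab _ _).2 ⟨h1, h2⟩⟩
      exfalso
      have hc : ContinuousAt (fun t : ℝ => R ⟨t, z.im⟩) (P z) := by
        refine ContinuousAt.comp (f := fun t : ℝ => (⟨t, z.im⟩ : ℂ)) (hat _ _ hv) ?_
        have : (fun t : ℝ => (⟨t, z.im⟩ : ℂ)) = fun t : ℝ => (t : ℂ) + (z.im : ℂ) * Complex.I := by
          funext w; apply Complex.ext <;> simp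
        rw [this]; fun_prop
      have e1 : R ⟨P z, z.im⟩ ≤ z.re := by
        refine le_of_tendsto (hc.tendsto.mono_left (nhdsWithin_le_nhds (s := Iio (P z)))) ?_
        filter_upwards [self_mem_nhdsWithin] with t ht using h1 t ht
      have e2 : w.re ≤ R ⟨P z, z.im⟩ := by
        refine ge_of_tendsto (hc.tendsto.mono_left (nhdsWithin_le_nhds (s := Ioi (P z)))) ?_
        filter_upwards [self_mem_nhdsWithin] with t ht
        rw [him]; exact h4 t ht
      linarith
    intro z hz w hw hzw
    have him : z.im = w.im := (Complex.ext_iff.1 hzw).2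
    have hPe : P z = P w := (Complex.ext_iff.1 hzw).1
    apply Complex.ext _ him
    rcases lt_trichotomy z.re w.re with h | h | h
    · exact absurd (key z w him hPe h) hz
    · exact h
    · exact absurd (key w z him.symm hPe.symm h) hw

/-- The left shadow of the graph of a function. -/
def shadowL (f : ℝ → ℝ) (s t : ℝ) : Set ℂ := {z | z.im ∈ Icc s t ∧ z.re ≤ f z.im}

/-- The right shadow of the graph of a function. -/
def shadowR (f : ℝ → ℝ) (s t : ℝ) : Set ℂ := {z | z.im ∈ Icc s t ∧ f z.im ≤ z.re}

theorem isClosed_shadowL {f : ℝ → ℝ} (hf : Continuous f) (s t : ℝ) : IsClosed (shadowL f s t) :=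
  (isClosed_Icc.preimage Complex.continuous_im).inter
    (isClosed_le Complex.continuous_re (hf.comp Complex.continuous_im))

theorem isClosed_shadowR {f : ℝ → ℝ} (hf : Continuous f) (s t : ℝ) : IsClosed (shadowR f s t) :=
  (isClosed_Icc.preimage Complex.continuous_im).inter
    (isClosed_le (hf.comp Complex.continuous_im) Complex.continuous_re)

/-- A ranking of vertical curves is realised by a function that is constant along the curves. -/
theorem exists_rank_function {ι : Type*} [Finite ι] {V : Set ℂ}
    {f : ι → ℝ → ℝ} {lo hi : ι → ℝ} {rk : ι → ℕ} (hf : ∀ i, Continuous (f i))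
    (hinter : ∀ i j, i ≠ j → gr (f i) (lo i) (hi i) ∩ gr (f j) (lo j) (hi j) ⊆ V)
    (hrk : ∀ i j, ∀ y ∈ Icc (lo i) (hi i) ∩ Icc (lo j) (hi j), f i y < f j y → rk i < rk j) :
    ∃ (R : ℂ → ℝ) (C : ℝ), ContinuousOn R Vᶜ ∧
      (∀ z w : ℂ, z.im = w.im → z.re < w.re → R z < R w) ∧ (∀ z : ℂ, |R z - z.re| ≤ C) ∧
      (∀ i, ∀ z ∈ gr (f i) (lo i) (hi i), z ∉ V → R z = rk i + 1) ∧
      (∀ i, ∀ z ∈ gr (f i) (lo i) (hi i), ∀ t < z.re, R ⟨t, z.im⟩ ≤ rk i + 1) ∧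
      (∀ i, ∀ z ∈ gr (f i) (lo i) (hi i), ∀ t > z.re, (rk i + 1 : ℝ) ≤ R ⟨t, z.im⟩) := by
  classical
  have := Fintype.ofFinite ι
  obtain ⟨K, hK⟩ : ∃ K : ℕ, ∀ i, rk i < K := by
    obtain ⟨K, hK⟩ := (finite_range rk).bddAbove
    exact ⟨K + 1, fun i => Nat.lt_succ_of_le (hK ⟨i, rfl⟩)⟩
  obtain ⟨M, hM0, hM⟩ : ∃ M : ℝ, 0 < M ∧ ∀ i, ∀ y ∈ Icc (lo i) (hi i), |f i y| < M := by
    have hcpt : IsCompact (⋃ i, (fun y => |f i y|) '' Icc (lo i) (hi i)) :=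
      isCompact_iUnion fun i => isCompact_Icc.image (hf i).abs
    obtain ⟨M, hM⟩ := hcpt.bddAbove
    refine ⟨|M| + 1, by positivity, fun i y hy => ?_⟩
    have := hM (mem_iUnion.2 ⟨i, y, hy, rfl⟩)
    exact lt_of_le_of_lt (this.trans (le_abs_self M)) (lt_add_one _)
  set A : ℕ → Set ℂ := fun k =>
    {z | z.re ≤ -M} ∪ ⋃ i ∈ {i | rk i < k}, shadowL (f i) (lo i) (hi i) with hA
  set B : ℕ → Set ℂ := fun k =>
    {z | M ≤ z.re} ∪ ⋃ i ∈ {i | k ≤ rk i}, shadowR (f i) (lo i) (hi i) with hB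
  have memA : ∀ k z, z ∈ A k ↔ z.re ≤ -M ∨ ∃ i, rk i < k ∧ z.im ∈ Icc (lo i) (hi i) ∧
      z.re ≤ f i z.im := fun k z => by
    simp only [hA, shadowL, mem_union, mem_ofPred_eq, mem_iUnion, exists_prop]
  have memB : ∀ k z, z ∈ B k ↔ M ≤ z.re ∨ ∃ i, k ≤ rk i ∧ z.im ∈ Icc (lo i) (hi i) ∧
      f i z.im ≤ z.re := fun k z => by
    simp only [hB, shadowR, mem_union, mem_ofPred_eq, mem_iUnion, exists_prop]
  have clA : ∀ k, IsClosed (A k) := fun k =>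
    (isClosed_le Complex.continuous_re continuous_const).union
      ((toFinite _).isClosed_biUnion fun i _ => isClosed_shadowL (hf i) _ _)
  have clB : ∀ k, IsClosed (B k) := fun k =>
    (isClosed_le continuous_const Complex.continuous_re).union
      ((toFinite _).isClosed_biUnion fun i _ => isClosed_shadowR (hf i) _ _)
  have neA : ∀ k, (A k).Nonempty := fun k => ⟨⟨-M, 0⟩, (memA _ _).2 (Or.inl le_rfl)⟩
  have neB : ∀ k, (B k).Nonempty := fun k => ⟨⟨M, 0⟩, (memB _ _).2 (Or.inl le_rfl)⟩
  have trA : ∀ k, ∀ z ∈ A k, ∀ t : ℝ, 0 ≤ t → z - t ∈ A k := by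
    intro k z hz t ht
    rw [memA] at hz ⊢
    simp only [Complex.sub_re, Complex.sub_im, Complex.ofReal_re, Complex.ofReal_im, sub_zero]
    rcases hz with h | ⟨i, h1, h2, h3⟩
    · left; linarith
    · exact Or.inr ⟨i, h1, h2, by linarith⟩
  have trB : ∀ k, ∀ z ∈ B k, ∀ t : ℝ, 0 ≤ t → z + t ∈ B k := by
    intro k z hz t ht
    rw [memB] at hz ⊢
    simp only [Complex.add_re, Complex.add_im, Complex.ofReal_re, Complex.ofReal_im, add_zero]
    rcases hz with h | ⟨i, h1, h2, h3⟩
    · left; linarith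
    · exact Or.inr ⟨i, h1, h2, by linarith⟩
  have AB : ∀ k z, z ∈ A k → z ∈ B k → z ∈ V := by
    intro k z hzA hzB
    rw [memA] at hzA
    rw [memB] at hzB
    rcases hzA with h1 | ⟨i, i1, i2, i3⟩
    · rcases hzB with h2 | ⟨j, j1, j2, j3⟩
      · linarith
      · have := (abs_lt.1 (hM j _ j2)).1
        linarith
    · rcases hzB with h2 | ⟨j, j1, j2, j3⟩
      · have := (abs_lt.1 (hM i _ i2)).2
        linarith
      · have hne : i ≠ j := by rintro rfl; omega
        rcases (j3.trans i3).lt_or_eq with h | h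
        · have := hrk j i _ ⟨j2, i2⟩ h
          omega
        · have e1 : z.re = f i z.im := by linarith
          have e2 : z.re = f j z.im := by linarith
          exact hinter i j hne ⟨⟨i2, e1⟩, ⟨j2, e2⟩⟩
  set σ : ℕ → ℂ → ℝ := fun k => sep (A k) (B k) with hσ
  set R : ℂ → ℝ := fun z => ∑ k ∈ Finset.range (K + 1), σ k z + min (z.re + M) 0 + max (z.re - M) 0
    with hR
  have σmono : ∀ k, ∀ z w : ℂ, z.im = w.im → z.re ≤ w.re → σ k z ≤ σ k w := fun k z w him hre =>
    sep_mono (clA k) (neA k) (neB k) (trA k) (trB k) him hre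
  have σ0 : ∀ k z, 0 ≤ σ k z := fun k z => sep_nonneg z
  have σ1 : ∀ k z, σ k z ≤ 1 := fun k z => sep_le_one z
  have sumlt : ∀ i, ∑ k ∈ Finset.range (K + 1), (if k ≤ rk i then (1 : ℝ) else 0) = rk i + 1 := by
    intro i
    rw [← Finset.sum_filter, Finset.sum_const]
    have : (Finset.range (K + 1)).filter (fun k => k ≤ rk i) = Finset.range (rk i + 1) := by
      ext k
      have := hK i
      simp only [Finset.mem_filter, Finset.mem_range]
      omega
    rw [this]; simp
  have edgeM : ∀ i, ∀ z ∈ gr (f i) (lo i) (hi i), |z.re| < M := fun i z hz => by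
    rw [hz.2]; exact hM i _ hz.1
  have Rle : ∀ i, ∀ z ∈ gr (f i) (lo i) (hi i), ∀ t ≤ z.re, R ⟨t, z.im⟩ ≤ rk i + 1 := by
    intro i z hz t ht
    have h1 := (abs_lt.1 (edgeM i z hz)).2
    have h2 : max (t - M) 0 = 0 := max_eq_right (by linarith)
    have h3 : min (t + M) 0 ≤ 0 := min_le_right _ _
    have h4 : ∑ k ∈ Finset.range (K + 1), σ k ⟨t, z.im⟩ ≤ rk i + 1 := by
      rw [← sumlt i]
      refine Finset.sum_le_sum fun k _ => ?_
      split_ifs with hk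
      · exact σ1 _ _
      · refine (sep_eq_zero ?_).le
        exact (memA _ _).2 (Or.inr ⟨i, not_le.1 hk, hz.1, hz.2 ▸ ht⟩)
    simp only [hR]
    rw [h2]; linarith
  have Rge : ∀ i, ∀ z ∈ gr (f i) (lo i) (hi i), ∀ t ≥ z.re, (∀ k ≤ rk i, (⟨t, z.im⟩ : ℂ) ∉ A k) →
      (rk i + 1 : ℝ) ≤ R ⟨t, z.im⟩ := by
    intro i z hz t ht hnA
    have h1 := (abs_lt.1 (edgeM i z hz)).1
    have h2 : min (t + M) 0 = 0 := min_eq_right (by linarith)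
    have h3 : 0 ≤ max (t - M) 0 := le_max_right _ _
    have h4 : (rk i + 1 : ℝ) ≤ ∑ k ∈ Finset.range (K + 1), σ k ⟨t, z.im⟩ := by
      rw [← sumlt i]
      refine Finset.sum_le_sum fun k _ => ?_
      split_ifs with hk
      · refine (sep_eq_one (clA k) (neA k) ?_ (hnA k hk)).ge
        exact (memB _ _).2 (Or.inr ⟨i, hk, hz.1, hz.2 ▸ ht⟩)
      · exact σ0 _ _
    simp only [hR]
    rw [h2]; linarith
  refine ⟨R, K + 1 + M, ?_, ?_, ?_, ?_, fun i z hz t ht => Rle i z hz t ht.le, ?_⟩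
  · have h1 : ∀ k ∈ Finset.range (K + 1), ContinuousOn (σ k) Vᶜ := fun k _ =>
      (continuousOn_sep (clA k) (clB k) (neA k) (neB k)).mono fun z hz h => hz (AB k z h.1 h.2)
    have h2 : Continuous fun z : ℂ => min (z.re + M) 0 := by fun_prop
    have h3 : Continuous fun z : ℂ => max (z.re - M) 0 := by fun_prop
    exact ((continuousOn_finsetSum _ h1).add h2.continuousOn).add h3.continuousOn
  · intro z w him hre
    have s1 : ∀ k ∈ Finset.range (K + 1), σ k z ≤ σ k w := fun k _ => σmono k z w him hre.le
    have s2 := Finset.sum_le_sum s1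
    have m1 : min (z.re + M) 0 ≤ min (w.re + M) 0 := by gcongr
    have m2 : max (z.re - M) 0 ≤ max (w.re - M) 0 := by gcongr
    simp only [hR]
    by_cases c1 : z.re < -M
    · have : min (z.re + M) 0 < min (w.re + M) 0 := by
        rw [min_eq_left (by linarith : z.re + M ≤ 0)]
        exact lt_min (by linarith) (by linarith)
      linarith
    by_cases c2 : M < w.re
    · have : max (z.re - M) 0 < max (w.re - M) 0 := by
        rw [max_eq_left (by linarith : 0 ≤ w.re - M)]
        exact max_lt (by linarith) (by linarith)
      linarith
    push Not at c1 c2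
    obtain ⟨x, hx, hx'⟩ := ((Ioo_infinite hre).sdiff (finite_range fun i => f i z.im)).nonempty
    set u : ℂ := ⟨x, z.im⟩ with hu
    set k : ℕ := (Finset.univ.filter fun i => z.im ∈ Icc (lo i) (hi i) ∧ f i z.im < x).sup
      fun i => rk i + 1 with hk
    have kK : k ∈ Finset.range (K + 1) := by
      rw [Finset.mem_range, Nat.lt_succ_iff, hk]
      exact Finset.sup_le fun i _ => hK i
    have hk1 : ∀ i, z.im ∈ Icc (lo i) (hi i) → f i z.im < x → rk i + 1 ≤ k := fun i h1 h2 => by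
      rw [hk]
      exact Finset.le_sup (f := fun i => rk i + 1)
        (Finset.mem_filter.2 ⟨Finset.mem_univ i, h1, h2⟩)
    have uA : u ∉ A k := by
      rw [memA]
      rintro (h | ⟨g, g1, g2, g3⟩)
      · have : x ≤ -M := h
        linarith [hx.1]
      · have g4 : x < f g z.im := lt_of_le_of_ne g3 fun h => hx' ⟨g, h.symm⟩
        rw [hk, Finset.lt_sup_iff] at g1
        obtain ⟨g0, h0, h0'⟩ := g1
        obtain ⟨-, h1, h2⟩ := Finset.mem_filter.1 h0
        have := hrk g0 g _ ⟨h1, g2⟩ (h2.trans g4)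
        omega
    have uB : u ∉ B k := by
      rw [memB]
      rintro (h | ⟨g, g1, g2, g3⟩)
      · have : M ≤ x := h
        linarith [hx.2]
      · have g4 : f g z.im < x := lt_of_le_of_ne g3 fun h => hx' ⟨g, h⟩
        have := hk1 g g2 g4
        omega
    have lt1 : σ k z < σ k w := (σmono k z u rfl hx.1.le).trans_lt
      (sep_lt (clA k) (clB k) (neA k) (neB k) (trA k) (trB k) him hx.2 uA uB)
    have := Finset.sum_lt_sum s1 ⟨k, kK, lt1⟩
    linarith
  · intro z
    have h0 : 0 ≤ ∑ k ∈ Finset.range (K + 1), σ k z := Finset.sum_nonneg fun k _ => σ0 k z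
    have h1 : ∑ k ∈ Finset.range (K + 1), σ k z ≤ K + 1 := by
      refine (Finset.sum_le_card_nsmul _ _ 1 fun k _ => σ1 k z).trans ?_
      simp
    have e : R z = ∑ k ∈ Finset.range (K + 1), σ k z + min (z.re + M) 0 + max (z.re - M) 0 := rfl
    rw [e, abs_le]
    rcases le_total (z.re + M) 0 with a1 | a1 <;> rcases le_total (z.re - M) 0 with a2 | a2
    · rw [min_eq_left a1, max_eq_right a2]; constructor <;> linarith
    · exfalso; linarith
    · rw [min_eq_right a1, max_eq_right a2]; constructor <;> linarith
    · rw [min_eq_right a1, max_eq_left a2]; constructor <;> linarith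
  · intro i z hz hzV
    refine le_antisymm (Rle i z hz z.re le_rfl) (Rge i z hz z.re le_rfl fun k hk h => hzV ?_)
    exact AB k z h ((memB _ _).2 (Or.inr ⟨i, hk, hz.1, hz.2.ge⟩))
  · intro i z hz t ht
    refine Rge i z hz t ht.le fun k hk h => ?_
    rw [memA] at h
    rcases h with h | ⟨g, g1, g2, g3⟩
    · have := (abs_lt.1 (edgeM i z hz)).1
      have h' : t ≤ -M := h
      have h'' : z.re < t := ht
      linarith
    · have h' : t ≤ f g z.im := g3
      have h'' : z.re < t := ht
      have h3 := hz.2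
      have := hrk i g _ ⟨hz.1, g2⟩ (by linarith)
      omega

/-- Ranked vertical curves become vertical segments after expanding their common points to
horizontal bars. -/
theorem exists_contraction {ι : Type*} [Finite ι] {V : Set ℂ} (hV : V.Finite)
    (hVi : InjOn Complex.im V)
    {f : ι → ℝ → ℝ} {lo hi : ι → ℝ} {rk : ι → ℕ} (hf : ∀ i, Continuous (f i))
    (hinter : ∀ i j, i ≠ j → gr (f i) (lo i) (hi i) ∩ gr (f j) (lo j) (hi j) ⊆ V)
    (hinj : Function.Injective rk)
    (hrk : ∀ i j, ∀ y ∈ Icc (lo i) (hi i) ∩ Icc (lo j) (hi j), f i y < f j y → rk i < rk j)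
    (hdeg : ∀ v ∈ V, ∃ i j, i ≠ j ∧ v ∈ gr (f i) (lo i) (hi i) ∧ v ∈ gr (f j) (lo j) (hi j)) :
    ∃ (π : ℂ → ℂ) (a b : ℂ → ℝ), Continuous π ∧ Function.Surjective π ∧
      (∀ v ∈ V, a v < b v) ∧
      (∀ v ∈ V, ∀ X ∈ Icc (a v) (b v), π ⟨X, v.im⟩ = v) ∧
      (∀ i, ∀ z ∈ gr (f i) (lo i) (hi i), π ⟨rk i + 1, z.im⟩ = z) ∧
      (∀ i, ∀ v ∈ V, v ∈ gr (f i) (lo i) (hi i) → (rk i + 1 : ℝ) ∈ Icc (a v) (b v)) ∧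
      InjOn π (⋃ v ∈ V, {z : ℂ | z.im = v.im ∧ z.re ∈ Icc (a v) (b v)})ᶜ := by
  obtain ⟨R, C, hR, hmono, hC, hgr, hle, hge⟩ := exists_rank_function hf hinter hrk
  obtain ⟨π, a, b, hπ, -, hs, hab, hbar, hπi⟩ :=
    exists_contraction_of_strictMono hV hVi hR hmono hC
  have hmem : ∀ i, ∀ v ∈ V, v ∈ gr (f i) (lo i) (hi i) → (rk i + 1 : ℝ) ∈ Icc (a v) (b v) :=
    fun i v hv hvi => (hab v hv _).2 ⟨hle i v hvi, hge i v hvi⟩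
  refine ⟨π, a, b, hπ, fun z => ⟨_, hs z⟩, fun v hv => ?_, hbar, fun i z hz => ?_, hmem, hπi⟩
  · obtain ⟨i, j, hij, h1, h2⟩ := hdeg v hv
    have m1 := hmem i v hv h1
    have m2 := hmem j v hv h2
    rcases lt_or_gt_of_ne (hinj.ne hij) with h | h
    · have : (rk i : ℝ) < rk j := by exact_mod_cast h
      linarith [m1.1, m2.2]
    · have : (rk j : ℝ) < rk i := by exact_mod_cast h
      linarith [m2.1, m1.2]
  · by_cases hzV : z ∈ V
    · exact hbar z hzV _ (hmem i z hzV hz)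
    · rw [← hgr i z hz hzV]; exact hs z

theorem Set.Finite.exists_gap {S : Set ℝ} (hS : S.Finite) :
    ∃ ε > 0, ∀ s ∈ S, ∀ t ∈ S, s < t → s + 2 * ε < t := by
  have hfin : ((fun p : ℝ × ℝ => p.2 - p.1) '' ((S ×ˢ S) ∩ {p | p.1 < p.2})).Finite :=
    ((hS.prod hS).subset inter_subset_left).image _
  rcases eq_empty_or_nonempty ((fun p : ℝ × ℝ => p.2 - p.1) '' ((S ×ˢ S) ∩ {p | p.1 < p.2}))
    with h | h
  · refine ⟨1, one_pos, fun s hs t ht hst => ?_⟩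
    have : t - s ∈ ((fun p : ℝ × ℝ => p.2 - p.1) '' ((S ×ˢ S) ∩ {p | p.1 < p.2})) :=
      ⟨(s, t), ⟨⟨hs, ht⟩, hst⟩, rfl⟩
    rw [h] at this
    exact this.elim
  · obtain ⟨⟨s0, t0⟩, ⟨-, h0⟩, hd⟩ := h.csInf_mem hfin
    have h0' : s0 < t0 := h0
    have hd' : t0 - s0 = _ := hd
    refine ⟨(t0 - s0) / 3, by linarith, fun s hs t ht hst => ?_⟩
    have : t0 - s0 ≤ t - s := by
      rw [hd']
      exact csInf_le hfin.bddBelow ⟨(s, t), ⟨⟨hs, ht⟩, hst⟩, rfl⟩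
    linarith

/-- A monotone drawing of a graph is a contraction of horizontal and vertical segments. -/
theorem IsPG.exists_contraction {W V : Set ℂ} {F : Set (Set ℂ)} (h : IsPG W F)
    (hi : ∀ e ∈ F, InjOn Complex.im e) (hW : InjOn Complex.im W) (hVW : V ⊆ W)
    (hdeg : ∀ v ∈ V, ∃ e ∈ F, ∃ f ∈ F, e ≠ f ∧ v ∈ e ∧ v ∈ f) :
    ∃ (π : ℂ → ℂ) (a b : ℂ → ℝ) (x : F → ℝ), Continuous π ∧ Function.Surjective π ∧
      (∀ v ∈ V, a v < b v) ∧
      (∀ v ∈ V, ∀ X ∈ Icc (a v) (b v), π ⟨X, v.im⟩ = v) ∧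
      Function.Injective x ∧
      (∀ e : F, (e : Set ℂ) ∩ W ⊆ V → ∃ u ∈ V, ∃ w ∈ V, u.im < w.im ∧ (e : Set ℂ) ∩ W = {u, w} ∧
        π '' {z | z.re = x e ∧ z.im ∈ Icc u.im w.im} = e ∧
        x e ∈ Icc (a u) (b u) ∧ x e ∈ Icc (a w) (b w) ∧
        ∀ v ∈ V, v.im ∈ Ioo u.im w.im → x e ∉ Icc (a v) (b v)) ∧
      InjOn π (⋃ v ∈ V, {z : ℂ | z.im = v.im ∧ z.re ∈ Icc (a v) (b v)})ᶜ := by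
  classical
  have := h.finE.to_subtype
  have key : ∀ e : F, ∃ p q : ℂ, p.im < q.im ∧ (e : Set ℂ) ∩ W = {p, q} ∧
      ∃ f : ℝ → ℝ, Continuous f ∧ (e : Set ℂ) = gr f p.im q.im := by
    rintro ⟨e, he⟩
    obtain ⟨p, q, hpq, hinc⟩ := h.arc e he
    have hne : p.im ≠ q.im := fun hh => hpq.ne (hi e he hpq.left_mem hpq.right_mem hh)
    rcases lt_or_gt_of_ne hne with hlt | hlt
    · exact ⟨p, q, hlt, hinc, hpq.exists_gr (hi e he) hlt⟩
    · exact ⟨q, p, hlt, by rw [pair_comm]; exact hinc, hpq.symm.exists_gr (hi e he) hlt⟩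
  choose p q hpq hinc f hf hgr using key
  have pW : ∀ e, p e ∈ W := fun e => ((hinc e).ge (by simp) : p e ∈ (e : Set ℂ) ∩ W).2
  have qW : ∀ e, q e ∈ W := fun e => ((hinc e).ge (by simp) : q e ∈ (e : Set ℂ) ∩ W).2
  obtain ⟨ε, hε, hgap⟩ := (h.finV.image Complex.im).exists_gap
  have gap : ∀ v ∈ W, ∀ w ∈ W, v.im < w.im → v.im + 2 * ε < w.im := fun v hv w hw =>
    hgap _ ⟨v, hv, rfl⟩ _ ⟨w, hw, rfl⟩
  have mem : ∀ e : F, ∀ y ∈ Icc (p e).im (q e).im, (⟨f e y, y⟩ : ℂ) ∈ (e : Set ℂ) := fun e y hy => by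
    rw [hgr e]; exact ⟨hy, rfl⟩
  have hend : ∀ e : F, ∀ z ∈ (e : Set ℂ), z ∈ W → z = p e ∨ z = q e := fun e z hz hzW => by
    have : z ∈ (e : Set ℂ) ∩ W := ⟨hz, hzW⟩
    rw [hinc e] at this; exact this
  have hne : ∀ i j : F, i ≠ j → ∀ y ∈ Ioo (p i).im (q i).im, y ∈ Icc (p j).im (q j).im →
      f i y ≠ f j y := by
    intro i j hij y hy hy' heq
    have h1 := mem i y ⟨hy.1.le, hy.2.le⟩
    have h2 := mem j y hy'
    rw [← heq] at h2
    have h3 := h.inter i i.2 j j.2 (fun hh => hij (Subtype.ext hh)) ⟨h1, h2⟩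
    rcases hend i _ h1 h3 with hh | hh
    · have := congrArg Complex.im hh
      exact hy.1.ne' this
    · have := congrArg Complex.im hh
      exact hy.2.ne this
  have egap : ∀ e, (p e).im + 2 * ε < (q e).im := fun e => gap _ (pW e) _ (qW e) (hpq e)
  obtain ⟨rk, hinj, hrk0⟩ := exists_rank_gr (f := f) (lo := fun e => (p e).im + ε)
    (hi := fun e => (q e).im - ε) hf (fun e => by have := egap e; linarith)
    (fun i j hij y hy => hne i j hij y ⟨by linarith [hy.1.1], by linarith [hy.1.2]⟩
      ⟨by linarith [hy.2.1], by linarith [hy.2.2]⟩)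
  have hrk : ∀ i j, ∀ y ∈ Icc (p i).im (q i).im ∩ Icc (p j).im (q j).im, f i y < f j y →
      rk i < rk j := by
    intro i j y hy hlt
    have hij : i ≠ j := by rintro rfl; exact lt_irrefl _ hlt
    obtain ⟨l, hl, hli, hlj, hly, hl'⟩ : ∃ l ∈ W, (p i).im ≤ l.im ∧ (p j).im ≤ l.im ∧ l.im ≤ y ∧
        (l = p i ∨ l = p j) := by
      rcases le_total (p i).im (p j).im with hh | hh
      · exact ⟨p j, pW j, hh, le_rfl, hy.2.1, Or.inr rfl⟩
      · exact ⟨p i, pW i, le_rfl, hh, hy.1.1, Or.inl rfl⟩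
    obtain ⟨u, hu, hui, huj, huy, hu'⟩ : ∃ u ∈ W, u.im ≤ (q i).im ∧ u.im ≤ (q j).im ∧ y ≤ u.im ∧
        (u = q i ∨ u = q j) := by
      rcases le_total (q i).im (q j).im with hh | hh
      · exact ⟨q i, qW i, le_rfl, hh, hy.1.2, Or.inl rfl⟩
      · exact ⟨q j, qW j, hh, le_rfl, hy.2.2, Or.inr rfl⟩
    have hlu : l.im < u.im := by
      rcases (hly.trans huy).lt_or_eq with hh | hh
      · exact hh
      exfalso
      have hyl : y = l.im := by linarith
      have hy1 := hy.1
      have hy2 := hy.2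
      have on : ∀ e : F, y ∈ Icc (p e).im (q e).im → y ≤ (p e).im ∨ (q e).im ≤ y →
          (⟨f e y, y⟩ : ℂ) = l := by
        intro e hye hor
        have hm := mem e y hye
        have hw : (⟨f e y, y⟩ : ℂ) ∈ W := by
          rcases hor with h1 | h1
          · have : y = (p e).im := le_antisymm h1 hye.1
            have hpe : p e ∈ (e : Set ℂ) := ((hinc e).ge (by simp) : p e ∈ (e : Set ℂ) ∩ W).1
            rw [hi e e.2 hm hpe this]; exact pW e
          · have : y = (q e).im := le_antisymm hye.2 h1
            have hqe : q e ∈ (e : Set ℂ) := ((hinc e).ge (by simp) : q e ∈ (e : Set ℂ) ∩ W).1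
            rw [hi e e.2 hm hqe this]; exact qW e
        exact hW hw hl hyl
      have h1 : y ≤ (p i).im ∨ y ≤ (p j).im := by
        rcases hl' with rfl | rfl
        · exact Or.inl hyl.le
        · exact Or.inr hyl.le
      have h2 : (q i).im ≤ y ∨ (q j).im ≤ y := by
        rcases hu' with rfl | rfl
        · left; linarith
        · right; linarith
      have h3 := hpq i
      have h4 := hpq j
      have h5 : (⟨f i y, y⟩ : ℂ) = ⟨f j y, y⟩ := by
        rcases h1 with h1 | h1 <;> rcases h2 with h2 | h2
        · linarith
        · rw [on i hy1 (Or.inl h1), on j hy2 (Or.inr h2)]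
        · rw [on i hy1 (Or.inr h2), on j hy2 (Or.inl h1)]
        · linarith
      exact hlt.ne (Complex.ext_iff.1 h5).1
    have hS : (insert y (Ioo l.im u.im)).OrdConnected := by
      refine ⟨fun s hs t ht c hc => ?_⟩
      by_cases hcy : c = y
      · exact Or.inl hcy
      right
      constructor
      · rcases hs with rfl | hs
        · exact hly.trans_lt (lt_of_le_of_ne hc.1 (Ne.symm hcy))
        · exact hs.1.trans_le hc.1
      · rcases ht with rfl | ht
        · exact (lt_of_le_of_ne hc.2 hcy).trans_le huy
        · exact hc.2.trans_lt ht.2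
    refine hrk0 i j (l.im + ε) ⟨⟨?_, ?_⟩, ⟨?_, ?_⟩⟩ ?_
    iterate 4 have := gap l hl u hu hlu; linarith
    refine lt_of_common (hf i) (hf j) hS ?_ (mem_insert _ _)
      (mem_insert_of_mem _ ⟨by linarith, by linarith [gap l hl u hu hlu]⟩) hlt
    rintro y' (rfl | hy')
    · exact hlt.ne
    · exact hne i j hij y' ⟨by linarith [hy'.1], by linarith [hy'.2]⟩
        ⟨by linarith [hy'.1], by linarith [hy'.2]⟩
  set lo : F → ℝ := fun e => if p e ∈ V then (p e).im else (p e).im + ε with hlo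
  set hi' : F → ℝ := fun e => if q e ∈ V then (q e).im else (q e).im - ε with hhi
  have lo_ge : ∀ e, (p e).im ≤ lo e := fun e => by
    simp only [hlo]; split_ifs <;> linarith
  have lo_le : ∀ e, lo e ≤ (p e).im + ε := fun e => by
    simp only [hlo]; split_ifs <;> linarith
  have hi_le : ∀ e, hi' e ≤ (q e).im := fun e => by
    simp only [hhi]; split_ifs <;> linarith
  have hi_ge : ∀ e, (q e).im - ε ≤ hi' e := fun e => by
    simp only [hhi]; split_ifs <;> linarith
  have sub : ∀ e, Icc (lo e) (hi' e) ⊆ Icc (p e).im (q e).im := fun e =>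
    Icc_subset_Icc (lo_ge e) (hi_le e)
  have grsub : ∀ e : F, gr (f e) (lo e) (hi' e) ⊆ (e : Set ℂ) := fun e z hz => by
    rw [hgr e]; exact ⟨sub e hz.1, hz.2⟩
  have memV : ∀ e : F, ∀ z ∈ gr (f e) (lo e) (hi' e), z ∈ W → z ∈ V := by
    intro e z hz hzW
    by_contra hzV
    rcases hend e z (grsub e hz) hzW with rfl | rfl
    · have h1 := hz.1.1
      simp only [hlo] at h1
      rw [if_neg hzV] at h1
      linarith
    · have h1 := hz.1.2
      simp only [hhi] at h1
      rw [if_neg hzV] at h1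
      linarith
  have Vmem : ∀ e : F, ∀ z ∈ (e : Set ℂ), z ∈ V → z ∈ gr (f e) (lo e) (hi' e) := by
    intro e z hz hzV
    have hz2 := hgr e ▸ hz
    refine ⟨?_, hz2.2⟩
    have := egap e
    rcases hend e z hz (hVW hzV) with rfl | rfl
    · have h1 : lo e = (p e).im := if_pos hzV
      exact ⟨h1.le, by linarith [hi_ge e]⟩
    · have h1 : hi' e = (q e).im := if_pos hzV
      exact ⟨by linarith [lo_le e], h1.ge⟩
  obtain ⟨π, a, b, hπ, hsurj, hab, hbar, hπe, hx, hoff⟩ :=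
    _root_.exists_contraction (V := V) (f := f) (lo := lo) (hi := hi') (rk := rk)
      (h.finV.subset hVW) (hW.mono hVW) hf
      (fun i j hij z hz => memV i z hz.1 (h.inter i i.2 j j.2 (fun hh => hij (Subtype.ext hh))
        ⟨grsub i hz.1, grsub j hz.2⟩)) hinj
      (fun i j y hy => hrk i j y ⟨sub i hy.1, sub j hy.2⟩)
      (fun v hv => by
        obtain ⟨e, he, e', he', hne', h1, h2⟩ := hdeg v hv
        exact ⟨⟨e, he⟩, ⟨e', he'⟩, fun hh => hne' (congrArg Subtype.val hh),
          Vmem ⟨e, he⟩ v h1 hv, Vmem ⟨e', he'⟩ v h2 hv⟩)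
  refine ⟨π, a, b, fun e => rk e + 1, hπ, hsurj, hab, hbar, ?_, ?_, hoff⟩
  · intro i j hij
    exact hinj (by exact_mod_cast (add_right_cancel hij : (rk i : ℝ) = rk j))
  · intro e heV
    have hp : p e ∈ (e : Set ℂ) ∩ W := (hinc e).ge (by simp)
    have hq : q e ∈ (e : Set ℂ) ∩ W := (hinc e).ge (by simp)
    have h1 : lo e = (p e).im := if_pos (heV hp)
    have h2 : hi' e = (q e).im := if_pos (heV hq)
    have hge : (e : Set ℂ) = gr (f e) (lo e) (hi' e) := by rw [h1, h2]; exact hgr e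
    refine ⟨p e, heV hp, q e, heV hq, hpq e, hinc e, ?_, hx e _ (heV hp) (hge ▸ hp.1),
      hx e _ (heV hq) (hge ▸ hq.1), ?_⟩
    · ext z
      constructor
      · rintro ⟨w, ⟨hw1, hw2⟩, rfl⟩
        have hm := mem e w.im hw2
        have := hπe e _ (hge ▸ hm)
        have hw : w = ⟨rk e + 1, w.im⟩ := Complex.ext hw1 rfl
        rw [hw]
        simp only at this
        rw [this]; exact hm
      · intro hz
        have hz2 : z ∈ gr (f e) (p e).im (q e).im := hgr e ▸ hz
        exact ⟨⟨rk e + 1, z.im⟩, ⟨rfl, hz2.1⟩, hπe e z (hge ▸ hz)⟩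
    · intro v hv hvi hx'
      have hm := mem e v.im ⟨hvi.1.le, hvi.2.le⟩
      have e1 := hπe e _ (hge ▸ hm)
      have e2 := hbar v hv _ hx'
      simp only at e1
      rw [e1] at e2
      rw [e2] at hm
      rcases hend e v hm (hVW hv) with rfl | rfl
      · exact lt_irrefl _ hvi.1
      · exact lt_irrefl _ hvi.2

theorem IsPG.image {V : Set ℂ} {E : Set (Set ℂ)} (h : IsPG V E) (φ : ℂ ≃ₜ ℂ) :
    IsPG (φ '' V) ((fun e => φ '' e) '' E) where
  finV := h.finV.image _
  finE := h.finE.image _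
  arc := by
    rintro _ ⟨e, he, rfl⟩
    obtain ⟨a, b, hab, hi⟩ := h.arc e he
    refine ⟨φ a, φ b, hab.image φ.continuous.continuousOn φ.injective.injOn, ?_⟩
    simp only
    rw [← image_inter φ.injective, hi, image_pair]
  inter := by
    rintro _ ⟨e, he, rfl⟩ _ ⟨f, hf, rfl⟩ hne
    simp only at hne ⊢
    rw [← image_inter φ.injective]
    exact image_mono (h.inter e he f hf fun hh => hne (hh ▸ rfl))

/-- In a 2-connected plane graph each vertex lies on two edges. -/
theorem IsPG.exists_two_edges {V : Set ℂ} {E : Set (Set ℂ)} (h : IsPG V E)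
    (h2 : ∀ u ∈ V, ∀ a ∈ V \ {u}, ∀ b ∈ V \ {u}, (adjGraph E u).Reachable a b)
    {v p q : ℂ} (hv : v ∈ V) (hp : p ∈ V) (hq : q ∈ V) (hpq : p ≠ q) (hvp : v ≠ p) (hvq : v ≠ q) :
    ∃ e ∈ E, ∃ f ∈ E, e ≠ f ∧ v ∈ e ∧ v ∈ f := by
  have step : ∀ u ∈ V, ∀ w ∈ V, u ≠ w → v ≠ u → v ≠ w →
      ∃ y, y ≠ u ∧ ∃ e ∈ E, IsArc e v y := by
    intro u hu w hw huw hvu hvw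
    obtain ⟨W⟩ := h2 u hu v ⟨hv, hvu⟩ w ⟨hw, huw.symm⟩
    cases W with
    | nil => exact absurd rfl hvw
    | cons hadj _ =>
      obtain ⟨-, hy, he⟩ := hadj
      exact ⟨_, hy, he⟩
  obtain ⟨y, -, e, he, hey⟩ := step p hp q hq hpq hvp hvq
  have hyV : y ∈ V := ((h.inter_eq he hey).ge (by simp) : y ∈ e ∩ V).2
  obtain ⟨w, hw, hyw, hvw⟩ : ∃ w ∈ V, y ≠ w ∧ v ≠ w := by
    by_cases hyp : y = p
    · exact ⟨q, hq, hyp ▸ hpq, hvq⟩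
    · exact ⟨p, hp, hyp, hvp⟩
  obtain ⟨x, hny, f, hf, hfy⟩ := step y hyV w hw hyw hey.ne hvw
  refine ⟨e, he, f, hf, ?_, hey.left_mem, hfy.left_mem⟩
  rintro rfl
  have : x ∈ ({v, y} : Set ℂ) := by
    rw [← h.inter_eq he hey, h.inter_eq he hfy]; simp
  rcases this with hh | hh
  · exact hfy.ne hh.symm
  · exact hny hh

/-- Every plane graph is contained in one that has a monotone drawing with all degrees at
least two. -/
theorem IsPG.exists_drawing {V : Set ℂ} {E : Set (Set ℂ)} (h : IsPG V E) :
    ∃ (W : Set ℂ) (F : Set (Set ℂ)) (φ : ℂ ≃ₜ ℂ), V ⊆ W ∧ E ⊆ F ∧ IsPG W F ∧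
      (∀ e ∈ E, e ∩ W ⊆ V) ∧ (∀ v ∈ V, ∃ e ∈ F, ∃ f ∈ F, e ≠ f ∧ v ∈ e ∧ v ∈ f) ∧
      (∀ e ∈ F, InjOn Complex.im (φ '' e)) ∧ InjOn Complex.im (φ '' W) := by
  obtain ⟨R, hR, hball⟩ : ∃ R > 0, carr V E ⊆ ball 0 R := by
    obtain ⟨R, hR⟩ := h.isCompact.isBounded.subset_ball 0
    exact ⟨|R| + 1, by positivity, hR.trans (ball_subset_ball (by linarith [le_abs_self R]))⟩
  have hVb : V ⊆ ball 0 R := subset_union_left.trans hball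
  have hEb : ∀ e ∈ E, e ⊆ ball 0 R := fun e he =>
    (subset_sUnion_of_mem he).trans (subset_union_right.trans hball)
  have hbs : ∀ z ∈ ball (0 : ℂ) R, z ∉ sphere (0 : ℂ) R := fun z hz hz' =>
    (mem_ball.1 hz).ne (mem_sphere.1 hz')
  set A := gr (fun y => -semi R y) (-R) R with hAdef
  set B := gr (semi R) (-R) R with hBdef
  have hAB : A ∪ B = sphere 0 R := gr_semi_union hR
  have hl := (isLens_semi hR).isTwoArc
  set p : ℂ := ⟨-semi R (-R), -R⟩ with hp
  set q : ℂ := ⟨-semi R R, R⟩ with hq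
  have hA : IsArc A p q := hl.left
  have hB : IsArc B p q := hl.right
  have hABi : A ∩ B = {p, q} := hl.inter
  have hAs : A ⊆ sphere 0 R := hAB ▸ subset_union_left
  have hBs : B ⊆ sphere 0 R := hAB ▸ subset_union_right
  have hne : A ≠ B := by
    rintro hh
    rw [hh, inter_self] at hABi
    have := hB.infinite
    rw [hABi] at this
    exact this (toFinite _)
  have hps : p ∈ sphere (0 : ℂ) R := hAs hA.left_mem
  have hqs : q ∈ sphere (0 : ℂ) R := hAs hA.right_mem
  have hpqs : ({p, q} : Set ℂ) ⊆ sphere 0 R := pair_subset hps hqs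
  have hEpq : ∀ e ∈ E, e ∩ (V ∪ {p, q}) = e ∩ V := by
    intro e he
    rw [inter_union_distrib_left, union_eq_left]
    rintro z ⟨hz, hz'⟩
    exact (hbs z (hEb e he hz) (hpqs hz')).elim
  have hV0 : (V ∪ {p, q}) ∩ sphere 0 R ⊆ {p, q} := by
    rintro z ⟨hz | hz, hzs⟩
    · exact (hbs z (hVb hz) hzs).elim
    · exact hz
  have h0 : IsPG (V ∪ {p, q}) (insert A (insert B E)) := by
    refine ⟨h.finV.union (toFinite _), (h.finE.insert _).insert _, ?_, ?_⟩
    · rintro e (rfl | rfl | he)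
      · exact ⟨p, q, hA, Subset.antisymm (fun z hz => hV0 ⟨hz.2, hAs hz.1⟩)
          (pair_subset ⟨hA.left_mem, by simp⟩ ⟨hA.right_mem, by simp⟩)⟩
      · exact ⟨p, q, hB, Subset.antisymm (fun z hz => hV0 ⟨hz.2, hBs hz.1⟩)
          (pair_subset ⟨hB.left_mem, by simp⟩ ⟨hB.right_mem, by simp⟩)⟩
      · obtain ⟨a, b, hab, hi⟩ := h.arc e he
        exact ⟨a, b, hab, (hEpq e he).trans hi⟩
    · rintro e (rfl | rfl | he) f (rfl | rfl | hf) hef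
      · exact absurd rfl hef
      · rw [hABi]; exact subset_union_right
      · exact fun z hz => (hbs z (hEb f hf hz.2) (hAs hz.1)).elim
      · rw [inter_comm, hABi]; exact subset_union_right
      · exact absurd rfl hef
      · exact fun z hz => (hbs z (hEb f hf hz.2) (hBs hz.1)).elim
      · exact fun z hz => (hbs z (hEb e he hz.1) (hAs hz.2)).elim
      · exact fun z hz => (hbs z (hEb e he hz.1) (hBs hz.2)).elim
      · exact (h.inter e he f hf hef).trans subset_union_left
  have hK0 : carr (V ∪ {p, q}) (insert A (insert B E)) ⊆ closedBall 0 R := by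
    refine union_subset (union_subset (hVb.trans ball_subset_closedBall)
      (hpqs.trans sphere_subset_closedBall)) (sUnion_subset ?_)
    rintro e (rfl | rfl | he)
    · exact hAs.trans sphere_subset_closedBall
    · exact hBs.trans sphere_subset_closedBall
    · exact (hEb e he).trans ball_subset_closedBall
  obtain ⟨F, hEF, hF, hKF, h2⟩ := h0.exists_enlargement hA (mem_insert _ _)
    (mem_insert_of_mem _ (mem_insert _ _)) hAB hV0 hK0
  have hAF : A ∈ F := hEF (mem_insert _ _)
  have hBF : B ∈ F := hEF (mem_insert_of_mem _ (mem_insert _ _))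
  have hdeg : ∀ v ∈ V, ∃ e ∈ F, ∃ f ∈ F, e ≠ f ∧ v ∈ e ∧ v ∈ f := fun v hv =>
    hF.exists_two_edges h2 (Or.inl hv) (p := p) (q := q) (by simp) (by simp) hA.ne
      (fun hh => hbs v (hVb hv) (hh ▸ hps)) (fun hh => hbs v (hVb hv) (hh ▸ hqs))
  obtain ⟨φ, hφ, hχ⟩ := hF.exists_monotone hR hAF hBF hKF h2
  refine ⟨V ∪ {p, q}, F, φ, subset_union_left,
    fun e he => hEF (mem_insert_of_mem _ (mem_insert_of_mem _ he)), hF,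
    fun e he => (hEpq e he).trans_subset inter_subset_right, hdeg, hφ, ?_⟩
  rwa [inter_eq_left.2] at hχ
  rintro v (hv | rfl | rfl)
  · obtain ⟨e, he, -, -, -, hve, -⟩ := hdeg v hv
    exact ⟨e, he, hve⟩
  · exact ⟨A, hAF, hA.left_mem⟩
  · exact ⟨A, hAF, hA.right_mem⟩

theorem injective_image_arc (G : PlaneGraph) : Function.Injective fun e => G.arc e '' Icc 0 1 := by
  intro e f hef
  by_contra hne
  have h1 : G.arc e (1 / 2) ∈ G.arc e '' Icc 0 1 := ⟨1 / 2, by norm_num, rfl⟩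
  have hef' : G.arc e '' Icc 0 1 = G.arc f '' Icc 0 1 := hef
  rw [hef'] at h1
  obtain ⟨s, hs, hs'⟩ := h1
  exact G.arcs_disj e f hne (1 / 2) (by norm_num) s hs hs'.symm

theorem isPG_of_planeGraph (G : PlaneGraph) (ψ : ℝ × ℝ ≃ₜ ℂ) :
    IsPG (ψ '' range G.vpos) (range fun e => ψ '' (G.arc e '' Icc 0 1)) ∧
      ∀ e, ψ '' (G.arc e '' Icc 0 1) ∩ ψ '' range G.vpos =
        {ψ (G.vpos (G.src e)), ψ (G.vpos (G.tgt e))} := by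
  have := G.Vfin
  have := G.Efin
  have hinc : ∀ e, ψ '' (G.arc e '' Icc 0 1) ∩ ψ '' range G.vpos =
        {ψ (G.vpos (G.src e)), ψ (G.vpos (G.tgt e))} := by
    intro e
    rw [← image_inter ψ.injective, ← image_pair]
    congr 1
    ext z
    constructor
    · rintro ⟨⟨t, ht, rfl⟩, v, hv⟩
      rcases ht.1.eq_or_lt with rfl | h0
      · left; exact G.arc_src e
      rcases ht.2.eq_or_lt with rfl | h1
      · right; exact G.arc_tgt e
      exact absurd hv.symm (G.int_avoid e t ⟨h0, h1⟩ v)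
    · rintro (rfl | rfl)
      · exact ⟨⟨0, by norm_num, G.arc_src e⟩, _, rfl⟩
      · exact ⟨⟨1, by norm_num, G.arc_tgt e⟩, _, rfl⟩
  refine ⟨⟨(finite_range _).image _, finite_range _, ?_, ?_⟩, hinc⟩
  · rintro _ ⟨e, rfl⟩
    refine ⟨_, _, ?_, hinc e⟩
    refine ⟨fun t => ψ (G.arc e t), ψ.continuous.comp_continuousOn (G.arc_cont e),
      ψ.injective.comp_injOn (G.arc_inj e), ?_, ?_, ?_⟩
    · exact congrArg ψ (G.arc_src e)
    · exact congrArg ψ (G.arc_tgt e)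
    · simp only
      rw [← image_comp]; rfl
  · rintro _ ⟨e, rfl⟩ _ ⟨f, rfl⟩ hne
    simp only at hne ⊢
    rw [← image_inter ψ.injective]
    refine image_mono ?_
    have hef : e ≠ f := fun h => hne (h ▸ rfl)
    rintro _ ⟨⟨t, ht, rfl⟩, s, hs, hts⟩
    rcases ht.1.eq_or_lt with rfl | h0
    · exact ⟨_, (G.arc_src e).symm⟩
    rcases ht.2.eq_or_lt with rfl | h1
    · exact ⟨_, (G.arc_tgt e).symm⟩
    exact absurd hts.symm (G.arcs_disj e f hef t ⟨h0, h1⟩ s hs)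

/-- Proposition 3.3: every 1-connected (connected and bridgeless) loopless
planar multigraph is the contraction of a Mondrian diagram.  There are a
Mondrian diagram `D`, bijections `φ, ψ` between vertices/edges of `G` and
horizontal/vertical segments of `D` matching incidences, and a continuous
surjection `π` of the plane which contracts each horizontal segment of `D`
to the corresponding vertex of `G`, maps each vertical segment of `D` onto
the corresponding edge arc of `G`, and is injective away from the horizontal
segments — i.e. contracting the horizontal segments of `D` yields a plane
graph isotopic to `G`. -/
theorem stmt_7 (G : PlaneGraph)
    (hconn : ∀ v w : G.V, Relation.ReflTransGen (G.AdjOff ∅) v w)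
    (hbridgeless : ∀ e : G.E,
      Relation.ReflTransGen (G.AdjOff {e}) (G.src e) (G.tgt e)) :
    ∃ D : Mondrian, ∃ (φ : G.V ≃ D.H) (ψ : G.E ≃ D.Vs),
      (∀ e : G.E,
        (D.bot (ψ e) = φ (G.src e) ∧ D.top (ψ e) = φ (G.tgt e)) ∨
        (D.bot (ψ e) = φ (G.tgt e) ∧ D.top (ψ e) = φ (G.src e))) ∧
      ∃ π : ℝ × ℝ → ℝ × ℝ,
        Continuous π ∧ Function.Surjective π ∧
        (∀ v : G.V, π '' D.hseg (φ v) = {G.vpos v}) ∧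
        (∀ e : G.E, π '' D.vseg (ψ e) = G.arc e '' Set.Icc 0 1) ∧
        Set.InjOn π (⋃ i, D.hseg i)ᶜ := by
  classical
  set κ : ℝ × ℝ ≃ₜ ℂ := Complex.equivRealProdCLM.symm.toHomeomorph with hκ
  have κre : ∀ z, (κ z).re = z.1 := fun z => rfl
  have κim : ∀ z, (κ z).im = z.2 := fun z => rfl
  obtain ⟨hPG, hends⟩ := isPG_of_planeGraph G κ
  obtain ⟨W, F, Φ, hVW, hEF, hWF, hEW, hdeg, hΦ, hΦ'⟩ := hPG.exists_drawing
  obtain ⟨π, a, b, x, hπ, hsurj, hab, hbar, hx, hedge, hoff⟩ :=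
    (hWF.image Φ).exists_contraction (V := Φ '' (κ '' range G.vpos))
      (by rintro _ ⟨e, he, rfl⟩; exact hΦ e he) hΦ' (image_mono hVW) (by
        rintro _ ⟨v, hv, rfl⟩
        obtain ⟨e, he, f, hf, hef, h1, h2⟩ := hdeg v hv
        exact ⟨_, ⟨e, he, rfl⟩, _, ⟨f, hf, rfl⟩, fun hh => hef (Φ.injective.image_injective hh),
          ⟨v, h1, rfl⟩, ⟨v, h2, rfl⟩⟩)
  set P : G.V → ℂ := fun v => Φ (κ (G.vpos v)) with hP
  have hPinj : Function.Injective P := fun v w h => G.vinj (κ.injective (Φ.injective h))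
  have hPmem : ∀ v, P v ∈ Φ '' (κ '' range G.vpos) := fun v =>
    ⟨_, ⟨_, ⟨v, rfl⟩, rfl⟩, rfl⟩
  have hrange : ∀ z ∈ Φ '' (κ '' range G.vpos), ∃ v, P v = z := by
    rintro _ ⟨_, ⟨_, ⟨v, rfl⟩, rfl⟩, rfl⟩; exact ⟨v, rfl⟩
  let S : G.E → ((fun e => Φ '' e) '' F : Set (Set ℂ)) := fun e =>
    ⟨Φ '' (κ '' (G.arc e '' Icc 0 1)), _, hEF ⟨e, rfl⟩, rfl⟩
  have hSinj : Function.Injective S := fun e f h => by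
    have h1 := congrArg Subtype.val h
    exact injective_image_arc G (κ.injective.image_injective (Φ.injective.image_injective h1))
  have hSW : ∀ e, (S e : Set ℂ) ∩ Φ '' W = {P (G.src e), P (G.tgt e)} := by
    intro e
    have h1 : κ '' (G.arc e '' Icc 0 1) ∩ W = κ '' (G.arc e '' Icc 0 1) ∩ κ '' range G.vpos :=
      Subset.antisymm (fun z hz => ⟨hz.1, hEW _ ⟨e, rfl⟩ hz⟩) (inter_subset_inter_right _ hVW)
    show Φ '' (κ '' (G.arc e '' Icc 0 1)) ∩ Φ '' W = _
    rw [← image_inter Φ.injective, h1, hends, image_pair]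
  have key : ∀ e, ∃ u w : G.V, (P u).im < (P w).im ∧
      ((u = G.src e ∧ w = G.tgt e) ∨ (u = G.tgt e ∧ w = G.src e)) ∧
      π '' {z | z.re = x (S e) ∧ z.im ∈ Icc (P u).im (P w).im} = S e ∧
      x (S e) ∈ Icc (a (P u)) (b (P u)) ∧ x (S e) ∈ Icc (a (P w)) (b (P w)) ∧
      ∀ v : G.V, (P v).im ∈ Ioo (P u).im (P w).im → x (S e) ∉ Icc (a (P v)) (b (P v)) := by
    intro e
    obtain ⟨u, hu, w, hw, hlt, h1, h2, h3, h4, h5⟩ := hedge (S e) (by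
      rw [hSW]; exact pair_subset (hPmem _) (hPmem _))
    obtain ⟨u, rfl⟩ := hrange u hu
    obtain ⟨w, rfl⟩ := hrange w hw
    refine ⟨u, w, hlt, ?_, h2, h3, h4, fun v => h5 _ (hPmem v)⟩
    rw [hSW, pair_eq_pair_iff] at h1
    rcases h1 with ⟨h6, h7⟩ | ⟨h6, h7⟩
    · exact Or.inl ⟨(hPinj h6).symm, (hPinj h7).symm⟩
    · exact Or.inr ⟨(hPinj h7).symm, (hPinj h6).symm⟩
  choose u w hlt hends' himg hu hw hv using key
  have him : ∀ v v' : G.V, (P v).im = (P v').im → v = v' := fun v v' h =>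
    hPinj (hΦ' (image_mono hVW (hPmem v)) (image_mono hVW (hPmem v')) h)
  let D : Mondrian :=
    { H := G.V
      Vs := G.E
      Hfin := G.Vfin
      Vfin := G.Efin
      hx1 := fun v => a (P v)
      hx2 := fun v => b (P v)
      hy := fun v => (P v).im
      hlt := fun v => hab _ (hPmem v)
      vx := fun e => x (S e)
      vy1 := fun e => (P (u e)).im
      vy2 := fun e => (P (w e)).im
      vlt := hlt
      bot := u
      top := w
      bot_mem := fun e => ⟨rfl, hu e⟩
      top_mem := fun e => ⟨rfl, hw e⟩
      hdisj := fun i j hij h => absurd (him i j h) hij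
      vdisj := fun e f hef h => absurd (hSinj (hx h)) hef
      vint := fun e i h1 h2 => hv e i ⟨h1, h2⟩ }
  have hseg : ∀ v : G.V, κ '' D.hseg v = {z | z.im = (P v).im ∧ z.re ∈ Icc (a (P v)) (b (P v))} := by
    intro v
    ext z
    constructor
    · rintro ⟨z, hz, rfl⟩; exact hz
    · intro hz; exact ⟨κ.symm z, hz, κ.apply_symm_apply z⟩
  have vseg : ∀ e : G.E, κ '' D.vseg e =
      {z | z.re = x (S e) ∧ z.im ∈ Icc (P (u e)).im (P (w e)).im} := by
    intro e
    ext z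
    constructor
    · rintro ⟨z, hz, rfl⟩; exact hz
    · intro hz; exact ⟨κ.symm z, hz, κ.apply_symm_apply z⟩
  refine ⟨D, Equiv.refl _, Equiv.refl _, hends', fun z => κ.symm (Φ.symm (π (κ z))), ?_, ?_, ?_,
    ?_, ?_⟩
  · fun_prop
  · exact κ.symm.surjective.comp (Φ.symm.surjective.comp (hsurj.comp κ.surjective))
  · intro v
    have h1 : (fun z => κ.symm (Φ.symm (π (κ z)))) '' D.hseg v =
        (fun z => κ.symm (Φ.symm (π z))) '' (κ '' D.hseg v) := by rw [← image_comp]; rfl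
    refine h1.trans ?_
    rw [hseg]
    have h2 : ∀ z ∈ {z : ℂ | z.im = (P v).im ∧ z.re ∈ Icc (a (P v)) (b (P v))}, π z = P v := by
      intro z hz
      have h3 := hbar _ (hPmem v) z.re hz.2
      rwa [← hz.1] at h3
    ext y
    constructor
    · rintro ⟨z, hz, rfl⟩
      simp only [mem_singleton_iff]
      rw [h2 z hz]
      simp [hP]
    · rintro rfl
      have hz : (⟨a (P v), (P v).im⟩ : ℂ) ∈
          {z : ℂ | z.im = (P v).im ∧ z.re ∈ Icc (a (P v)) (b (P v))} :=
        ⟨rfl, le_rfl, (hab _ (hPmem v)).le⟩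
      refine ⟨_, hz, ?_⟩
      simp only
      rw [h2 _ hz]
      simp [hP]
  · intro e
    have h1 : (fun z => κ.symm (Φ.symm (π (κ z)))) '' D.vseg e =
        (fun z => κ.symm (Φ.symm z)) '' (π '' (κ '' D.vseg e)) := by
      rw [← image_comp, ← image_comp]; rfl
    refine h1.trans ?_
    rw [vseg, himg]
    show _ '' (Φ '' (κ '' (G.arc e '' Icc 0 1))) = _
    rw [← image_comp, ← image_comp]
    convert image_id (G.arc e '' Icc 0 1) using 1
    refine image_congr fun z _ => ?_
    simp
  · intro z hz z' hz' h
    have hmem : ∀ z, z ∈ (⋃ i, D.hseg i)ᶜ → κ z ∈ (⋃ v ∈ Φ '' (κ '' range G.vpos),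
        {z : ℂ | z.im = v.im ∧ z.re ∈ Icc (a v) (b v)})ᶜ := by
      intro z hz h
      obtain ⟨v, hv, h⟩ := mem_iUnion₂.1 h
      obtain ⟨v, rfl⟩ := hrange v hv
      exact hz (mem_iUnion.2 ⟨v, h⟩)
    exact κ.injective (hoff (hmem z hz) (hmem z' hz')
      (Φ.symm.injective (κ.symm.injective h)))
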